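/- In the setting of the measure estimate for ℛ_δ: let d ≥ 2, S(d) = 2⌊d²/2⌋, c ∈ (1, 1+c₂(d)), |ψ| ≤ τ, ℛ_δ = {θ ∈ [0,1) : |ψ̂(θ)| > δNL}, and suppose N^{(θ(d,c)−1)/(2dc)+ε₃} < δ < 1 where ε₃ = S(d)(c−1)ε₁/(2dc·u₁(u₁+ε₁)) with u₁ = 2S(d)(c−1)/(1−θ(d,c)). If θ₁, …, θ_R ∈ ℛ_δ are N^{−1}-spaced points (i.e. the distance in 𝕋 between any two distinct θ_r is at least N^{−1}), then R ≪_{ε₁} δ^{−(2d+ε₁)}. -/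

import Mathlib

open scoped BigOperators Classical
open Real

noncomputable section

/-- `e(t) = e^{2πit}`. -/
def eC (t : ℝ) : ℂ := Complex.exp (2 * Real.pi * Complex.I * t)

/-- The Piatetski-Shapiro set `ℕ^c = {⌊n^c⌋ : n ∈ ℕ}`. -/
def PS (c : ℝ) : Set ℕ := {m | ∃ n : ℕ, 0 < n ∧ m = ⌊(n : ℝ) ^ c⌋₊}

/-- The Fourier transform `f̂(α) = ∑_{n ∈ ℤ} f(n) e(αn)` of a finitely
supported function on `ℤ`. -/
def FT (f : ℤ → ℂ) (α : ℝ) : ℂ := ∑ᶠ n : ℤ, f n * eC (α * n)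

/-- `w = (1/2) log log x`. -/
def wps (x : ℕ) : ℝ := Real.log (Real.log x) / 2

/-- `W = 4 d³ ∏_{p ≤ w} p`. -/
def Wps (d x : ℕ) : ℕ :=
  4 * d ^ 3 * ∏ p ∈ Finset.filter Nat.Prime (Finset.Iic ⌊wps x⌋₊), p

/-- `σ(b) = #{z ∈ [W] : z^d ≡ -b (mod W)}`. -/
def sigmaPS (d W b : ℕ) : ℕ :=
  ((Finset.Icc 1 W).filter fun z => (z ^ d + b) % W = 0).card

/-- `N = ⌊x^d / W⌋ + 1`. -/
def Nps (d x : ℕ) : ℕ := ⌊(x : ℝ) ^ d / (Wps d x : ℝ)⌋₊ + 1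

/-- `b ∈ [W]` and `-b ∈ (ℤ/Wℤ)^{×d}`. -/
def bSpec (d x b : ℕ) : Prop :=
  b ∈ Finset.Icc 1 (Wps d x) ∧
    ∃ z : (ZMod (Wps d x))ˣ, (z : ZMod (Wps d x)) ^ d = -(b : ZMod (Wps d x))

/-- `S(d) = 2⌊d²/2⌋`. -/
def Sd (d : ℕ) : ℕ := 2 * (d ^ 2 / 2)

def hD (d : ℕ) : ℝ := 1 / ((d : ℝ) * ((d : ℝ) + 1) ^ 2 - 1)
def kD (d : ℕ) : ℝ := 2 / (27 * (d : ℝ) ^ 2 - 14)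
def lD (d : ℕ) : ℝ := 2 / (27 * (d : ℝ) ^ 2 - 5)

/-- `θ(d, c)`. -/
def θdc (d : ℕ) (c : ℝ) : ℝ :=
  if d = 2 then (4 * c + 7) / 13
  else if d = 3 then (15 * c + 14) / 30
  else if d ≤ 11 then (1 + c) / 2 * (1 - hD d)
  else if 2 ∣ d then (1 + c) / 2 * (1 - kD d)
  else (1 + c) / 2 * (1 - lD d)

/-- `c₂(d)`. -/
def c2ps (d : ℕ) : ℝ :=
  if d = 2 then 1 / 54
  else if d = 3 then 1 / 495
  else if d ≤ 11 then 2 * hD d / (4 * (Sd d : ℝ) + 1 - hD d)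
  else if 2 ∣ d then 2 * kD d / (4 * (Sd d : ℝ) + 1 - kD d)
  else 2 * lD d / (4 * (Sd d : ℝ) + 1 - lD d)

/-- The majorant `ν = ν_b` from the density transfer lemma, characterized by
its defining property. -/
def nuSpec (d x : ℕ) (c : ℝ) (b : ℕ) (ν : ℤ → ℝ) : Prop :=
  (∀ n : ℤ, ∀ p : ℕ, p.Prime → p ∈ PS c → p ≤ x →
      (Wps d x : ℤ) * n - (b : ℤ) = (p : ℤ) ^ d →
      ν n = c * (Nat.totient (Wps d x) : ℝ) /
          ((sigmaPS d (Wps d x) b : ℝ) * (Wps d x : ℝ)) *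
          (p : ℝ) ^ ((d : ℝ) - 1 / c) * Real.log p) ∧
  (∀ n : ℤ, (¬ ∃ p : ℕ, p.Prime ∧ p ∈ PS c ∧ p ≤ x ∧
      (Wps d x : ℤ) * n - (b : ℤ) = (p : ℤ) ^ d) → ν n = 0)

/-- The majorant `τ`, characterized by its defining property. -/
def tauSpec (d x : ℕ) (c : ℝ) (b : ℕ) (τ : ℤ → ℝ) : Prop :=
  (∀ n : ℤ, ∀ m : ℕ, m ∈ PS c → m ≤ x →
      (Wps d x : ℤ) * n - (b : ℤ) = (m : ℤ) ^ d →
      τ n = c / (sigmaPS d (Wps d x) b : ℝ) * (m : ℝ) ^ ((d : ℝ) - 1 / c)) ∧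
  (∀ n : ℤ, (¬ ∃ m : ℕ, m ∈ PS c ∧ m ≤ x ∧
      (Wps d x : ℤ) * n - (b : ℤ) = (m : ℤ) ^ d) → τ n = 0)

/-- The function `μ`, characterized by its defining property. -/
def muSpec (d x : ℕ) (b : ℕ) (μ : ℤ → ℝ) : Prop :=
  (∀ n : ℤ, ∀ m : ℕ, 1 ≤ m → m ≤ x →
      (Wps d x : ℤ) * n - (b : ℤ) = (m : ℤ) ^ d →
      μ n = (m : ℝ) ^ (d - 1) / (sigmaPS d (Wps d x) b : ℝ)) ∧
  (∀ n : ℤ, (¬ ∃ m : ℕ, 1 ≤ m ∧ m ≤ x ∧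
      (Wps d x : ℤ) * n - (b : ℤ) = (m : ℤ) ^ d) → μ n = 0)

/-- `u₁ = 2S(d)(c−1)/(1−θ(d,c))`. -/
def u1ps (d : ℕ) (c : ℝ) : ℝ := 2 * (Sd d : ℝ) * (c - 1) / (1 - θdc d c)

/-- `ε₃ = S(d)(c−1)ε₁ / (2dc·u₁(u₁+ε₁))`. -/
def ε3ps (d : ℕ) (c ε₁ : ℝ) : ℝ :=
  (Sd d : ℝ) * (c - 1) * ε₁ /
    (2 * (d : ℝ) * c * u1ps d c * (u1ps d c + ε₁))

namespace VM
local notation "ℙ" => (by positivity)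
local notation "𝕃" => (by linarith)
local notation "𝕆" => (by omega)
local notation:max "®" a:max => (a : ℝ)
open Finset (sum_congr range mul_sum sum_add_distrib mem_range sum_mul sum_comm sum_sub_distrib sum_product' mem_product mem_filter sum_const card_univ sum_le_sum sum_fiberwise_of_maps_to univ sum_nonneg mem_univ sum_le_sum_of_subset_of_nonneg filter_subset sum_product card_range single_le_sum sum_range_succ' sum_range_succ sum_le_card_nsmul add_sum_erase ne_of_mem_erase sum_filter sum_mul_sum Icc mem_Icc card_le_card_of_injOn mem_image Ico mem_Ico mem_image_of_mem prod_range_succ sum_Ico_eq_sum_range card_eq_sum_card_fiberwise card_le_card filter_filter mem_coe coe_filter sum_image Ioc)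
open Nat (le_of_dvd mod_lt mod_eq_of_lt cast_nonneg cast_sub le_mul_of_pos_left mul_div_le lt_mul_div_succ lt_succ_iff sub_le floor_le lt_floor_add_one lt_succ_of_le le_floor card_Ico cast_zero cast_one cast_le eq_of_mul_eq_mul_left card_eq_fintype_card Coprime div_add_mod floor_pos pow_log_le_self)
open Complex (ofReal_sum ofReal_pow mul_conj' norm_real norm_conj)
open Int (castRingHom mul_ediv_cancel' mul_ediv_cancel_left one_le_abs)
open Polynomial

def Cl (p k : ℕ) (φ : Fin k → ℤ[X]) : Prop :=
  ∀ j, ∃ u : ZMod p, u ≠ 0 ∧ (φ j).map (castRingHom (ZMod p)) = C u * X ^ (j.val + 1)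

lemma dvd_deriv {K : Type*} [Field K] (P : K[X]) (t : K) (r : ℕ)
    (h : ∀ l, 1 ≤ l → l ≤ r → (taylor t P).coeff l = 0) : (X - C t) ^ r ∣ derivative P := by
  have h1 : (X - C t) ^ (r + 1) ∣ P - C (P.eval t) := by
    rw [X_sub_C_pow_dvd_iff, X_pow_dvd_iff]
    intro l hl
    rw [← taylor_apply, map_sub, coeff_sub]
    rcases Nat.eq_zero_or_pos l with rfl | hl0
    · simp
    · rw [h l hl0 𝕆, taylor_C, coeff_C, if_neg 𝕆, sub_zero]
  obtain ⟨Q, hQ⟩ := h1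
  have : derivative P = derivative (P - C (P.eval t)) := by simp
  rw [this, hQ, derivative_mul, derivative_pow]
  simp only [Nat.add_sub_cancel]
  refine dvd_add (Dvd.dvd.mul_right ?_ _) (Dvd.dvd.mul_right (pow_dvd_pow _ (Nat.le_succ r)) _)
  exact Dvd.dvd.mul_right (Dvd.dvd.mul_left dvd_rfl _) _

lemma exists_c {p k : ℕ} [Fact p.Prime] (hk : k < p) {φ : Fin k → ℤ[X]} (hφ : Cl p k φ) {r : ℕ}
    (hr : r ≤ k) (ξ η : ℤ) (hne : r < k → ¬ (p : ℤ) ∣ ξ - η) :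
    ∃ c : Fin r → Fin k → ℤ, ∃ D : ℤ, ¬ (p : ℤ) ∣ D ∧ ∀ i : Fin r,
      (∀ l, 1 ≤ l → l ≤ k - r → (taylor η (∑ j, C (c i j) * φ j)).coeff l = 0) ∧
      (∀ l, 1 ≤ l → l ≤ i.val → (taylor ξ (∑ j, C (c i j) * φ j)).coeff l = 0) ∧
      (taylor ξ (∑ j, C (c i j) * φ j)).coeff (i.val + 1) = D := by
  let M : Matrix (Fin k) (Fin k) ℤ := Matrix.of fun l j =>
    if l.val < r then (taylor ξ (φ j)).coeff (l.val + 1) else (taylor η (φ j)).coeff (l.val - r + 1)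
  have hc : ∀ (v : Fin k → ℤ) (t : ℤ) (n : ℕ), (taylor t (∑ j, C (v j) * φ j)).coeff n
      = ∑ j, (taylor t (φ j)).coeff n * v j := by
    intro v t n
    simp only [map_sum, finsetSum_coeff, taylor_mul, taylor_C, coeff_C_mul]
    exact sum_congr rfl fun _ _ => mul_comm _ _
  have hadj : ∀ l i : Fin k, ∑ j, M l j * M.adjugate j i = if l = i then M.det else 0 := by
    intro l i
    have := congrFun (congrFun M.mul_adjugate l) i
    rw [Matrix.mul_apply] at this
    rw [this]; simp [Matrix.one_apply]
  refine ⟨fun i j => M.adjugate j (Fin.castLE hr i), M.det, ?_, fun i => ⟨?_, ?_, ?_⟩⟩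
  · intro hdvd
    let f := castRingHom (ZMod p)
    have h0 : (M.map f).det = 0 := by
      have := RingHom.map_det f M
      rw [RingHom.mapMatrix_apply] at this
      rw [← this]; exact (ZMod.intCast_zmod_eq_zero_iff_dvd _ _).2 hdvd
    obtain ⟨v, hv0, hv⟩ := Matrix.exists_mulVec_eq_zero_iff.2 h0
    let P : (ZMod p)[X] := ∑ j, C (v j) * (φ j).map f
    have hco : ∀ (t : ℤ) (n : ℕ), (taylor (t : ZMod p) P).coeff n
        = ∑ j, f ((taylor t (φ j)).coeff n) * v j := by
      intro t n
      simp only [P, map_sum, finsetSum_coeff, taylor_mul, taylor_C, coeff_C_mul]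
      refine sum_congr rfl fun j _ => ?_
      rw [mul_comm, ← coeff_map, taylor_apply, taylor_apply, Polynomial.map_comp]
      simp [f]
    have h1 : (X - C (ξ : ZMod p)) ^ r ∣ derivative P := by
      refine dvd_deriv P _ r fun l h1 h2 => ?_
      have := congrFun hv ⟨l - 1, by omega⟩
      rw [hco]
      simp only [Matrix.mulVec, dotProduct, Matrix.map_apply, M, Matrix.of_apply] at this
      simp only [if_pos (show l - 1 < r by omega)] at this
      simpa [Nat.sub_add_cancel h1] using this
    have h2 : (X - C (η : ZMod p)) ^ (k - r) ∣ derivative P := by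
      refine dvd_deriv P _ _ fun l h1 h2 => ?_
      have := congrFun hv ⟨r + l - 1, by omega⟩
      rw [hco]
      simp only [Matrix.mulVec, dotProduct, Matrix.map_apply, M, Matrix.of_apply] at this
      simp only [if_neg (show ¬ (r + l - 1 < r) by omega)] at this
      have e : r + l - 1 - r + 1 = l := by omega
      simpa [e] using this
    have h3 : (X - C (ξ : ZMod p)) ^ r * (X - C (η : ZMod p)) ^ (k - r) ∣ derivative P := by
      rcases hr.eq_or_lt with rfl | hlt
      · simpa using h1
      · refine IsCoprime.mul_dvd (IsCoprime.pow ?_) h1 h2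
        refine isCoprime_X_sub_C_of_isUnit_sub (IsUnit.mk0 _ fun h => hne hlt ?_)
        rw [← ZMod.intCast_zmod_eq_zero_iff_dvd]; simpa using h
    choose u hu0 hu using hφ
    have hP : P = ∑ j : Fin k, C (v j * u j) * X ^ (j.val + 1) := by
      refine sum_congr rfl fun j _ => ?_
      rw [hu, C_mul, mul_assoc]
    have hdP : derivative P = ∑ j : Fin k, C (v j * u j * ((j.val + 1 : ℕ) : ZMod p)) * X ^ j.val := by
      rw [hP, derivative_sum]
      refine sum_congr rfl fun j _ => ?_
      rw [derivative_C_mul_X_pow]; simp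
    have hz : derivative P = 0 := by
      by_contra hne0
      have hd := degree_le_of_dvd h3 hne0
      have hm : ((X - C (ξ : ZMod p)) ^ r * (X - C (η : ZMod p)) ^ (k - r)).degree = (k : WithBot ℕ) := by
        rw [degree_mul, degree_pow, degree_pow, degree_X_sub_C, degree_X_sub_C]
        simp only [nsmul_eq_mul, mul_one]
        rw [← Nat.cast_add]; congr 1; omega
      have hl : (derivative P).degree < k := by
        rw [hdP]; exact degree_sum_fin_lt _
      rw [hm] at hd
      exact absurd hl (not_lt.2 hd)
    apply hv0
    funext j
    have hcj : (derivative P).coeff j.val = v j * u j * ((j.val + 1 : ℕ) : ZMod p) := by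
      rw [hdP, finsetSum_coeff, Finset.sum_eq_single j]
      · rw [coeff_C_mul_X_pow, if_pos rfl]
      · intro b _ hb
        rw [coeff_C_mul_X_pow, if_neg (fun h => hb (Fin.ext h.symm))]
      · simp
    rw [hz, coeff_zero] at hcj
    have hj : ((j.val + 1 : ℕ) : ZMod p) ≠ 0 := by
      rw [Ne, ZMod.natCast_eq_zero_iff]
      exact fun h => absurd (le_of_dvd 𝕆 h) (by have := j.2; omega)
    rcases mul_eq_zero.1 hcj.symm with h | h
    · rcases mul_eq_zero.1 h with h | h
      · exact h
      · exact absurd h (hu0 j)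
    · exact absurd h hj
  · intro l h1 h2
    have := hadj ⟨r + l - 1, by omega⟩ (Fin.castLE hr i)
    rw [if_neg (fun h => by have := congrArg Fin.val h; simp at this; have := i.2; omega)] at this
    rw [hc, ← this]
    refine sum_congr rfl fun j _ => ?_
    simp only [M, Matrix.of_apply]
    rw [if_neg 𝕆]
    congr 3; omega
  · intro l h1 h2
    have := hadj ⟨l - 1, by have := i.2; omega⟩ (Fin.castLE hr i)
    rw [if_neg (fun h => by have := congrArg Fin.val h; simp at this; omega)] at this
    rw [hc, ← this]
    refine sum_congr rfl fun j _ => ?_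
    simp only [M, Matrix.of_apply]
    rw [if_pos (by have := i.2; omega)]
    congr 2; omega
  · have := hadj (Fin.castLE hr i) (Fin.castLE hr i)
    rw [if_pos rfl] at this
    rw [hc, ← this]
    refine sum_congr rfl fun j _ => ?_
    simp only [M, Matrix.of_apply, Fin.val_castLE]
    rw [if_pos i.2]

/-- polynomial with vanishing low coefficients -/
lemma low_coeff (T : ℤ[X]) (n : ℕ) (m : ℤ) (h : ∀ l, 1 ≤ l → l ≤ n → T.coeff l = 0) :
    ∃ Q : ℤ[X], (∀ z, T.eval (m * z) - T.eval 0 = m ^ (n + 1) * Q.eval z) ∧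
      ∀ p : ℕ, (p : ℤ) ∣ m → Q.map (castRingHom (ZMod p)) = C ((T.coeff (n + 1) : ℤ) : ZMod p) * X ^ (n + 1) := by
  set N := T.natDegree + n + 2
  refine ⟨∑ l ∈ range N, if l ≤ n then 0 else C (T.coeff l * m ^ (l - (n + 1))) * X ^ l, ?_, ?_⟩
  · intro z
    rw [← coeff_zero_eq_eval_zero, eval_eq_sum_range' (show T.natDegree < N by omega), eval_finset_sum,
      mul_sum, sub_eq_iff_eq_add]
    have : T.coeff 0 = ∑ l ∈ range N, if l = 0 then T.coeff 0 else 0 := by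
      rw [Finset.sum_ite_eq']; simp [N]
    rw [this, ← sum_add_distrib]
    refine sum_congr rfl fun l _ => ?_
    rcases Nat.eq_zero_or_pos l with rfl | hl
    · simp
    by_cases hln : l ≤ n
    · simp [h l hl hln, hln, hl.ne']
    · rw [if_neg hln, if_neg hl.ne']
      simp only [eval_mul, eval_C, eval_pow, eval_X, add_zero]
      have : m ^ l = m ^ (n + 1) * m ^ (l - (n + 1)) := by rw [← pow_add]; congr 1; omega
      rw [mul_pow, this]; ring
  · intro p hp
    rw [Polynomial.map_sum, Finset.sum_eq_single (n + 1)]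
    · simp
    · intro l _ hl
      by_cases hln : l ≤ n
      · simp [hln]
      · rw [if_neg hln]
        have : ((m : ℤ) : ZMod p) = 0 := (ZMod.intCast_zmod_eq_zero_iff_dvd _ _).2 hp
        have h2 : l - (n + 1) ≠ 0 := by omega
        rw [Polynomial.map_mul, map_C, eq_intCast, Int.cast_mul, Int.cast_pow, this, zero_pow h2]; simp
    · intro h; exact absurd (mem_range.2 𝕆) h

open Polynomial

def F (p B : ℕ) [NeZero (p ^ B)] {k : ℕ} (φ : Fin k → ℤ[X]) (a : ℤ → ℂ) (pt : ℤ → ℤ) (X : Finset ℤ)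
    (β : Fin k → ZMod (p ^ B)) : ℂ :=
  ∑ i ∈ X, a i * ZMod.stdAddChar (∑ j, β j * (((φ j).eval (pt i) : ℤ) : ZMod (p ^ B)))

lemma norm_std {N : ℕ} [NeZero N] (x : ZMod N) : ‖ZMod.stdAddChar x‖ = 1 := AddChar.norm_apply _ _

lemma std_scale {p B B' : ℕ} [Fact p.Prime] (h : B' ≤ B) (n : ℤ) :
    ZMod.stdAddChar (((p : ℤ) ^ (B - B') * n : ℤ) : ZMod (p ^ B)) = ZMod.stdAddChar (n : ZMod (p ^ B')) := by
  have hp : (p : ℂ) ≠ 0 := by exact_mod_cast (Fact.out : p.Prime).ne_zero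
  rw [ZMod.stdAddChar_coe, ZMod.stdAddChar_coe]
  congr 1
  have : p ^ B = p ^ (B - B') * p ^ B' := by rw [← pow_add]; congr 1; omega
  rw [this]; push_cast
  field_simp

/-- the shift vectors -/
lemma shift_exists {p k : ℕ} [Fact p.Prime] (hk : k < p) {φ : Fin k → ℤ[X]} (hφ : Cl p k φ) {r a b H B : ℕ}
    (hr : r ≤ k) (ha : 1 ≤ a) (ξ η : ℤ) (hne : r < k → ¬ (p : ℤ) ∣ ξ - η) (hB : r * (H + a) ≤ B)
    (hb : r < k → r * (H + a) ≤ (k - r + 1) * b) :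
    ∃ ψ : Fin r → ℤ[X], Cl p r ψ ∧ ∃ v : (Fin r → ZMod (p ^ (r * H))) → Fin k → ZMod (p ^ B),
      (∀ (w : ℤ → ℂ) (pt : ℤ → ℤ) (X : Finset ℤ) β s, (∀ i ∈ X, (p : ℤ) ^ a ∣ pt i - ξ) →
        ‖F p B φ w pt X (β + v s)‖ = ‖F p (r * H) ψ
          (fun i => w i * ZMod.stdAddChar (∑ j, β j * (((φ j).eval (pt i) : ℤ) : ZMod (p ^ B))))
          (fun i => (pt i - ξ) / (p : ℤ) ^ a) X s‖) ∧
      (r < k → ∀ (w : ℤ → ℂ) (pt : ℤ → ℤ) (X : Finset ℤ) β s, (∀ i ∈ X, (p : ℤ) ^ b ∣ pt i - η) →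
        ‖F p B φ w pt X (β + v s)‖ = ‖F p B φ w pt X β‖) := by
  obtain ⟨c, D, hD, hc⟩ := exists_c hk hφ hr ξ η hne
  have hp0 : (p : ℤ) ≠ 0 := by exact_mod_cast (Fact.out : p.Prime).ne_zero
  set Ψ : Fin r → ℤ[X] := fun i => ∑ j, C (c i j) * φ j with hΨ
  have hev : ∀ i x, (Ψ i).eval x = ∑ j, c i j * (φ j).eval x := by
    intro i x; simp [hΨ, eval_finset_sum]
  have hQ : ∀ i : Fin r, ∃ Q : ℤ[X], (∀ z, (Ψ i).eval (ξ + (p : ℤ) ^ a * z) - (Ψ i).eval ξ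
      = ((p : ℤ) ^ a) ^ (i.val + 1) * Q.eval z) ∧
      Q.map (castRingHom (ZMod p)) = C ((D : ℤ) : ZMod p) * X ^ (i.val + 1) := by
    intro i
    obtain ⟨Q, h1, h2⟩ := low_coeff (taylor ξ (Ψ i)) i.val ((p : ℤ) ^ a) (hc i).2.1
    refine ⟨Q, fun z => ?_, ?_⟩
    · rw [← h1 z, taylor_eval, taylor_eval, zero_add, add_comm]
    · rw [h2 p (dvd_pow_self _ 𝕆), (hc i).2.2]
  choose ψ hψ1 hψ2 using hQ
  have hee : ∀ l : Fin r, (l.val + 1) * a + r * H ≤ B := fun l => by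
    have : (l.val + 1) * a ≤ r * a := Nat.mul_le_mul_right _ l.2
    rw [mul_add] at hB; omega
  set e : Fin r → ℕ := fun l => B - r * H - (l.val + 1) * a with he
  set v : (Fin r → ZMod (p ^ (r * H))) → Fin k → ZMod (p ^ B) :=
    fun s j => ((∑ l, ((s l).val : ℤ) * (p : ℤ) ^ e l * c l j : ℤ) : ZMod (p ^ B)) with hv
  have hvφ : ∀ s x, ∑ j, v s j * (((φ j).eval x : ℤ) : ZMod (p ^ B))
      = ((∑ l, ((s l).val : ℤ) * (p : ℤ) ^ e l * (Ψ l).eval x : ℤ) : ZMod (p ^ B)) := by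
    intro s x
    simp only [hv, ← Int.cast_mul, ← Int.cast_sum, hev]
    congr 1
    simp only [sum_mul, mul_sum]
    rw [sum_comm]
    exact sum_congr rfl fun _ _ => sum_congr rfl fun _ _ => by ring
  have hsplit : ∀ β s x, ZMod.stdAddChar (∑ j, (β + v s) j * (((φ j).eval x : ℤ) : ZMod (p ^ B)))
      = ZMod.stdAddChar (∑ j, β j * (((φ j).eval x : ℤ) : ZMod (p ^ B))) *
        ZMod.stdAddChar ((∑ l, ((s l).val : ℤ) * (p : ℤ) ^ e l * (Ψ l).eval x : ℤ) : ZMod (p ^ B)) := by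
    intro β s x
    rw [← AddChar.map_add_eq_mul, ← hvφ, ← sum_add_distrib]
    simp only [Pi.add_apply, add_mul]
  refine ⟨ψ, fun i => ⟨(D : ZMod p), ?_, hψ2 i⟩, v, ?_, ?_⟩
  · rwa [Ne, ZMod.intCast_zmod_eq_zero_iff_dvd]
  · intro w pt X β s hX
    have key : F p B φ w pt X (β + v s) = ZMod.stdAddChar
        ((∑ l, ((s l).val : ℤ) * (p : ℤ) ^ e l * (Ψ l).eval ξ : ℤ) : ZMod (p ^ B)) * F p (r * H) ψ
          (fun i => w i * ZMod.stdAddChar (∑ j, β j * (((φ j).eval (pt i) : ℤ) : ZMod (p ^ B))))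
          (fun i => (pt i - ξ) / (p : ℤ) ^ a) X s := by
      unfold F
      rw [mul_sum]
      refine sum_congr rfl fun i hi => ?_
      have hz : pt i = ξ + (p : ℤ) ^ a * ((pt i - ξ) / (p : ℤ) ^ a) := by
        rw [mul_ediv_cancel' (hX i hi)]; ring
      have h1 : (∑ l, ((s l).val : ℤ) * (p : ℤ) ^ e l * (Ψ l).eval (pt i) : ℤ)
          = (∑ l, ((s l).val : ℤ) * (p : ℤ) ^ e l * (Ψ l).eval ξ)
            + (p : ℤ) ^ (B - r * H) * ∑ l, ((s l).val : ℤ) * (ψ l).eval ((pt i - ξ) / (p : ℤ) ^ a) := by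
        rw [mul_sum, ← sum_add_distrib]
        refine sum_congr rfl fun l _ => ?_
        have h2 := hψ1 l ((pt i - ξ) / (p : ℤ) ^ a)
        rw [← hz] at h2
        have h3 : (p : ℤ) ^ (B - r * H) = (p : ℤ) ^ e l * ((p : ℤ) ^ a) ^ (l.val + 1) := by
          rw [← pow_mul, ← pow_add]; congr 1
          have := hee l; have h5 := mul_comm a (l.val + 1); simp only [he]; omega
        rw [h3, sub_eq_iff_eq_add.1 h2]; ring
      have h4 : ((∑ l, ((s l).val : ℤ) * (ψ l).eval ((pt i - ξ) / (p : ℤ) ^ a) : ℤ) : ZMod (p ^ (r * H)))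
          = ∑ j, s j * (((ψ j).eval ((pt i - ξ) / (p : ℤ) ^ a) : ℤ) : ZMod (p ^ (r * H))) := by
        push_cast; simp
      rw [hsplit, h1, Int.cast_add, AddChar.map_add_eq_mul, std_scale (by rw [mul_add] at hB; omega), h4]
      ring
    rw [key, norm_mul, norm_std, one_mul]
  · intro hrk w pt X β s hX
    have key : F p B φ w pt X (β + v s) = ZMod.stdAddChar
        ((∑ l, ((s l).val : ℤ) * (p : ℤ) ^ e l * (Ψ l).eval η : ℤ) : ZMod (p ^ B)) * F p B φ w pt X β := by
      unfold F
      rw [mul_sum]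
      refine sum_congr rfl fun i hi => ?_
      rw [hsplit]
      have : ((∑ l, ((s l).val : ℤ) * (p : ℤ) ^ e l * (Ψ l).eval (pt i) : ℤ) : ZMod (p ^ B))
          = ((∑ l, ((s l).val : ℤ) * (p : ℤ) ^ e l * (Ψ l).eval η : ℤ) : ZMod (p ^ B)) := by
        rw [← sub_eq_zero, ← Int.cast_sub, ZMod.intCast_zmod_eq_zero_iff_dvd, ← sum_sub_distrib]
        refine Finset.dvd_sum fun l _ => ?_
        rw [← mul_sub, mul_assoc]
        refine Dvd.dvd.mul_left ?_ _
        obtain ⟨z, hz⟩ := hX i hi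
        obtain ⟨Q, h1, -⟩ := low_coeff (taylor η (Ψ l)) (k - r) ((p : ℤ) ^ b) (hc l).1
        have h2 := h1 z
        rw [taylor_eval, taylor_eval, zero_add, ← hz, sub_add_cancel] at h2
        rw [h2, ← mul_assoc]
        refine Dvd.dvd.mul_right ?_ _
        push_cast
        rw [← pow_mul, ← pow_add]
        refine pow_dvd_pow _ ?_
        have h3 := hb hrk
        have h4 := mul_comm b (k - r + 1)
        have : (l.val + 1) * a ≤ r * a := Nat.mul_le_mul_right _ l.2
        rw [mul_add] at h3; simp only [he]; omega
      rw [this]; ring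
    rw [key, norm_mul, norm_std, one_mul]

open Polynomial

def cls (p : ℕ) (pt : ℤ → ℤ) (X : Finset ℤ) (n : ℕ) (ξ : ℤ) : Finset ℤ :=
  X.filter fun i => (p : ℤ) ^ n ∣ pt i - ξ

def DecH (p k : ℕ) [Fact p.Prime] (C η : ℝ) (h : ℕ) : Prop :=
  ∀ B, k * h ≤ B → ∀ φ : Fin k → ℤ[X], Cl p k φ → ∀ w pt X,
    ∑ β, ‖F p B φ w pt X β‖ ^ (k * (k + 1)) ≤
      C * ®p ^ (η * h + h * ((k * (k + 1) : ℕ) / 2 - 1 : ℝ)) *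
        ∑ ξ ∈ range (p ^ h), ∑ β, ‖F p B φ w pt (cls p pt X h ξ) β‖ ^ (k * (k + 1))

lemma sum_range_pow {p : ℕ} [Fact p.Prime] (a H : ℕ) (g : ℤ → ℝ) :
    ∑ ξ ∈ range (p ^ (a + H)), g ξ
      = ∑ ξ ∈ range (p ^ a), ∑ ζ ∈ range (p ^ H), g (ξ + (p : ℤ) ^ a * ζ) := by
  have hp : 0 < p ^ a := pow_pos (Fact.out : p.Prime).pos _
  rw [← sum_product']
  symm
  refine Finset.sum_bij' (fun x _ => x.1 + p ^ a * x.2) (fun n _ => (n % p ^ a, n / p ^ a)) ?_ ?_ ?_ ?_ ?_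
  · rintro ⟨x, y⟩ h
    simp only [mem_product, mem_range] at h ⊢
    rw [pow_add]; nlinarith [h.1, h.2]
  · intro n h
    simp only [mem_product, mem_range] at h ⊢
    exact ⟨mod_lt _ hp, Nat.div_lt_of_lt_mul (by rwa [← pow_add])⟩
  · rintro ⟨x, y⟩ h
    simp only [mem_product, mem_range] at h
    simp only [Prod.mk.injEq]
    refine ⟨?_, ?_⟩
    · rw [Nat.add_mul_mod_self_left, mod_eq_of_lt h.1]
    · rw [Nat.add_mul_div_left _ _ hp, Nat.div_eq_of_lt h.1, zero_add]
  · intro n _; exact Nat.mod_add_div n _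
  · rintro ⟨x, y⟩ _; push_cast; rfl

lemma cls_sub {p : ℕ} [Fact p.Prime] (pt : ℤ → ℤ) (X : Finset ℤ) (a H : ℕ) (ξ ζ : ℤ) :
    cls p (fun i => (pt i - ξ) / (p : ℤ) ^ a) (cls p pt X a ξ) H ζ = cls p pt X (a + H) (ξ + (p : ℤ) ^ a * ζ) := by
  have hp0 : (p : ℤ) ^ a ≠ 0 := pow_ne_zero _ (by exact_mod_cast (Fact.out : p.Prime).ne_zero)
  ext i
  simp only [cls, mem_filter, and_assoc]
  refine and_congr_right fun _ => ⟨?_, fun h => ?_⟩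
  · rintro ⟨⟨z, hz⟩, h2⟩
    rw [hz, mul_ediv_cancel_left _ hp0] at h2
    have : pt i - (ξ + (p : ℤ) ^ a * ζ) = (p : ℤ) ^ a * (z - ζ) := by linear_combination hz
    rw [this, pow_add]
    exact mul_dvd_mul_left _ h2
  · obtain ⟨z, hz⟩ := h
    have hz' : pt i - ξ = (p : ℤ) ^ a * (ζ + (p : ℤ) ^ H * z) := by rw [pow_add] at hz; linear_combination hz
    rw [hz', mul_ediv_cancel_left _ hp0]
    exact ⟨dvd_mul_right _ _, ⟨z, by ring⟩⟩

lemma sub_cls {p : ℕ} (pt : ℤ → ℤ) (X : Finset ℤ) (a H : ℕ) (ξ ζ : ℤ) :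
    cls p pt X (a + H) (ξ + (p : ℤ) ^ a * ζ) ⊆ cls p pt X a ξ := by
  intro i
  simp only [cls, mem_filter]
  rintro ⟨h1, h2⟩
  refine ⟨h1, ?_⟩
  have h3 : (p : ℤ) ^ a ∣ pt i - (ξ + (p : ℤ) ^ a * ζ) := (pow_dvd_pow _ (Nat.le_add_right a H)).trans h2
  have h4 : pt i - ξ = pt i - (ξ + (p : ℤ) ^ a * ζ) + (p : ℤ) ^ a * ζ := by ring
  rw [h4]
  exact dvd_add h3 (dvd_mul_right ((p : ℤ) ^ a) ζ)

lemma TI {p k : ℕ} [Fact p.Prime] (hk : k < p) {φ : Fin k → ℤ[X]} (hφ : Cl p k φ) {r a b H B : ℕ} {C ε : ℝ}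
    (hD : DecH p r C ε H) (hr : r ≤ k) (ha : 1 ≤ a) (ξ η : ℤ) (hne : r < k → ¬ (p : ℤ) ∣ ξ - η)
    (hB : r * (H + a) ≤ B) (hb : r < k → r * (H + a) ≤ (k - r + 1) * b) (m : ℕ) (hm : r < k ∨ m = 0)
    (w : ℤ → ℂ) (pt : ℤ → ℤ) (X : Finset ℤ) :
    ∑ β, ‖F p B φ w pt (cls p pt X a ξ) β‖ ^ (r * (r + 1)) * ‖F p B φ w pt (cls p pt X b η) β‖ ^ m ≤
      C * ®p ^ (ε * H + H * ((r * (r + 1) : ℕ) / 2 - 1 : ℝ)) * ∑ ζ ∈ range (p ^ H),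
        ∑ β, ‖F p B φ w pt (cls p pt X (a + H) (ξ + (p : ℤ) ^ a * ζ)) β‖ ^ (r * (r + 1)) *
          ‖F p B φ w pt (cls p pt X b η) β‖ ^ m := by
  obtain ⟨ψ, hψ, v, h1, h2⟩ := shift_exists hk hφ hr ha ξ η hne hB hb
  set S : ℝ := ((Fintype.card (Fin r → ZMod (p ^ (r * H))) : ℕ) : ℝ) with hS
  have hSpos : 0 < S := by rw [hS]; exact_mod_cast Fintype.card_pos
  have key : ∀ X' ⊆ cls p pt X a ξ, S * ∑ β, ‖F p B φ w pt X' β‖ ^ (r * (r + 1)) * ‖F p B φ w pt (cls p pt X b η) β‖ ^ m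
      = ∑ β, (∑ s, ‖F p (r * H) ψ
          (fun i => w i * ZMod.stdAddChar (∑ j, β j * (((φ j).eval (pt i) : ℤ) : ZMod (p ^ B))))
          (fun i => (pt i - ξ) / (p : ℤ) ^ a) X' s‖ ^ (r * (r + 1))) * ‖F p B φ w pt (cls p pt X b η) β‖ ^ m := by
    intro X' hX'
    have e1 : ∀ s, ∑ β, ‖F p B φ w pt X' β‖ ^ (r * (r + 1)) * ‖F p B φ w pt (cls p pt X b η) β‖ ^ m
        = ∑ β, ‖F p B φ w pt X' (β + v s)‖ ^ (r * (r + 1)) * ‖F p B φ w pt (cls p pt X b η) (β + v s)‖ ^ m := fun s =>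
      (Equiv.sum_comp (Equiv.addRight (v s)) fun β =>
        ‖F p B φ w pt X' β‖ ^ (r * (r + 1)) * ‖F p B φ w pt (cls p pt X b η) β‖ ^ m).symm
    have e2 : S * ∑ β, ‖F p B φ w pt X' β‖ ^ (r * (r + 1)) * ‖F p B φ w pt (cls p pt X b η) β‖ ^ m
        = ∑ s : Fin r → ZMod (p ^ (r * H)), ∑ β, ‖F p B φ w pt X' β‖ ^ (r * (r + 1)) * ‖F p B φ w pt (cls p pt X b η) β‖ ^ m := by
      rw [sum_const, card_univ, nsmul_eq_mul]
    rw [e2, sum_congr rfl fun s _ => e1 s, sum_comm]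
    refine sum_congr rfl fun β _ => ?_
    rw [sum_mul]
    refine sum_congr rfl fun s _ => ?_
    rw [h1 w pt X' β s fun i hi => (mem_filter.1 (hX' hi)).2]
    congr 1
    rcases hm with hm | rfl
    · rw [h2 hm w pt (cls p pt X b η) β s fun i hi => (mem_filter.1 hi).2]
    · simp
  refine le_of_mul_le_mul_left ?_ hSpos
  rw [key _ subset_rfl, mul_left_comm, mul_sum,
    sum_congr rfl fun (ζ : ℕ) _ => key _ (sub_cls pt X a H ξ (ζ : ℤ)), sum_comm, mul_sum]
  refine sum_le_sum fun β _ => ?_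
  rw [← sum_mul, ← mul_assoc]
  refine mul_le_mul_of_nonneg_right ?_ ℙ
  refine (hD (r * H) le_rfl ψ hψ _ _ _).trans_eq ?_
  congr 1
  exact sum_congr rfl fun ζ _ => by rw [cls_sub]

lemma cls_part {p : ℕ} [Fact p.Prime] (pt : ℤ → ℤ) (X : Finset ℤ) (n m : ℕ) (ξ : ℤ) (g : ℤ → ℂ) :
    ∑ i ∈ cls p pt X n ξ, g i = ∑ ζ ∈ range (p ^ m), ∑ i ∈ cls p pt X (n + m) (ξ + (p : ℤ) ^ n * ζ), g i := by
  have hp : 0 < p ^ m := pow_pos (Fact.out : p.Prime).pos _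
  rw [← sum_fiberwise_of_maps_to (s := cls p pt X n ξ) (t := range (p ^ m))
    (g := fun i => (((pt i - ξ) / (p : ℤ) ^ n) % ((p ^ m : ℕ) : ℤ)).toNat)]
  · refine sum_congr rfl fun ζ hζ => sum_congr ?_ fun _ _ => rfl
    rw [← cls_sub]
    ext i
    simp only [cls, mem_filter]
    refine and_congr_right fun _ => ?_
    have h1 := Int.emod_nonneg ((pt i - ξ) / (p : ℤ) ^ n) (b := ((p ^ m : ℕ) : ℤ)) (by exact_mod_cast hp.ne')
    have h2 : ((ζ : ℤ)) % ((p ^ m : ℕ) : ℤ) = ζ := by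
      exact_mod_cast mod_eq_of_lt (mem_range.1 hζ)
    rw [← Nat.cast_pow (α := ℤ) p m, Int.dvd_iff_emod_eq_zero, ← Int.emod_eq_emod_iff_emod_sub_eq_zero, h2]
    omega
  · intro i _
    have h1 := Int.emod_nonneg ((pt i - ξ) / (p : ℤ) ^ n) (b := ((p ^ m : ℕ) : ℤ)) (by exact_mod_cast hp.ne')
    have h2 := Int.emod_lt_of_pos ((pt i - ξ) / (p : ℤ) ^ n) (b := ((p ^ m : ℕ) : ℤ)) (by exact_mod_cast hp)
    simp only [mem_range]; omega

lemma F_split {p B k : ℕ} [Fact p.Prime] {φ : Fin k → ℤ[X]} (w : ℤ → ℂ) (pt : ℤ → ℤ) (X : Finset ℤ) (n m : ℕ) (ξ : ℤ)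
    (β : Fin k → ZMod (p ^ B)) : ‖F p B φ w pt (cls p pt X n ξ) β‖
      ≤ ∑ ζ ∈ range (p ^ m), ‖F p B φ w pt (cls p pt X (n + m) (ξ + (p : ℤ) ^ n * ζ)) β‖ := by
  refine le_trans (le_of_eq ?_) (norm_sum_le _ _)
  congr 1
  exact cls_part pt X n m ξ _


lemma holder2 {α : Type*} (s : Finset α) (f g : α → ℝ) (hf : ∀ i ∈ s, 0 ≤ f i) (hg : ∀ i ∈ s, 0 ≤ g i) {t : ℝ} (h0 : 0 < t)
    (h1 : t < 1) : ∑ i ∈ s, f i ^ (1 - t) * g i ^ t ≤ (∑ i ∈ s, f i) ^ (1 - t) * (∑ i ∈ s, g i) ^ t := by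
  have hpq : (1 / (1 - t)).HolderConjugate (1 / t) := by
    rw [Real.holderConjugate_iff]
    refine ⟨by rw [lt_div_iff₀ 𝕃]; linarith, by simp⟩
  have := Real.inner_le_Lp_mul_Lq_of_nonneg s hpq (f := fun i => f i ^ (1 - t)) (g := fun i => g i ^ t)
    (fun i hi => rpow_nonneg (hf i hi) _) (fun i hi => rpow_nonneg (hg i hi) _)
  refine this.trans_eq ?_
  have e1 : 1 / (1 / (1 - t)) = 1 - t := by simp
  have e2 : 1 / (1 / t) = t := by simp
  rw [e1, e2]
  congr 2
  · refine sum_congr rfl fun i hi => ?_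
    rw [← rpow_mul (hf i hi), mul_one_div_cancel 𝕃, rpow_one]
  · refine sum_congr rfl fun i hi => ?_
    rw [← rpow_mul (hg i hi), mul_one_div_cancel 𝕃, rpow_one]

def T (p : ℕ) (ι : Type) [Fintype ι] (a b : ℕ) : Finset ((ℕ × ℕ) × ι) :=
  ((range (p ^ a) ×ˢ range (p ^ b)).filter fun x => ¬ (p : ℤ) ∣ x.1 - x.2) ×ˢ univ

def AA (p : ℕ) {ι : Type} [Fintype ι] (U : ℕ → ℤ → ι → ℝ) (m n a b : ℕ) : ℝ :=
  ∑ x ∈ T p ι a b, U a x.1.1 x.2 ^ m * U b x.1.2 x.2 ^ n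

def NN (p : ℕ) {ι : Type} [Fintype ι] (U : ℕ → ℤ → ι → ℝ) (q a : ℕ) : ℝ :=
  ∑ ξ ∈ range (p ^ a), ∑ β, U a ξ β ^ q

variable {p : ℕ} {ι : Type} [Fintype ι] {U : ℕ → ℤ → ι → ℝ}

lemma AA_nonneg (hU : ∀ n ξ β, 0 ≤ U n ξ β) (m n a b : ℕ) : 0 ≤ AA p U m n a b :=
  sum_nonneg fun x _ => mul_nonneg (pow_nonneg (hU _ _ _) _) (pow_nonneg (hU _ _ _) _)

lemma NN_nonneg (hU : ∀ n ξ β, 0 ≤ U n ξ β) (q a : ℕ) : 0 ≤ NN p U q a :=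
  sum_nonneg fun x _ => sum_nonneg fun _ _ => pow_nonneg (hU _ _ _) _

lemma AA_symm (m n a b : ℕ) : AA p U m n a b = AA p U n m b a := by
  refine Finset.sum_bij' (fun x _ => ((x.1.2, x.1.1), x.2)) (fun x _ => ((x.1.2, x.1.1), x.2)) ?_ ?_ ?_ ?_ ?_
  · rintro ⟨⟨x, y⟩, β⟩; simp only [T, mem_product, mem_filter, mem_univ, and_true]
    exact fun h => ⟨h.1.symm, fun h' => h.2 ((dvd_sub_comm).1 h')⟩
  · rintro ⟨⟨x, y⟩, β⟩; simp only [T, mem_product, mem_filter, mem_univ, and_true]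
    exact fun h => ⟨h.1.symm, fun h' => h.2 ((dvd_sub_comm).1 h')⟩
  · intros; rfl
  · intros; rfl
  · intros; exact mul_comm _ _

lemma AA_holder (hU : ∀ n ξ β, 0 ≤ U n ξ β) {m n m1 n1 m2 n2 : ℕ} (a b : ℕ) {t : ℝ} (h0 : 0 < t) (h1 : t < 1)
    (hm : (m : ℝ) = (1 - t) * m1 + t * m2) (hn : (n : ℝ) = (1 - t) * n1 + t * n2) :
    AA p U m n a b ≤ AA p U m1 n1 a b ^ (1 - t) * AA p U m2 n2 a b ^ t := by
  refine le_trans (le_of_eq ?_) (holder2 (T p ι a b) _ _ (fun x _ => mul_nonneg (pow_nonneg (hU _ _ _) _) (pow_nonneg (hU _ _ _) _))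
    (fun x _ => mul_nonneg (pow_nonneg (hU _ _ _) _) (pow_nonneg (hU _ _ _) _)) h0 h1)
  refine sum_congr rfl fun x _ => ?_
  have key : ∀ u : ℝ, 0 ≤ u → ∀ m m1 m2 : ℕ, (m : ℝ) = (1 - t) * m1 + t * m2 → u ^ m = (u ^ m1) ^ (1 - t) * (u ^ m2) ^ t := by
    intro u hu m m1 m2 hm
    rw [← rpow_natCast, ← rpow_natCast, ← rpow_natCast, ← rpow_mul hu, ← rpow_mul hu,
      ← rpow_add_of_nonneg hu (mul_nonneg (cast_nonneg _) 𝕃) (mul_nonneg (cast_nonneg _) h0.le), hm]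
    congr 1; ring
  rw [key _ (hU _ _ _) _ _ _ hm, key _ (hU _ _ _) _ _ _ hn, mul_rpow (pow_nonneg (hU _ _ _) _) (pow_nonneg (hU _ _ _) _),
    mul_rpow (pow_nonneg (hU _ _ _) _) (pow_nonneg (hU _ _ _) _)]
  ring

lemma AA_zero (hU : ∀ n ξ β, 0 ≤ U n ξ β) (q a b : ℕ) : AA p U 0 q a b ≤ ®p ^ (a : ℝ) * NN p U q b := by
  unfold AA T NN
  calc _ ≤ ∑ x ∈ (range (p ^ a) ×ˢ range (p ^ b)) ×ˢ (univ : Finset ι), U b x.1.2 x.2 ^ q := by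
        refine (sum_le_sum_of_subset_of_nonneg (Finset.product_subset_product_left (filter_subset _ _))
          fun x _ _ => mul_nonneg (pow_nonneg (hU _ _ _) _) (pow_nonneg (hU _ _ _) _)).trans_eq ?_
        exact sum_congr rfl fun x _ => by rw [pow_zero, one_mul]
    _ = _ := by
        rw [sum_product, sum_product]
        simp only [sum_const, card_range, nsmul_eq_mul]
        push_cast; rw [rpow_natCast]

lemma comb {x y C P e1 e2 S t : ℝ} (hP : 0 < P) (hx : 0 ≤ x) (hy : 0 ≤ y) (hC : 0 ≤ C) (hS : 0 ≤ S) (h0 : 0 < t) (h1 : t < 1)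
    (h1' : x ≤ C * P ^ e1 * S) (h2 : y ≤ C * P ^ e2 * S) :
    x ^ (1 - t) * y ^ t ≤ C * P ^ ((1 - t) * e1 + t * e2) * S := by
  calc x ^ (1 - t) * y ^ t ≤ (C * P ^ e1 * S) ^ (1 - t) * (C * P ^ e2 * S) ^ t := by
        refine mul_le_mul (rpow_le_rpow hx h1' 𝕃) (rpow_le_rpow hy h2 h0.le) ℙ ℙ
    _ = (C ^ (1 - t) * C ^ t) * (P ^ (e1 * (1 - t)) * P ^ (e2 * t)) * (S ^ (1 - t) * S ^ t) := by
        rw [mul_rpow ℙ hS, mul_rpow hC ℙ, mul_rpow ℙ hS, mul_rpow hC ℙ,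
          ← rpow_mul hP.le, ← rpow_mul hP.le]; ring
    _ = _ := by
        rw [← rpow_add hP, ← rpow_add_of_nonneg hC 𝕃 h0.le, ← rpow_add_of_nonneg hS 𝕃 h0.le]
        simp only [sub_add_cancel, rpow_one]
        congr 3; ring


structure Sys (p k h : ℕ) {ι : Type} [Fintype ι] (U : ℕ → ℤ → ι → ℝ) (C ε η : ℝ) : Prop where
  nn : ∀ n ξ β, 0 ≤ U n ξ β
  rs : ∀ a, 1 ≤ a → a ≤ h → NN p U (k * (k + 1)) a ≤
    C * ®p ^ ((η + (k * (k + 1) / 2 - 1)) * ((h : ℝ) - a)) * NN p U (k * (k + 1)) h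
  lo : ∀ r a a' b, 1 ≤ r → r < k → 1 ≤ a → a ≤ a' → r * a' ≤ (k - r + 1) * b → a' ≤ h →
    AA p U (r * (r + 1)) (k * (k + 1) - r * (r + 1)) a b ≤ C * ®p ^ ((ε + (r * (r + 1) / 2 - 1)) * ((a' : ℝ) - a)) *
      AA p U (r * (r + 1)) (k * (k + 1) - r * (r + 1)) a' b

def yy (k : ℕ) (η : ℝ) : ℕ → ℕ → ℝ
  | _, 0 => η
  | 0, _ + 1 => 0
  | n + 1, r + 1 => ((k - (r + 1) : ℝ) / (k - r)) * yy k η n r + yy k η n (k - (r + 1)) / (r + 1)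

lemma yy_nonneg {k : ℕ} {η : ℝ} (hη : 0 ≤ η) (n : ℕ) : ∀ r, r < k → 0 ≤ yy k η n r := by
  induction n with
  | zero => rintro (_ | r) _ <;> rw [yy]; exact hη
  | succ n ih =>
    rintro (_ | r) hr
    · rw [yy]; exact hη
    rw [yy]
    have h1 : ((r : ℝ) + 1) < k := by exact_mod_cast hr
    have h2 := ih r 𝕆
    have h3 := ih (k - (r + 1)) 𝕆
    have : 0 ≤ (k - (r + 1) : ℝ) / (k - r) := div_nonneg 𝕃 𝕃
    positivity

def EE (k r : ℕ) (a b : ℝ) : ℝ := a + b - (a * (r * (r + 1)) + b * (k * (k + 1) - r * (r + 1))) / 2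

def PP (p k : ℕ) (η ε η0 C' : ℝ) (n h : ℕ) {ι : Type} [Fintype ι] (U : ℕ → ℤ → ι → ℝ) : Prop :=
  ∀ r a b : ℕ, r < k → 1 ≤ a → k ^ (n + 1) ≤ b → k ^ (n + 1) * b ≤ h → r * a ≤ (k - r + 1) * b →
    AA p U (r * (r + 1)) (k * (k + 1) - r * (r + 1)) a b ≤
      C' * ®p ^ (EE k r a b + (η + n * ε) * h - yy k η0 n r * b) * (®p ^ (h * (k * (k + 1) / 2 - 1 : ℝ)) * NN p U (k * (k + 1)) h)

lemma qle {k r : ℕ} (h : r ≤ k) : r * (r + 1) ≤ k * (k + 1) := Nat.mul_le_mul h 𝕆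

lemma PP0 {p k h : ℕ} (hp : 1 < p) {ι : Type} [Fintype ι] {U : ℕ → ℤ → ι → ℝ} {C ε η η0 : ℝ} (hC : 0 ≤ C)
    (hη : η0 ≤ η) (hs : Sys p k h U C ε η) {a b : ℕ} (hb : 1 ≤ b) (hbh : b ≤ h) :
    AA p U 0 (k * (k + 1)) a b ≤ C * ®p ^ (EE k 0 a b + η * h - η0 * b) * (®p ^ (h * (k * (k + 1) / 2 - 1 : ℝ)) * NN p U (k * (k + 1)) h) := by
  have hp0 : (0 : ℝ) < p := by positivity
  have hp1 : (1 : ℝ) ≤ p := by exact_mod_cast hp.le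
  have hN := NN_nonneg (p := p) hs.nn (k * (k + 1)) h
  calc _ ≤ _ := AA_zero hs.nn _ _ _
    _ ≤ ®p ^ (a : ℝ) * _ := mul_le_mul_of_nonneg_left (hs.rs b hb hbh) ℙ
    _ = C * ®p ^ ((a : ℝ) + (η + (k * (k + 1) / 2 - 1)) * ((h : ℝ) - b)) * NN p U (k * (k + 1)) h := by
      rw [rpow_add hp0]; ring
    _ ≤ C * ®p ^ (EE k 0 a b + η * h - η0 * b + (h * (k * (k + 1) / 2 - 1 : ℝ))) * NN p U (k * (k + 1)) h := by
      refine mul_le_mul_of_nonneg_right (mul_le_mul_of_nonneg_left (rpow_le_rpow_of_exponent_le hp1 ?_) hC) hN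
      have : η0 * b ≤ η * b := mul_le_mul_of_nonneg_right hη ℙ
      simp only [EE]; push_cast; linarith
    _ = _ := by rw [rpow_add hp0]; ring

lemma expo {k r : ℕ} (h0 : 0 < r) (hr : r < k) :
    ((r * (r + 1) : ℕ) : ℝ) = (1 - 1 / ((k - r + 1 : ℕ) : ℝ)) * ((r - 1) * (r - 1 + 1) : ℕ) + 1 / ((k - r + 1 : ℕ) : ℝ) * (k * (k + 1) - (k - r) * (k - r + 1) : ℕ) ∧
    ((k * (k + 1) - r * (r + 1) : ℕ) : ℝ) = (1 - 1 / ((k - r + 1 : ℕ) : ℝ)) * (k * (k + 1) - (r - 1) * (r - 1 + 1) : ℕ) + 1 / ((k - r + 1 : ℕ) : ℝ) * ((k - r) * (k - r + 1) : ℕ) := by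
  obtain ⟨r, rfl⟩ : ∃ r', r = r' + 1 := ⟨r - 1, by omega⟩
  obtain ⟨m, rfl⟩ : ∃ m, k = r + 1 + m := ⟨k - (r + 1), by omega⟩
  have e1 : r + 1 + m - (r + 1) = m := by omega
  rw [e1, Nat.add_sub_cancel, cast_sub (qle 𝕆), cast_sub (qle 𝕆), cast_sub (qle 𝕆)]
  have : (m : ℝ) + 1 ≠ 0 := by positivity
  push_cast
  constructor <;> · field_simp; ring

lemma expo2 {k r : ℕ} (hr : r + 1 < k) {a a' b h ε η Y n : ℝ} (hε : 0 ≤ ε) {y0 y1 : ℝ} (hy1 : 0 ≤ y1) (hY : y1 ≤ Y)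
    (ha : 1 ≤ a) (hh : a' ≤ h) (h2 : (k - r) * b ≤ (r + 1) * a' + (r + 1)) :
    (ε + ((r + 1 : ℕ) * ((r + 1 : ℕ) + 1) / 2 - 1)) * (a' - a) + ((1 - 1 / ((k - (r + 1) + 1 : ℕ) : ℝ)) * (EE k (r + 1 - 1) a' b + (η + n * ε) * h - y0 * b)
      + 1 / ((k - (r + 1) + 1 : ℕ) : ℝ) * (EE k (k - (r + 1)) b a' + (η + n * ε) * h - y1 * a')) ≤
      Y + (EE k (r + 1) a b + (η + (n + 1) * ε) * h - (((k - (r + 1) : ℝ) / (k - r)) * y0 + y1 / (r + 1)) * b) := by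
  obtain ⟨m, rfl⟩ : ∃ m, k = r + 1 + m := ⟨k - (r + 1), by omega⟩
  have e1 : r + 1 + m - (r + 1) = m := by omega
  rw [e1, Nat.add_sub_cancel]
  have hm : (1 : ℝ) ≤ m := by exact_mod_cast (by omega : 1 ≤ m)
  have hr0 : (0 : ℝ) ≤ r := cast_nonneg r
  have hm0 : (m : ℝ) + 1 ≠ 0 := by positivity
  have e2 : ((r + 1 + m : ℕ) : ℝ) - r = m + 1 := by push_cast; ring
  have e3 : ((r + 1 + m : ℕ) : ℝ) - (r + 1) = m := by push_cast; ring
  rw [e2] at h2 ⊢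
  rw [e3]
  have h3 : y1 / (r + 1) * b ≤ 1 / (m + 1) * (y1 * a') + Y := by
    have : b / (r + 1) ≤ (a' + 1) / (m + 1) := by rw [div_le_div_iff₀ ℙ ℙ]; linarith
    have h4 := mul_le_mul_of_nonneg_left this hy1
    have h5 : y1 / (m + 1) ≤ Y := (div_le_self hy1 𝕃).trans hY
    have e : y1 * ((a' + 1) / (m + 1)) = 1 / (m + 1) * (y1 * a') + y1 / (m + 1) := by ring
    have e' : y1 / (r + 1) * b = y1 * (b / (r + 1)) := by ring
    rw [e']; linarith
  have h4 : ε * (a' - a) ≤ ε * h := mul_le_mul_of_nonneg_left 𝕃 hε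
  have e4 : (1 - 1 / ((m + 1 : ℕ) : ℝ)) = m / (m + 1) := by push_cast; field_simp; ring
  have e5 : ((r + 1 : ℕ) * ((r + 1 : ℕ) + 1) / 2 - 1 : ℝ) * (a' - a) + (m / (m + 1) * (EE (r + 1 + m) r a' b) + 1 / (m + 1) * (EE (r + 1 + m) m b a')) = EE (r + 1 + m) (r + 1) a b := by
    simp only [EE]; push_cast; field_simp; ring
  rw [e4]
  have e6 : (m : ℝ) / (m + 1) + 1 / (m + 1) = 1 := by field_simp
  push_cast at e5 ⊢
  have e7 : (m : ℝ) / (m + 1) * ((η + n * ε) * h) + 1 / (m + 1) * ((η + n * ε) * h) = (η + n * ε) * h := by rw [← add_mul, e6, one_mul]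
  linarith only [e7, h3, e5, h4]

set_option maxHeartbeats 1000000 in
lemma PPn {p k : ℕ} (hp : 1 < p) (hk : 2 ≤ k) {C ε η η0 : ℝ} (hC : 1 ≤ C) (hε : 0 ≤ ε)
    (hη0 : 0 ≤ η0) (hη : η0 ≤ η) (n : ℕ) : ∃ C' : ℝ, 1 ≤ C' ∧ ∀ (h : ℕ) {ι : Type} [Fintype ι] (U : ℕ → ℤ → ι → ℝ),
      Sys p k h U C ε η → PP p k η ε η0 C' n h U := by
  have hp0 : (0 : ℝ) < p := by positivity
  have hp1 : (1 : ℝ) ≤ p := by exact_mod_cast hp.le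
  have hk2 : (2 : ℝ) ≤ k := by exact_mod_cast hk
  have base : ∀ n : ℕ, ∀ (h : ℕ) {ι : Type} [Fintype ι] (U : ℕ → ℤ → ι → ℝ), Sys p k h U C ε η → ∀ a b : ℕ, 1 ≤ a →
      k ^ (n + 1) ≤ b → b ≤ h → AA p U 0 (k * (k + 1)) a b ≤
      C * ®p ^ (EE k 0 a b + (η + n * ε) * h - yy k η0 n 0 * b) * (®p ^ (h * (k * (k + 1) / 2 - 1 : ℝ)) * NN p U (k * (k + 1)) h) := by
    intro n h ι _ U hs a b ha hb hbh
    have hN := NN_nonneg (p := p) hs.nn (k * (k + 1)) h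
    have hb1 : 1 ≤ b := le_trans (Nat.one_le_pow _ _ 𝕆) hb
    refine (PP0 hp 𝕃 hη hs hb1 hbh).trans ?_
    have : 0 ≤ (n : ℝ) * ε * h := by positivity
    have h2 : EE k 0 a b + η * h - η0 * b ≤ EE k 0 a b + (η + n * ε) * h - yy k η0 n 0 * b := by rw [yy]; linarith
    exact mul_le_mul_of_nonneg_right (mul_le_mul_of_nonneg_left (rpow_le_rpow_of_exponent_le hp1 h2) 𝕃) ℙ
  induction n with
  | zero =>
    refine ⟨C, hC, fun h ι _ U hs r a b hr ha hb hbh hab => ?_⟩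
    have hN := NN_nonneg (p := p) hs.nn (k * (k + 1)) h
    simp only [zero_add, pow_one] at hb hbh
    have hb1 : 1 ≤ b := by omega
    have hbh' : b ≤ h := le_trans (le_mul_of_pos_left _ 𝕆) hbh
    rcases Nat.eq_zero_or_pos r with rfl | hr0
    · simpa using base 0 h U hs a b ha (by simpa using hb) hbh'
    have hah' : a ≤ h := by
      refine le_trans ?_ hbh
      calc a ≤ r * a := le_mul_of_pos_left _ hr0
        _ ≤ _ := hab
        _ ≤ k * b := Nat.mul_le_mul_right _ 𝕆
    have hr1 : (1 : ℝ) ≤ r := by exact_mod_cast hr0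
    have hrk : (r : ℝ) + 1 ≤ k := by exact_mod_cast hr
    have hq : (0 : ℝ) < k * (k + 1) := by positivity
    have ht0 : (0 : ℝ) < r * (r + 1) / (k * (k + 1)) := by positivity
    have ht1 : (r * (r + 1) / (k * (k + 1)) : ℝ) < 1 := by rw [div_lt_one hq]; nlinarith
    have e1 := PP0 hp 𝕃 hη hs hb1 hbh' (a := a)
    have e2 := PP0 hp 𝕃 hη hs ha hah' (a := b)
    rw [AA_symm] at e2
    refine (AA_holder hs.nn (m1 := 0) (n1 := k * (k + 1)) (m2 := k * (k + 1)) (n2 := 0) a b ht0 ht1 ?_ ?_).trans ?_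
    · push_cast; field_simp; ring
    · push_cast [qle hr.le]; field_simp; ring
    refine (comb hp0 (AA_nonneg hs.nn _ _ _ _) (AA_nonneg hs.nn _ _ _ _) 𝕃 ℙ ht0 ht1 e1 e2).trans ?_
    refine mul_le_mul_of_nonneg_right (mul_le_mul_of_nonneg_left (rpow_le_rpow_of_exponent_le hp1 ?_) 𝕃) ℙ
    obtain ⟨r', rfl⟩ : ∃ r', r = r' + 1 := ⟨r - 1, by omega⟩
    rw [yy]
    have e3 : ∀ t : ℝ, 0 < t → t < 1 → t * (k * (k + 1)) = (r' + 1) * (r' + 1 + 1) → (1 - t) * (EE k 0 a b + η * h - η0 * b) + t * (EE k 0 b a + η * h - η0 * a) ≤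
        EE k (r' + 1) a b + (η + (0 : ℕ) * ε) * h - 0 * b := by
      intro t h0 h1 ht
      have u1 : 0 ≤ (1 - t) * (η0 * b) := mul_nonneg (by linarith only [h1]) ℙ
      have u2 : 0 ≤ t * (η0 * a) := by positivity
      simp only [EE]; push_cast
      rw [← ht]
      linarith only [u1, u2]
    refine e3 _ ht0 ht1 ?_
    push_cast; field_simp
  | succ n ih =>
    obtain ⟨C₁, hC₁, ih⟩ := ih
    obtain ⟨Y, hY⟩ : ∃ Y : ℝ, 0 ≤ Y ∧ ∀ r < k, yy k η0 n r ≤ Y :=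
      ⟨∑ r ∈ range k, yy k η0 n r, sum_nonneg fun r hr => yy_nonneg hη0 n r (mem_range.1 hr), fun r hr =>
        single_le_sum (f := yy k η0 n) (fun r hr => yy_nonneg hη0 n r (mem_range.1 hr)) (mem_range.2 hr)⟩
    have hCC : C ≤ C * C₁ * ®p ^ Y := by
      have : 1 ≤ C₁ * ®p ^ Y := one_le_mul_of_one_le_of_one_le hC₁ (one_le_rpow hp1 hY.1)
      nlinarith
    refine ⟨C * C₁ * ®p ^ Y, hC.trans hCC, fun h ι _ U hs r a b hr ha hb hbh hab => ?_⟩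
    have hN := NN_nonneg (p := p) hs.nn (k * (k + 1)) h
    have hkn : 1 ≤ k ^ (n + 1) := Nat.one_le_pow _ _ 𝕆
    rw [pow_succ] at hb hbh
    have hkb : k * b ≤ h := le_trans (by rw [mul_assoc]; exact le_mul_of_pos_left _ hkn) hbh
    have hb1 : k ≤ b := le_trans (le_mul_of_pos_left _ hkn) hb
    rcases Nat.eq_zero_or_pos r with rfl | hr0
    · have := base (n + 1) h U hs a b ha (by rw [pow_succ]; exact hb) (le_trans (le_mul_of_pos_left _ 𝕆) hkb)
      rw [zero_mul, Nat.sub_zero]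
      refine this.trans (mul_le_mul_of_nonneg_right (mul_le_mul_of_nonneg_right hCC ℙ) ℙ)
    set K := k - r + 1 with hK
    set a' := K * b / r with ha'
    have h1 : r * a' ≤ K * b := mul_div_le _ _
    have h2 : K * b < r * a' + r := by
      have := lt_mul_div_succ (K * b) hr0
      rw [mul_add, mul_one] at this; exact this
    have h3 : a ≤ a' := (Nat.le_div_iff_mul_le hr0).2 (by rw [mul_comm]; exact hab)
    have hKk : K ≤ k := by omega
    have h4 : a' ≤ k * b := by
      calc a' ≤ r * a' := le_mul_of_pos_left _ hr0
        _ ≤ K * b := h1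
        _ ≤ k * b := Nat.mul_le_mul_right _ hKk
    have h5 : b ≤ k * a' := by
      have : 2 * b ≤ K * b := Nat.mul_le_mul_right _ 𝕆
      have : r * a' ≤ k * a' := Nat.mul_le_mul_right _ hr.le
      omega
    have hKr : ((K : ℕ) : ℝ) = k - r + 1 := by rw [hK]; push_cast [hr.le]; ring
    have hKK : (2 : ℝ) ≤ K := by exact_mod_cast (by omega : 2 ≤ K)
    have ht0 : (0 : ℝ) < 1 / K := by positivity
    have ht1 : (1 / K : ℝ) < 1 := by rw [div_lt_one ℙ]; linarith only [hKK]
    have g1 : k ^ (n + 1) ≤ b := le_trans (Nat.le_mul_of_pos_right _ 𝕆) hb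
    have g2 : k ^ (n + 1) * b ≤ h := le_trans (Nat.mul_le_mul_right _ (Nat.le_mul_of_pos_right _ 𝕆)) hbh
    have g3 : k ^ (n + 1) ≤ a' := Nat.le_of_mul_le_mul_left (by rw [mul_comm]; exact hb.trans h5) (show 0 < k by omega)
    have g4 : k ^ (n + 1) * a' ≤ h := le_trans (Nat.mul_le_mul_left _ h4) (by rw [← mul_assoc]; exact hbh)
    have i1 := ih h U hs (r - 1) a' b 𝕆 (ha.trans h3) g1 g2 (by
      have : (r - 1) * a' ≤ r * a' := Nat.mul_le_mul_right _ 𝕆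
      have : K * b ≤ (k - (r - 1) + 1) * b := Nat.mul_le_mul_right _ 𝕆
      omega)
    have i2 := ih h U hs (k - r) b a' 𝕆 𝕆 g3 g4 (by
      have e : k - (k - r) + 1 = r + 1 := by omega
      rw [e]
      have : (r + 1) * a' = r * a' + a' := by ring
      have : K * b = (k - r) * b + b := by rw [hK]; ring
      omega)
    rw [AA_symm] at i2
    have hh := hs.lo r a a' b hr0 hr ha h3 h1 (h4.trans hkb)
    refine hh.trans ?_
    have hol := AA_holder (p := p) hs.nn a' b ht0 ht1 (expo hr0 hr).1 (expo hr0 hr).2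
    have hol2 := hol.trans (comb hp0 (AA_nonneg hs.nn _ _ _ _) (AA_nonneg hs.nn _ _ _ _) (by linarith only [ht1, ht0, hC₁]) ℙ ht0 ht1 i1 i2)
    refine (mul_le_mul_of_nonneg_left hol2 ℙ).trans ?_
    set S := ®p ^ (h * (k * (k + 1) / 2 - 1 : ℝ)) * NN p U (k * (k + 1)) h
    have hS : 0 ≤ S := by positivity
    obtain ⟨r', rfl⟩ : ∃ r', r = r' + 1 := ⟨r - 1, by omega⟩
    have e5 : ∀ x y : ℝ, C * ®p ^ x * (C₁ * ®p ^ y * S) = C * C₁ * ®p ^ (x + y) * S := by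
      intro x y; rw [rpow_add hp0]; ring
    have e6 : ∀ x : ℝ, C * C₁ * ®p ^ Y * ®p ^ x * S = C * C₁ * ®p ^ (Y + x) * S := by
      intro x; rw [rpow_add hp0]; ring
    rw [e5, e6]
    refine mul_le_mul_of_nonneg_right (mul_le_mul_of_nonneg_left (rpow_le_rpow_of_exponent_le hp1 ?_) ℙ) hS
    rw [yy]
    have hh' : (a' : ℝ) ≤ h := by exact_mod_cast h4.trans hkb
    have := expo2 hr (a := a) (a' := a') (b := b) (h := h) (η := η) (n := n) hε (y0 := yy k η0 n r') (yy_nonneg hη0 n (k - (r' + 1)) 𝕆)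
      (hY.2 _ 𝕆) (by exact_mod_cast ha) hh' (by
        have : ((K * b : ℕ) : ℝ) ≤ ((r' + 1) * a' + (r' + 1) : ℕ) := by exact_mod_cast h2.le
        push_cast [hKr] at this ⊢; linarith only [this])
    simp only [hK, Nat.add_sub_cancel] at this ⊢
    push_cast at this ⊢
    exact this


open Polynomial

lemma yy_sum {k : ℕ} (hk : 2 ≤ k) (η : ℝ) (n : ℕ) :
    ∑ r ∈ range (k - 1), yy k η n (r + 1) = n * ((k - 1) / k * η) := by
  obtain ⟨i, rfl⟩ : ∃ i, k = i + 2 := ⟨k - 2, by omega⟩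
  rw [show i + 2 - 1 = i + 1 by omega]
  induction n with
  | zero => simp [yy]
  | succ n ih =>
    simp only [yy]
    rw [sum_add_distrib, sum_range_succ' (fun r : ℕ => (((i + 2 : ℕ) : ℝ) - (r + 1)) / ((i + 2 : ℕ) - r) * yy (i + 2) η n r) i,
      ← Finset.sum_range_reflect (fun r : ℕ => yy (i + 2) η n (i + 2 - (r + 1)) / ((r : ℝ) + 1))]
    have e1 : ∑ r ∈ range i, (((i + 2 : ℕ) : ℝ) - ((r + 1 : ℕ) + 1)) / ((i + 2 : ℕ) - (r + 1 : ℕ)) * yy (i + 2) η n (r + 1)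
        = ∑ r ∈ range (i + 1), ((i : ℝ) - r) / (i + 1 - r) * yy (i + 2) η n (r + 1) := by
      rw [sum_range_succ _ i]
      simp only [sub_self, zero_div, zero_mul, add_zero]
      refine sum_congr rfl fun r _ => ?_
      push_cast; congr 2 <;> ring
    have e2 : ∑ j ∈ range (i + 1), yy (i + 2) η n (i + 2 - (i + 1 - 1 - j + 1)) / (((i + 1 - 1 - j : ℕ) : ℝ) + 1)
        = ∑ r ∈ range (i + 1), 1 / (i + 1 - r) * yy (i + 2) η n (r + 1) := by
      refine sum_congr rfl fun r hr => ?_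
      have hr := mem_range.1 hr
      rw [show i + 2 - (i + 1 - 1 - r + 1) = r + 1 by omega, show i + 1 - 1 - r = i - r by omega, cast_sub 𝕆]
      ring
    rw [e1, e2, add_right_comm, ← sum_add_distrib]
    have e3 : ∀ r ∈ range (i + 1), ((i : ℝ) - r) / (i + 1 - r) * yy (i + 2) η n (r + 1) + 1 / (i + 1 - r) * yy (i + 2) η n (r + 1) = yy (i + 2) η n (r + 1) := by
      intro r hr
      have : (r : ℝ) ≤ i := by exact_mod_cast lt_succ_iff.1 (mem_range.1 hr)
      have : (i : ℝ) + 1 - r ≠ 0 := by linarith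
      field_simp; ring
    rw [sum_congr rfl e3, ih]
    have : yy (i + 2) η n 0 = η := by cases n <;> rw [yy]
    rw [this]; push_cast; ring

lemma powsum {α : Type*} (s : Finset α) (f : α → ℝ) (hf : ∀ i ∈ s, 0 ≤ f i) {n : ℕ} (hn : 1 ≤ n) :
    (∑ i ∈ s, f i) ^ n ≤ (s.card : ℝ) ^ (n - 1) * ∑ i ∈ s, f i ^ n := by
  obtain ⟨n, rfl⟩ : ∃ m, n = m + 1 := ⟨n - 1, by omega⟩
  rcases s.eq_empty_or_nonempty with rfl | hs
  · simp
  have h := Finset.card_pos.2 hs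
  have := pow_sum_div_card_le_sum_pow (s := s) (f := f) hf n
  rw [div_le_iff₀ ℙ] at this
  rw [Nat.add_sub_cancel, mul_comm]; exact this

lemma broad {p : ℕ} (hp : 1 < p) (u : ℕ → ℝ) (hu : ∀ i, 0 ≤ u i) {m n : ℕ} :
    (∑ i ∈ range p, u i) ^ (m + n) ≤ 2 ^ (m + n) * ∑ i ∈ range p, u i ^ (m + n) +
      ®p ^ (2 * (m + n)) * ∑ i ∈ range p, ∑ j ∈ range p, if ¬ (p : ℤ) ∣ i - j then u i ^ m * u j ^ n else 0 := by
  have hp0 : (1 : ℝ) ≤ p := by exact_mod_cast hp.le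
  have nn : ∀ i j : ℕ, 0 ≤ if ¬ (p : ℤ) ∣ i - j then u i ^ m * u j ^ n else 0 := fun i j => by
    have := hu i; have := hu j; split_ifs <;> positivity
  have n1 : 0 ≤ ∑ i ∈ range p, u i ^ (m + n) := sum_nonneg fun i _ => pow_nonneg (hu i) _
  have n2 : 0 ≤ ∑ i ∈ range p, ∑ j ∈ range p, if ¬ (p : ℤ) ∣ i - j then u i ^ m * u j ^ n else 0 :=
    sum_nonneg fun i _ => sum_nonneg fun j _ => nn i j
  have hS : 0 ≤ ∑ i ∈ range p, u i := sum_nonneg fun i _ => hu i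
  obtain ⟨i0, hi0, hmax⟩ := Finset.exists_max_image (range p) u ⟨0, mem_range.2 𝕆⟩
  by_cases h : ∃ j ∈ range p, j ≠ i0 ∧ u i0 ≤ p * u j
  · obtain ⟨j, hj, hne, hle⟩ := h
    have h1 : ∑ i ∈ range p, u i ≤ p * u i0 := by
      refine (sum_le_card_nsmul _ _ _ hmax).trans_eq ?_
      rw [card_range, nsmul_eq_mul]
    have hd : ¬ (p : ℤ) ∣ (i0 : ℤ) - j := by
      intro hd
      have a1 := mem_range.1 hj; have a2 := mem_range.1 hi0
      have := Int.eq_zero_of_abs_lt_dvd hd (by rw [abs_lt]; omega)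
      omega
    calc (∑ i ∈ range p, u i) ^ (m + n) ≤ (p * u i0) ^ (m + n) := by gcongr
      _ = ®p ^ (m + n) * (u i0 ^ m * u i0 ^ n) := by rw [mul_pow, pow_add (u i0)]
      _ ≤ ®p ^ (m + n) * (u i0 ^ m * (p * u j) ^ n) := by
        have := hu i0; gcongr
      _ = ®p ^ (m + n + n) * (u i0 ^ m * u j ^ n) := by rw [mul_pow, pow_add _ (m + n)]; ring
      _ ≤ ®p ^ (2 * (m + n)) * (u i0 ^ m * u j ^ n) := by
        have := hu i0; have := hu j
        exact mul_le_mul_of_nonneg_right (pow_le_pow_right₀ hp0 𝕆) ℙ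
      _ ≤ ®p ^ (2 * (m + n)) * ∑ i ∈ range p, ∑ j ∈ range p, if ¬ (p : ℤ) ∣ i - j then u i ^ m * u j ^ n else 0 := by
        refine mul_le_mul_of_nonneg_left ?_ ℙ
        refine le_trans ?_ (single_le_sum (f := fun i : ℕ => ∑ j ∈ range p, if ¬ (p : ℤ) ∣ (i : ℤ) - j then u i ^ m * u j ^ n else 0) (fun i _ => sum_nonneg fun j _ => nn i j) hi0)
        refine le_trans ?_ (single_le_sum (f := fun j : ℕ => if ¬ (p : ℤ) ∣ (i0 : ℤ) - j then u i0 ^ m * u j ^ n else 0) (fun j _ => nn i0 j) hj)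
        rw [if_pos hd]
      _ ≤ _ := le_add_of_nonneg_left ℙ
  · push Not at h
    have h1 : ∑ i ∈ range p, u i ≤ 2 * u i0 := by
      rw [← add_sum_erase _ _ hi0]
      have : ∑ i ∈ (range p).erase i0, u i ≤ ∑ i ∈ (range p).erase i0, u i0 / p :=
        sum_le_sum fun i hi => by
          rw [le_div_iff₀ 𝕃, mul_comm]
          exact (h i (Finset.mem_of_mem_erase hi) (ne_of_mem_erase hi)).le
      rw [sum_const, nsmul_eq_mul] at this
      have h3 : (((range p).erase i0).card : ℝ) ≤ p := by
        exact_mod_cast (Finset.card_erase_le).trans_eq (card_range p)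
      have h4 : (((range p).erase i0).card : ℝ) * (u i0 / p) ≤ p * (u i0 / p) :=
        mul_le_mul_of_nonneg_right h3 (div_nonneg (hu _) 𝕃)
      rw [mul_div_cancel₀ _ (by linarith : (p : ℝ) ≠ 0)] at h4
      linarith
    calc (∑ i ∈ range p, u i) ^ (m + n) ≤ (2 * u i0) ^ (m + n) := by gcongr
      _ = 2 ^ (m + n) * u i0 ^ (m + n) := mul_pow _ _ _
      _ ≤ 2 ^ (m + n) * ∑ i ∈ range p, u i ^ (m + n) := by
        refine mul_le_mul_of_nonneg_left ?_ ℙ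
        exact single_le_sum (f := fun i => u i ^ (m + n)) (fun i _ => pow_nonneg (hu i) _) hi0
      _ ≤ _ := le_add_of_nonneg_right ℙ

lemma AA_iter {p : ℕ} {ι : Type} [Fintype ι] {U : ℕ → ℤ → ι → ℝ} (m n a b : ℕ) : AA p U m n a b =
    ∑ ξ ∈ range (p ^ a), ∑ η ∈ range (p ^ b), if ¬ (p : ℤ) ∣ ξ - η then ∑ β, U a ξ β ^ m * U b η β ^ n else 0 := by
  unfold AA T
  rw [sum_product, sum_filter, sum_product]

open Polynomial

def Dec (p k : ℕ) [Fact p.Prime] (η : ℝ) : Prop := ∃ C : ℝ, 1 ≤ C ∧ ∀ h, DecH p k C η h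

lemma DecH.mono {p k : ℕ} [Fact p.Prime] {C C' η η' : ℝ} {h : ℕ} (H : DecH p k C η h) (hC : C ≤ C') (hC0 : 0 ≤ C) (hη : η ≤ η') :
    DecH p k C' η' h := by
  intro B hB φ hφ w pt X
  refine (H B hB φ hφ w pt X).trans ?_
  have hp1 : (1 : ℝ) ≤ p := by exact_mod_cast (Fact.out : p.Prime).one_lt.le
  refine mul_le_mul_of_nonneg_right (mul_le_mul hC (rpow_le_rpow_of_exponent_le hp1 ?_) ℙ 𝕃)
    (sum_nonneg fun _ _ => sum_nonneg fun _ _ => by positivity)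
  have := mul_le_mul_of_nonneg_right hη (cast_nonneg (α := ℝ) h)
  linarith

lemma cls_zero {p : ℕ} (pt : ℤ → ℤ) (X : Finset ℤ) (ξ : ℤ) : cls p pt X 0 ξ = X := by simp [cls]

lemma triv {p k : ℕ} [Fact p.Prime] (hk : 1 ≤ k) (h B : ℕ) (φ : Fin k → ℤ[X]) (w : ℤ → ℂ) (pt : ℤ → ℤ) (X : Finset ℤ) :
    ∑ β, ‖F p B φ w pt X β‖ ^ (k * (k + 1)) ≤ ®p ^ (h * (k * (k + 1) - 1)) *
        ∑ ξ ∈ range (p ^ h), ∑ β, ‖F p B φ w pt (cls p pt X h ξ) β‖ ^ (k * (k + 1)) := by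
  rw [sum_comm, mul_sum]
  refine sum_le_sum fun β _ => ?_
  have h1 := F_split (φ := φ) w pt X 0 h 0 β
  rw [cls_zero] at h1
  refine (pow_le_pow_left₀ (norm_nonneg _) h1 _).trans ?_
  refine (powsum _ _ (fun _ _ => norm_nonneg _) (by nlinarith)).trans_eq ?_
  simp [pow_mul]

def UU (p B : ℕ) [Fact p.Prime] {k : ℕ} (φ : Fin k → ℤ[X]) (w : ℤ → ℂ) (pt : ℤ → ℤ) (X : Finset ℤ) (n : ℕ) (ξ : ℤ)
    (β : Fin k → ZMod (p ^ B)) : ℝ := ‖F p B φ w pt (cls p pt X n ξ) β‖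

lemma dvd_shift {p a : ℕ} (ha : 1 ≤ a) (ξ ζ η : ℤ) : (p : ℤ) ∣ (ξ + (p : ℤ) ^ a * ζ) - η ↔ (p : ℤ) ∣ ξ - η := by
  have : (p : ℤ) ∣ (p : ℤ) ^ a * ζ := (dvd_pow_self _ 𝕆).mul_right _
  rw [show (ξ + (p : ℤ) ^ a * ζ) - η = (ξ - η) + (p : ℤ) ^ a * ζ by ring]
  exact dvd_add_left this

lemma sys {p k h B : ℕ} [Fact p.Prime] (hk : k < p) {C ε η : ℝ} (hB : k * h ≤ B)
    (h1 : ∀ H, DecH p k C η H) (h2 : ∀ r, 1 ≤ r → r < k → ∀ H, DecH p r C ε H) {φ : Fin k → ℤ[X]} (hφ : Cl p k φ) (w pt X) :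
    Sys p k h (UU p B φ w pt X) C ε η where
  nn _ _ _ := norm_nonneg _
  rs a ha hah := by
    obtain ⟨H, rfl⟩ : ∃ H, h = a + H := ⟨h - a, by omega⟩
    unfold NN
    rw [sum_range_pow a H fun ξ => ∑ β, UU p B φ w pt X (a + H) ξ β ^ (k * (k + 1)), mul_sum]
    refine sum_le_sum fun ξ _ => ?_
    have := TI hk hφ (h1 H) le_rfl ha ξ ξ (fun h => absurd h (lt_irrefl _)) (by rw [add_comm]; exact hB) (B := B) (b := 0)
      (fun h => absurd h (lt_irrefl _)) 0 (Or.inr rfl) w pt X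
    simp only [pow_zero, mul_one] at this
    refine this.trans_eq ?_
    congr 3
    push_cast; ring
  lo r a a' b hr hrk ha haa hab hah := by
    obtain ⟨H, rfl⟩ : ∃ H, a' = a + H := ⟨a' - a, by omega⟩
    rw [AA_iter, AA_iter, sum_range_pow a H fun ξ => ∑ η ∈ range (p ^ b), if ¬ (p : ℤ) ∣ ξ - η then
      ∑ β, UU p B φ w pt X (a + H) ξ β ^ (r * (r + 1)) * UU p B φ w pt X b η β ^ (k * (k + 1) - r * (r + 1)) else 0, mul_sum]
    refine sum_le_sum fun ξ _ => ?_
    rw [sum_comm, mul_sum]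
    refine sum_le_sum fun θ _ => ?_
    simp only [dvd_shift ha]
    split_ifs with hd
    · simp
    have := TI hk hφ (h2 r hr hrk H) hrk.le ha ξ θ (fun _ => hd) (B := B) (b := b) (le_trans (by
        rw [add_comm]; exact Nat.mul_le_mul hrk.le hah) hB) (fun _ => by rw [add_comm]; exact hab) (k * (k + 1) - r * (r + 1)) (Or.inl hrk) w pt X
    refine this.trans_eq ?_
    congr 3
    push_cast; ring

lemma AA_one {p k B : ℕ} [Fact p.Prime] {φ : Fin k → ℤ[X]} (w pt X) {b m n : ℕ} (hb : 1 ≤ b) (hn : 1 ≤ n) :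
    AA p (UU p B φ w pt X) m n 1 1 ≤ ®p ^ (b * n) * AA p (UU p B φ w pt X) m n 1 b := by
  obtain ⟨H, rfl⟩ : ∃ H, b = 1 + H := ⟨b - 1, by omega⟩
  have hp1 : (1 : ℝ) ≤ p := by exact_mod_cast (Fact.out : p.Prime).one_lt.le
  rw [AA_iter, AA_iter, mul_sum]
  refine sum_le_sum fun ξ _ => ?_
  rw [sum_range_pow 1 H fun η => if ¬ (p : ℤ) ∣ ξ - η then
      ∑ β, UU p B φ w pt X 1 ξ β ^ m * UU p B φ w pt X (1 + H) η β ^ n else 0, mul_sum]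
  refine sum_le_sum fun θ _ => ?_
  have e : ∀ ζ : ℕ, (p : ℤ) ∣ (ξ : ℤ) - (θ + (p : ℤ) ^ 1 * ζ) ↔ (p : ℤ) ∣ (ξ : ℤ) - θ := fun ζ => by
    rw [dvd_sub_comm, dvd_shift le_rfl, dvd_sub_comm]
  simp only [e]
  split_ifs with hd
  · simp
  rw [sum_comm, mul_sum]
  refine sum_le_sum fun β _ => ?_
  rw [← mul_sum, mul_left_comm]
  refine mul_le_mul_of_nonneg_left ?_ (pow_nonneg (norm_nonneg _) _)
  refine (pow_le_pow_left₀ (norm_nonneg _) (F_split (φ := φ) w pt X 1 H θ β) _).trans ?_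
  refine (powsum _ _ (fun _ _ => norm_nonneg _) hn).trans ?_
  refine mul_le_mul_of_nonneg_right ?_ (sum_nonneg fun _ _ => pow_nonneg (norm_nonneg _) _)
  rw [card_range]; push_cast
  rw [← pow_mul]
  exact pow_le_pow_right₀ hp1 (Nat.mul_le_mul 𝕆 𝕆)

open Polynomial

lemma pow16 {p q : ℕ} (hp : 16 ≤ p) (hq : 6 ≤ q) : (2 : ℝ) ^ q * ®p ^ (-((q : ℝ) / 2 - 1)) ≤ 1 / 2 := by
  have hp' : (16 : ℝ) ≤ p := by exact_mod_cast hp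
  have hq' : (6 : ℝ) ≤ q := by exact_mod_cast hq
  calc (2 : ℝ) ^ q * ®p ^ (-((q : ℝ) / 2 - 1)) ≤ (2 : ℝ) ^ q * (16 : ℝ) ^ (-((q : ℝ) / 2 - 1)) := by
        refine mul_le_mul_of_nonneg_left (rpow_le_rpow_of_nonpos (by norm_num) hp' 𝕃) ℙ
    _ = (2 : ℝ) ^ ((q : ℝ) + 4 * (-((q : ℝ) / 2 - 1))) := by
        rw [rpow_add (by norm_num), rpow_mul (by norm_num), rpow_natCast]; norm_num
    _ ≤ (2 : ℝ) ^ (-1 : ℝ) := rpow_le_rpow_of_exponent_le (by norm_num) 𝕃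
    _ = 1 / 2 := by rw [rpow_neg_one]; norm_num

set_option maxHeartbeats 1000000 in
lemma improve {p k : ℕ} [Fact p.Prime] (hp : 16 ≤ p) (hk : 2 ≤ k) (hkp : k < p) (hlow : ∀ r, 1 ≤ r → r < k → ∀ ε > 0, Dec p r ε)
    {η0 : ℝ} (hη0 : 0 < η0) : ∃ κ > 0, ∀ η ≥ η0, Dec p k η → Dec p k (η - κ) := by
  have hp0 : (0 : ℝ) < p := by positivity
  have hp1 : (1 : ℝ) ≤ p := by exact_mod_cast (by omega : 1 ≤ p)
  have hk2 : (2 : ℝ) ≤ k := by exact_mod_cast hk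
  obtain ⟨n, hn⟩ := exists_nat_gt ((k : ℝ) * (k * (k + 1) + 1) / η0)
  have hn' : (k : ℝ) * (k * (k + 1) + 1) ≤ n * η0 := by rw [div_lt_iff₀ hη0] at hn; exact hn.le
  obtain ⟨r, hr, hry⟩ : ∃ r ∈ range (k - 1), (k * (k + 1) + 1 : ℝ) ≤ yy k η0 n (r + 1) := by
    refine Finset.exists_le_of_sum_le ⟨0, mem_range.2 𝕆⟩ ?_
    rw [yy_sum hk, sum_const, card_range, nsmul_eq_mul, cast_sub 𝕆]
    push_cast
    have : (n : ℝ) * ((k - 1) / k * η0) = (k - 1) * (n * η0 / k) := by ring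
    rw [this]
    refine mul_le_mul_of_nonneg_left ?_ 𝕃
    rw [le_div_iff₀ ℙ]; linarith
  have hr := mem_range.1 hr
  set D : ℕ := k ^ (n + 1) with hD
  have hDk : k ≤ D := by rw [hD, pow_succ]; exact le_mul_of_pos_left _ (Nat.pow_pos 𝕆)
  have hD0 : (0 : ℝ) < D := by exact_mod_cast (by omega : 0 < D)
  set ε : ℝ := 1 / (2 * (n + 1) * D) with hε
  have hε0 : 0 < ε := by positivity
  refine ⟨min η0 (1 / (2 * D)), lt_min hη0 ℙ, fun η hη hdec => ?_⟩
  set κ := min η0 (1 / (2 * D : ℝ)) with hκ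
  have hκ1 : κ ≤ η := (min_le_left _ _).trans hη
  have hκ2 : κ ≤ 1 / (2 * D) := min_le_right _ _
  obtain ⟨C0, hC0, hdec⟩ := hdec
  choose! Cr hCr hlow' using fun r h1 h2 => hlow r h1 h2 ε hε0
  obtain ⟨C, hC1, hC2⟩ : ∃ C : ℝ, C0 ≤ C ∧ ∀ r, 1 ≤ r → r < k → Cr r ≤ C := by
    refine ⟨C0 + ∑ r ∈ (range k).filter (1 ≤ ·), Cr r, le_add_of_nonneg_right (sum_nonneg fun r hr => ?_), fun r h1 h2 => ?_⟩
    · have := hCr r (mem_filter.1 hr).2 (mem_range.1 (mem_filter.1 hr).1); linarith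
    · have : Cr r ≤ ∑ r ∈ (range k).filter (1 ≤ ·), Cr r := single_le_sum (f := Cr) (fun r hr => by
        have := hCr r (mem_filter.1 hr).2 (mem_range.1 (mem_filter.1 hr).1); linarith) (by simp [h1, h2])
      linarith
  obtain ⟨C', hC', hPP⟩ := PPn (p := p) 𝕆 hk (hC0.trans hC1) hε0.le hη0.le hη n
  set Cn : ℝ := ®p ^ (D * D * (k * (k + 1))) + 2 * ®p ^ (2 * (k * (k + 1))) * C' * p with hCn
  refine ⟨Cn, ?_, fun h => ?_⟩
  · have : 1 ≤ ®p ^ (D * D * (k * (k + 1))) := one_le_pow₀ hp1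
    have : 0 ≤ 2 * ®p ^ (2 * (k * (k + 1))) * C' * p := by positivity
    linarith
  have hCn0 : 0 ≤ Cn := by positivity
  have small : ∀ h ≤ D * D, DecH p k Cn (η - κ) h := by
    intro h hh B hB φ hφ w pt X
    refine (triv 𝕆 h B φ w pt X).trans (mul_le_mul_of_nonneg_right ?_
      (sum_nonneg fun _ _ => sum_nonneg fun _ _ => by positivity))
    have e1 : ®p ^ (h * (k * (k + 1) - 1)) ≤ ®p ^ (D * D * (k * (k + 1))) :=
      pow_le_pow_right₀ hp1 (Nat.mul_le_mul hh 𝕆)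
    have e2 : ®p ^ (h * (k * (k + 1) - 1)) ≤ Cn := by
      have : 0 ≤ 2 * ®p ^ (2 * (k * (k + 1))) * C' * p := by positivity
      linarith
    have e3 : (1 : ℝ) ≤ ®p ^ ((η - κ) * h + h * ((k * (k + 1) : ℕ) / 2 - 1 : ℝ)) := by
      refine one_le_rpow hp1 (add_nonneg (mul_nonneg 𝕃 ℙ) (mul_nonneg ℙ ?_))
      have : (2 : ℝ) * 2 ≤ k * (k + 1) := mul_le_mul hk2 𝕃 (by norm_num) ℙ
      push_cast; linarith
    exact e2.trans (le_mul_of_one_le_right hCn0 e3)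
  induction h with
  | zero => exact small 0 𝕆
  | succ h ih =>
    rcases lt_or_ge (h + 1) (D * D) with hlt | hge
    · exact small _ hlt.le
    intro B hB φ hφ w pt X
    have hs := sys (h := h + 1) hkp hB (fun H => (hdec H).mono hC1 𝕃 le_rfl)
      (fun r h1 h2 H => (hlow' r h1 h2 H).mono (hC2 r h1 h2) (by linarith [hCr r h1 h2]) le_rfl) hφ w pt X
    set U := UU p B φ w pt X with hU
    set q := k * (k + 1) with hq
    have hqr : (q : ℝ) = k * (k + 1) := by rw [hq]; push_cast; ring
    have hN := NN_nonneg (p := p) hs.nn q (h + 1)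
    set S := ®p ^ (((h + 1 : ℕ) : ℝ) * (k * (k + 1) / 2 - 1)) * NN p U q (h + 1) with hS
    have hS0 : 0 ≤ S := by positivity
    have goal : ∑ β, ‖F p B φ w pt X β‖ ^ q ≤ Cn * ®p ^ ((η - κ) * ((h + 1 : ℕ) : ℝ)) * S := by
      set b := (h + 1) / D with hb
      have hb1 : D ≤ b := (Nat.le_div_iff_mul_le 𝕆).2 hge
      have hb2 : D * b ≤ h + 1 := mul_div_le _ _
      have hb3 : ((h + 1 : ℕ) : ℝ) / D ≤ b + 1 := by
        rw [div_le_iff₀ hD0]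
        have := lt_mul_div_succ (h + 1) (show 0 < D by omega)
        have h2 : ((h + 1 : ℕ) : ℝ) ≤ (D * (b + 1) : ℕ) := by exact_mod_cast this.le
        push_cast at h2 ⊢; linarith only [h2]
      have hP := hPP (h + 1) U hs (r + 1) 1 b 𝕆 le_rfl hb1 hb2 (by
        have : 1 * b ≤ (k - (r + 1) + 1) * b := Nat.mul_le_mul_right _ 𝕆
        omega)
      set m := (r + 1) * (r + 1 + 1) with hm
      have hmq : m + 2 ≤ q := by
        have : (r + 1) * (r + 1 + 1) + 2 ≤ (r + 2) * (r + 2 + 1) := by ring_nf; omega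
        have h2 : (r + 2) * (r + 2 + 1) ≤ q := qle 𝕆
        omega
      have hbr : AA p U m (q - m) 1 1 ≤ C' * p * ®p ^ ((η - κ) * ((h + 1 : ℕ) : ℝ)) * S := by
        refine (AA_one w pt X (b := b) 𝕆 𝕆).trans ?_
        refine (mul_le_mul_of_nonneg_left hP ℙ).trans ?_
        rw [← rpow_natCast]
        have e : ∀ x y z : ℝ, ®p ^ x * (C' * ®p ^ y * S) = C' * ®p ^ (x + y) * S := by
          intro x y z; rw [rpow_add hp0]; ring
        have e' : C' * p * ®p ^ ((η - κ) * ((h + 1 : ℕ) : ℝ)) * S = C' * ®p ^ (1 + (η - κ) * ((h + 1 : ℕ) : ℝ)) * S := by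
          rw [rpow_add hp0, rpow_one]; ring
        rw [e _ _ 0, e']
        refine mul_le_mul_of_nonneg_right (mul_le_mul_of_nonneg_left (rpow_le_rpow_of_exponent_le hp1 ?_) (by linarith only [hC'])) hS0
        have hmr : (m : ℝ) = (r + 1) * (r + 1 + 1) := by rw [hm]; push_cast; ring
        have hmq' : (m : ℝ) + 2 ≤ q := by exact_mod_cast hmq
        have hm2 : (2 : ℝ) ≤ m := by rw [hmr]; have := cast_nonneg (α := ℝ) r; exact (by norm_num : (2 : ℝ) = 1 * 2).trans_le (mul_le_mul (by linarith only []) (by linarith only []) (by norm_num) ℙ)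
        have hbb : (0 : ℝ) ≤ b := cast_nonneg b
        have f1 : EE k (r + 1) ((1 : ℕ) : ℝ) b ≤ 0 := by
          simp only [EE]; push_cast; rw [← hmr, ← hqr]; have := mul_le_mul_of_nonneg_left (show (2 : ℝ) ≤ q - m by linarith only [hmq']) hbb; linarith only [hm2, this]
        have f2 : (q + 1 : ℝ) * b ≤ yy k η0 n (r + 1) * b := mul_le_mul_of_nonneg_right (by rw [hqr]; exact hry) hbb
        have f3 : ((b * (q - m) : ℕ) : ℝ) ≤ q * b := by
          exact_mod_cast (Nat.mul_le_mul_left _ (sub_le _ _)).trans_eq (mul_comm _ _)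
        have f4 : n * ε ≤ 1 / (2 * D) := by
          rw [hε, mul_one_div, div_le_div_iff₀ ℙ ℙ]; linarith only [hD0]
        have f5 : (n * ε + κ) * ((h + 1 : ℕ) : ℝ) ≤ ((h + 1 : ℕ) : ℝ) / D := by
          have : n * ε + κ ≤ 1 / D := by
            have : (1 : ℝ) / D = 1 / (2 * D) + 1 / (2 * D) := by field_simp; norm_num
            linarith only [hκ2, f4, this]
          refine (mul_le_mul_of_nonneg_right this ℙ).trans_eq (by ring)
        linarith only [f2, f1, f3, f5, hb3]
      have hnar : ∑ ξ ∈ range p, ∑ β, U 1 ξ β ^ q ≤ Cn * ®p ^ (-((q : ℝ) / 2 - 1)) * ®p ^ ((η - κ) * ((h + 1 : ℕ) : ℝ)) * S := by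
        have e1 : ∀ ξ : ℕ, ∑ β, U 1 ξ β ^ q ≤ Cn * ®p ^ ((η - κ) * h + h * ((q : ℝ) / 2 - 1)) * ∑ ζ ∈ range (p ^ h), ∑ β, U (1 + h) (ξ + (p : ℤ) ^ 1 * ζ) β ^ q := by
          intro ξ
          have := TI hkp hφ ih le_rfl le_rfl ξ ξ (fun h => absurd h (lt_irrefl _)) hB (B := B) (b := 0)
            (fun h => absurd h (lt_irrefl _)) 0 (Or.inr rfl) w pt X
          simp only [pow_zero, mul_one] at this
          exact this
        refine (sum_le_sum fun ξ _ => e1 ξ).trans ?_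
        rw [← mul_sum]
        have e2 := sum_range_pow (p := p) 1 h fun ξ => ∑ β, U (1 + h) ξ β ^ q
        rw [pow_one] at e2
        rw [← e2, add_comm 1 h]
        change _ * NN p U q (h + 1) ≤ _
        rw [hS, ← mul_assoc]
        refine mul_le_mul_of_nonneg_right ?_ hN
        rw [mul_assoc, mul_assoc, ← rpow_add hp0, ← rpow_add hp0]
        refine mul_le_mul_of_nonneg_left (rpow_le_rpow_of_exponent_le hp1 ?_) hCn0
        rw [← hqr]; push_cast
        linarith only [hκ1]
      have hbn : ∑ β, ‖F p B φ w pt X β‖ ^ q ≤ 2 ^ q * ∑ ξ ∈ range p, ∑ β, U 1 ξ β ^ q + ®p ^ (2 * q) * AA p U m (q - m) 1 1 := by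
        rw [AA_iter, sum_comm, mul_sum]
        simp only [pow_one]
        have e3 : ∀ i ∈ range p, ∑ j ∈ range p, (if ¬ (p : ℤ) ∣ (i : ℤ) - j then ∑ β, U 1 i β ^ m * U 1 j β ^ (q - m) else 0)
            = ∑ β, ∑ j ∈ range p, if ¬ (p : ℤ) ∣ (i : ℤ) - j then U 1 i β ^ m * U 1 j β ^ (q - m) else 0 := by
          intro i _
          rw [sum_comm]
          refine sum_congr rfl fun j _ => ?_
          split_ifs <;> simp
        rw [sum_congr rfl e3, sum_comm, mul_sum, ← sum_add_distrib]
        refine sum_le_sum fun β _ => ?_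
        have h1 := F_split (φ := φ) w pt X 0 1 0 β
        rw [cls_zero] at h1
        simp only [pow_one, pow_zero, one_mul, zero_add] at h1
        have h2 := broad (p := p) 𝕆 (fun i : ℕ => U 1 i β) (fun i => norm_nonneg _) (m := m) (n := q - m)
        rw [show m + (q - m) = q by omega] at h2
        exact (pow_le_pow_left₀ (norm_nonneg _) h1 _).trans h2
      have hq6 : 6 ≤ q := Nat.mul_le_mul hk (show 3 ≤ k + 1 by omega)
      have h16 := pow16 (p := p) (q := q) hp hq6
      set P := ®p ^ ((η - κ) * ((h + 1 : ℕ) : ℝ))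
      have hP0 : 0 ≤ P := by positivity
      have a1 : 2 ^ q * (Cn * ®p ^ (-((q : ℝ) / 2 - 1)) * P * S) ≤ Cn / 2 * P * S := by
        have : 2 ^ q * (Cn * ®p ^ (-((q : ℝ) / 2 - 1)) * P * S) = (2 ^ q * ®p ^ (-((q : ℝ) / 2 - 1))) * (Cn * P * S) := by ring
        rw [this]
        refine (mul_le_mul_of_nonneg_right h16 ℙ).trans_eq (by ring)
      have a2 : ®p ^ (2 * q) * (C' * p * P * S) ≤ Cn / 2 * P * S := by
        have : ®p ^ (2 * q) * C' * p ≤ Cn / 2 := by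
          rw [hCn]; have : 0 ≤ ®p ^ (D * D * q) := by positivity
          linarith only [this]
        have h3 : 0 ≤ P * S := by positivity
        linarith only [this, h3, mul_le_mul_of_nonneg_right this h3]
      have a3 := mul_le_mul_of_nonneg_left hnar (show (0 : ℝ) ≤ 2 ^ q by positivity)
      have a4 := mul_le_mul_of_nonneg_left hbr (show (0 : ℝ) ≤ ®p ^ (2 * q) by positivity)
      linarith only [a3, a1, a4, hbn, a2]
    refine goal.trans_eq ?_
    have hNd : ∑ ξ ∈ range (p ^ (h + 1)), ∑ β, ‖F p B φ w pt (cls p pt X (h + 1) ξ) β‖ ^ q = NN p U q (h + 1) := rfl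
    rw [hS, rpow_add hp0, hqr, hNd]; ring

open Polynomial

lemma std_sum {N : ℕ} [NeZero N] {ι : Type*} (s : Finset ι) (f : ι → ZMod N) :
    ZMod.stdAddChar (∑ i ∈ s, f i) = ∏ i ∈ s, ZMod.stdAddChar (f i) := by
  induction s using Finset.induction_on with
  | empty => simp
  | insert a s ha ih => rw [Finset.sum_insert ha, Finset.prod_insert ha, AddChar.map_add_eq_mul, ih]

lemma orth {N k : ℕ} [NeZero N] (c : Fin k → ZMod N) :
    ∑ β : Fin k → ZMod N, ZMod.stdAddChar (∑ j, β j * c j) = if c = 0 then (N : ℂ) ^ k else 0 := by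
  have h1 : ∀ β : Fin k → ZMod N, ZMod.stdAddChar (∑ j, β j * c j) = ∏ j, ZMod.stdAddChar (β j * c j) := fun β =>
    std_sum _ _
  rw [sum_congr rfl fun β _ => h1 β]
  have := (Finset.prod_univ_sum (fun _ : Fin k => (univ : Finset (ZMod N))) fun j x => ZMod.stdAddChar (x * c j)).symm
  rw [Fintype.piFinset_univ] at this
  rw [this]
  simp only [AddChar.sum_mulShift _ (ZMod.isPrimitive_stdAddChar N), ZMod.card]
  split_ifs with h
  · subst h; simp
  · obtain ⟨j, hj⟩ := Function.ne_iff.1 h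
    refine Finset.prod_eq_zero (mem_univ j) ?_
    rw [if_neg (show ¬ c j = 0 from hj)]; simp

lemma inj1 {p h : ℕ} [Fact p.Prime] {φ : ℤ[X]} {u : ZMod p} (hu : u ≠ 0) (hφ : φ.map (castRingHom (ZMod p)) = C u * X ^ 1) (x y : ℤ)
    (hd : (p : ℤ) ^ h ∣ φ.eval x - φ.eval y) : (p : ℤ) ^ h ∣ x - y := by
  obtain ⟨a, rfl⟩ := ZMod.intCast_surjective u
  have h1 : C (p : ℤ) ∣ φ - C a * X := by
    rw [C_dvd_iff_dvd_coeff]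
    intro i
    have := congrArg (fun P => P.coeff i) hφ
    rw [← ZMod.intCast_zmod_eq_zero_iff_dvd] 
    simp only [coeff_map, coeff_sub, Int.cast_sub, pow_one, coeff_C_mul, Int.cast_mul] at this ⊢
    simp only [eq_intCast] at this
    rw [this]; simp [coeff_X]
  obtain ⟨G, hG⟩ := h1
  obtain ⟨g, hg⟩ := sub_dvd_eval_sub x y G
  have h2 : φ = C a * X + C (p : ℤ) * G := by rw [← hG]; ring
  have h3 : φ.eval x - φ.eval y = (x - y) * (a + p * g) := by
    rw [h2]; simp only [eval_add, eval_mul, eval_C, eval_X]; linear_combination (p : ℤ) * hg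
  rw [h3] at hd
  refine IsCoprime.dvd_of_dvd_mul_right (IsCoprime.pow_left ?_) hd
  rw [(Nat.prime_iff_prime_int.1 (Fact.out : p.Prime)).coprime_iff_not_dvd]
  intro hd
  refine hu ((ZMod.intCast_zmod_eq_zero_iff_dvd _ _).2 ((dvd_add_left (dvd_mul_right _ _)).1 hd))

lemma base1 {p : ℕ} [Fact p.Prime] (h : ℕ) : DecH p 1 1 0 h := by
  intro B hB φ hφ w pt X
  obtain ⟨u, hu, hφ⟩ := hφ 0
  norm_num
  set G : ℤ → ℤ → ℂ := fun i i' => w i * (starRingEnd ℂ) (w i') * ∑ β : Fin 1 → ZMod (p ^ B),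
    ZMod.stdAddChar (∑ j, β j * ((((φ j).eval (pt i) - (φ j).eval (pt i') : ℤ)) : ZMod (p ^ B))) with hG
  have e1 : ∀ X' : Finset ℤ, ((∑ β, ‖F p B φ w pt X' β‖ ^ 2 : ℝ) : ℂ) = ∑ i ∈ X', ∑ i' ∈ X', G i i' := by
    intro X'
    simp only [hG, mul_sum]
    rw [sum_congr rfl fun i _ => sum_comm, sum_comm]
    rw [ofReal_sum]
    refine sum_congr rfl fun β _ => ?_
    rw [ofReal_pow, ← mul_conj', F, map_sum, sum_mul_sum]
    refine sum_congr rfl fun i _ => sum_congr rfl fun i' _ => ?_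
    rw [map_mul, ← AddChar.map_neg_eq_conj]
    have : (∑ j, β j * (((φ j).eval (pt i) - (φ j).eval (pt i') : ℤ) : ZMod (p ^ B))) =
      (∑ j, β j * (((φ j).eval (pt i) : ℤ) : ZMod (p ^ B))) + -(∑ j, β j * (((φ j).eval (pt i') : ℤ) : ZMod (p ^ B))) := by
      rw [← Finset.sum_neg_distrib, ← sum_add_distrib]
      refine sum_congr rfl fun j _ => ?_
      push_cast; ring
    rw [this, AddChar.map_add_eq_mul]; ring
  have e2 : ∀ i i', ¬ (p : ℤ) ^ h ∣ pt i - pt i' → G i i' = 0 := by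
    intro i i' hd
    simp only [hG]
    rw [orth, if_neg, mul_zero]
    intro h0
    have := congrFun h0 0
    simp only [Pi.zero_apply] at this
    rw [ZMod.intCast_zmod_eq_zero_iff_dvd] at this
    refine hd (inj1 hu (by simpa using hφ) _ _ (dvd_trans ?_ this))
    push_cast; exact pow_dvd_pow _ 𝕆
  refine le_of_eq ?_
  have e3 : ((∑ β, ‖F p B φ w pt X β‖ ^ 2 : ℝ) : ℂ) = ((∑ ξ ∈ range (p ^ h), ∑ β, ‖F p B φ w pt (cls p pt X h ξ) β‖ ^ 2 : ℝ) : ℂ) := by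
    rw [e1, ofReal_sum, sum_congr rfl fun ξ _ => e1 _]
    have := cls_part (p := p) pt X 0 h 0 fun i => ∑ i' ∈ X, G i i'
    rw [cls_zero] at this
    rw [this]
    simp only [pow_zero, one_mul, zero_add]
    refine sum_congr rfl fun ξ _ => sum_congr rfl fun i hi => ?_
    symm
    refine Finset.sum_subset (filter_subset _ _) fun i' hi' hn => e2 _ _ fun hd => hn ?_
    simp only [cls, mem_filter] at hi ⊢
    refine ⟨hi', ?_⟩
    have := dvd_sub hi.2 hd
    rwa [show pt i - ξ - (pt i - pt i') = pt i' - ξ by ring] at this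
  exact_mod_cast e3

lemma dec_all {p : ℕ} [Fact p.Prime] (hp : 16 ≤ p) (k : ℕ) (hk : 1 ≤ k) (hkp : k < p) : ∀ ε > 0, Dec p k ε := by
  induction k using Nat.strong_induction_on with
  | _ k ih =>
  intro ε hε
  rcases (by omega : k = 1 ∨ 2 ≤ k) with rfl | hk2
  · exact ⟨1, le_rfl, fun h => (base1 h).mono le_rfl zero_le_one hε.le⟩
  obtain ⟨κ, hκ, himp⟩ := improve hp hk2 hkp (fun r h1 h2 => ih r h2 h1 𝕆) hε
  have hp0 : (0 : ℝ) < p := by positivity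
  have start : Dec p k ((k * (k + 1) : ℕ) / 2 : ℝ) := by
    refine ⟨1, le_rfl, fun h B hB φ hφ w pt X => (triv hk h B φ w pt X).trans_eq ?_⟩
    congr 1
    rw [one_mul, ← rpow_natCast]
    congr 1
    rw [Nat.cast_mul, cast_sub (by nlinarith)]; push_cast; ring
  have mono : ∀ {η η' : ℝ}, η ≤ η' → Dec p k η → Dec p k η' := fun h ⟨C, hC, H⟩ => ⟨C, hC, fun n => (H n).mono le_rfl 𝕃 h⟩
  have it : ∀ n : ℕ, Dec p k (max ε ((k * (k + 1) : ℕ) / 2 - n * κ : ℝ)) := by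
    intro n
    induction n with
    | zero => exact mono (by simp) start
    | succ n ih =>
      have h1 := himp _ (le_max_left _ _) ih
      refine mono ?_ h1
      rcases le_total ε ((k * (k + 1) : ℕ) / 2 - n * κ : ℝ) with h | h
      · rw [max_eq_right h]; refine le_trans (le_of_eq ?_) (le_max_right _ _); push_cast; ring
      · rw [max_eq_left h]; exact le_trans 𝕃 (le_max_left _ _)
  obtain ⟨n, hn⟩ := exists_nat_gt (((k * (k + 1) : ℕ) / 2 : ℝ) / κ)
  rw [div_lt_iff₀ hκ] at hn
  have := it n
  rwa [max_eq_left 𝕃] at this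

def JJ (k s Y : ℕ) : Finset ((Fin s → ℤ) × (Fin s → ℤ)) :=
  ((Fintype.piFinset fun _ => Icc (1 : ℤ) Y) ×ˢ (Fintype.piFinset fun _ => Icc (1 : ℤ) Y)).filter
    fun t => ∀ j : Fin k, ∑ i, t.1 i ^ (j.val + 1) = ∑ i, t.2 i ^ (j.val + 1)

theorem vmvt (k : ℕ) (hk : 1 ≤ k) {ε : ℝ} (hε : 0 < ε) : ∃ C : ℝ, 0 < C ∧ ∀ s, 2 * s = k * (k + 1) → ∀ Y : ℕ, 1 ≤ Y →
    ((JJ k s Y).card : ℝ) ≤ C * ®Y ^ (s + ε) := by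
  obtain ⟨p, hpk, hpp⟩ := Nat.exists_infinite_primes (16 + k)
  haveI : Fact p.Prime := ⟨hpp⟩
  obtain ⟨C, hC, hD⟩ := dec_all (p := p) 𝕆 k hk 𝕆 ε hε
  have hp0 : (0 : ℝ) < p := by exact_mod_cast hpp.pos
  refine ⟨C * ®p ^ ((k * (k + 1) : ℕ) / 2 + ε : ℝ), by positivity, fun s hs Y hY => ?_⟩
  have hsr : ((k * (k + 1) : ℕ) / 2 : ℝ) = s := by rw [← hs]; push_cast; ring
  rw [hsr]
  obtain ⟨h, hh1, hh2⟩ : ∃ h : ℕ, Y ≤ p ^ h ∧ p ^ h ≤ p * Y := by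
    refine ⟨Nat.clog p Y, Nat.le_pow_clog hpp.one_lt _, ?_⟩
    rcases Nat.lt_or_ge Y 2 with h | h
    · rw [Nat.clog_of_right_le_one 𝕆]; have := hpp.pos; nlinarith
    · have h1 := Nat.pow_pred_clog_lt_self hpp.one_lt h
      have h2 := Nat.clog_pos hpp.one_lt h
      obtain ⟨m, hm⟩ : ∃ m, Nat.clog p Y = m + 1 := ⟨_, (Nat.succ_pred_eq_of_pos h2).symm⟩
      rw [hm] at h1 ⊢
      rw [pow_succ, mul_comm]
      exact Nat.mul_le_mul_left _ h1.le
  set φ : Fin k → ℤ[X] := fun j => X ^ (j.val + 1)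
  have hφ : Cl p k φ := fun j => ⟨1, one_ne_zero, by simp [φ]⟩
  set B := k * h
  set I := Icc (1 : ℤ) Y with hI
  have main := hD h B le_rfl φ hφ (fun _ => 1) id I
  set V : (Fin s → ℤ) → Fin k → ℤ := fun t j => ∑ i, t i ^ (j.val + 1) with hV
  have lower : ((p ^ B : ℕ) : ℝ) ^ k * (JJ k s Y).card ≤ ∑ β, ‖F p B φ (fun _ => 1) id I β‖ ^ (k * (k + 1)) := by
    have e1 : ∀ β, F p B φ (fun _ => 1) id I β ^ s = ∑ t ∈ Fintype.piFinset fun _ : Fin s => I, ZMod.stdAddChar (∑ j, β j * ((V t j : ℤ) : ZMod (p ^ B))) := by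
      intro β
      have h1 := Finset.prod_univ_sum (fun _ : Fin s => I) fun _ i => ZMod.stdAddChar (∑ j, β j * (((φ j).eval i : ℤ) : ZMod (p ^ B)))
      rw [Finset.prod_const, card_univ, Fintype.card_fin] at h1
      simp only [F, one_mul, id]
      rw [h1]
      refine sum_congr rfl fun t _ => ?_
      rw [← std_sum, sum_comm]
      congr 1
      refine sum_congr rfl fun j _ => ?_
      rw [← mul_sum]; simp [hV, φ]
    have e2 : ((∑ β, ‖F p B φ (fun _ => 1) id I β‖ ^ (k * (k + 1)) : ℝ) : ℂ) = ((∑ t ∈ Fintype.piFinset fun _ : Fin s => I, ∑ t' ∈ Fintype.piFinset fun _ : Fin s => I,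
        if (fun j => ((V t j - V t' j : ℤ) : ZMod (p ^ B))) = 0 then ((p ^ B : ℕ) : ℝ) ^ k else 0 : ℝ) : ℂ) := by
      push_cast
      calc _ = ∑ β, F p B φ (fun _ => 1) id I β ^ s * (starRingEnd ℂ) (F p B φ (fun _ => 1) id I β ^ s) := by
            refine sum_congr rfl fun β _ => ?_
            rw [mul_conj', norm_pow, ← hs, mul_comm 2 s, pow_mul]; push_cast; rfl
        _ = ∑ β : Fin k → ZMod (p ^ B), ∑ t ∈ Fintype.piFinset fun _ : Fin s => I, ∑ t' ∈ Fintype.piFinset fun _ : Fin s => I,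
              ZMod.stdAddChar (∑ j, β j * ((V t j - V t' j : ℤ) : ZMod (p ^ B))) := by
            refine sum_congr rfl fun β _ => ?_
            rw [e1, map_sum, sum_mul_sum]
            refine sum_congr rfl fun t _ => sum_congr rfl fun t' _ => ?_
            rw [← AddChar.map_neg_eq_conj, ← AddChar.map_add_eq_mul, ← Finset.sum_neg_distrib, ← sum_add_distrib]
            congr 1
            refine sum_congr rfl fun j _ => ?_
            push_cast; ring
        _ = _ := by
            rw [sum_comm]
            refine sum_congr rfl fun t _ => ?_
            rw [sum_comm]
            refine sum_congr rfl fun t' _ => ?_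
            rw [orth]
            push_cast; split_ifs <;> simp
    rw [Complex.ofReal_inj] at e2
    rw [e2, JJ, ← sum_product', Finset.card_filter, Nat.cast_sum, mul_sum]
    refine sum_le_sum fun t _ => ?_
    have : 0 ≤ ((p ^ B : ℕ) : ℝ) ^ k := by positivity
    split_ifs with h1 h2 h2
    · simp
    · exact absurd (_root_.funext fun j => by simp only [hV]; rw [h1 j, sub_self]; simp) h2
    · simpa using this
    · simp
  have upper : ∑ ξ ∈ range (p ^ h), ∑ β, ‖F p B φ (fun _ => 1) id (cls p id I h ξ) β‖ ^ (k * (k + 1)) ≤ ®p ^ h * ((p ^ B : ℕ) : ℝ) ^ k := by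
    have e1 : ∀ ξ : ℕ, ∀ β, ‖F p B φ (fun _ => 1) id (cls p id I h ξ) β‖ ≤ 1 := by
      intro ξ β
      have hc : (cls p id I h ξ).card ≤ 1 := by
        rw [Finset.card_le_one]
        intro a ha b hb
        simp only [cls, mem_filter, hI, mem_Icc, id] at ha hb
        have hd := dvd_sub ha.2 hb.2
        rw [show a - ξ - (b - ξ) = a - b by ring] at hd
        have hYp : (Y : ℤ) ≤ (p : ℤ) ^ h := by exact_mod_cast hh1
        have := Int.eq_zero_of_abs_lt_dvd hd (by rw [abs_lt]; constructor <;> linarith only [ha, hh1, hb, ha.1.1, ha.1.2, hb.1.1, hb.1.2])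
        omega
      refine (norm_sum_le _ _).trans ?_
      simp only [one_mul, norm_std, sum_const, nsmul_eq_mul, mul_one]
      exact_mod_cast hc
    calc _ ≤ ∑ ξ ∈ range (p ^ h), ∑ β : Fin k → ZMod (p ^ B), (1 : ℝ) :=
          sum_le_sum fun ξ _ => sum_le_sum fun β _ => pow_le_one₀ (norm_nonneg _) (e1 ξ β)
      _ = _ := by
          simp only [sum_const, card_range, card_univ, Fintype.card_fun, ZMod.card, Fintype.card_fin, nsmul_eq_mul]
          push_cast; ring
  have hpB : 0 < ((p ^ B : ℕ) : ℝ) ^ k := by have := hpp.pos; positivity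
  have h3 := lower.trans (main.trans (mul_le_mul_of_nonneg_left upper ℙ))
  have h4 : ((JJ k s Y).card : ℝ) ≤ C * (®p ^ (ε * h + h * ((k * (k + 1) : ℕ) / 2 - 1 : ℝ)) * ®p ^ h) := by
    refine le_of_mul_le_mul_left (h3.trans_eq ?_) hpB
    ring
  refine h4.trans ?_
  rw [mul_assoc]
  refine mul_le_mul_of_nonneg_left ?_ 𝕃
  rw [← mul_rpow hp0.le ℙ, ← rpow_natCast (p : ℝ) h, ← rpow_add hp0]
  have e : ε * h + h * ((k * (k + 1) : ℕ) / 2 - 1 : ℝ) + h = h * (s + ε) := by rw [hsr]; ring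
  rw [e, rpow_mul hp0.le, rpow_natCast]
  refine rpow_le_rpow ℙ (by exact_mod_cast hh2) ℙ


lemma eC_add (a b : ℝ) : eC (a + b) = eC a * eC b := by
  unfold eC; rw [← Complex.exp_add]; push_cast; ring_nf
lemma eC_zero : eC 0 = 1 := by simp [eC]
lemma eC_int (n : ℤ) : eC n = 1 := by
  unfold eC; rw [Complex.exp_eq_one_iff]; exact ⟨n, by push_cast; ring⟩
lemma eC_eq (t : ℝ) : eC t = Complex.exp (Complex.I * ((2 * π * t : ℝ) : ℂ)) := by unfold eC; push_cast; ring_nf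
lemma norm_eC (t : ℝ) : ‖eC t‖ = 1 := by rw [eC_eq, Complex.norm_exp_I_mul_ofReal]
lemma eC_ne (t : ℝ) : eC t ≠ 0 := Complex.exp_ne_zero _
lemma eC_neg (t : ℝ) : eC (-t) = (starRingEnd ℂ) (eC t) := by
  have h1 : eC (-t) * eC t = 1 := by rw [← eC_add, neg_add_cancel, eC_zero]
  have h2 : (starRingEnd ℂ) (eC t) * eC t = 1 := by rw [mul_comm, mul_conj', norm_eC]; simp
  exact mul_right_cancel₀ (eC_ne t) (h1.trans h2.symm)
lemma eC_sub (a b : ℝ) : eC (a - b) = eC a * (starRingEnd ℂ) (eC b) := by rw [sub_eq_add_neg, eC_add, eC_neg]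
lemma eC_add_int (t : ℝ) (n : ℤ) : eC (t + n) = eC t := by rw [eC_add, eC_int, mul_one]
lemma eC_nat_mul (n : ℕ) (t : ℝ) : eC (n * t) = eC t ^ n := by
  unfold eC; rw [← Complex.exp_nat_mul]; push_cast; ring_nf
lemma eC_sub_one (t : ℝ) : ‖eC t - 1‖ = 2 * |sin (π * t)| := by
  rw [eC_eq, Complex.norm_exp_I_mul_ofReal_sub_one, norm_mul, norm_eq_abs, norm_eq_abs, abs_two]
  congr 3; ring
lemma eC_sub_one_le (t : ℝ) : ‖eC t - 1‖ ≤ 7 * |t| := by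
  rw [eC_sub_one]
  have h := abs_sin_le_abs (x := π * t)
  rw [abs_mul, abs_of_pos pi_pos] at h
  nlinarith [pi_lt_d2, abs_nonneg t]
lemma eC_lip (a b : ℝ) : ‖eC a - eC b‖ ≤ 7 * |a - b| := by
  have : eC a - eC b = (eC (a - b) - 1) * eC b := by rw [sub_mul, ← eC_add]; ring_nf
  rw [this, norm_mul, norm_eC, mul_one]; exact eC_sub_one_le _

/-- distance to the nearest integer -/
def nn (t : ℝ) : ℝ := |t - round t|
lemma nn_nonneg (t : ℝ) : 0 ≤ nn t := abs_nonneg _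
lemma nn_le (t : ℝ) (n : ℤ) : nn t ≤ |t - n| := round_le t n
lemma nn_le_half (t : ℝ) : nn t ≤ 1 / 2 := abs_sub_round t
lemma nn_sub_le (a b y : ℝ) : nn (a - b) ≤ nn (a - y) + nn (b - y) := by
  refine (nn_le _ (round (a - y) - round (b - y))).trans ?_
  refine le_trans (le_of_eq ?_) (abs_sub (a - y - round (a - y)) (b - y - round (b - y)))
  congr 1; push_cast; ring
lemma nn_add_int (t : ℝ) (n : ℤ) : nn (t + n) = nn t := by
  unfold nn; rw [round_add_intCast]; congr 1; push_cast; ring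
lemma nn_neg (t : ℝ) : nn (-t) = nn t := by
  have : ∀ t, nn (-t) ≤ nn t := fun t => (nn_le _ (-round t)).trans_eq (by rw [nn, ← abs_neg]; congr 1; push_cast; ring)
  exact le_antisymm (this t) (by simpa using this (-t))
lemma nn_of_le {t : ℝ} (h : |t| ≤ 1 / 2) : nn t = |t| := by
  refine le_antisymm (by simpa using nn_le t 0) ?_
  by_cases h0 : round t = 0
  · simp [nn, h0]
  · have h1 : (1 : ℝ) ≤ |(round t : ℝ)| := by exact_mod_cast one_le_abs h0
    have h2 := abs_sub_abs_le_abs_sub (round t : ℝ) t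
    rw [abs_sub_comm] at h2
    unfold nn; linarith
lemma eC_nn (t : ℝ) : 4 * nn t ≤ ‖eC t - 1‖ := by
  have h1 : eC t = eC (t - round t) := by
    rw [← eC_add_int (t - round t) (round t)]; ring_nf
  rw [h1, eC_sub_one]
  have h2 := nn_le_half t
  unfold nn at *
  set u := t - round t
  have h3 := mul_abs_le_abs_sin (x := π * u) (by rw [abs_mul, abs_of_pos pi_pos]; nlinarith [pi_pos])
  rw [abs_mul, abs_of_pos pi_pos] at h3
  have : 2 / π * (π * |u|) = 2 * |u| := by field_simp
  linarith

/-- Dirichlet kernel bound -/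
lemma geom (α : ℝ) (N : ℕ) : ‖∑ n ∈ range N, eC (n * α)‖ * (2 * nn α) ≤ 1 := by
  simp only [eC_nat_mul]
  have h1 := mul_geom_sum (eC α) N
  have h2 := congrArg norm h1
  rw [norm_mul] at h2
  have h3 : ‖eC α ^ N - 1‖ ≤ 2 := by
    refine (norm_sub_le _ _).trans ?_
    rw [norm_pow, norm_eC]; norm_num
  nlinarith [eC_nn α, norm_nonneg (∑ n ∈ range N, eC α ^ n)]

/-- spaced points count -/
lemma spaced {ι : Type*} (S : Finset ι) (g : ι → ℝ) {κ ρ y : ℝ} (hρ : 0 < ρ) (h1 : ∀ i ∈ S, |g i - y| ≤ κ)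
    (h2 : ∀ i ∈ S, ∀ j ∈ S, i ≠ j → ρ ≤ |g i - g j|) (hκ : 0 ≤ κ) : (S.card : ℝ) ≤ 2 * κ / ρ + 1 := by
  have hm : ∀ i ∈ S, ⌊(g i - y + κ) / ρ⌋₊ ∈ range (⌊2 * κ / ρ⌋₊ + 1) := by
    intro i hi
    rw [mem_range, lt_succ_iff]
    refine Nat.floor_le_floor ?_
    have := abs_le.1 (h1 i hi)
    gcongr; linarith
  have hinj : ∀ i ∈ S, ∀ j ∈ S, ⌊(g i - y + κ) / ρ⌋₊ = ⌊(g j - y + κ) / ρ⌋₊ → i = j := by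
    intro i hi j hj h
    by_contra hij
    have hn : ∀ i ∈ S, 0 ≤ (g i - y + κ) / ρ := fun i hi => div_nonneg (by linarith [(abs_le.1 (h1 i hi)).1]) hρ.le
    have := h2 i hi j hj hij
    have a1 := floor_le (hn i hi)
    have a2 := lt_floor_add_one ((g i - y + κ) / ρ)
    have b1 := floor_le (hn j hj)
    have b2 := lt_floor_add_one ((g j - y + κ) / ρ)
    rw [h] at a1 a2
    have h3 : |(g i - y + κ) / ρ - (g j - y + κ) / ρ| < 1 := by rw [abs_lt]; constructor <;> linarith
    rw [← sub_div, abs_div, abs_of_pos hρ, div_lt_one hρ] at h3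
    rw [show g i - y + κ - (g j - y + κ) = g i - g j by ring] at h3
    linarith
  have := card_le_card_of_injOn _ hm hinj
  rw [card_range] at this
  have h3 : (S.card : ℝ) ≤ ⌊2 * κ / ρ⌋₊ + 1 := by exact_mod_cast this
  linarith [floor_le (show 0 ≤ 2 * κ / ρ by positivity)]

lemma spaced_nn {ι : Type*} (S : Finset ι) (g : ι → ℝ) {κ ρ y : ℝ} (hρ : 0 < ρ) (h1 : ∀ i ∈ S, nn (g i - y) ≤ κ)
    (h2 : ∀ i ∈ S, ∀ j ∈ S, i ≠ j → ρ ≤ nn (g i - g j)) (hκ : 0 ≤ κ) : (S.card : ℝ) ≤ 2 * κ / ρ + 1 := by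
  refine spaced S (fun i => g i - round (g i - y)) (y := y) hρ (fun i hi => ?_) (fun i hi j hj hij => ?_) hκ
  · rw [sub_right_comm]; exact h1 i hi
  · refine (h2 i hi j hj hij).trans ((nn_le _ (round (g i - y) - round (g j - y))).trans_eq ?_)
    congr 1; push_cast; ring

/-- monotone-type multiplicity count: spacing along the reals, range at most V -/
lemma spaced_range (S : Finset ℕ) (g : ℕ → ℝ) {κ ρ y V z : ℝ} (hρ : 0 < ρ) (hκ : 0 ≤ κ) (hκ1 : κ ≤ 1) (hV : ∀ i ∈ S, |g i - z| ≤ V) (hV0 : 0 ≤ V)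
    (h2 : ∀ i ∈ S, ∀ j ∈ S, i ≠ j → ρ ≤ |g i - g j|) :
    ((S.filter fun i => nn (g i - y) ≤ κ).card : ℝ) ≤ (2 * V + 3) * (2 * κ / ρ + 1) := by
  set S' := S.filter fun i => nn (g i - y) ≤ κ with hS'
  set T := S'.image fun i => round (g i - y) with hT
  have hTc : (T.card : ℝ) ≤ 2 * V + 3 := by
    have := spaced T (fun n => (n : ℝ)) (y := z - y) (κ := V + 1) (ρ := 1) one_pos ?_ ?_ 𝕃
    · linarith
    · intro n hn
      obtain ⟨i, hi, rfl⟩ := mem_image.1 hn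
      have hi := mem_filter.1 hi
      have h1 := abs_le.1 (hV i hi.1)
      have h3 := abs_le.1 (show |g i - y - round (g i - y)| ≤ κ from hi.2)
      rw [abs_le]; constructor <;> linarith
    · intro i _ j _ hij
      have : (1 : ℤ) ≤ |i - j| := one_le_abs (sub_ne_zero.2 hij)
      exact_mod_cast this
  have h3 := Finset.card_eq_sum_card_image (fun i => round (g i - y)) S'
  rw [h3]; push_cast
  refine (sum_le_card_nsmul T _ (2 * κ / ρ + 1) fun n hn => ?_).trans ?_
  · refine spaced _ g (y := y + n) hρ (fun i hi => ?_) (fun i hi j hj hij => ?_) hκ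
    · obtain ⟨a, b⟩ := mem_filter.1 hi
      rw [← b, ← sub_sub]; exact (mem_filter.1 a).2
    · exact h2 i (mem_filter.1 (mem_filter.1 hi).1).1 j (mem_filter.1 (mem_filter.1 hj).1).1 hij
  · rw [nsmul_eq_mul]; exact mul_le_mul_of_nonneg_right hTc ℙ

lemma le_nn {t μ : ℝ} (k : ℤ) (h1 : k + μ ≤ t) (h2 : t ≤ k + 1 - μ) : μ ≤ nn t := by
  unfold nn
  rcases le_or_gt (round t) k with h | h
  · have : (round t : ℝ) ≤ k := by exact_mod_cast h
    exact le_trans 𝕃 (le_abs_self _)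
  · have : (k : ℝ) + 1 ≤ round t := by exact_mod_cast h
    exact le_trans 𝕃 (neg_le_abs _)

/-- Kusmin–Landau -/
lemma KL (f : ℕ → ℝ) (k : ℤ) (a b : ℕ) {μ : ℝ} (hμ : 0 < μ) (h1 : ∀ n ∈ Ico a b, k + μ ≤ f (n + 1) - f n ∧ f (n + 1) - f n ≤ k + 1 - μ)
    (h2 : ∀ n, a ≤ n → n + 1 < b → f (n + 1) - f n ≤ f (n + 2) - f (n + 1)) : ‖∑ n ∈ Ico a b, eC (f n)‖ ≤ 1 / μ := by
  rcases Nat.lt_or_ge a b with hab | hab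
  swap
  · rw [Finset.Ico_eq_empty 𝕆]; simp; exact hμ.le
  set g : ℕ → ℝ := fun n => f (n + 1) - f n - k with hg
  set w : ℕ → ℂ := fun n => 1 / (1 - eC (g n)) with hw
  set v : ℕ → ℝ := fun n => cos (π * g n) / sin (π * g n) with hv
  have hE : ∀ n, eC (f (n + 1)) = eC (f n) * eC (g n) := by
    intro n
    rw [← eC_add, ← eC_add_int (f n + g n) k]; simp only [hg]; ring_nf
  have hr : ∀ n ∈ Ico a b, μ ≤ g n ∧ g n ≤ 1 - μ := fun n hn => by
    have := h1 n hn; simp only [hg]; constructor <;> linarith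
  have hnrm : ∀ n ∈ Ico a b, 4 * μ ≤ ‖1 - eC (g n)‖ := fun n hn => by
    rw [norm_sub_rev]
    have := le_nn (t := g n) 0 (by simpa using (hr n hn).1) (by simpa using (hr n hn).2)
    linarith [eC_nn (g n)]
  have hne : ∀ n ∈ Ico a b, 1 - eC (g n) ≠ 0 := fun n hn => norm_pos_iff.1 (by linarith [hnrm n hn])
  have hwn : ∀ n ∈ Ico a b, ‖w n‖ ≤ 1 / (4 * μ) := fun n hn => by
    simp only [hw]; rw [norm_div, norm_one]; exact one_div_le_one_div_of_le 𝕃 (hnrm n hn)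
  have hs : ∀ n ∈ Ico a b, 0 < sin (π * g n) := fun n hn => by
    have := hr n hn
    exact sin_pos_of_pos_of_lt_pi (mul_pos pi_pos 𝕃) (by nlinarith [pi_pos])
  have hwv : ∀ n ∈ Ico a b, w n = 1 / 2 + (v n / 2 : ℝ) * Complex.I := by
    intro n hn
    have hs' := hs n hn
    simp only [hw]
    rw [div_eq_iff (hne n hn)]
    have e1 : eC (g n) = ((cos (π * g n)) ^ 2 - (sin (π * g n)) ^ 2 : ℝ) + ((2 * sin (π * g n) * cos (π * g n) : ℝ)) * Complex.I := by
      rw [eC_eq, mul_comm, Complex.exp_mul_I, ← Complex.ofReal_cos, ← Complex.ofReal_sin, mul_assoc 2 π, cos_two_mul, sin_two_mul]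
      congr 2; nlinarith [sin_sq_add_cos_sq (π * g n)]
    rw [e1]
    have e2 : ((sin (π * g n) : ℝ) : ℂ) ^ 2 + ((cos (π * g n) : ℝ) : ℂ) ^ 2 = 1 := by exact_mod_cast sin_sq_add_cos_sq (π * g n)
    have e3 : ((v n : ℝ) : ℂ) * ((sin (π * g n) : ℝ) : ℂ) = ((cos (π * g n) : ℝ) : ℂ) := by
      have : v n * sin (π * g n) = cos (π * g n) := div_mul_cancel₀ _ hs'.ne'
      exact_mod_cast this
    have e4 := Complex.I_sq
    simp only [Complex.ofReal_sub, ofReal_pow, Complex.ofReal_mul, Complex.ofReal_div, Complex.ofReal_ofNat]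
    set S := ((sin (π * g n) : ℝ) : ℂ)
    set D := ((cos (π * g n) : ℝ) : ℂ)
    linear_combination (-(1:ℂ) / 2 + v n / 2 * Complex.I) * e2 - (S * Complex.I + D) * e3 + v n * S * D * e4
  have hvn : ∀ n ∈ Ico a b, |v n| ≤ 1 / (2 * μ) := by
    intro n hn
    have e1 : v n = 2 * (w n).im := by rw [hwv n hn]; simp; ring
    rw [e1, abs_mul, abs_two]
    have := (Complex.abs_im_le_norm (w n)).trans (hwn n hn)
    have e3 : 1 / (2 * μ) = 2 * (1 / (4 * μ)) := by field_simp; norm_num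
    linarith
  have hanti : ∀ n, a ≤ n → n + 1 < b → v (n + 1) ≤ v n := by
    intro n hn hn'
    have m1 : n ∈ Ico a b := mem_Ico.2 ⟨hn, by omega⟩
    have m2 : n + 1 ∈ Ico a b := mem_Ico.2 ⟨by omega, hn'⟩
    simp only [hv]
    rw [div_le_div_iff₀ (hs _ m2) (hs _ m1)]
    have h3 : 0 ≤ sin (π * g (n + 1) - π * g n) := by
      have := h2 n hn hn'
      have h4 := (hr _ m2).2; have h5 := (hr _ m1).1
      refine sin_nonneg_of_nonneg_of_le_pi ?_ ?_
      · rw [← mul_sub]; exact mul_nonneg pi_pos.le (by simp only [hg]; linarith)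
      · nlinarith [pi_pos]
    rw [sin_sub] at h3; linarith
  have main : ∀ j, a + j + 1 ≤ b → ‖∑ n ∈ Ico a (a + j + 1), eC (f n) - (eC (f a) * w a - eC (f (a + j + 1)) * w (a + j))‖ ≤ (v a - v (a + j)) / 2 := by
    intro j
    induction j with
    | zero =>
      intro hj
      have hm : a ∈ Ico a b := mem_Ico.2 ⟨le_rfl, hab⟩
      have e0 : w a * (1 - eC (g a)) = 1 := by simp only [hw]; exact div_mul_cancel₀ _ (hne a hm)
      have e1 : eC (f a) - (eC (f a) * w a - eC (f (a + 1)) * w a) = 0 := by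
        rw [hE]; linear_combination (-eC (f a)) * e0
      simp only [add_zero, Nat.Ico_succ_singleton, Finset.sum_singleton, e1, norm_zero, sub_self, zero_div, le_refl]
    | succ j ih =>
      intro hj
      have hm1 : a + j ∈ Ico a b := mem_Ico.2 ⟨by omega, by omega⟩
      have hm : a + j + 1 ∈ Ico a b := mem_Ico.2 ⟨by omega, by omega⟩
      have e0 : w (a + j + 1) * (1 - eC (g (a + j + 1))) = 1 := by simp only [hw]; exact div_mul_cancel₀ _ (hne _ hm)
      rw [← add_assoc, Finset.sum_Ico_succ_top 𝕆]
      have e1 : ∑ n ∈ Ico a (a + j + 1), eC (f n) + eC (f (a + j + 1)) - (eC (f a) * w a - eC (f (a + j + 1 + 1)) * w (a + j + 1)) =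
        (∑ n ∈ Ico a (a + j + 1), eC (f n) - (eC (f a) * w a - eC (f (a + j + 1)) * w (a + j))) + eC (f (a + j + 1)) * (w (a + j + 1) - w (a + j)) := by
        rw [hE (a + j + 1)]; linear_combination (-eC (f (a + j + 1))) * e0
      rw [e1]
      refine (norm_add_le _ _).trans ?_
      have e2 : w (a + j + 1) - w (a + j) = ((v (a + j + 1) - v (a + j)) / 2 : ℝ) * Complex.I := by
        rw [hwv _ hm, hwv _ hm1]; push_cast; ring
      rw [norm_mul, norm_eC, one_mul, e2, norm_mul, Complex.norm_I, mul_one, norm_real, norm_eq_abs, abs_of_nonpos (by linarith [hanti (a + j) 𝕆 𝕆])]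
      linarith [ih 𝕆]
  obtain ⟨j, rfl⟩ : ∃ j, b = a + j + 1 := ⟨b - a - 1, by omega⟩
  have hm1 : a + j ∈ Ico a (a + j + 1) := mem_Ico.2 ⟨by omega, by omega⟩
  have hm : a ∈ Ico a (a + j + 1) := mem_Ico.2 ⟨le_rfl, hab⟩
  have h5 := main j le_rfl
  have h6 := norm_le_norm_sub_add (∑ n ∈ Ico a (a + j + 1), eC (f n)) (eC (f a) * w a - eC (f (a + j + 1)) * w (a + j))
  have h7 := norm_sub_le (eC (f a) * w a) (eC (f (a + j + 1)) * w (a + j))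
  rw [norm_mul, norm_mul, norm_eC, norm_eC, one_mul, one_mul] at h7
  have := hwn _ hm; have := hwn _ hm1
  have := abs_le.1 (hvn _ hm); have := abs_le.1 (hvn _ hm1)
  have e1 : 1 / (4 * μ) = 1 / μ / 4 := by field_simp
  have e2 : 1 / (2 * μ) = 1 / μ / 2 := by field_simp
  simp only [e1, e2] at *
  linarith

/-- van der Corput inequality -/
lemma vdC (z : ℕ → ℂ) (M H : ℕ) (hH : 1 ≤ H) (hz : ∀ n, ‖z n‖ ≤ 1) (B : ℕ → ℝ)
    (hB : ∀ l, 1 ≤ l → l < H → ‖∑ n ∈ range (M - l), z (n + l) * (starRingEnd ℂ) (z n)‖ ≤ B l) :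
    H * ‖∑ n ∈ range M, z n‖ ^ 2 ≤ (M + H) * (M + 2 * ∑ l ∈ Ico 1 H, B l) := by
  set u : ℕ → ℕ → ℂ := fun h n => if h ≤ n ∧ n - h < M then z (n - h) else 0 with hu
  have hB0 : ∀ l ∈ Ico 1 H, 0 ≤ B l := fun l hl => (norm_nonneg _).trans (hB l (mem_Ico.1 hl).1 (mem_Ico.1 hl).2)
  have e1 : ∀ h ∈ range H, ∑ n ∈ range (M + H), u h n = ∑ n ∈ range M, z n := by
    intro h hh
    simp only [hu, mem_range] at hh ⊢
    rw [← sum_filter]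
    refine Finset.sum_nbij' (fun n => n - h) (fun n => n + h) ?_ ?_ ?_ ?_ ?_ <;> simp only [mem_filter, mem_range] <;> intros <;> first | omega | trivial
  have e2 : ∀ h h', h ≤ h' → h' < H → ∑ n ∈ range (M + H), u h n * (starRingEnd ℂ) (u h' n) = ∑ n ∈ range (M - (h' - h)), z (n + (h' - h)) * (starRingEnd ℂ) (z n) := by
    intro h h' hh hh'
    have : ∀ n, u h n * (starRingEnd ℂ) (u h' n) = if h' ≤ n ∧ n - h < M then z (n - h) * (starRingEnd ℂ) (z (n - h')) else 0 := by
      intro n; simp only [hu]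
      split_ifs <;> first | omega | simp
    simp only [this]
    rw [← sum_filter]
    refine Finset.sum_nbij' (fun n => n - h') (fun n => n + h') ?_ ?_ ?_ ?_ ?_ <;> simp only [mem_filter, mem_range] <;> intros <;> first | omega | skip
    congr 2; omega
  have e3 : ∀ h ∈ range H, ∀ h' ∈ range H, ‖∑ n ∈ range (M + H), u h n * (starRingEnd ℂ) (u h' n)‖ ≤
      (if h = h' then (M : ℝ) else 0) + ∑ l ∈ Ico 1 H, ((if h' = h + l then B l else 0) + (if h = h' + l then B l else 0)) := by
    have key : ∀ h h', h < h' → h' < H → ‖∑ n ∈ range (M + H), u h n * (starRingEnd ℂ) (u h' n)‖ ≤ ∑ l ∈ Ico 1 H, (if h' = h + l then B l else 0) := by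
      intro h h' hh hh'
      rw [e2 h h' hh.le hh']
      refine (hB (h' - h) 𝕆 𝕆).trans ?_
      refine le_trans (le_of_eq ?_) (single_le_sum (f := fun l => if h' = h + l then B l else 0) (fun l hl => by split_ifs; exacts [hB0 l hl, le_rfl]) (mem_Ico.2 ⟨by omega, by omega⟩ : h' - h ∈ Ico 1 H))
      rw [if_pos 𝕆]
    have pos : ∀ h h', 0 ≤ ∑ l ∈ Ico 1 H, (if h' = h + l then B l else 0) := fun h h' => sum_nonneg fun l hl => by split_ifs; exacts [hB0 l hl, le_rfl]
    intro h hh h' hh'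
    rw [mem_range] at hh hh'
    rw [sum_add_distrib]
    rcases lt_trichotomy h h' with hl | hl | hl
    · rw [if_neg hl.ne]; linarith [key h h' hl hh', pos h' h]
    · subst hl
      rw [if_pos rfl, e2 h h le_rfl hh]
      refine le_trans ?_ (show (M : ℝ) ≤ _ by linarith [pos h h])
      refine (norm_sum_le _ _).trans ((sum_le_card_nsmul _ _ 1 fun n _ => ?_).trans (by simp))
      rw [norm_mul, RCLike.norm_conj]; exact mul_le_one₀ (hz _) (norm_nonneg _) (hz _)
    · rw [if_neg hl.ne']
      have e : ‖∑ n ∈ range (M + H), u h n * (starRingEnd ℂ) (u h' n)‖ = ‖∑ n ∈ range (M + H), u h' n * (starRingEnd ℂ) (u h n)‖ := by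
        rw [← RCLike.norm_conj (K := ℂ), map_sum]; congr 1
        refine sum_congr rfl fun n _ => ?_
        rw [map_mul, RCLike.conj_conj, mul_comm]
      rw [e]; linarith [key h' h hl hh, pos h h']
  have hS : (H : ℂ) * ∑ n ∈ range M, z n = ∑ n ∈ range (M + H), ∑ h ∈ range H, u h n := by
    rw [sum_comm, sum_congr rfl e1]; simp
  have h4 : ®H ^ 2 * ‖∑ n ∈ range M, z n‖ ^ 2 ≤ (M + H) * ∑ n ∈ range (M + H), ‖∑ h ∈ range H, u h n‖ ^ 2 := by
    have h5 : (H : ℝ) * ‖∑ n ∈ range M, z n‖ ≤ ∑ n ∈ range (M + H), ‖∑ h ∈ range H, u h n‖ := by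
      have := norm_sum_le (range (M + H)) fun n => ∑ h ∈ range H, u h n
      rw [← hS, norm_mul, Complex.norm_natCast] at this; exact this
    have h6 := sq_sum_le_card_mul_sum_sq (s := range (M + H)) (f := fun n => ‖∑ h ∈ range H, u h n‖)
    rw [card_range] at h6; push_cast at h6
    rw [← mul_pow]
    exact (pow_le_pow_left₀ ℙ h5 2).trans h6
  have h7 : ∑ n ∈ range (M + H), ‖∑ h ∈ range H, u h n‖ ^ 2 ≤ H * (M + 2 * ∑ l ∈ Ico 1 H, B l) := by
    have e : ((∑ n ∈ range (M + H), ‖∑ h ∈ range H, u h n‖ ^ 2 : ℝ) : ℂ) = ∑ h ∈ range H, ∑ h' ∈ range H, ∑ n ∈ range (M + H), u h n * (starRingEnd ℂ) (u h' n) := by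
      rw [sum_congr rfl fun h _ => sum_comm, sum_comm, ofReal_sum]
      refine sum_congr rfl fun n _ => ?_
      rw [ofReal_pow, ← mul_conj', map_sum, sum_mul_sum]
    have h8 : ∑ n ∈ range (M + H), ‖∑ h ∈ range H, u h n‖ ^ 2 = ‖((∑ n ∈ range (M + H), ‖∑ h ∈ range H, u h n‖ ^ 2 : ℝ) : ℂ)‖ := by
      rw [norm_real, Real.norm_of_nonneg (sum_nonneg fun _ _ => by positivity)]
    rw [h8, e]
    refine (norm_sum_le _ _).trans ((sum_le_sum fun h hh => (norm_sum_le _ _).trans (sum_le_sum fun h' hh' => e3 h hh h' hh')).trans ?_)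
    have h9 : ∀ h ∈ range H, ∑ h' ∈ range H, ((if h = h' then (M : ℝ) else 0) + ∑ l ∈ Ico 1 H, ((if h' = h + l then B l else 0) + (if h = h' + l then B l else 0))) ≤ M + 2 * ∑ l ∈ Ico 1 H, B l := by
      intro h hh
      rw [sum_add_distrib, Finset.sum_ite_eq, if_pos hh, sum_comm, mul_sum]
      refine add_le_add le_rfl (sum_le_sum fun l hl => ?_)
      rw [sum_add_distrib, two_mul]
      refine add_le_add ?_ ?_
      · rw [Finset.sum_ite_eq']; split_ifs; exacts [le_rfl, hB0 l hl]
      · rw [← sum_filter, sum_const, nsmul_eq_mul]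
        refine mul_le_of_le_one_left (hB0 l hl) ?_
        exact_mod_cast Finset.card_le_one.2 fun a ha b hb => by simp only [mem_filter] at ha hb; omega
    refine (sum_le_sum h9).trans ?_
    rw [sum_const, card_range, nsmul_eq_mul]
  have hH0 : (0 : ℝ) < H := by exact_mod_cast hH
  refine le_of_mul_le_mul_left ?_ hH0
  calc (H : ℝ) * (H * ‖∑ n ∈ range M, z n‖ ^ 2) = ®H ^ 2 * ‖∑ n ∈ range M, z n‖ ^ 2 := by ring
    _ ≤ _ := h4.trans (mul_le_mul_of_nonneg_left h7 ℙ)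
    _ = _ := by ring

def dl (f : ℕ → ℝ) : ℕ → ℝ := fun n => f (n + 1) - f n

def VT (k : ℕ) (a b A C : ℝ) : Prop := ∀ l : ℝ, 0 < l → ∀ M : ℕ, ∀ f : ℕ → ℝ, (∀ n < M, l ≤ dl^[k] f n ∧ dl^[k] f n ≤ A * l) →
  ‖∑ n ∈ range M, eC (f n)‖ ≤ C * (M * l ^ a + ®M ^ (1 - b) * l ^ (-a))

lemma norm_sum_eC_le {ι : Type*} (S : Finset ι) (f : ι → ℝ) : ‖∑ n ∈ S, eC (f n)‖ ≤ S.card := by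
  refine (norm_sum_le _ _).trans ?_
  simp [norm_eC]

lemma ico_of_convex (S : Finset ℕ) (h : ∀ i ∈ S, ∀ j ∈ S, ∀ n, i ≤ n → n ≤ j → n ∈ S) : ∃ a b, S = Ico a b := by
  rcases S.eq_empty_or_nonempty with rfl | hS
  · exact ⟨0, 0, by simp⟩
  · refine ⟨S.min' hS, S.max' hS + 1, ?_⟩
    ext n; rw [mem_Ico]
    exact ⟨fun hn => ⟨S.min'_le n hn, lt_succ_of_le (S.le_max' n hn)⟩, fun hn => h _ (S.min'_mem hS) _ (S.max'_mem hS) n hn.1 𝕆⟩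

lemma VT_base {A : ℝ} (hA : 1 ≤ A) : VT 2 (1 / 2) 1 A (8 * A + 12) := by
  intro l hl M f hf
  rw [sub_self, rpow_zero, one_mul, rpow_neg hl.le, ← sqrt_eq_rpow]
  set μ := √l with hμ
  have hμ0 : 0 < μ := sqrt_pos.2 hl
  have hμ2 : μ * μ = l := mul_self_sqrt hl.le
  have hM0 : (0 : ℝ) ≤ M := cast_nonneg M
  rcases le_or_gt (1 / 2) μ with h | h
  · refine (norm_sum_eC_le _ _).trans ?_
    rw [card_range]
    have : 0 < μ⁻¹ := inv_pos.2 hμ0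
    nlinarith [mul_nonneg hM0 hμ0.le]
  have hg1 : ∀ n j, n + j ≤ M → l * j ≤ dl f (n + j) - dl f n ∧ dl f (n + j) - dl f n ≤ A * l * j := by
    intro n j
    induction j with
    | zero => intro _; simp
    | succ j ih =>
      intro hj
      have h1 := ih 𝕆
      have h2 := hf (n + j) 𝕆
      have e : dl^[2] f (n + j) = dl f (n + (j + 1)) - dl f (n + j) := rfl
      rw [e] at h2
      push_cast
      constructor <;> linarith [h1.1, h1.2, h2.1, h2.2]
  have hmono : ∀ n m, n ≤ m → m ≤ M → dl f n ≤ dl f m := by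
    intro n m h1 h2
    obtain ⟨j, rfl⟩ := Nat.exists_eq_add_of_le h1
    have := (hg1 n j h2).1
    have : 0 ≤ l * j := by positivity
    linarith
  have hsp : ∀ n ∈ range M, ∀ m ∈ range M, n ≠ m → l ≤ |dl f n - dl f m| := by
    have key : ∀ n m, n < m → m < M → l ≤ |dl f n - dl f m| := by
      intro n m h1 h2
      obtain ⟨j, rfl⟩ := Nat.exists_eq_add_of_lt h1
      have := (hg1 n (j + 1) h2.le).1
      rw [abs_sub_comm]
      refine le_trans ?_ (le_abs_self _)
      refine le_trans ?_ this
      push_cast; nlinarith [(cast_nonneg j : (0:ℝ) ≤ j)]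
    intro n hn m hm hnm
    rw [mem_range] at hn hm
    rcases lt_or_gt_of_ne hnm with h | h
    · exact key n m h hm
    · rw [abs_sub_comm]; exact key m n h hn
  have hfib : ∀ k : ℤ, ‖∑ n ∈ (range M).filter fun n => ⌊dl f n⌋ = k, eC (f n)‖ ≤ 4 / μ := by
    intro k
    set S := (range M).filter fun n => ⌊dl f n⌋ = k with hS
    have hS1 : ∀ n ∈ S, n < M ∧ (k : ℝ) ≤ dl f n ∧ dl f n < k + 1 := fun n hn => by
      have := mem_filter.1 hn
      exact ⟨mem_range.1 this.1, Int.floor_eq_iff.1 this.2⟩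
    have cnt : ∀ (T : Finset ℕ) (y : ℝ), T ⊆ S → (∀ n ∈ T, |dl f n - y| ≤ μ / 2) → ‖∑ n ∈ T, eC (f n)‖ ≤ 1 / μ + 1 := by
      intro T y hT hy
      refine (norm_sum_eC_le _ _).trans ((spaced T (dl f) hl hy (fun i hi j hj => hsp i (mem_filter.1 (hT hi)).1 j (mem_filter.1 (hT hj)).1) ℙ).trans_eq ?_)
      rw [← hμ2]; field_simp
    have h1 := Finset.sum_filter_add_sum_filter_not S (fun n => dl f n < k + μ) fun n => eC (f n)
    have h2 := Finset.sum_filter_add_sum_filter_not (S.filter fun n => ¬ dl f n < k + μ) (fun n => (k : ℝ) + 1 - μ < dl f n) fun n => eC (f n)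
    rw [← h1, ← h2]
    have b1 := cnt (S.filter fun n => dl f n < k + μ) (k + μ / 2) (filter_subset _ _) fun n hn => by
      have := mem_filter.1 hn
      have h3 := hS1 n this.1
      rw [abs_le]; constructor <;> linarith
    have b2 := cnt ((S.filter fun n => ¬ dl f n < k + μ).filter fun n => (k : ℝ) + 1 - μ < dl f n) (k + 1 - μ / 2) ((filter_subset _ _).trans (filter_subset _ _)) fun n hn => by
      have := mem_filter.1 hn
      have h3 := hS1 n (mem_filter.1 this.1).1
      rw [abs_le]; constructor <;> linarith
    have b3 : ‖∑ n ∈ (S.filter fun n => ¬ dl f n < k + μ).filter fun n => ¬ (k : ℝ) + 1 - μ < dl f n, eC (f n)‖ ≤ 1 / μ := by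
      set U := (S.filter fun n => ¬ dl f n < k + μ).filter fun n => ¬ (k : ℝ) + 1 - μ < dl f n with hU
      have hU1 : ∀ n, n ∈ U ↔ n < M ∧ k + μ ≤ dl f n ∧ dl f n ≤ k + 1 - μ := by
        intro n
        simp only [hU, hS, mem_filter, mem_range, not_lt]
        constructor
        · rintro ⟨⟨⟨a, _⟩, b⟩, c⟩; exact ⟨a, b, c⟩
        · rintro ⟨a, b, c⟩; exact ⟨⟨⟨a, Int.floor_eq_iff.2 ⟨by linarith, by linarith⟩⟩, b⟩, c⟩
      obtain ⟨a, b, hab⟩ := ico_of_convex U fun i hi j hj n h1 h2 => by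
        rw [hU1] at *
        exact ⟨by omega, hi.2.1.trans (hmono _ _ h1 𝕆), (hmono _ _ h2 𝕆).trans hj.2.2⟩
      rw [hab] at hU1 ⊢
      refine KL f k a b hμ0 (fun n hn => ((hU1 n).1 hn).2) fun n h1 h2 => ?_
      have := (hU1 (n + 1)).1 (mem_Ico.2 ⟨by omega, h2⟩)
      exact hmono n (n + 1) 𝕆 𝕆
    refine (norm_add_le _ _).trans ?_
    have := norm_add_le (∑ n ∈ (S.filter fun n => ¬ dl f n < k + μ).filter fun n => (k : ℝ) + 1 - μ < dl f n, eC (f n)) (∑ n ∈ (S.filter fun n => ¬ dl f n < k + μ).filter fun n => ¬ (k : ℝ) + 1 - μ < dl f n, eC (f n))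
    have h3 : 2 ≤ 1 / μ := by rw [le_div_iff₀ hμ0]; linarith
    have h4 : 4 / μ = 4 * (1 / μ) := by ring
    linarith
  set T := (range M).image fun n => ⌊dl f n⌋ with hT
  have hTc : (T.card : ℝ) ≤ 2 * (A * l * M) + 3 := by
    have := spaced T (fun n => (n : ℝ)) (y := dl f 0) (κ := A * l * M + 1) (ρ := 1) one_pos ?_ ?_ ℙ
    · linarith
    · intro n hn
      obtain ⟨i, hi, rfl⟩ := mem_image.1 hn
      rw [mem_range] at hi
      have h1 := hg1 0 i 𝕆
      rw [zero_add] at h1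
      have h2 : A * l * i ≤ A * l * M := by gcongr
      have h4 : 0 ≤ l * i := by positivity
      have h3 := Int.floor_le (dl f i); have h5 := Int.lt_floor_add_one (dl f i)
      rw [abs_le]; constructor <;> linarith
    · intro i _ j _ hij
      have : (1 : ℤ) ≤ |i - j| := one_le_abs (sub_ne_zero.2 hij)
      exact_mod_cast this
  rw [← sum_fiberwise_of_maps_to (t := T) (g := fun n => ⌊dl f n⌋) (fun n hn => mem_image_of_mem _ hn)]
  refine (norm_sum_le _ _).trans ((sum_le_card_nsmul _ _ _ fun k _ => hfib k).trans ?_)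
  rw [nsmul_eq_mul]
  refine (mul_le_mul_of_nonneg_right hTc ℙ).trans ?_
  rw [← hμ2]
  have : (2 * (A * (μ * μ) * M) + 3) * (4 / μ) = 8 * A * (M * μ) + 12 * μ⁻¹ := by field_simp; ring
  rw [this]
  have : 0 ≤ M * μ := by positivity
  have : 0 < μ⁻¹ := by positivity
  nlinarith

lemma sum_rpow_neg {a : ℝ} (h0 : 0 ≤ a) (h1 : a ≤ 1 / 2) (H : ℕ) : ∑ l ∈ Ico 1 H, ®l ^ (-a) ≤ 2 * ®H ^ (1 - a) := by
  have key : ∀ n : ℕ, ∑ l ∈ Ico 1 (n + 1), ®l ^ (-a) ≤ 2 * ®n ^ (1 - a) := by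
    intro n
    induction n with
    | zero => simp; positivity
    | succ n ih =>
      rw [Finset.sum_Ico_succ_top 𝕆]
      have hn : (0 : ℝ) < (n : ℝ) + 1 := by positivity
      have h3 := rpow_one_add_le_one_add_mul_self (s := -1 / ((n : ℝ) + 1)) (by rw [le_div_iff₀ hn]; linarith [(cast_nonneg n : (0:ℝ) ≤ n)]) (p := 1 - a) 𝕃 𝕃
      have e1 : (1 : ℝ) + -1 / (n + 1) = n / (n + 1) := by field_simp; ring
      rw [e1, div_rpow ℙ hn.le, div_le_iff₀ ℙ] at h3
      have e2 : ((n : ℝ) + 1) ^ (1 - a) = (n + 1) * ((n : ℝ) + 1) ^ (-a) := by rw [sub_eq_add_neg, rpow_add hn, rpow_one]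
      rw [e2] at h3
      push_cast
      rw [e2]
      set z := ((n : ℝ) + 1) ^ (-a)
      have hz : 0 < z := by positivity
      have e3 : (1 + (1 - a) * (-1 / ((n : ℝ) + 1))) * ((n + 1) * z) = (n + 1) * z - (1 - a) * z := by field_simp; ring
      rw [e3] at h3
      nlinarith
  rcases H with _ | n
  · simp; positivity
  · refine (key n).trans ?_
    push_cast
    have : ®n ^ (1 - a) ≤ ((n : ℝ) + 1) ^ (1 - a) := rpow_le_rpow ℙ 𝕃 𝕃
    linarith

lemma dl_shift (f : ℕ → ℝ) (k l n : ℕ) : dl^[k] (fun n => f (n + l) - f n) n = dl^[k] f (n + l) - dl^[k] f n := by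
  induction k generalizing n with
  | zero => rfl
  | succ k ih =>
    rw [Function.iterate_succ_apply', Function.iterate_succ_apply']
    simp only [dl] at ih ⊢
    rw [ih, ih, show n + 1 + l = n + l + 1 by ring]; ring

lemma sq_fin {S K X Z : ℝ} (hK : 1 ≤ K) (hX : 0 ≤ X) (hZ : 0 ≤ Z) (h : S ^ 2 ≤ K * (X ^ 2 + Z ^ 2)) : S ≤ K * (X + Z) := by
  refine (abs_le_of_sq_le_sq' ?_ ℙ).2
  have h1 : X ^ 2 + Z ^ 2 ≤ (X + Z) ^ 2 := by nlinarith
  have h2 : K ≤ K ^ 2 := by nlinarith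
  rw [mul_pow]
  exact h.trans (mul_le_mul h2 h1 ℙ ℙ)

set_option maxHeartbeats 1000000 in
lemma VT_step {k : ℕ} {a b A C : ℝ} (ha : 0 < a) (ha2 : a ≤ 1 / 2) (hb : 0 ≤ b) (hb1 : b ≤ 1) (hC : 0 ≤ C) (h : VT k a b A C) :
    VT (k + 1) (a / (2 * (1 + a))) (b / 2) A (4 + 20 * C) := by
  intro l hl M f hf
  set a' := a / (2 * (1 + a)) with ha'
  have ha'0 : 0 < a' := by positivity
  set X := (M : ℝ) * l ^ a' with hX
  set Z := ®M ^ (1 - b / 2) * l ^ (-a') with hZ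
  have hX0 : 0 ≤ X := by positivity
  have hZ0 : 0 ≤ Z := by positivity
  have triv : (M : ℝ) ≤ X + Z → ‖∑ n ∈ range M, eC (f n)‖ ≤ (4 + 20 * C) * (X + Z) := fun h => by
    have := norm_sum_eC_le (range M) f
    rw [card_range] at this
    nlinarith [mul_nonneg hC (add_nonneg hX0 hZ0)]
  rcases Nat.eq_zero_or_pos M with rfl | hM
  · simp; positivity
  have hM1 : (1 : ℝ) ≤ M := by exact_mod_cast hM
  rcases le_or_gt 1 l with hl1 | hl1
  · refine triv (le_add_of_le_of_nonneg ?_ hZ0)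
    exact le_mul_of_one_le_right ℙ (one_le_rpow hl1 ha'0.le)
  set y := l ^ (-(2 * a')) with hy
  have hy0 : 0 < y := by positivity
  have hy1 : 1 ≤ y := one_le_rpow_of_pos_of_le_one_of_nonpos hl hl1.le 𝕃
  rcases le_or_gt (M : ℝ) y with hMy | hMy
  · refine triv (le_add_of_nonneg_of_le hX0 ?_)
    have h1 : ®M ^ (1 / 2 : ℝ) ≤ l ^ (-a') := by
      have := rpow_le_rpow ℙ hMy (show (0:ℝ) ≤ 1 / 2 by norm_num)
      rw [hy, ← rpow_mul hl.le] at this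
      convert this using 2; ring
    calc (M : ℝ) = ®M ^ (1 : ℝ) := (rpow_one _).symm
      _ ≤ ®M ^ ((1 - b / 2) + 1 / 2) := rpow_le_rpow_of_exponent_le hM1 𝕃
      _ = ®M ^ (1 - b / 2) * ®M ^ (1 / 2 : ℝ) := rpow_add ℙ _ _
      _ ≤ Z := mul_le_mul_of_nonneg_left h1 ℙ
  set H := ⌊y⌋₊ with hH
  have hH1 : 1 ≤ H := le_floor (by simpa using hy1)
  have hH1r : (1 : ℝ) ≤ H := by exact_mod_cast hH1
  have hHy : (H : ℝ) ≤ y := floor_le hy0.le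
  have hyH : y ≤ 2 * H := by linarith [lt_floor_add_one y]
  have hHM : (H : ℝ) ≤ M := by linarith
  set B : ℕ → ℝ := fun j => C * (M * (j * l) ^ a + ®M ^ (1 - b) * (j * l) ^ (-a)) with hB
  have hv := vdC (fun n => eC (f n)) M H hH1 (fun n => (norm_eC _).le) B (by
    intro j hj1 hj2
    have hj0 : (0 : ℝ) < j := by exact_mod_cast hj1
    have h1 : ∀ i ≤ M, ∀ n, n + i ≤ M → i * l ≤ dl^[k] f (n + i) - dl^[k] f n ∧ dl^[k] f (n + i) - dl^[k] f n ≤ A * (i * l) := by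
      intro i hi n
      induction i with
      | zero => intro _; simp
      | succ i ih =>
        intro hn
        have h1 := ih 𝕆 𝕆
        have h2 := hf (n + i) 𝕆
        rw [Function.iterate_succ_apply'] at h2
        have e : dl (dl^[k] f) (n + i) = dl^[k] f (n + (i + 1)) - dl^[k] f (n + i) := rfl
        rw [e] at h2
        push_cast
        constructor <;> linarith [h1.1, h1.2, h2.1, h2.2]
    have h2 := h (j * l) ℙ (M - j) (fun n => f (n + j) - f n) (fun n hn => by
      rw [dl_shift]; exact h1 j 𝕆 n 𝕆)
    simp only [eC_sub] at h2
    refine h2.trans (mul_le_mul_of_nonneg_left ?_ hC)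
    have : ((M - j : ℕ) : ℝ) ≤ M := by exact_mod_cast sub_le _ _
    gcongr)
  have hHl : (0 : ℝ) < H * l := by positivity
  have e1 : l ^ (1 - 2 * a') = y * l := by rw [hy, sub_eq_add_neg, rpow_add hl, rpow_one, mul_comm]
  have ea : (1 - 2 * a') * a = 2 * a' := by rw [ha']; field_simp; ring
  have q1 : (H * l) ^ a ≤ l ^ (2 * a') := by
    rw [← ea, rpow_mul hl.le, e1]
    exact rpow_le_rpow hHl.le (by gcongr) ha.le
  have q2 : (H * l) ^ (-a) ≤ 2 * l ^ (-(2 * a')) := by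
    have h3 : (y * l / 2) ^ (-a) ≤ 2 * l ^ (-(2 * a')) := by
      rw [div_rpow ℙ (by norm_num), ← e1, ← rpow_mul hl.le, mul_neg, ea, rpow_neg zero_le_two, div_inv_eq_mul, mul_comm]
      gcongr
      calc (2 : ℝ) ^ a ≤ 2 ^ (1 : ℝ) := rpow_le_rpow_of_exponent_le (by norm_num) 𝕃
        _ = 2 := rpow_one _
    refine le_trans (rpow_le_rpow_of_nonpos ℙ ?_ 𝕃) h3
    have := mul_le_mul_of_nonneg_right hyH hl.le
    linarith only [this]
  have q3 : 1 ≤ 2 * H * l ^ (2 * a') := by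
    have : y * l ^ (2 * a') = 1 := by rw [hy, ← rpow_add hl]; simp
    exact this ▸ mul_le_mul_of_nonneg_right hyH (rpow_pos_of_pos hl (2 * a')).le
  have hsum : ∑ j ∈ Ico 1 H, B j ≤ C * H * (M * (H * l) ^ a + 2 * (®M ^ (1 - b) * (H * l) ^ (-a))) := by
    simp only [hB]
    rw [← mul_sum, sum_add_distrib, ← mul_sum, ← mul_sum, mul_assoc]
    refine mul_le_mul_of_nonneg_left ?_ hC
    rw [mul_add]
    refine add_le_add ?_ ?_
    · rw [mul_left_comm]
      refine mul_le_mul_of_nonneg_left ?_ ℙ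
      refine (sum_le_card_nsmul _ _ ((H * l) ^ a) fun j hj => ?_).trans ?_
      · have : (j : ℝ) ≤ H := by exact_mod_cast (mem_Ico.1 hj).2.le
        gcongr
      · rw [nsmul_eq_mul, card_Ico]
        refine mul_le_mul_of_nonneg_right ?_ ℙ
        exact_mod_cast sub_le _ _
    · have : ∀ j ∈ Ico 1 H, ((j : ℝ) * l) ^ (-a) = l ^ (-a) * ®j ^ (-a) := fun j _ => by
        rw [mul_rpow ℙ hl.le, mul_comm]
      rw [sum_congr rfl this, ← mul_sum]
      have h5 := sum_rpow_neg ha.le ha2 H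
      have e6 : (H : ℝ) * (H * l) ^ (-a) = l ^ (-a) * ®H ^ (1 - a) := by
        rw [mul_rpow ℙ hl.le, sub_eq_add_neg, rpow_add ℙ, rpow_one]; ring
      have : (H : ℝ) * (2 * (®M ^ (1 - b) * (H * l) ^ (-a))) = ®M ^ (1 - b) * (l ^ (-a) * (2 * ®H ^ (1 - a))) := by
        linear_combination 2 * ®M ^ (1 - b) * e6
      rw [this]; gcongr
  set S := ‖∑ n ∈ range M, eC (f n)‖ with hS
  have hS0 : 0 ≤ S := norm_nonneg _
  have eX : X ^ 2 = M ^ 2 * l ^ (2 * a') := by rw [hX, mul_pow, ← rpow_natCast (l ^ a'), ← rpow_mul hl.le]; congr 2; push_cast; ring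
  have eZ : Z ^ 2 = M * ®M ^ (1 - b) * l ^ (-(2 * a')) := by
    rw [hZ, mul_pow, ← rpow_natCast (l ^ (-a')), ← rpow_mul hl.le, ← rpow_natCast (®M ^ (1 - b / 2)), ← rpow_mul ℙ]
    rw [show (1 - b / 2) * (2 : ℕ) = 1 + (1 - b) by push_cast; ring, rpow_add ℙ, rpow_one]; congr 2; push_cast; ring
  have hfin : S ^ 2 ≤ (4 + 20 * C) * (X ^ 2 + Z ^ 2) := by
    refine le_of_mul_le_mul_left ?_ (show (0:ℝ) < H by linarith)
    have h6 : (M + H : ℝ) ≤ 2 * M := by linarith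
    have hM0 : (0:ℝ) ≤ M := by linarith
    have h7 : (M : ℝ) * (H * l) ^ a + 2 * (®M ^ (1 - b) * (H * l) ^ (-a)) ≤ M * l ^ (2 * a') + 4 * (®M ^ (1 - b) * l ^ (-(2 * a'))) := by
      have := mul_le_mul_of_nonneg_left q1 hM0
      have := mul_le_mul_of_nonneg_left q2 (show 0 ≤ ®M ^ (1 - b) by positivity)
      linarith
    have h8 := hsum.trans (mul_le_mul_of_nonneg_left h7 (show 0 ≤ C * H by positivity))
    calc H * S ^ 2 ≤ (M + H) * (M + 2 * ∑ j ∈ Ico 1 H, B j) := hv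
      _ ≤ (M + H) * (M * (2 * H * l ^ (2 * a')) + 2 * (C * H * (M * l ^ (2 * a') + 4 * (®M ^ (1 - b) * l ^ (-(2 * a')))))) := by
          refine mul_le_mul_of_nonneg_left ?_ 𝕃
          have := mul_le_mul_of_nonneg_left q3 hM0
          linarith
      _ ≤ (2 * M) * (M * (2 * H * l ^ (2 * a')) + 2 * (C * H * (M * l ^ (2 * a') + 4 * (®M ^ (1 - b) * l ^ (-(2 * a')))))) :=
          mul_le_mul_of_nonneg_right h6 ℙ
      _ = H * (4 * X ^ 2 + C * (4 * X ^ 2 + 16 * Z ^ 2)) := by rw [eX, eZ]; ring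
      _ ≤ _ := by
          refine mul_le_mul_of_nonneg_left ?_ 𝕃
          linarith [mul_nonneg hC (sq_nonneg X), mul_nonneg hC (sq_nonneg Z), sq_nonneg Z]
  exact sq_fin 𝕃 hX0 hZ0 hfin

lemma VT34 (A : ℝ) (hA : 1 ≤ A) : ∃ C, 0 < C ∧ VT 3 (1 / 6) (1 / 2) A C ∧ VT 4 (1 / 14) (1 / 4) A C := by
  have h3 := VT_step (by norm_num) (by norm_num) (by norm_num) (by norm_num) 𝕃 (VT_base hA)
  have h4 := VT_step (by norm_num) (by norm_num) (by norm_num) (by norm_num) 𝕃 h3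
  norm_num at h3 h4
  refine ⟨4 + 20 * (4 + 20 * (8 * A + 12)), by linarith, fun l hl M f hf => (h3 l hl M f hf).trans ?_, h4⟩
  refine mul_le_mul_of_nonneg_right 𝕃 ℙ

lemma diff_chain (k : ℕ) : ∀ (g : ℕ → ℝ → ℝ), (∀ i < k, ∀ t, 0 ≤ t → HasDerivAt (g i) (g (i + 1) t) t) → ∀ (a : ℕ) (L U : ℝ),
    (∀ t : ℝ, a ≤ t → t ≤ a + k → L ≤ g k t ∧ g k t ≤ U) → L ≤ dl^[k] (fun n => g 0 n) a ∧ dl^[k] (fun n => g 0 n) a ≤ U := by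
  induction k with
  | zero => intro g _ a L U h; exact h a le_rfl (by simp)
  | succ k ih =>
    intro g hg a L U h
    have := ih (fun i t => g i (t + 1) - g i t) (fun i hi t ht => by
      have h1 := (hg i 𝕆 (t + 1) 𝕃).comp_add_const t 1
      exact h1.sub (hg i 𝕆 t ht)) a L U (fun t h1 h2 => by
        have ht : 0 ≤ t := le_trans (cast_nonneg a) h1
        obtain ⟨ξ, hξ, e⟩ := exists_hasDerivAt_eq_slope (g k) (g (k + 1)) (show t < t + 1 by linarith)
          (fun u hu => (hg k 𝕆 u (by linarith [hu.1])).continuousAt.continuousWithinAt) (fun u hu => hg k 𝕆 u (by linarith [hu.1]))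
        rw [show t + 1 - t = 1 by ring, div_one] at e
        rw [← e]
        exact h ξ (by linarith [hξ.1]) (by push_cast; linarith [hξ.2]))
    rw [Function.iterate_succ_apply]
    convert this using 3
    · ext n; simp [dl]
    · ext n; simp [dl]

def cf (p : ℝ) (i : ℕ) : ℝ := ∏ j ∈ range i, (p - j)
def rp (p : ℝ) (i : ℕ) (t : ℝ) : ℝ := cf p i * t ^ (p - i)

lemma rp_deriv (p : ℝ) (i : ℕ) {t : ℝ} (ht : 0 < t) : HasDerivAt (rp p i) (rp p (i + 1) t) t := by
  have h : HasDerivAt (rp p i) _ t := (hasDerivAt_rpow_const (x := t) (p := p - i) (Or.inl ht.ne')).const_mul (cf p i)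
  convert h using 1
  rw [rp, cf, cf, prod_range_succ]
  push_cast
  rw [show p - ((i : ℝ) + 1) = p - i - 1 by ring]; ring

lemma cf_nat (d k : ℕ) (h : d < k) : cf d k = 0 := Finset.prod_eq_zero (mem_range.2 h) (sub_self _)

lemma cf_ne {g : ℝ} (h0 : 0 < g) (h1 : g < 1) (k : ℕ) : cf g k ≠ 0 := by
  refine Finset.prod_ne_zero_iff.2 fun j _ => ?_
  rcases j with _ | j
  · simp; exact h0.ne'
  · push_cast; intro h; linarith [(cast_nonneg j : (0:ℝ) ≤ j)]

/-- the exponential sums -/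
def SS (d : ℕ) (g α : ℝ) (h : ℤ) (M : ℕ) : ℂ := ∑ m ∈ Ico M (2 * M), eC (α * ®m ^ d + h * ®m ^ g)

lemma SS_neg (d : ℕ) (g α : ℝ) (h : ℤ) (M : ℕ) : ‖SS d g (-α) (-h) M‖ = ‖SS d g α h M‖ := by
  rw [← norm_conj, SS, SS, map_sum]
  congr 2; ext m
  rw [← eC_neg]; congr 1; push_cast; ring

lemma SS_triv (d : ℕ) (g α : ℝ) (h : ℤ) (M : ℕ) : ‖SS d g α h M‖ ≤ M := by
  refine (norm_sum_eC_le _ _).trans ?_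
  rw [card_Ico]; exact_mod_cast 𝕆

lemma SS_VT {d : ℕ} {g : ℝ} (h0 : 0 < g) (h1 : g < 1) (hd3 : d ≤ 3) {a b C : ℝ} (ha : 0 < a) (hC : 0 < C) (hVT : VT (d + 1) a b (6 ^ (d + 1)) C) :
    ∃ C' > 0, ∀ M : ℕ, 1 ≤ M → ∀ α : ℝ, ∀ h : ℤ, h ≠ 0 → |(h : ℝ)| ≤ ®M ^ (1 - g) →
      ‖SS d g α h M‖ ≤ C' * (®M ^ (1 - d * a) + ®M ^ (1 - b + (d + 1 - g) * a)) := by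
  set κ := |cf g (d + 1)| with hκ
  have hκ0 : 0 < κ := abs_pos.2 (cf_ne h0 h1 _)
  set B := κ * (6 : ℝ) ^ (g - (d + 1)) with hB
  have hB0 : 0 < B := by positivity
  refine ⟨C * (B ^ a + B ^ (-a)), by positivity, ?_⟩
  intro M hM
  have hM1 : (1 : ℝ) ≤ M := by exact_mod_cast hM
  have hM0 : (0 : ℝ) < M := by linarith
  have key : ∀ α : ℝ, ∀ h : ℤ, 0 < h * cf g (d + 1) → |(h : ℝ)| ≤ ®M ^ (1 - g) →
      ‖SS d g α h M‖ ≤ C * (B ^ a + B ^ (-a)) * (®M ^ (1 - d * a) + ®M ^ (1 - b + (d + 1 - g) * a)) := by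
    intro α h hs hh
    have hh0 : (h : ℝ) ≠ 0 := fun e => by simp [e] at hs
    have hh1 : (1 : ℝ) ≤ |(h : ℝ)| := by
      have : h ≠ 0 := by exact_mod_cast hh0
      exact_mod_cast one_le_abs this
    set l := |(h : ℝ)| * B * ®M ^ (g - (d + 1)) with hl
    have hl0 : 0 < l := by positivity
    have habs : (h : ℝ) * cf g (d + 1) = |(h : ℝ)| * κ := by rw [hκ, ← abs_mul, abs_of_pos hs]
    have hG : ∀ n < M, l ≤ dl^[d + 1] (fun n => α * ((M + n : ℕ) : ℝ) ^ d + h * ((M + n : ℕ) : ℝ) ^ g) n ∧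
        dl^[d + 1] (fun n => α * ((M + n : ℕ) : ℝ) ^ d + h * ((M + n : ℕ) : ℝ) ^ g) n ≤ 6 ^ (d + 1) * l := by
      intro n hn
      have hn' : (n : ℝ) ≤ M := by exact_mod_cast hn.le
      have := diff_chain (d + 1) (fun i t => α * rp d i (t + M) + h * rp g i (t + M)) (fun i _ t ht =>
        (((rp_deriv d i (show 0 < t + M by linarith)).comp_add_const t M).const_mul α).add (((rp_deriv g i (show 0 < t + M by linarith)).comp_add_const t M).const_mul (h : ℝ))) n l (6 ^ (d + 1) * l) (by
          intro t h1' h2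
          have ht0 : 0 ≤ t := le_trans (cast_nonneg n) h1'
          have e : α * rp d (d + 1) (t + M) + h * rp g (d + 1) (t + M) = |(h : ℝ)| * κ * (t + M) ^ (g - (d + 1)) := by
            rw [rp, rp, cf_nat d (d + 1) 𝕆, ← habs]; push_cast; ring
          simp only [e]
          have hneg : g - ((d : ℝ) + 1) ≤ 0 := by linarith [(cast_nonneg d : (0:ℝ) ≤ d)]
          have hd3' : (d : ℝ) ≤ 3 := by exact_mod_cast hd3
          push_cast at h2
          have u1 : (6 * M : ℝ) ^ (g - ((d : ℝ) + 1)) ≤ (t + M) ^ (g - ((d : ℝ) + 1)) :=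
            rpow_le_rpow_of_nonpos 𝕃 𝕃 hneg
          have u2 : (t + M : ℝ) ^ (g - ((d : ℝ) + 1)) ≤ ®M ^ (g - ((d : ℝ) + 1)) :=
            rpow_le_rpow_of_nonpos 𝕃 𝕃 hneg
          rw [mul_rpow (by norm_num) hM0.le] at u1
          constructor
          · rw [hl, hB]
            calc _ = |(h : ℝ)| * κ * (6 ^ (g - ((d : ℝ) + 1)) * ®M ^ (g - ((d : ℝ) + 1))) := by ring
              _ ≤ _ := by gcongr
          · have u3 : (1 : ℝ) ≤ 6 ^ (d + 1) * 6 ^ (g - ((d : ℝ) + 1)) := by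
              rw [← rpow_natCast, ← rpow_add (by norm_num)]
              exact one_le_rpow (by norm_num) (by push_cast; linarith)
            rw [hl, hB]
            calc |(h : ℝ)| * κ * (t + M) ^ (g - ((d : ℝ) + 1)) ≤ |(h : ℝ)| * κ * ®M ^ (g - ((d : ℝ) + 1)) := by gcongr
              _ ≤ (|(h : ℝ)| * κ * ®M ^ (g - ((d : ℝ) + 1))) * (6 ^ (d + 1) * 6 ^ (g - ((d : ℝ) + 1))) := le_mul_of_one_le_right ℙ u3
              _ = _ := by ring)
      convert this using 3
      all_goals
        ext i
        simp only [rp, cf, Finset.range_zero, Finset.prod_empty, cast_zero, sub_zero, one_mul, rpow_natCast]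
        push_cast; rw [add_comm (i : ℝ)]
    have hS := hVT l hl0 M _ hG
    have e : SS d g α h M = ∑ n ∈ range M, eC (α * ((M + n : ℕ) : ℝ) ^ d + h * ((M + n : ℕ) : ℝ) ^ g) := by
      rw [SS, sum_Ico_eq_sum_range, two_mul, Nat.add_sub_cancel]
    rw [e]
    refine hS.trans ?_
    rw [mul_assoc]
    refine mul_le_mul_of_nonneg_left ?_ hC.le
    have p1 : l ^ a ≤ B ^ a * ®M ^ (-(d * a)) := by
      have : l ≤ B * ®M ^ (-(d : ℝ)) := by
        rw [hl]
        calc _ ≤ ®M ^ (1 - g) * B * ®M ^ (g - (d + 1)) := by gcongr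
          _ = B * (®M ^ (1 - g) * ®M ^ (g - (d + 1))) := by ring
          _ = _ := by rw [← rpow_add hM0]; congr 2; ring
      refine (rpow_le_rpow hl0.le this ha.le).trans_eq ?_
      rw [mul_rpow hB0.le ℙ, ← rpow_mul hM0.le]; congr 2; ring
    have p2 : l ^ (-a) ≤ B ^ (-a) * ®M ^ ((d + 1 - g) * a) := by
      have : B * ®M ^ (g - (d + 1)) ≤ l := by
        rw [hl, mul_assoc |(h : ℝ)|]; exact le_mul_of_one_le_left ℙ hh1
      refine (rpow_le_rpow_of_nonpos ℙ this 𝕃).trans_eq ?_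
      rw [mul_rpow hB0.le ℙ, ← rpow_mul hM0.le]; congr 2; ring
    have q1 : (M : ℝ) * l ^ a ≤ B ^ a * ®M ^ (1 - d * a) := by
      rw [sub_eq_add_neg, rpow_add hM0, rpow_one]
      calc _ ≤ (M : ℝ) * (B ^ a * ®M ^ (-(d * a))) := by gcongr
        _ = _ := by ring
    have q2 : ®M ^ (1 - b) * l ^ (-a) ≤ B ^ (-a) * ®M ^ (1 - b + (d + 1 - g) * a) := by
      rw [rpow_add hM0 (1 - b)]
      calc _ ≤ ®M ^ (1 - b) * (B ^ (-a) * ®M ^ ((d + 1 - g) * a)) := by gcongr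
        _ = _ := by ring
    have r1 : 0 < B ^ a := by positivity
    have r2 : 0 < B ^ (-a) := by positivity
    have r3 : 0 < ®M ^ (1 - d * a) := by positivity
    have r4 : 0 < ®M ^ (1 - b + (d + 1 - g) * a) := by positivity
    nlinarith [mul_pos r1 r4, mul_pos r2 r3]
  intro α h hh hb
  rcases lt_or_gt_of_ne (mul_ne_zero (Int.cast_ne_zero.2 hh : (h : ℝ) ≠ 0) (cf_ne h0 h1 (d + 1))) with hs | hs
  · rw [← SS_neg]
    exact key (-α) (-h) (by push_cast; linarith) (by push_cast; rwa [abs_neg])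
  · exact key α h hs hb

lemma c2_23 {d : ℕ} (hd : d = 2 ∨ d = 3) {c : ℝ} (hc1 : 1 < c) (hc2 : c < 1 + c2ps d) : (d = 2 → 54 / 55 ≤ 1 / c) ∧ (d = 3 → 495 / 496 ≤ 1 / c) := by
  rcases hd with rfl | rfl
  · refine ⟨fun _ => ?_, by norm_num⟩
    norm_num [c2ps] at hc2
    rw [le_div_iff₀ 𝕃]; linarith
  · refine ⟨by norm_num, fun _ => ?_⟩
    norm_num [c2ps] at hc2
    rw [le_div_iff₀ 𝕃]; linarith

lemma rpow_two_le {M e1 e2 e C : ℝ} (hM : 1 ≤ M) (hC : 0 < C) (h1 : e1 ≤ e) (h2 : e2 ≤ e) : C * (M ^ e1 + M ^ e2) ≤ 2 * C * M ^ e := by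
  have := rpow_le_rpow_of_exponent_le hM h1
  have := rpow_le_rpow_of_exponent_le hM h2
  nlinarith

lemma B1low {d : ℕ} (hd : d = 2 ∨ d = 3) {c : ℝ} (hc1 : 1 < c) (hc2 : c < 1 + c2ps d) :
    ∃ C > 0, ∀ M : ℕ, 1 ≤ M → ∀ α : ℝ, ∀ h : ℤ, h ≠ 0 → |(h : ℝ)| ≤ ®M ^ (1 - 1 / c) →
      ‖SS d (1 / c) α h M‖ ≤ C * ®M ^ (θdc d c / c) := by
  have hg0 : 0 < 1 / c := by positivity
  have hg1 : 1 / c < 1 := by rw [div_lt_one 𝕃]; exact hc1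
  have hcg : c * (1 / c) = 1 := by field_simp
  have hh := c2_23 hd hc1 hc2
  set g := 1 / c with hg
  rcases hd with rfl | rfl
  · obtain ⟨C, hC, h3, _⟩ := VT34 (6 ^ 3) (by norm_num)
    obtain ⟨C', hC', h⟩ := SS_VT (d := 2) hg0 hg1 (by norm_num) (by norm_num) hC h3
    refine ⟨2 * C', by positivity, fun M hM α k hk hk2 => (h M hM α k hk hk2).trans ?_⟩
    have := hh.1 rfl
    have e : θdc 2 c / c = (4 + 7 * g) / 13 := by rw [θdc, if_pos rfl, hg]; field_simp
    refine rpow_two_le (by exact_mod_cast hM) hC' ?_ ?_ <;> rw [e] <;> push_cast <;> linarith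
  · obtain ⟨C, hC, _, h3⟩ := VT34 (6 ^ 4) (by norm_num)
    obtain ⟨C', hC', h⟩ := SS_VT (d := 3) hg0 hg1 (by norm_num) (by norm_num) hC h3
    refine ⟨2 * C', by positivity, fun M hM α k hk hk2 => (h M hM α k hk hk2).trans ?_⟩
    have := hh.2 rfl
    have e : θdc 3 c / c = (15 + 14 * g) / 30 := by rw [θdc, if_neg (by norm_num), if_pos rfl, hg]; field_simp
    refine rpow_two_le (by exact_mod_cast hM) hC' ?_ ?_ <;> rw [e] <;> push_cast <;> linarith

lemma rat_far (r : ℚ) (l n : ℤ) (h : ¬ (r.den : ℤ) ∣ l) : 1 / (r.den : ℝ) ≤ |(r : ℝ) * l - n| := by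
  have hd : (0 : ℝ) < r.den := by exact_mod_cast r.den_pos
  have e : (r : ℝ) * l - n = ((r.num * l - n * r.den : ℤ) : ℝ) / r.den := by
    rw [eq_div_iff hd.ne']
    conv_lhs => rw [show (r : ℝ) = r.num / r.den by exact_mod_cast (Rat.num_div_den r).symm]
    push_cast; field_simp
  rw [e, abs_div, abs_of_pos hd]
  have : r.num * l - n * r.den ≠ 0 := fun h0 => by
    have h1 : (r.den : ℤ) ∣ r.num * l := ⟨n, by linarith⟩
    have h2 : IsCoprime (r.den : ℤ) r.num := by
      rw [Int.isCoprime_iff_gcd_eq_one, Int.gcd_comm]; exact r.reduced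
    exact h (h2.dvd_of_dvd_mul_left h1)
  gcongr
  exact_mod_cast one_le_abs this

lemma spacing (α : ℝ) (r : ℚ) (h : |α - r| ≤ 1 / (r.den : ℝ) ^ 2) (l : ℤ) (h0 : l ≠ 0) (hl : 2 * |l| ≤ r.den) : 1 / (2 * (r.den : ℝ)) ≤ nn (α * l) := by
  have hd : (0 : ℝ) < r.den := by exact_mod_cast r.den_pos
  have h1 := rat_far r l (round (α * l)) fun h => by
    have := Int.le_of_dvd (abs_pos.2 h0) ((dvd_abs _ _).2 h)
    have := abs_pos.2 h0
    omega
  have h2 : |(l : ℝ)| ≤ r.den / 2 := by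
    have : ((2 * |l| : ℤ) : ℝ) ≤ ((r.den : ℤ) : ℝ) := by exact_mod_cast hl
    push_cast at this; linarith
  have h3 : |(α - r) * l| ≤ 1 / (2 * r.den) := by
    rw [abs_mul]
    calc _ ≤ 1 / (r.den : ℝ) ^ 2 * (r.den / 2) := by gcongr
      _ = _ := by field_simp
  have h4 := abs_sub_abs_le_abs_sub ((r : ℝ) * l - round (α * l)) (-((α - r) * l))
  rw [show (r : ℝ) * l - round (α * l) - -((α - r) * l) = α * l - round (α * l) by ring, abs_neg] at h4
  have : 1 / (r.den : ℝ) = 1 / (2 * r.den) + 1 / (2 * r.den) := by field_simp; norm_num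
  unfold nn; linarith

lemma count (α : ℝ) (r : ℚ) (h : |α - r| ≤ 1 / (r.den : ℝ) ^ 2) (u L : ℕ) (y : ℝ) {κ : ℝ} (hκ : 0 ≤ κ) :
    (((Ico u (u + L)).filter fun l : ℕ => nn (α * l - y) ≤ κ).card : ℝ) ≤ (2 * L / r.den + 1) * (4 * κ * r.den + 1) := by
  have hd : (0 : ℝ) < r.den := by exact_mod_cast r.den_pos
  set B := r.den / 2 + 1 with hB
  set S := (Ico u (u + L)).filter fun l : ℕ => nn (α * l - y) ≤ κ with hS
  have hm : ∀ l ∈ S, (l - u) / B ∈ range (L / B + 1) := fun l hl => by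
    have := mem_Ico.1 (mem_filter.1 hl).1
    rw [mem_range, lt_succ_iff]; exact Nat.div_le_div_right 𝕆
  have hf : ∀ j ∈ range (L / B + 1), ((S.filter fun l => (l - u) / B = j).card : ℝ) ≤ 4 * κ * r.den + 1 := by
    intro j _
    have := spaced_nn (S.filter fun l => (l - u) / B = j) (fun l : ℕ => α * l) (κ := κ) (ρ := 1 / (2 * (r.den : ℝ))) (y := y) ℙ
      (fun l hl => (mem_filter.1 (mem_filter.1 hl).1).2) ?_ hκ
    · refine this.trans_eq ?_; field_simp; ring
    intro l hl l' hl' hne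
    have a1 := mem_filter.1 hl; have a2 := mem_filter.1 hl'
    have b1 := mem_Ico.1 (mem_filter.1 a1.1).1
    have b2 := mem_Ico.1 (mem_filter.1 a2.1).1
    have c1 := (Nat.div_eq_iff 𝕆).1 a1.2
    have c2 := (Nat.div_eq_iff 𝕆).1 a2.2
    have := spacing α r h ((l : ℤ) - l') 𝕆 (by
      have : |(l : ℤ) - l'| ≤ r.den / 2 := by rw [abs_le]; omega
      omega)
    refine this.trans_eq ?_
    congr 1; push_cast; ring
  have hc : (S.card : ℝ) = ∑ j ∈ range (L / B + 1), ((S.filter fun l => (l - u) / B = j).card : ℝ) := by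
    exact_mod_cast card_eq_sum_card_fiberwise hm
  rw [hc]
  refine (sum_le_card_nsmul _ _ _ hf).trans ?_
  rw [nsmul_eq_mul, card_range]
  refine mul_le_mul_of_nonneg_right ?_ ℙ
  push_cast
  gcongr
  refine Nat.cast_div_le.trans ?_
  have : (r.den : ℝ) ≤ 2 * B := by exact_mod_cast 𝕆
  rw [div_le_div_iff₀ (by exact_mod_cast Nat.succ_pos _) hd]
  nlinarith [(cast_nonneg L : (0:ℝ) ≤ L)]

/-- the hypothesis class for minor arc bounds -/
def B0 (d : ℕ) (s : ℝ) : Prop := ∃ C > 0, ∀ x M : ℕ, 1 ≤ M → M ≤ x → ∀ (α : ℝ) (r : ℚ), |α - r| ≤ 1 / (r.den : ℝ) ^ 2 →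
  ®x ^ (1 - s) ≤ r.den → (r.den : ℝ) ≤ ®x ^ (d - 1 + s) → ‖SS d 1 α 0 M‖ ≤ C * ®x ^ (1 - s)

lemma B0two {s : ℝ} (hs0 : 0 ≤ s) (hs : s ≤ 1 / 6) : B0 2 s := by
  refine ⟨30, by norm_num, fun x M hM hMx α r hr hq1 hq2 => ?_⟩
  have hM1 : (1 : ℝ) ≤ M := by exact_mod_cast hM
  have hMx' : (M : ℝ) ≤ x := by exact_mod_cast hMx
  have hx1 : (1 : ℝ) ≤ x := by linarith
  have hx0 : (0 : ℝ) < x := by linarith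
  set X := (x : ℝ) with hX
  have hd : (0 : ℝ) < r.den := by exact_mod_cast r.den_pos
  set κ := X ^ (-(1 / 2 + s)) with hκ
  have hκ0 : 0 < κ := by positivity
  have e0 : SS 2 1 α 0 M = ∑ n ∈ range M, eC (α * ((M + n : ℕ) : ℝ) ^ 2) := by
    rw [SS, sum_Ico_eq_sum_range, two_mul, Nat.add_sub_cancel]; simp
  rw [e0]
  set z : ℕ → ℂ := fun n => eC (α * ((M + n : ℕ) : ℝ) ^ 2) with hz
  have hv := vdC z M M hM (fun n => (norm_eC _).le) (fun l => if nn (α * ((2 * l : ℕ) : ℝ)) ≤ κ then (M : ℝ) else 1 / (2 * κ)) (by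
    intro l hl1 hl2
    have e1 : ∀ n, z (n + l) * (starRingEnd ℂ) (z n) = eC (α * (2 * M * l + l ^ 2)) * eC (n * (α * ((2 * l : ℕ) : ℝ))) := by
      intro n
      simp only [hz]; rw [← eC_sub, ← eC_add]; congr 1; push_cast; ring
    simp only [e1]
    rw [← mul_sum, norm_mul, norm_eC, one_mul]
    split_ifs with hc
    · refine (norm_sum_eC_le _ _).trans ?_
      rw [card_range]; exact_mod_cast sub_le _ _
    · have := geom (α * ((2 * l : ℕ) : ℝ)) (M - l)
      rw [le_div_iff₀ ℙ]
      refine le_trans ?_ this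
      gcongr; exact (not_le.1 hc).le)
  have hcnt : (((Ico 1 M).filter fun l : ℕ => nn (α * ((2 * l : ℕ) : ℝ)) ≤ κ).card : ℝ) ≤ (2 * (2 * M : ℕ) / r.den + 1) * (4 * κ * r.den + 1) := by
    refine le_trans ?_ (count α r hr 0 (2 * M) 0 hκ0.le)
    norm_cast
    refine card_le_card_of_injOn (fun l => 2 * l) (fun l hl => ?_) (fun a _ b _ h => by simpa using h)
    have := mem_filter.1 hl
    have h2 := mem_Ico.1 this.1
    refine mem_filter.2 ⟨mem_Ico.2 ⟨Nat.zero_le _, by dsimp only; omega⟩, ?_⟩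
    rw [sub_zero]; exact this.2
  have hsum : ∑ l ∈ Ico 1 M, (if nn (α * ((2 * l : ℕ) : ℝ)) ≤ κ then (M : ℝ) else 1 / (2 * κ)) ≤ M * ((2 * (2 * M : ℕ) / r.den + 1) * (4 * κ * r.den + 1)) + M * (1 / (2 * κ)) := by
    rw [Finset.sum_ite, sum_const, sum_const, nsmul_eq_mul, nsmul_eq_mul, mul_comm (_ : ℝ) (M : ℝ)]
    refine add_le_add (mul_le_mul_of_nonneg_left hcnt 𝕃) (mul_le_mul_of_nonneg_right ?_ ℙ)
    have := (Finset.card_filter_le (Ico 1 M) fun l => ¬ nn (α * ((2 * l : ℕ) : ℝ)) ≤ κ)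
    rw [card_Ico] at this
    exact_mod_cast this.trans 𝕆
  set S := ‖∑ n ∈ range M, z n‖ with hS
  have h1 : S ^ 2 ≤ 2 * (M + 2 * (M * ((2 * (2 * M : ℕ) / r.den + 1) * (4 * κ * r.den + 1)) + M * (1 / (2 * κ)))) := by
    refine le_of_mul_le_mul_left ?_ (show (0:ℝ) < M by linarith)
    refine hv.trans ?_
    have : (M : ℝ) + M = M * 2 := by ring
    rw [this, mul_assoc (M : ℝ)]
    gcongr
  have p1 : (2 * (2 * M : ℕ) / r.den + 1 : ℝ) ≤ 5 * X ^ s := by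
    have : (M : ℝ) / r.den ≤ X ^ s := by
      rw [div_le_iff₀ hd]
      refine hMx'.trans ?_
      calc X = X ^ s * X ^ (1 - s) := by rw [← rpow_add hx0]; simp
        _ ≤ _ := by gcongr
    have h2 : 1 ≤ X ^ s := one_le_rpow hx1 hs0
    push_cast
    rw [show 2 * (2 * (M : ℝ)) / r.den = 4 * (M / r.den) by ring]; linarith only [this, h2]
  have p2 : 4 * κ * r.den + 1 ≤ 5 * X ^ (1 / 2 : ℝ) := by
    have h3 : κ * r.den ≤ X ^ (1 / 2 : ℝ) := by
      calc κ * r.den ≤ X ^ (-(1 / 2 + s)) * X ^ (((2 : ℕ) : ℝ) - 1 + s) := by gcongr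
        _ = _ := by rw [← rpow_add hx0]; congr 1; push_cast; ring
    have h2 : 1 ≤ X ^ (1 / 2 : ℝ) := one_le_rpow hx1 (by norm_num)
    linarith only [h3, h2]
  have p3 : 1 / (2 * κ) ≤ X ^ s * X ^ (1 / 2 : ℝ) := by
    rw [hκ, rpow_neg hx0.le, ← rpow_add hx0, add_comm s]
    have : 0 < X ^ (1 / 2 + s) := by positivity
    rw [show 1 / (2 * (X ^ (1 / 2 + s))⁻¹) = X ^ (1 / 2 + s) / 2 by field_simp]; linarith only [this]
  have p4 : (2 * (2 * M : ℕ) / r.den + 1 : ℝ) * (4 * κ * r.den + 1) ≤ 25 * (X ^ s * X ^ (1 / 2 : ℝ)) := by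
    calc _ ≤ (5 * X ^ s) * (5 * X ^ (1 / 2 : ℝ)) := by gcongr
      _ = _ := by ring
  set P := X ^ s * X ^ (1 / 2 : ℝ) with hP
  have hP1 : 1 ≤ P := by
    rw [hP, ← rpow_add hx0]; exact one_le_rpow hx1 (by linarith only [hs0])
  have h5 : S ^ 2 ≤ 106 * (X * P) := by
    refine h1.trans ?_
    have q1 : (M : ℝ) * ((2 * (2 * M : ℕ) / r.den + 1 : ℝ) * (4 * κ * r.den + 1)) ≤ X * (25 * P) := by gcongr
    have q2 : (M : ℝ) * (1 / (2 * κ)) ≤ X * P := by gcongr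
    have q3 : (M : ℝ) ≤ X * P := hMx'.trans (le_mul_of_one_le_right hx0.le hP1)
    linarith only [q3, q1, q2]
  have h6 : X * P ≤ (X ^ (1 - s)) ^ 2 := by
    rw [hP, ← rpow_add hx0, ← rpow_natCast, ← rpow_mul hx0.le]
    nth_rw 1 [← rpow_one X]
    rw [← rpow_add hx0]
    exact rpow_le_rpow_of_exponent_le hx1 (by push_cast; linarith only [hs])
  refine (abs_le_of_sq_le_sq' ?_ ℙ).2
  rw [mul_pow]; nlinarith [sq_nonneg (X ^ (1 - s))]

lemma sum_inv_sq (K : ℕ) : ∑ k ∈ range K, 1 / ((k : ℝ) + 1) ^ 2 ≤ 2 := by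
  have key : ∀ K : ℕ, ∑ k ∈ range (K + 1), 1 / ((k : ℝ) + 1) ^ 2 ≤ 2 - 1 / ((K : ℝ) + 1) := by
    intro K
    induction K with
    | zero => norm_num
    | succ K ih =>
      rw [sum_range_succ]
      have h : (0 : ℝ) < (K : ℝ) + 1 := by positivity
      have : 1 / (((K + 1 : ℕ) : ℝ) + 1) ^ 2 ≤ 1 / (K + 1) - 1 / (((K + 1 : ℕ) : ℝ) + 1) := by
        push_cast
        rw [div_sub_div _ _ ℙ ℙ, div_le_div_iff₀ ℙ ℙ]
        nlinarith
      linarith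
  rcases K with _ | K
  · simp
  · refine (key K).trans ?_
    have : 0 < 1 / ((K : ℝ) + 1) := by positivity
    linarith

lemma DK_bound (N : ℕ) (hN : 1 ≤ N) (t : ℝ) : ‖∑ a ∈ range (2 * N), eC (a * t)‖ ^ 2 ≤ 4 * ®N ^ 2 * (1 / ((⌊N * nn t⌋₊ : ℝ) + 1) ^ 2) := by
  have hN0 : (0 : ℝ) < N := by exact_mod_cast hN
  set k := ⌊N * nn t⌋₊ with hk
  set D := ‖∑ a ∈ range (2 * N), eC (a * t)‖ with hD
  have hD0 : 0 ≤ D := norm_nonneg _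
  have h1 : D ≤ 2 * N := by
    refine (norm_sum_eC_le _ _).trans ?_
    rw [card_range]; push_cast; rfl
  have h2 : (k : ℝ) ≤ N * nn t := floor_le (mul_nonneg hN0.le (nn_nonneg t))
  have h3 : D * (2 * nn t) ≤ 1 := geom t (2 * N)
  rw [mul_one_div, le_div_iff₀ ℙ, ← mul_pow, show 4 * ®N ^ 2 = (2 * N) ^ 2 by ring]
  refine pow_le_pow_left₀ ℙ ?_ 2
  rcases Nat.eq_zero_or_pos k with h0 | h0
  · rw [h0]; simpa using h1
  · have : (1 : ℝ) ≤ k := by exact_mod_cast h0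
    have h4 : D * k ≤ D * (N * nn t) := mul_le_mul_of_nonneg_left h2 hD0
    have h5 : (N : ℝ) * (D * (2 * nn t)) ≤ N * 1 := mul_le_mul_of_nonneg_left h3 hN0.le
    nlinarith

lemma row_bound {ι : Type*} (S : Finset ι) (γ : ι → ℝ) (N : ℕ) (hN : 1 ≤ N) {𝓜 : ℝ} (hm : ∀ y : ℝ, ((S.filter fun i => nn (γ i - y) ≤ 1 / N).card : ℝ) ≤ 𝓜) (t : ℝ) :
    ∑ j ∈ S, ‖∑ a ∈ range (2 * N), eC (a * (γ j - t))‖ ^ 2 ≤ 16 * 𝓜 * ®N ^ 2 := by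
  have hN0 : (0 : ℝ) < N := by exact_mod_cast hN
  have h𝓜 : 0 ≤ 𝓜 := (cast_nonneg _).trans (hm 0)
  refine (sum_le_sum fun j _ => DK_bound N hN (γ j - t)).trans ?_
  have hmap : ∀ j ∈ S, ⌊N * nn (γ j - t)⌋₊ ∈ range N := fun j _ => by
    rw [mem_range, Nat.floor_lt (mul_nonneg hN0.le (nn_nonneg _))]
    nlinarith [nn_le_half (γ j - t)]
  rw [← sum_fiberwise_of_maps_to hmap]
  have hk : ∀ k ∈ range N, ∑ j ∈ S.filter (fun j => ⌊N * nn (γ j - t)⌋₊ = k), 4 * ®N ^ 2 * (1 / ((⌊N * nn (γ j - t)⌋₊ : ℝ) + 1) ^ 2) ≤ 8 * 𝓜 * ®N ^ 2 * (1 / ((k : ℝ) + 1) ^ 2) := by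
    intro k _
    have hc : ((S.filter (fun j => ⌊N * nn (γ j - t)⌋₊ = k)).card : ℝ) ≤ 2 * 𝓜 := by
      have hsub : S.filter (fun j => ⌊N * nn (γ j - t)⌋₊ = k) ⊆ (S.filter fun i => nn (γ i - (t + (k + 1 / 2) / N)) ≤ 1 / N) ∪ (S.filter fun i => nn (γ i - (t - (k + 1 / 2) / N)) ≤ 1 / N) := by
        intro j hj
        have hj := mem_filter.1 hj
        have h1 := (Nat.floor_eq_iff (mul_nonneg hN0.le (nn_nonneg _))).1 hj.2
        set r := round (γ j - t) with hr
        have a1 : (k : ℝ) / N ≤ nn (γ j - t) := by rw [div_le_iff₀ hN0]; linarith [h1.1]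
        have a2 : nn (γ j - t) ≤ (k + 1) / N := by rw [le_div_iff₀ hN0]; linarith [h1.2]
        have a3 : ((k : ℝ) + 1) / N = k / N + 1 / N := by ring
        have a4 : ((k : ℝ) + 1 / 2) / N = k / N + 1 / N / 2 := by ring
        have a5 : 0 < 1 / (N : ℝ) := by positivity
        rw [Finset.mem_union, mem_filter, mem_filter]
        unfold nn at a1 a2
        rcases le_total 0 (γ j - t - r) with h | h
        · left; refine ⟨hj.1, (nn_le _ r).trans ?_⟩
          rw [abs_of_nonneg h] at a1 a2
          rw [abs_le]; constructor <;> linarith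
        · right; refine ⟨hj.1, (nn_le _ r).trans ?_⟩
          rw [abs_of_nonpos h] at a1 a2
          rw [abs_le]; constructor <;> linarith
      have h2 := (card_le_card hsub).trans (Finset.card_union_le _ _)
      have h3 : ((S.filter (fun j => ⌊N * nn (γ j - t)⌋₊ = k)).card : ℝ) ≤ ((S.filter fun i => nn (γ i - (t + (k + 1 / 2) / N)) ≤ 1 / N).card : ℝ) + ((S.filter fun i => nn (γ i - (t - (k + 1 / 2) / N)) ≤ 1 / N).card : ℝ) := by exact_mod_cast h2
      linarith [hm (t + (k + 1 / 2) / N), hm (t - (k + 1 / 2) / N)]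
    have : ∀ j ∈ S.filter (fun j => ⌊N * nn (γ j - t)⌋₊ = k), 4 * ®N ^ 2 * (1 / ((⌊N * nn (γ j - t)⌋₊ : ℝ) + 1) ^ 2) = 4 * ®N ^ 2 * (1 / ((k : ℝ) + 1) ^ 2) := fun j hj => by
      rw [(mem_filter.1 hj).2]
    rw [sum_congr rfl this, sum_const, nsmul_eq_mul]
    refine (mul_le_mul_of_nonneg_right hc ℙ).trans_eq (by ring)
  refine (sum_le_sum hk).trans ?_
  rw [← mul_sum]
  have := sum_inv_sq N
  have h0 : 0 ≤ 8 * 𝓜 * ®N ^ 2 := by positivity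
  nlinarith

/-- large sieve -/
lemma LS {ι : Type*} (S : Finset ι) (γ : ι → ℝ) (c : ι → ℂ) (N : ℕ) (hN : 1 ≤ N) {𝓜 : ℝ} (hm : ∀ y : ℝ, ((S.filter fun i => nn (γ i - y) ≤ 1 / N).card : ℝ) ≤ 𝓜) :
    ∑ n ∈ range N, ‖∑ i ∈ S, c i * eC (n * γ i)‖ ^ 2 ≤ 16 * 𝓜 * N * ∑ i ∈ S, ‖c i‖ ^ 2 := by
  have hN0 : (0 : ℝ) < N := by exact_mod_cast hN
  set A : ℝ → ℝ := fun u => ‖∑ i ∈ S, c i * eC (u * γ i)‖ ^ 2 with hA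
  have hA0 : ∀ u, 0 ≤ A u := fun u => by positivity
  have h1 : (N : ℝ) * ∑ n ∈ range N, A n ≤ ∑ b ∈ range (2 * N), ∑ a ∈ range (2 * N), A ((a : ℝ) - b) := by
    rw [← nsmul_eq_mul]
    nth_rw 1 [← card_range N]
    rw [← sum_const]
    refine (sum_le_sum fun b hb => ?_).trans (sum_le_sum_of_subset_of_nonneg (Finset.range_subset_range.2 (show N ≤ 2 * N by omega)) fun b _ _ => sum_nonneg fun a _ => hA0 _)
    have : ∑ n ∈ range N, A n = ∑ a ∈ (range N).map (addRightEmbedding b), A ((a : ℝ) - b) := by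
      rw [Finset.sum_map]; refine sum_congr rfl fun n _ => ?_
      simp
    rw [this]
    refine sum_le_sum_of_subset_of_nonneg (fun a ha => ?_) fun a _ _ => hA0 _
    obtain ⟨n, hn, rfl⟩ := Finset.mem_map.1 ha
    simp at hn hb ⊢; omega
  have h2 : ((∑ b ∈ range (2 * N), ∑ a ∈ range (2 * N), A ((a : ℝ) - b) : ℝ) : ℂ) =
      ∑ i ∈ S, ∑ j ∈ S, c i * (starRingEnd ℂ) (c j) * ((‖∑ a ∈ range (2 * N), eC (a * (γ i - γ j))‖ ^ 2 : ℝ) : ℂ) := by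
    have e1 : ∀ u : ℝ, ((A u : ℝ) : ℂ) = ∑ i ∈ S, ∑ j ∈ S, c i * (starRingEnd ℂ) (c j) * eC (u * (γ i - γ j)) := by
      intro u
      simp only [hA]
      push_cast
      rw [← mul_conj', map_sum, sum_mul_sum]
      refine sum_congr rfl fun i _ => sum_congr rfl fun j _ => ?_
      rw [mul_sub, eC_sub, map_mul]; ring
    push_cast
    simp only [e1]
    rw [sum_congr rfl fun b _ => sum_comm, sum_comm]
    refine sum_congr rfl fun i _ => ?_
    rw [sum_congr rfl fun b _ => sum_comm, sum_comm]
    refine sum_congr rfl fun j _ => ?_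
    rw [← mul_conj', map_sum, sum_mul_sum, sum_comm, mul_sum]
    refine sum_congr rfl fun a _ => ?_
    rw [mul_sum]
    refine sum_congr rfl fun b _ => ?_
    rw [sub_mul, eC_sub]
  have h3 : ∑ b ∈ range (2 * N), ∑ a ∈ range (2 * N), A ((a : ℝ) - b) ≤ 16 * 𝓜 * ®N ^ 2 * ∑ i ∈ S, ‖c i‖ ^ 2 := by
    set K : ι → ι → ℝ := fun i j => ‖∑ a ∈ range (2 * N), eC (a * (γ i - γ j))‖ ^ 2 with hK
    have hKs : ∀ i j, K i j = K j i := fun i j => by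
      simp only [hK]; congr 1
      rw [← norm_conj, map_sum]; congr 2; ext a
      rw [← eC_neg]; congr 1; ring
    have hK0 : ∀ i j, 0 ≤ K i j := fun i j => by positivity
    calc _ = ‖((∑ b ∈ range (2 * N), ∑ a ∈ range (2 * N), A ((a : ℝ) - b) : ℝ) : ℂ)‖ := by
          rw [norm_real, norm_eq_abs, abs_of_nonneg]
          exact sum_nonneg fun _ _ => sum_nonneg fun _ _ => hA0 _
      _ ≤ ∑ i ∈ S, ∑ j ∈ S, (‖c i‖ ^ 2 / 2 * K i j + ‖c j‖ ^ 2 / 2 * K i j) := by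
          rw [h2]
          refine (norm_sum_le _ _).trans (sum_le_sum fun i _ => (norm_sum_le _ _).trans (sum_le_sum fun j _ => ?_))
          rw [norm_mul, norm_mul, norm_conj, norm_real, norm_eq_abs, abs_of_nonneg (hK0 i j), ← add_mul]
          refine mul_le_mul_of_nonneg_right ?_ (hK0 i j)
          nlinarith [sq_nonneg (‖c i‖ - ‖c j‖)]
      _ = ∑ i ∈ S, ‖c i‖ ^ 2 * ∑ j ∈ S, K j i := by
          simp only [sum_add_distrib]
          rw [sum_comm (f := fun i j => ‖c j‖ ^ 2 / 2 * K i j), ← sum_add_distrib]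
          refine sum_congr rfl fun i _ => ?_
          rw [← sum_add_distrib, mul_sum]
          refine sum_congr rfl fun j _ => ?_
          rw [hKs i j]; ring
      _ ≤ ∑ i ∈ S, ‖c i‖ ^ 2 * (16 * 𝓜 * ®N ^ 2) := sum_le_sum fun i _ => mul_le_mul_of_nonneg_left (row_bound S γ N hN hm (γ i)) ℙ
      _ = _ := by rw [← sum_mul]; ring
  refine le_of_mul_le_mul_left ?_ hN0
  refine h1.trans (h3.trans_eq ?_)
  ring

lemma LSdual {ι : Type*} (S : Finset ι) (γ : ι → ℝ) (r : ℕ → ℂ) (N : ℕ) (hN : 1 ≤ N) {𝓜 : ℝ} (hm : ∀ y : ℝ, ((S.filter fun i => nn (γ i - y) ≤ 1 / N).card : ℝ) ≤ 𝓜) :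
    ∑ i ∈ S, ‖∑ n ∈ range N, r n * eC (n * γ i)‖ ^ 2 ≤ 16 * 𝓜 * N * ∑ n ∈ range N, ‖r n‖ ^ 2 := by
  set T : ι → ℂ := fun i => ∑ n ∈ range N, r n * eC (n * γ i) with hT
  set E := ∑ i ∈ S, ‖T i‖ ^ 2 with hE
  set X : ℕ → ℂ := fun n => ∑ i ∈ S, (starRingEnd ℂ) (T i) * eC (n * γ i) with hX
  have hE0 : 0 ≤ E := sum_nonneg fun i _ => by positivity
  have hF0 : 0 ≤ ∑ n ∈ range N, ‖r n‖ ^ 2 := sum_nonneg fun i _ => by positivity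
  have h1 : E ≤ ∑ n ∈ range N, ‖r n‖ * ‖X n‖ := by
    have e : (E : ℂ) = ∑ n ∈ range N, r n * X n := by
      simp only [hE, hX]
      push_cast
      simp only [mul_sum]
      rw [sum_comm]
      refine sum_congr rfl fun i _ => ?_
      rw [← mul_conj']
      nth_rw 1 [hT]
      simp only
      rw [sum_mul]
      exact sum_congr rfl fun n _ => by ring
    calc E = ‖(E : ℂ)‖ := by rw [norm_real, norm_eq_abs, abs_of_nonneg hE0]
      _ ≤ _ := by rw [e]; exact (norm_sum_le _ _).trans (sum_le_sum fun n _ => (norm_mul _ _).le)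
  have h2 := Finset.sum_mul_sq_le_sq_mul_sq (range N) (fun n => ‖r n‖) (fun n => ‖X n‖)
  have h3 := LS S γ (fun i => (starRingEnd ℂ) (T i)) N hN hm
  simp only [norm_conj] at h3
  change _ ≤ _ * E at h3
  have h4 : E ^ 2 ≤ (∑ n ∈ range N, ‖r n‖ ^ 2) * (16 * _ * N * E) := (pow_le_pow_left₀ hE0 h1 2).trans (h2.trans (mul_le_mul_of_nonneg_left h3 hF0))
  rcases hE0.eq_or_lt with h | h
  · rw [← h]
    have h𝓜 : 0 ≤ 𝓜 := (cast_nonneg _).trans (hm 0)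
    positivity
  · refine le_of_mul_le_mul_right ?_ h
    nlinarith

lemma VBcore {ι : Type*} (S : Finset ι) (k s Y : ℕ) (hs : 1 ≤ s) (hY : 1 ≤ Y) (γ : ι → Fin k → ℝ) (j0 : Fin k) {𝓜 : ℝ}
    (hm : ∀ y : ℝ, ((S.filter fun i => nn (γ i j0 - y) ≤ 1 / ®Y ^ (j0.val + 1)).card : ℝ) ≤ 𝓜) :
    ∑ m ∈ S, ‖∑ t ∈ Icc (1 : ℤ) Y, eC (∑ j, γ m j * ®t ^ (j.val + 1))‖ ^ (2 * s) ≤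
      16 * 𝓜 * (∏ j : Fin k, (2 * s * ®Y ^ (j.val + 1))) * (JJ k s Y).card := by
  set T : Finset (Fin s → ℤ) := Fintype.piFinset fun _ => Icc (1 : ℤ) Y with hT
  set v : (Fin s → ℤ) → Fin k → ℤ := fun t j => ∑ i, t i ^ (j.val + 1) with hv
  set v' : (Fin s → ℤ) → Fin k → ℤ := fun t j => if j = j0 then 0 else v t j with hv'
  set V := T.image v' with hV
  set N := s * Y ^ (j0.val + 1) + 1 with hN
  have h𝓜 : 0 ≤ 𝓜 := (cast_nonneg _).trans (hm 0)
  have hvb : ∀ t ∈ T, ∀ j, 1 ≤ v t j ∧ v t j ≤ s * (Y : ℤ) ^ (j.val + 1) := by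
    intro t ht j
    have h1 : ∀ i, 1 ≤ t i ^ (j.val + 1) ∧ t i ^ (j.val + 1) ≤ (Y : ℤ) ^ (j.val + 1) := fun i => by
      have := mem_Icc.1 (Fintype.mem_piFinset.1 ht i)
      exact ⟨one_le_pow₀ this.1, pow_le_pow_left₀ 𝕃 this.2 _⟩
    constructor
    · have := sum_le_sum fun i (_ : i ∈ univ) => (h1 i).1
      simp at this
      simp only [hv]; have hs' : (1 : ℤ) ≤ s := by exact_mod_cast hs
      linarith
    · have := sum_le_sum fun i (_ : i ∈ univ) => (h1 i).2
      simpa using this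
  set r : (Fin k → ℤ) → ℕ → ℕ := fun u n => (T.filter fun t => v' t = u ∧ (v t j0).toNat = n).card with hr
  have hpow : ∀ m, (∑ t ∈ Icc (1 : ℤ) Y, eC (∑ j, γ m j * ®t ^ (j.val + 1))) ^ s =
      ∑ u ∈ V, eC (∑ j, γ m j * u j) * ∑ n ∈ range N, (r u n : ℂ) * eC (n * γ m j0) := by
    intro m
    rw [Finset.sum_pow', ← hT]
    have e1 : ∀ t ∈ T, ∏ i, eC (∑ j, γ m j * ((t i : ℤ) : ℝ) ^ (j.val + 1)) = eC (∑ j, γ m j * v' t j) * eC ((v t j0).toNat * γ m j0) := by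
      intro t ht
      have e2 : ∀ (ι' : Finset (Fin s)) (f : Fin s → ℝ), ∏ i ∈ ι', eC (f i) = eC (∑ i ∈ ι', f i) := by
        intro ι' f
        induction ι' using Finset.induction_on with
        | empty => simp [eC_zero]
        | insert a b h ih => rw [Finset.prod_insert h, Finset.sum_insert h, eC_add, ih]
      rw [e2, ← eC_add, sum_comm]
      congr 1
      have e3 : (((v t j0).toNat : ℕ) : ℝ) = ((v t j0 : ℤ) : ℝ) := by
        have := Int.toNat_of_nonneg (show 0 ≤ v t j0 by linarith [(hvb t ht j0).1])
        exact_mod_cast congrArg (Int.cast : ℤ → ℝ) this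
      have e4 : ∀ j, ∑ i, γ m j * ((t i : ℤ) : ℝ) ^ (j.val + 1) = γ m j * ((v t j : ℤ) : ℝ) := fun j => by
        simp only [hv]; push_cast; rw [mul_sum]
      rw [e3, sum_congr rfl fun j _ => e4 j, ← add_sum_erase _ _ (mem_univ j0), ← add_sum_erase _ (fun j => γ m j * ((v' t j : ℤ) : ℝ)) (mem_univ j0)]
      have e5 : ∑ j ∈ univ.erase j0, γ m j * ((v t j : ℤ) : ℝ) = ∑ j ∈ univ.erase j0, γ m j * ((v' t j : ℤ) : ℝ) :=
        sum_congr rfl fun j hj => by simp only [hv', if_neg (ne_of_mem_erase hj)]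
      rw [e5]
      simp only [hv', if_true]; push_cast; ring
    rw [sum_congr rfl e1, ← sum_fiberwise_of_maps_to (t := V) (g := v') fun t ht => mem_image_of_mem _ ht]
    refine sum_congr rfl fun u _ => ?_
    have e6 : ∀ t ∈ T.filter fun t => v' t = u, eC (∑ j, γ m j * v' t j) * eC ((v t j0).toNat * γ m j0) = eC (∑ j, γ m j * u j) * eC ((v t j0).toNat * γ m j0) := fun t ht => by
      rw [(mem_filter.1 ht).2]
    rw [sum_congr rfl e6, ← mul_sum]
    congr 1
    rw [← sum_fiberwise_of_maps_to (t := range N) (g := fun t => (v t j0).toNat) fun t ht => ?_]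
    · refine sum_congr rfl fun n _ => ?_
      rw [filter_filter]
      have e7 : ∀ t ∈ T.filter fun t => v' t = u ∧ (v t j0).toNat = n, eC ((v t j0).toNat * γ m j0) = eC (n * γ m j0) := fun t ht => by
        rw [(mem_filter.1 ht).2.2]
      rw [sum_congr rfl e7, sum_const, nsmul_eq_mul]
    · have := hvb t (mem_filter.1 ht).1 j0
      rw [mem_range, hN, lt_succ_iff, Int.toNat_le]
      push_cast; exact this.2
  have hLS : ∀ u : Fin k → ℤ, ∑ m ∈ S, ‖∑ n ∈ range N, (r u n : ℂ) * eC (n * γ m j0)‖ ^ 2 ≤ 16 * 𝓜 * N * ∑ n ∈ range N, (r u n : ℝ) ^ 2 := by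
    intro u
    have := LSdual S (fun m => γ m j0) (fun n => (r u n : ℂ)) N 𝕆 (𝓜 := 𝓜) (fun y => le_trans ?_ (hm y))
    · simpa using this
    · have : 1 / (N : ℝ) ≤ 1 / ®Y ^ (j0.val + 1) := by
        have hY0 : (0 : ℝ) < Y := by exact_mod_cast hY
        refine one_div_le_one_div_of_le ℙ ?_
        have : Y ^ (j0.val + 1) ≤ N := by rw [hN]; nlinarith [Nat.zero_le (Y ^ (j0.val + 1))]
        exact_mod_cast this
      exact_mod_cast card_le_card (fun i hi => mem_filter.2 ⟨(mem_filter.1 hi).1, le_trans (mem_filter.1 hi).2 this⟩)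
  have hJ : ∑ u ∈ V, ∑ n ∈ range N, (r u n : ℝ) ^ 2 ≤ (JJ k s Y).card := by
    have h1 : ∀ t ∈ JJ k s Y, (v' t.1, (v t.1 j0).toNat) ∈ V ×ˢ range N := fun t ht => by
      have ht1 := (mem_product.1 (mem_filter.1 ht).1).1
      rw [mem_product]
      refine ⟨mem_image_of_mem _ ht1, ?_⟩
      have := hvb t.1 ht1 j0
      rw [mem_range, hN, lt_succ_iff, Int.toNat_le]
      push_cast; exact this.2
    rw [← sum_product']
    rw [card_eq_sum_card_fiberwise h1]
    push_cast
    refine sum_le_sum fun p hp => ?_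
    have : (r p.1 p.2) ^ 2 ≤ ((JJ k s Y).filter fun t => (v' t.1, (v t.1 j0).toNat) = p).card := by
      rw [sq, hr, ← Finset.card_product]
      refine card_le_card fun t ht => ?_
      obtain ⟨a, b⟩ := mem_product.1 ht
      have a := mem_filter.1 a
      have b := mem_filter.1 b
      refine mem_filter.2 ⟨mem_filter.2 ⟨mem_product.2 ⟨a.1, b.1⟩, fun j => ?_⟩, Prod.ext a.2.1 a.2.2⟩
      by_cases hj : j = j0
      · have c1 := (hvb _ a.1 j0).1
        have c2 := (hvb _ b.1 j0).1
        have c3 := a.2.2.trans b.2.2.symm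
        rw [hj]; change v t.1 j0 = v t.2 j0
        omega
      · have := congrFun (a.2.1.trans b.2.1.symm) j
        simpa only [hv', if_neg hj] using this
    exact_mod_cast this
  have hVc : (V.card : ℝ) * N ≤ ∏ j : Fin k, (2 * s * ®Y ^ (j.val + 1)) := by
    have h1 : V ⊆ Fintype.piFinset fun j : Fin k => if j = j0 then ({0} : Finset ℤ) else Icc 1 (s * (Y : ℤ) ^ (j.val + 1)) := by
      intro u hu
      obtain ⟨t, ht, rfl⟩ := mem_image.1 hu
      rw [Fintype.mem_piFinset]
      intro j
      simp only [hv']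
      split_ifs with h
      · simp
      · exact mem_Icc.2 (hvb t ht j)
    have h2 := card_le_card h1
    rw [Fintype.card_piFinset, ← Finset.mul_prod_erase _ _ (mem_univ j0), if_pos rfl, Finset.card_singleton, one_mul] at h2
    have h3 : ∏ j ∈ univ.erase j0, (if j = j0 then ({0} : Finset ℤ) else Icc 1 (s * (Y : ℤ) ^ (j.val + 1))).card ≤ ∏ j ∈ univ.erase j0, (2 * s * Y ^ (j.val + 1)) := by
      refine Finset.prod_le_prod' fun j hj => ?_
      rw [if_neg (ne_of_mem_erase hj), Int.card_Icc]
      have : ((s : ℤ) * (Y : ℤ) ^ (j.val + 1) + 1 - 1).toNat = s * Y ^ (j.val + 1) := by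
        rw [add_sub_cancel_right]; exact_mod_cast Int.toNat_natCast _
      rw [this]; nlinarith [Nat.zero_le (s * Y ^ (j.val + 1))]
    have h4 : N ≤ 2 * s * Y ^ (j0.val + 1) := by
      have : 1 ≤ s * Y ^ (j0.val + 1) := Nat.mul_pos hs (pow_pos hY _)
      rw [hN]; nlinarith
    have h5 : V.card * N ≤ ∏ j : Fin k, (2 * s * Y ^ (j.val + 1)) := by
      rw [← Finset.mul_prod_erase _ _ (mem_univ j0), mul_comm]
      exact Nat.mul_le_mul h4 (h2.trans h3)
    exact_mod_cast h5
  calc _ ≤ ∑ m ∈ S, (V.card : ℝ) * ∑ u ∈ V, ‖∑ n ∈ range N, (r u n : ℂ) * eC (n * γ m j0)‖ ^ 2 := by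
        refine sum_le_sum fun m _ => ?_
        rw [mul_comm 2 s, pow_mul, ← norm_pow, hpow m]
        refine (pow_le_pow_left₀ (norm_nonneg _) (norm_sum_le _ _) 2).trans ?_
        refine sq_sum_le_card_mul_sum_sq.trans (le_of_eq ?_)
        congr 1
        refine sum_congr rfl fun u _ => ?_
        rw [norm_mul, norm_eC, one_mul]
    _ = (V.card : ℝ) * ∑ u ∈ V, ∑ m ∈ S, ‖∑ n ∈ range N, (r u n : ℂ) * eC (n * γ m j0)‖ ^ 2 := by
        rw [← mul_sum, sum_comm]
    _ ≤ (V.card : ℝ) * ∑ u ∈ V, 16 * 𝓜 * N * ∑ n ∈ range N, (r u n : ℝ) ^ 2 := by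
        gcongr with u _; exact hLS u
    _ = 16 * 𝓜 * (V.card * N) * ∑ u ∈ V, ∑ n ∈ range N, (r u n : ℝ) ^ 2 := by
        rw [← mul_sum]; ring
    _ ≤ _ := mul_le_mul (mul_le_mul_of_nonneg_left hVc (mul_nonneg (by norm_num) h𝓜)) hJ (sum_nonneg fun _ _ => sum_nonneg fun _ _ => sq_nonneg _) (mul_nonneg (mul_nonneg (by norm_num) h𝓜) (Finset.prod_nonneg fun _ _ => by positivity))

lemma prod_Y (k s : ℕ) (h : 2 * s = k * (k + 1)) (Y : ℝ) : ∏ j : Fin k, (2 * s * Y ^ (j.val + 1)) = (2 * s) ^ k * Y ^ s := by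
  rw [Finset.prod_mul_distrib, Finset.prod_const, card_univ, Fintype.card_fin, Finset.prod_pow_eq_pow_sum]
  congr 2
  rw [Fin.sum_univ_eq_sum_range (fun j => j + 1)]
  have h2 := sum_range_succ' (fun j => j) k
  have := Finset.sum_range_id_mul_two (k + 1)
  rw [Nat.add_sub_cancel] at this
  nlinarith

lemma VB (k : ℕ) (hk : 1 ≤ k) {ε : ℝ} (hε : 0 < ε) : ∃ C > 0, ∀ (M Y : ℕ), 1 ≤ Y → 1 ≤ M → ∀ (f c : ℕ → ℝ) (γ : ℕ → Fin k → ℝ) (E 𝓜 : ℝ), 0 ≤ E →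
    (∀ m ∈ Ico M (2 * M), ∀ t : ℕ, 1 ≤ t → t ≤ Y → |f (m + t) - c m - ∑ j, γ m j * ®t ^ (j.val + 1)| ≤ E) → ∀ j0 : Fin k,
    (∀ y : ℝ, (((Ico M (2 * M)).filter fun i => nn (γ i j0 - y) ≤ 1 / ®Y ^ (j0.val + 1)).card : ℝ) ≤ 𝓜) →
    ‖∑ m ∈ Ico M (2 * M), eC (f m)‖ ≤ 2 * Y + 7 * M * E + C * M * (𝓜 / M) ^ (1 / ((k : ℝ) * (k + 1))) * ®Y ^ ε := by
  obtain ⟨s, hs⟩ : ∃ s, 2 * s = k * (k + 1) := ⟨k * (k + 1) / 2, Nat.mul_div_cancel' (Nat.even_mul_succ_self k).two_dvd⟩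
  have hs1 : 1 ≤ s := by nlinarith
  obtain ⟨C, hC, hJ⟩ := vmvt k hk hε
  have hs1r : (1 : ℝ) ≤ s := by exact_mod_cast hs1
  set C1 := 16 * (2 * (s : ℝ)) ^ k * C with hC1
  have hC10 : 0 < C1 := by positivity
  refine ⟨C1 ^ (1 / (2 * s : ℝ)), by positivity, ?_⟩
  intro M Y hY hM f c γ E 𝓜 hE hf j0 hm
  have hY1 : (1 : ℝ) ≤ Y := by exact_mod_cast hY
  have hM1 : (1 : ℝ) ≤ M := by exact_mod_cast hM
  have h𝓜 : 0 ≤ 𝓜 := (cast_nonneg _).trans (hm 0)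
  set S := Ico M (2 * M) with hS
  have hSc : S.card = M := by rw [hS, card_Ico]; omega
  set P : ℕ → ℂ := fun m => ∑ t ∈ Icc (1 : ℤ) Y, eC (∑ j, γ m j * ®t ^ (j.val + 1)) with hP
  have hPn : ∀ m, P m = ∑ t ∈ Icc 1 Y, eC (∑ j, γ m j * ®t ^ (j.val + 1)) := fun m => by
    have : Icc (1 : ℤ) Y = (Icc 1 Y).map Nat.castEmbedding := by
      ext z; simp only [mem_Icc, Finset.mem_map, Nat.castEmbedding_apply]
      constructor
      · rintro ⟨h1, h2⟩; exact ⟨z.toNat, by omega, by omega⟩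
      · rintro ⟨n, h, rfl⟩; omega
    simp only [hP]; rw [this, Finset.sum_map]; simp
  -- average over t
  set Z := ‖∑ m ∈ S, eC (f m)‖ with hZ
  have hmain : (Y : ℝ) * Z ≤ Y * (2 * Y) + Y * (7 * M * E) + ∑ m ∈ S, ‖P m‖ := by
    have a1 : (Y : ℝ) * Z ≤ ‖∑ t ∈ Icc 1 Y, ∑ m ∈ S, eC (f (m + t))‖ + Y * (2 * Y) := by
      have e1 : (Y : ℂ) * ∑ m ∈ S, eC (f m) = ∑ t ∈ Icc 1 Y, ∑ m ∈ S, eC (f (m + t)) + ∑ t ∈ Icc 1 Y, (∑ m ∈ S, eC (f m) - ∑ m ∈ S, eC (f (m + t))) := by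
        rw [← sum_add_distrib]; simp
      have e2 : (Y : ℝ) * Z = ‖(Y : ℂ) * ∑ m ∈ S, eC (f m)‖ := by rw [norm_mul]; simp [hZ]
      rw [e2, e1]
      refine (norm_add_le _ _).trans (add_le_add le_rfl ((norm_sum_le _ _).trans ((sum_le_card_nsmul _ _ (2 * (Y : ℝ)) fun t ht => ?_).trans_eq (by simp))))
      have ht' := mem_Icc.1 ht
      have e1 : ∑ m ∈ S, eC (f (m + t)) = ∑ m ∈ Ico (M + t) (2 * M + t), eC (f m) := by
        rw [hS, Finset.sum_Ico_add' (fun m => eC (f m))]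
      have e2 : ∑ m ∈ Ico M (M + t), eC (f m) + ∑ m ∈ Ico (M + t) (2 * M + t), eC (f m) = ∑ m ∈ S, eC (f m) + ∑ m ∈ Ico (2 * M) (2 * M + t), eC (f m) := by
        rw [Finset.sum_Ico_consecutive _ 𝕆 𝕆, Finset.sum_Ico_consecutive _ 𝕆 𝕆]
      rw [← e1] at e2
      have e3 : ∑ m ∈ S, eC (f m) - ∑ m ∈ S, eC (f (m + t)) = ∑ m ∈ Ico M (M + t), eC (f m) - ∑ m ∈ Ico (2 * M) (2 * M + t), eC (f m) := by
        linear_combination -e2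
      have b1 := norm_sum_eC_le (Ico M (M + t)) f
      have b2 := norm_sum_eC_le (Ico (2 * M) (2 * M + t)) f
      rw [card_Ico] at b1 b2
      simp only [Nat.add_sub_cancel_left] at b1 b2
      have : (t : ℝ) ≤ Y := by exact_mod_cast ht'.2
      rw [e3]
      linarith [norm_sub_le (∑ m ∈ Ico M (M + t), eC (f m)) (∑ m ∈ Ico (2 * M) (2 * M + t), eC (f m))]
    have a2 : ‖∑ t ∈ Icc 1 Y, ∑ m ∈ S, eC (f (m + t))‖ ≤ ∑ m ∈ S, (‖P m‖ + Y * (7 * E)) := by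
      rw [sum_comm]
      refine (norm_sum_le _ _).trans (sum_le_sum fun m hmS => ?_)
      have e1 : ∑ t ∈ Icc 1 Y, eC (f (m + t)) = eC (c m) * P m + ∑ t ∈ Icc 1 Y, (eC (f (m + t)) - eC (c m + ∑ j, γ m j * ®t ^ (j.val + 1))) := by
        rw [hPn, sum_sub_distrib, mul_sum]
        simp only [eC_add]; ring
      rw [e1]
      refine (norm_add_le _ _).trans (add_le_add (by rw [norm_mul, norm_eC, one_mul]) ((norm_sum_le _ _).trans ((sum_le_card_nsmul _ _ (7 * E) fun t ht => ?_).trans_eq (by simp))))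
      have ht' := mem_Icc.1 ht
      refine (eC_lip _ _).trans (mul_le_mul_of_nonneg_left ?_ (by norm_num))
      rw [← sub_sub]
      exact hf m hmS t ht'.1 ht'.2
    rw [sum_add_distrib, sum_const, hSc, nsmul_eq_mul] at a2
    linarith
  have hY0 : (0 : ℝ) < Y := by linarith
  have hM0 : (0 : ℝ) < M := by linarith
  have hpow : ∑ m ∈ S, ‖P m‖ ^ (2 * s) ≤ C1 * 𝓜 * ®Y ^ (2 * s + ε) := by
    refine (VBcore S k s Y hs1 hY γ j0 hm).trans ?_
    rw [prod_Y k s hs]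
    calc _ ≤ 16 * 𝓜 * ((2 * s) ^ k * ®Y ^ s) * (C * ®Y ^ (s + ε)) := by gcongr; exact hJ s hs Y hY
      _ = C1 * 𝓜 * (®Y ^ (s : ℝ) * ®Y ^ (s + ε)) := by rw [hC1, rpow_natCast]; ring
      _ = _ := by rw [← rpow_add hY0]; congr 2; ring
  set Q := ∑ m ∈ S, ‖P m‖ with hQ
  have hQ0 : 0 ≤ Q := sum_nonneg fun _ _ => norm_nonneg _
  have hhold : Q ^ (2 * s) ≤ ®M ^ (2 * s) * (C1 * (𝓜 / M) * ®Y ^ (2 * s + ε)) := by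
    have h1 := pow_sum_div_card_le_sum_pow (s := S) (f := fun m => ‖P m‖) (fun _ _ => norm_nonneg _) (2 * s - 1)
    rw [show 2 * s - 1 + 1 = 2 * s by omega, hSc, div_le_iff₀ ℙ] at h1
    refine h1.trans ((mul_le_mul_of_nonneg_right hpow ℙ).trans_eq ?_)
    rw [show ®M ^ (2 * s) = ®M ^ (2 * s - 1) * M by rw [← pow_succ]; congr 1; omega]
    field_simp
  have hfin : Q ≤ M * (C1 ^ (1 / (2 * s : ℝ)) * (𝓜 / M) ^ (1 / (2 * s : ℝ)) * (Y * ®Y ^ (ε / (2 * s)))) := by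
    refine (pow_le_pow_iff_left₀ hQ0 ℙ (show 2 * s ≠ 0 by omega)).1 (hhold.trans_eq ?_)
    have hroot : ∀ z : ℝ, 0 ≤ z → (z ^ (1 / (2 * s : ℝ))) ^ (2 * s) = z := fun z hz => by
      rw [← rpow_natCast, ← rpow_mul hz]; push_cast
      rw [one_div, inv_mul_cancel₀ ℙ, rpow_one]
    rw [mul_pow, mul_pow, mul_pow, hroot _ hC10.le, hroot _ ℙ, mul_pow, ← rpow_natCast (®Y ^ (ε / (2 * s))), ← rpow_mul hY0.le, rpow_add hY0]
    congr 3
    · rw [← rpow_natCast]; push_cast; rfl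
    · push_cast; field_simp
  have e9 : (k : ℝ) * (k + 1) = 2 * s := by exact_mod_cast hs.symm
  rw [e9]
  refine le_of_mul_le_mul_left ?_ hY0
  refine (hmain.trans (add_le_add le_rfl hfin)).trans ?_
  have : ®Y ^ (ε / (2 * s)) ≤ ®Y ^ ε := rpow_le_rpow_of_exponent_le hY1 (div_le_self hε.le 𝕃)
  calc _ ≤ Y * (2 * Y) + Y * (7 * M * E) + M * (C1 ^ (1 / (2 * s : ℝ)) * (𝓜 / M) ^ (1 / (2 * s : ℝ)) * (Y * ®Y ^ ε)) := by gcongr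
    _ = _ := by ring

lemma binom_fin (e : ℕ) (α : ℝ) (m t : ℕ) : α * (((m + t : ℕ) : ℝ)) ^ (e + 2) - α * ®m ^ (e + 2)
    = ∑ j : Fin (e + 2), α * ((e + 2).choose (j.val + 1) * ®m ^ (e + 1 - j.val)) * ®t ^ (j.val + 1) := by
  rw [Fin.sum_univ_eq_sum_range (fun j => α * ((e + 2).choose (j + 1) * ®m ^ (e + 1 - j)) * ®t ^ (j + 1))]
  push_cast
  rw [add_comm (m : ℝ), add_pow, sum_range_succ']
  simp only [pow_zero, Nat.sub_zero, Nat.choose_zero_right, cast_one, mul_one, one_mul]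
  rw [mul_add, add_sub_cancel_right, mul_sum]
  refine sum_congr rfl fun j _ => ?_
  rw [show e + 2 - (j + 1) = e + 1 - j by omega]
  ring

set_option maxHeartbeats 1000000 in
lemma B0hi {d : ℕ} (hd : 3 ≤ d) {s : ℝ} (hs0 : 0 ≤ s) (hs : s * (d * (d + 2)) < 1) : B0 d s := by
  obtain ⟨e, rfl⟩ : ∃ e, d = e + 2 := ⟨d - 2, by omega⟩
  set D : ℝ := ((e + 2 : ℕ) : ℝ) with hD
  have hD3 : (3 : ℝ) ≤ D := by rw [hD]; exact_mod_cast hd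
  have hDD : 1 ≤ D * (D + 2) := by nlinarith
  have hs1 : s < 1 := lt_of_le_of_lt (le_mul_of_one_le_right hs0 hDD) hs
  set p : ℝ := 1 / (D * (D + 1)) with hp
  have hp0 : 0 < p := by positivity
  have hpD : p * (D * (D + 1)) = 1 := by rw [hp]; field_simp
  have hε : 0 < (1 - s * (D * (D + 2))) * p := mul_pos 𝕃 hp0
  obtain ⟨C, hC, hVB⟩ := VB (e + 2) 𝕆 hε
  set A : ℝ := 16 * D * 2 ^ (e + 2) with hA
  have hA0 : 0 < A := by positivity
  refine ⟨2 + C * A ^ p, by positivity, fun x M hM hMx α r hr hq1 hq2 => ?_⟩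
  have hM1 : (1 : ℝ) ≤ M := by exact_mod_cast hM
  have hMx' : (M : ℝ) ≤ x := by exact_mod_cast hMx
  have hx1 : (1 : ℝ) ≤ x := hM1.trans hMx'
  have hx0 : (0 : ℝ) < x := by linarith
  have hX1 : 1 ≤ ®x ^ (1 - s) := one_le_rpow hx1 𝕃
  set Y := ⌊®x ^ (1 - s)⌋₊ with hY
  have hYle : (Y : ℝ) ≤ ®x ^ (1 - s) := floor_le ℙ
  have hY1 : 1 ≤ Y := le_floor (by simpa using hX1)
  have hY1' : (1 : ℝ) ≤ Y := by exact_mod_cast hY1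
  have hYge : ®x ^ (1 - s) / 2 ≤ Y := by have := lt_floor_add_one (®x ^ (1 - s)); rw [← hY] at this; linarith
  have hq0 : (0 : ℝ) < r.den := by exact_mod_cast r.den_pos
  have key := hVB M Y hY1 hM (fun m => α * ®m ^ (e + 2)) (fun m => α * ®m ^ (e + 2))
    (fun m j => α * ((e + 2).choose (j.val + 1) * ®m ^ (e + 1 - j.val))) 0 (A * ®x ^ (D * s)) le_rfl
    (fun m _ t _ _ => by rw [← binom_fin]; simp)
    ⟨e, by omega⟩ (fun y => by
      set κ : ℝ := 1 / ®Y ^ (e + 1) with hκ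
      have hκ0 : 0 < κ := by positivity
      have h1 : (((Ico M (2 * M)).filter fun i : ℕ => nn (α * ((e + 2).choose (e + 1) * ®i ^ (e + 1 - e)) - y) ≤ κ).card : ℝ)
          ≤ ((Ico ((e + 2) * M) ((e + 2) * M + (e + 2) * M)).filter fun l : ℕ => nn (α * l - y) ≤ κ).card := by
        refine cast_le.2 (card_le_card_of_injOn (fun i => (e + 2) * i) (fun i hi => ?_) fun i _ j _ h => eq_of_mul_eq_mul_left 𝕆 h)
        obtain ⟨a, b⟩ := mem_filter.1 hi
        rw [mem_Ico] at a
        refine mem_filter.2 ⟨mem_Ico.2 ⟨Nat.mul_le_mul_left _ a.1, by rw [← mul_add, ← two_mul]; exact Nat.mul_lt_mul_of_pos_left a.2 𝕆⟩, ?_⟩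
        rw [show e + 1 - e = 1 by omega, pow_one, show (e + 2).choose (e + 1) = e + 2 from Nat.choose_succ_self_right (e + 1)] at b
        simpa using b
      refine (h1.trans (count α r hr _ _ y hκ0.le)).trans ?_
      have hκ2 : κ ≤ 2 ^ (e + 1) * ®x ^ (-((1 - s) * (D - 1))) := by
        rw [hκ, rpow_neg hx0.le, rpow_mul hx0.le, show D - 1 = ((e + 1 : ℕ) : ℝ) by rw [hD]; push_cast; ring, rpow_natCast, ← div_eq_mul_inv,
          div_le_div_iff₀ ℙ ℙ, one_mul, ← mul_pow]
        exact pow_le_pow_left₀ ℙ 𝕃 _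
      have hDs' : s ≤ D * s := le_mul_of_one_le_left hs0 𝕃
      have hDs : 1 ≤ ®x ^ (D * s) := one_le_rpow hx1 ℙ
      have t1 : (M : ℝ) / r.den ≤ ®x ^ (D * s) := by
        rw [div_le_iff₀ hq0]
        calc (M : ℝ) ≤ ®x ^ (1 : ℝ) := by simpa using hMx'
          _ ≤ ®x ^ (D * s + (1 - s)) := rpow_le_rpow_of_exponent_le hx1 𝕃
          _ ≤ _ := by rw [rpow_add hx0]; gcongr
      have t2 : κ * r.den ≤ 2 ^ (e + 1) * ®x ^ (D * s) := by
        calc κ * r.den ≤ (2 ^ (e + 1) * ®x ^ (-((1 - s) * (D - 1)))) * ®x ^ (D - 1 + s) := by gcongr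
          _ = _ := by rw [mul_assoc, ← rpow_add hx0]; congr 2; ring
      have t3 : (M : ℝ) * κ ≤ 2 ^ (e + 1) * ®x ^ (D * s) := by
        calc (M : ℝ) * κ ≤ ®x ^ (1 : ℝ) * (2 ^ (e + 1) * ®x ^ (-((1 - s) * (D - 1)))) := by rw [rpow_one]; gcongr
          _ = 2 ^ (e + 1) * ®x ^ (1 - (1 - s) * (D - 1)) := by rw [mul_left_comm, ← rpow_add hx0]; rfl
          _ ≤ _ := by gcongr 2 ^ (e + 1) * ?_; exact rpow_le_rpow_of_exponent_le hx1 (by linarith [show (1 - s) * (D - 1) = D - 1 - D * s + s by ring])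
      have e1 : (2 * (((e + 2) * M : ℕ) : ℝ) / r.den + 1) * (4 * κ * r.den + 1) = 8 * D * (M * κ) + 2 * D * (M / r.den) + 4 * (κ * r.den) + 1 := by
        rw [Nat.cast_mul]; field_simp; ring
      rw [e1, hA]
      have h2 : (1 : ℝ) ≤ 2 ^ (e + 1) := one_le_pow₀ (by norm_num)
      rw [pow_succ 2 (e + 1)]
      set Z := (2 : ℝ) ^ (e + 1) * ®x ^ (D * s)
      have hZ : ®x ^ (D * s) ≤ Z := le_mul_of_one_le_left ℙ h2
      have : 16 * D * (2 ^ (e + 1) * 2) * ®x ^ (D * s) = 32 * D * Z := by ring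
      rw [this]
      have u1 := mul_le_mul_of_nonneg_left t3 (show 0 ≤ 8 * D by positivity)
      have u2 := mul_le_mul_of_nonneg_left (t1.trans hZ) (show 0 ≤ 2 * D by positivity)
      have u3 : Z ≤ D * Z := le_mul_of_one_le_left (by linarith only [hDs, hZ]) 𝕃
      linarith only [hDs, hZ, u1, t2, u3, u2])
  have e2 : SS (e + 2) 1 α 0 M = ∑ m ∈ Ico M (2 * M), eC (α * ®m ^ (e + 2)) := by simp [SS]
  rw [e2]
  refine key.trans ?_
  rw [mul_zero, add_zero, add_mul, ← hD]
  refine add_le_add 𝕃 ?_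
  rw [← hp, div_rpow ℙ ℙ, mul_rpow hA0.le ℙ, ← rpow_mul hx0.le]
  calc C * M * (A ^ p * ®x ^ (D * s * p) / ®M ^ p) * ®Y ^ ((1 - s * (D * (D + 2))) * p)
      = C * A ^ p * (®M ^ (1 - p) * ®x ^ (D * s * p) * ®Y ^ ((1 - s * (D * (D + 2))) * p)) := by
        rw [rpow_sub 𝕃, rpow_one]; ring
    _ ≤ C * A ^ p * (®x ^ (1 - p) * ®x ^ (D * s * p) * ®x ^ ((1 - s * (D * (D + 2))) * p)) := by
        have : (Y : ℝ) ≤ x := hYle.trans (by simpa using rpow_le_rpow_of_exponent_le hx1 (show 1 - s ≤ 1 by linarith))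
        have : p ≤ 1 := by rw [hp, div_le_one ℙ]; exact one_le_mul_of_one_le_of_one_le 𝕃 𝕃
        gcongr
    _ = C * A ^ p * ®x ^ (1 - s) := by
        rw [← rpow_add hx0, ← rpow_add hx0]; congr 2
        have : (D * s - s * (D * (D + 2))) * p = -s * (p * (D * (D + 1))) := by ring
        rw [hpD] at this; linarith only [this]


lemma taylor (n : ℕ) : ∀ (g : ℕ → ℝ → ℝ) (m U : ℝ), (∀ i < n, ∀ u, m ≤ u → HasDerivAt (g i) (g (i + 1) u) u) → (∀ u, m ≤ u → |g n u| ≤ U) →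
    ∀ t, 0 ≤ t → |g 0 (m + t) - ∑ j ∈ range n, g j m * t ^ j / j.factorial| ≤ U * t ^ n := by
  induction n with
  | zero => intro g m U _ h t ht; simpa using h (m + t) 𝕃
  | succ n ih =>
    intro g m U hg h T hT
    have hU : 0 ≤ U := (abs_nonneg _).trans (h m le_rfl)
    set F : ℝ → ℝ := fun t => g 0 (m + t) - ∑ j ∈ range (n + 1), g j m * t ^ j / j.factorial with hF
    have hd : ∀ t ∈ Set.Icc 0 T, HasDerivWithinAt F (g 1 (m + t) - ∑ j ∈ range n, g (j + 1) m * t ^ j / j.factorial) (Set.Icc 0 T) t := by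
      intro t ht
      refine HasDerivAt.hasDerivWithinAt (HasDerivAt.sub ((hg 0 𝕆 (m + t) (by linarith [ht.1])).comp_const_add m t) ?_)
      have : HasDerivAt (fun t : ℝ => ∑ j ∈ range (n + 1), g j m * t ^ j / j.factorial) (∑ j ∈ range (n + 1), g j m * (j * t ^ (j - 1)) / j.factorial) t :=
        HasDerivAt.fun_sum fun j _ => ((hasDerivAt_pow j t).const_mul _).div_const _
      refine this.congr_deriv ?_
      rw [sum_range_succ']
      simp only [cast_zero, zero_mul, mul_zero, zero_div, add_zero, Nat.add_sub_cancel]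
      refine sum_congr rfl fun j _ => ?_
      rw [Nat.factorial_succ]; push_cast; field_simp
    have := (convex_Icc 0 T).norm_image_sub_le_of_norm_hasDerivWithin_le (C := U * T ^ n) hd (fun t ht => by
      rw [norm_eq_abs]
      refine (ih (fun i => g (i + 1)) m U (fun i hi => hg (i + 1) 𝕆) h t ht.1).trans ?_
      gcongr; exact ht.1; exact ht.2) (Set.left_mem_Icc.2 hT) (Set.right_mem_Icc.2 hT)
    have h0 : F 0 = 0 := by
      rw [hF]; dsimp only
      rw [sum_range_succ']; simp
    rw [h0, sub_zero, sub_zero, norm_eq_abs, norm_eq_abs, abs_of_nonneg hT] at this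
    rw [pow_succ, ← mul_assoc]; exact this

lemma class_count (Q M : ℕ) (hQ : 1 ≤ Q) (G F : ℕ → ℝ) {V ρ κ z : ℝ} (hρ : 0 < ρ) (hκ : 0 ≤ κ) (hκ1 : κ ≤ 1) (hV0 : 0 ≤ V)
    (hG : ∀ m m', m % Q = m' % Q → ∃ n : ℤ, G m - F m = G m' - F m' + n)
    (hV : ∀ i ∈ Ico M (2 * M), |F i - z| ≤ V)
    (hF : ∀ i ∈ Ico M (2 * M), ∀ j ∈ Ico M (2 * M), i < j → ρ * ((j : ℝ) - i) ≤ |F i - F j|) (y : ℝ) :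
    (((Ico M (2 * M)).filter fun i => nn (G i - y) ≤ κ).card : ℝ) ≤ (2 * V + 3) * (2 * κ / ρ + Q) := by
  have hQ0 : (0 : ℝ) < Q := by exact_mod_cast hQ
  rw [card_eq_sum_card_fiberwise (f := fun m => m % Q) (t := range Q) fun m _ => mem_coe.2 (mem_range.2 (mod_lt _ hQ))]
  push_cast
  have key : ∀ u ∈ range Q, ((((Ico M (2 * M)).filter fun i => nn (G i - y) ≤ κ).filter fun m => m % Q = u).card : ℝ) ≤ (2 * V + 3) * (2 * κ / (ρ * Q) + 1) := by
    intro u hu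
    have hF' : ∀ i ∈ (Ico M (2 * M)).filter (fun m => m % Q = u), ∀ j ∈ (Ico M (2 * M)).filter (fun m => m % Q = u), i < j → ρ * Q ≤ |F i - F j| := by
      intro i hi j hj hij
      rw [mem_filter] at hi hj
      refine le_trans (mul_le_mul_of_nonneg_left ?_ hρ.le) (hF i hi.1 j hj.1 hij)
      have : Q ≤ j - i := le_of_dvd 𝕆 ((Nat.modEq_iff_dvd' hij.le).1 (hi.2.trans hj.2.symm))
      rw [← cast_sub hij.le]; exact_mod_cast this
    have := spaced_range ((Ico M (2 * M)).filter fun m => m % Q = u) F (κ := κ) (y := y - (G u - F u)) (mul_pos hρ hQ0) hκ hκ1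
      (fun i hi => hV i (mem_filter.1 hi).1) hV0 (fun i hi j hj hij => by
        rcases lt_or_gt_of_ne hij with h | h
        · exact hF' i hi j hj h
        · rw [abs_sub_comm]; exact hF' j hj i hi h)
    refine le_trans (cast_le.2 (card_le_card fun i hi => ?_)) this
    simp only [mem_filter] at hi ⊢
    refine ⟨⟨hi.1.1, hi.2⟩, ?_⟩
    obtain ⟨n, hn⟩ := hG i u (by rw [hi.2, mod_eq_of_lt (mem_range.1 hu)])
    rw [← nn_add_int _ n, show F i - (y - (G u - F u)) + n = G i - y by linarith]
    exact hi.1.2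
  refine (sum_le_sum key).trans_eq ?_
  rw [sum_const, card_range, nsmul_eq_mul]
  field_simp

lemma dich (α : ℝ) (M : ℕ) (hM : 1 ≤ M) {κ T : ℝ} (hκ : 8 * M * κ < 1) (hT : 1 < T) {y : ℝ}
    (h : T < ((Ico M (2 * M)).filter fun i : ℕ => nn (α * i - y) ≤ κ).card) :
    ∃ r : ℚ, (r.den : ℝ) * (T - 1) ≤ M ∧ |α - r| * (T - 1) ≤ 2 * κ := by
  have hM1 : (1 : ℝ) ≤ M := by exact_mod_cast hM
  obtain ⟨r, hr, hq⟩ := Real.exists_rat_abs_sub_le_and_den_le α (n := 2 * M) 𝕆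
  push_cast at hr
  have hq0 : (0 : ℝ) < r.den := by exact_mod_cast r.den_pos
  have hq1 : (1 : ℝ) ≤ r.den := by exact_mod_cast r.den_pos
  have hq2 : (r.den : ℝ) ≤ 2 * M := by exact_mod_cast hq
  set S := (Ico M (2 * M)).filter fun i : ℕ => nn (α * i - y) ≤ κ with hS
  have hne : S.Nonempty := Finset.card_pos.1 (by exact_mod_cast (by linarith : (0 : ℝ) < S.card))
  set m0 := S.min' hne
  set m1 := S.max' hne
  have hβ : |α - r| * ((2 * M + 1) * r.den) ≤ 1 := by rwa [le_div_iff₀ ℙ] at hr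
  have hl : ∀ m ∈ S, m0 ≤ m ∧ m - m0 < M ∧ r.den ∣ m - m0 ∧ |α - r| * ((m - m0 : ℕ) : ℝ) ≤ 2 * κ := by
    intro m hm
    have h0 : m0 ≤ m := S.min'_le m hm
    have a1 := mem_filter.1 hm
    have a0 := mem_filter.1 (S.min'_mem hne)
    rw [mem_Ico] at a1 a0
    have hlM : m - m0 < M := by have := a0.1.1; omega
    set l := m - m0 with hldef
    have hlM' : (l : ℝ) ≤ M := by exact_mod_cast hlM.le
    have hb : nn (α * l) ≤ 2 * κ := by
      have := nn_sub_le (α * m) (α * m0) y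
      rw [← mul_sub, ← cast_sub h0] at this
      exact this.trans (by linarith [a1.2, a0.2])
    have hβl : |α - r| * l * (2 * r.den) ≤ 1 := by
      refine le_trans ?_ hβ
      have : (l : ℝ) * (2 * r.den) ≤ (2 * M + 1) * r.den := by nlinarith
      rw [mul_assoc]; gcongr
    have hdv : r.den ∣ l := by
      by_contra hnd
      have h1 := rat_far r l (round (α * l)) (by exact_mod_cast hnd)
      have h2 : |(r : ℝ) * (l : ℤ) - round (α * l)| ≤ nn (α * l) + |α - r| * l := by
        rw [nn, ← abs_of_nonneg (cast_nonneg l : (0:ℝ) ≤ l), ← abs_mul, abs_of_nonneg (cast_nonneg l : (0:ℝ) ≤ l)]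
        refine le_trans (le_of_eq ?_) (abs_sub _ _)
        push_cast; congr 1; ring
      have h3 : 1 / (r.den : ℝ) ≤ 2 * κ + |α - r| * l := h1.trans (h2.trans 𝕃)
      rw [div_le_iff₀ hq0] at h3
      have : 0 ≤ κ := by linarith [nn_nonneg (α * l)]
      nlinarith
    refine ⟨h0, hlM, hdv, ?_⟩
    obtain ⟨l', hl'⟩ := hdv
    have e1 : α * l = (α - r) * l + ((r.num * l' : ℤ) : ℝ) := by
      have : (r : ℝ) * r.den = r.num := by exact_mod_cast Rat.mul_den_eq_num r
      rw [hl']; push_cast; rw [← this]; ring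
    have hx : |(α - r) * l| ≤ 1 / 2 := by
      rw [abs_mul, abs_of_nonneg (cast_nonneg l : (0:ℝ) ≤ l)]
      have : 0 ≤ |α - r| * l := by positivity
      nlinarith
    rw [e1, nn_add_int, nn_of_le hx, abs_mul, abs_of_nonneg (cast_nonneg l : (0:ℝ) ≤ l)] at hb
    exact hb
  obtain ⟨h0, h1, ⟨l', hl'⟩, h3⟩ := hl m1 (S.max'_mem hne)
  have hcard : S.card ≤ l' + 1 := by
    rw [← card_range (l' + 1)]
    refine card_le_card_of_injOn (fun m => (m - m0) / r.den) (fun m hm => ?_) fun m hm m' hm' e => ?_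
    · have : m ≤ m1 := S.le_max' m hm
      rw [Finset.coe_range, Set.mem_Iio, lt_succ_iff, Nat.div_le_iff_le_mul_add_pred r.den_pos]
      have := (hl m hm).1
      omega
    · obtain ⟨a1, -, ⟨a, ha⟩, -⟩ := hl m hm
      obtain ⟨b1, -, ⟨b, hb⟩, -⟩ := hl m' hm'
      simp only [ha, hb, Nat.mul_div_cancel_left _ r.den_pos] at e
      subst e; omega
  have hTl : T - 1 ≤ l' := by
    have : (S.card : ℝ) ≤ l' + 1 := by exact_mod_cast hcard
    linarith
  have h1' : (r.den : ℝ) * l' ≤ M := by exact_mod_cast (by omega : r.den * l' ≤ M)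
  have hll : (l' : ℝ) ≤ ((m1 - m0 : ℕ) : ℝ) := by
    rw [hl']; push_cast; exact le_mul_of_one_le_left (cast_nonneg _) hq1
  exact ⟨r, (mul_le_mul_of_nonneg_left hTl hq0.le).trans h1', (mul_le_mul_of_nonneg_left (hTl.trans hll) (abs_nonneg _)).trans h3⟩


lemma hi_H {d : ℕ} (hd : 4 ≤ d) {c : ℝ} (hc2 : c < 1 + c2ps d) :
    ∃ H : ℝ, 0 < H ∧ H * (d * (d + 1)) ≤ 0.2022 ∧ θdc d c = (1 + c) / 2 * (1 - H) ∧ c - 1 ≤ H / 32 := by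
  have hd4 : (4 : ℝ) ≤ d := by exact_mod_cast hd
  have hS : (16 : ℝ) ≤ Sd d := by
    have : 8 ≤ d ^ 2 / 2 := by rw [Nat.le_div_iff_mul_le (by norm_num)]; nlinarith
    exact_mod_cast (by rw [Sd]; omega : 16 ≤ Sd d)
  have fin : ∀ H : ℝ, 0 < H → H * (d * (d + 1)) ≤ 0.2022 → c < 1 + 2 * H / (4 * (Sd d : ℝ) + 1 - H) → c - 1 ≤ H / 32 := by
    intro H h0 h1 h
    have : H ≤ 1 := (le_mul_of_one_le_right h0.le (by nlinarith)).trans (h1.trans (by norm_num))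
    have : 2 * H / (4 * (Sd d : ℝ) + 1 - H) ≤ 2 * H / 64 := by gcongr; linarith
    linarith
  have q : ∀ D : ℝ, 0 < D → (d * (d + 1) : ℝ) * 2 ≤ 0.2022 * D → 0 < 2 / D ∧ 2 / D * (d * (d + 1)) ≤ 0.2022 := fun D h h' =>
    ⟨by positivity, by rw [div_mul_eq_mul_div, div_le_iff₀ h]; linarith⟩
  rw [c2ps, if_neg 𝕆, if_neg 𝕆] at hc2
  simp only [θdc]
  rw [if_neg 𝕆, if_neg 𝕆]
  split_ifs at hc2 ⊢
  · have h1 : 0 < (d : ℝ) * ((d : ℝ) + 1) ^ 2 - 1 := by nlinarith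
    have e1 : hD d = 2 / (2 * ((d : ℝ) * ((d : ℝ) + 1) ^ 2 - 1)) := by rw [hD]; field_simp
    obtain ⟨a, b⟩ := q (2 * ((d : ℝ) * ((d : ℝ) + 1) ^ 2 - 1)) 𝕃 (by nlinarith)
    rw [← e1] at a b
    exact ⟨hD d, a, b, rfl, fin _ a b hc2⟩
  · obtain ⟨a, b⟩ := q (27 * ®d ^ 2 - 14) (by nlinarith) (by nlinarith)
    exact ⟨kD d, a, b, rfl, fin _ a b hc2⟩
  · obtain ⟨a, b⟩ := q (27 * ®d ^ 2 - 5) (by nlinarith) (by nlinarith)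
    exact ⟨lD d, a, b, rfl, fin _ a b hc2⟩

lemma abs_le_add {u v : ℝ} (h : 0 ≤ u * v) : |v| ≤ |u + v| := by
  rw [← sq_le_sq]; nlinarith [sq_nonneg u]

set_option maxHeartbeats 1000000 in
lemma cnt_i {e i : ℕ} (hi : i = 1 ∨ i = 2) (he : 2 ≤ e) {g : ℝ} (hg0 : 0 < g) (hg1 : g < 1) (hg : 1 - g ≤ 0.001) :
    ∃ A > 0, ∀ (M Y : ℕ) (α : ℝ) (h : ℤ) (r : ℚ) , 1 ≤ M → h ≠ 0 → |(h : ℝ)| ≤ ®M ^ (1 - g) → (r.den : ℝ) ≤ ®M ^ (0.22 : ℝ) →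
      |(e + 2) * α - r| ≤ 2 ^ (e + 2) * ®M ^ (0.256 - (e + 1) : ℝ) → 0 ≤ ((e + 2) * α - r) * (h * cf g (i + 1)) →
      1 ≤ Y → ®M ^ (1 - 0.3454 : ℝ) / 2 ≤ Y → ∀ y,
      (((Ico M (2 * M)).filter fun m : ℕ => nn (α * ((e + 2).choose i * ®m ^ (e + 2 - i)) + h * (rp g i m / i.factorial) - y) ≤ 1 / ®Y ^ i).card : ℝ)
        ≤ A * ®M ^ (0.78 : ℝ) := by
  set B : ℝ := (e + 2).choose i / (e + 2) with hB
  have hB0 : 0 ≤ B := by positivity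
  obtain ⟨b, hb⟩ : ∃ b : ℕ, 2 * B = b := by
    rcases hi with rfl | rfl
    · refine ⟨2, ?_⟩; rw [hB, Nat.choose_one_right]; push_cast; field_simp
    · refine ⟨e + 1, ?_⟩; rw [hB, Nat.cast_choose_two]; push_cast; field_simp; ring
  have hdB : (e + 2) * B = (e + 2).choose i := by rw [hB]; field_simp
  set c0 := |cf g (i + 1)| / 16 with hc0
  have hcf := cf_ne hg0 hg1 (i + 1)
  have hc00 : 0 < c0 := by positivity
  set C1 := (2 : ℝ) ^ (e + 2) * (B * 2 ^ (e + 2)) + 1 with hC1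
  have hC10 : 1 ≤ C1 := by rw [hC1]; linarith [show 0 ≤ (2 : ℝ) ^ (e + 2) * (B * 2 ^ (e + 2)) by positivity]
  have hfac : (i.factorial : ℝ) ≤ 2 ∧ (1 : ℝ) ≤ i.factorial := by rcases hi with rfl | rfl <;> norm_num [Nat.factorial]
  have hcfi : |cf g i| ≤ 1 := by
    rcases hi with rfl | rfl <;> simp only [cf, prod_range_succ, Finset.prod_range_zero, abs_le] <;> push_cast <;> constructor <;> nlinarith
  refine ⟨5 * C1 * (8 / c0 + 2), by positivity, fun M Y α h r hM hh hhM hq hβ hs hY1 hY y => ?_⟩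
  have hM1 : (1 : ℝ) ≤ M := by exact_mod_cast hM
  have hM0 : (0 : ℝ) < M := by linarith
  have hY0 : (0 : ℝ) < Y := by exact_mod_cast hY1
  have hh1 : (1 : ℝ) ≤ |(h : ℝ)| := by rw [← Int.cast_abs]; exact_mod_cast one_le_abs hh
  set β := (e + 2) * α - r with hβd
  set v : ℝ := 0.256 * (2 - i) with hv
  have hv0 : 0 ≤ v := by rcases hi with rfl | rfl <;> rw [hv] <;> norm_num
  have hMv : 1 ≤ ®M ^ v := one_le_rpow hM1 hv0
  set ρ := |(h : ℝ)| * |cf g (i + 1)| / 2 * (2 * M : ℝ) ^ (g - (i + 1)) with hρ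
  have hmv : ∀ m m' : ℕ, M ≤ m → m < m' → ∃ ξ : ℝ, (m : ℝ) < ξ ∧ ξ < m' ∧ rp g i m' - rp g i m = rp g (i + 1) ξ * ((m' : ℝ) - m) := by
    intro m m' h1 h2
    have h1' : (M : ℝ) ≤ m := by exact_mod_cast h1
    have h2' : (m : ℝ) < m' := by exact_mod_cast h2
    obtain ⟨ξ, hξ, eq⟩ := exists_hasDerivAt_eq_slope (rp g i) (rp g (i + 1)) h2' (fun u hu => (rp_deriv g i (by linarith only [hM1, hg1, hu, hg, h1', hu.1])).continuousAt.continuousWithinAt)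
      (fun u hu => rp_deriv g i (by linarith only [hM1, hg1, hu, hg, h1', hu.1]))
    refine ⟨ξ, hξ.1, hξ.2, ?_⟩
    rw [eq]; field_simp [sub_ne_zero.2 h2'.ne']
  have key := class_count (2 * r.den) M (by have := r.den_pos; omega) (fun m => α * ((e + 2).choose i * ®m ^ (e + 2 - i)) + h * (rp g i m / i.factorial))
    (fun m => β * (B * ®m ^ (e + 2 - i)) + h * (rp g i m / i.factorial)) (V := C1 * ®M ^ v) (ρ := ρ) (κ := 1 / ®Y ^ i) (z := 0)
    ℙ ℙ (by rw [div_le_one ℙ]; exact one_le_pow₀ (by exact_mod_cast hY1)) ℙ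
    (fun m m' hmm => by
      have h1 : ((2 * r.den : ℕ) : ℤ) ∣ (m : ℤ) ^ (e + 2 - i) - (m' : ℤ) ^ (e + 2 - i) := by
        refine dvd_trans ?_ (sub_dvd_pow_sub_pow _ _ _)
        exact Nat.modEq_iff_dvd.1 (show m' ≡ m [MOD 2 * r.den] from hmm.symm)
      obtain ⟨w, hw⟩ := h1
      have hw' : ®m ^ (e + 2 - i) = ®m' ^ (e + 2 - i) + 2 * r.den * w := by
        have := congrArg (fun z : ℤ => (z : ℝ)) hw
        push_cast at this; linarith only [this]
      refine ⟨r.num * b * w, ?_⟩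
      have hrd : (r : ℝ) * r.den = r.num := by exact_mod_cast Rat.mul_den_eq_num r
      push_cast
      rw [hw', ← hdB, ← hrd, ← hb, hβd]; ring)
    (fun m hm => by
      rw [mem_Ico] at hm
      have m1 : (M : ℝ) ≤ m := by exact_mod_cast hm.1
      have m2 : (m : ℝ) ≤ 2 * M := by exact_mod_cast hm.2.le
      rw [sub_zero]
      refine (abs_add_le _ _).trans ?_
      rw [hC1, add_mul, abs_mul β, abs_of_nonneg (show 0 ≤ B * ®m ^ (e + 2 - i) by positivity), abs_mul (h : ℝ), abs_div, Nat.abs_cast]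
      refine add_le_add ?_ ?_
      · calc |β| * (B * ®m ^ (e + 2 - i)) ≤ 2 ^ (e + 2) * ®M ^ (0.256 - (e + 1) : ℝ) * (B * (2 * M : ℝ) ^ (e + 2 - i)) := by gcongr
          _ ≤ 2 ^ (e + 2) * ®M ^ (0.256 - (e + 1) : ℝ) * (B * (2 ^ (e + 2) * ®M ^ ((e + 2 - i : ℕ) : ℝ))) := by
            rw [mul_pow, rpow_natCast]; gcongr
            · norm_num
            · omega
          _ = 2 ^ (e + 2) * (B * 2 ^ (e + 2)) * (®M ^ (0.256 - (e + 1) : ℝ) * ®M ^ ((e + 2 - i : ℕ) : ℝ)) := by ring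
          _ ≤ _ := by
            rw [← rpow_add hM0]; gcongr
            rw [cast_sub 𝕆]; push_cast; rcases hi with rfl | rfl <;> rw [hv] <;> norm_num <;> linarith
      · rw [one_mul]
        refine le_trans ?_ hMv
        have : |rp g i m| ≤ ®M ^ (g - i) := by
          rw [rp, abs_mul, abs_of_nonneg (by positivity : 0 ≤ ®m ^ (g - i))]
          refine (mul_le_of_le_one_left ℙ hcfi).trans (rpow_le_rpow_of_nonpos hM0 m1 ?_)
          rcases hi with rfl | rfl <;> push_cast <;> linarith
        calc |(h : ℝ)| * (|rp g i m| / i.factorial) ≤ ®M ^ (1 - g) * ®M ^ (g - i) := by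
              gcongr; exact (div_le_self (abs_nonneg _) hfac.2).trans this
          _ ≤ 1 := by
              rw [← rpow_add hM0]; refine rpow_le_one_of_one_le_of_nonpos hM1 ?_
              rcases hi with rfl | rfl <;> push_cast <;> linarith)
    (fun m hm m' hm' hlt => by
      rw [mem_Ico] at hm hm'
      obtain ⟨ξ, x1, x2, eq⟩ := hmv m m' hm.1 hlt
      have m1 : (M : ℝ) ≤ m := by exact_mod_cast hm.1
      have m2 : (m' : ℝ) ≤ 2 * M := by exact_mod_cast hm'.2.le
      have hmm : 0 < (m' : ℝ) - m := by linarith only [x1, x2]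
      have hξ0 : 0 < ξ := by linarith only [hM1, m1, hg1, hg, x1]
      have hp : 0 ≤ ®m' ^ (e + 2 - i) - ®m ^ (e + 2 - i) := sub_nonneg.2 (pow_le_pow_left₀ ℙ (by linarith only [x1, x2]) _)
      set P := ®m' ^ (e + 2 - i) - ®m ^ (e + 2 - i)
      rw [abs_sub_comm, show β * (B * ®m' ^ (e + 2 - i)) + h * (rp g i m' / i.factorial) - (β * (B * ®m ^ (e + 2 - i)) + h * (rp g i m / i.factorial))
        = β * (B * P) + h * ((rp g i m' - rp g i m) / i.factorial) by simp only [P]; ring, eq]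
      have hsq : |h * (rp g (i + 1) ξ * ((m' : ℝ) - m) / i.factorial)| ≤ |β * (B * P) + h * (rp g (i + 1) ξ * ((m' : ℝ) - m) / i.factorial)| := by
        refine abs_le_add ?_
        rw [rp, show β * (B * P) * (h * (cf g (i + 1) * ξ ^ (g - (i + 1 : ℕ)) * ((m' : ℝ) - m) / i.factorial))
          = (β * (h * cf g (i + 1))) * (B * P * (ξ ^ (g - (i + 1 : ℕ)) * ((m' : ℝ) - m) / i.factorial)) by ring]
        positivity
      refine le_trans ?_ hsq
      rw [abs_mul, abs_div, abs_mul, rp, abs_mul, abs_of_pos hmm, Nat.abs_cast, abs_of_pos (by positivity : 0 < ξ ^ (g - ((i + 1 : ℕ) : ℝ))), hρ]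
      rw [show |(h : ℝ)| * |cf g (i + 1)| / 2 * (2 * M : ℝ) ^ (g - (i + 1)) * ((m' : ℝ) - m) = |(h : ℝ)| * (|cf g (i + 1)| * (2 * M : ℝ) ^ (g - (i + 1)) * ((m' : ℝ) - m) / 2) by ring]
      gcongr
      · push_cast
        refine rpow_le_rpow_of_nonpos hξ0 (by linarith only [m2, x2]) ?_
        linarith only [hg1, (cast_nonneg i : (0 : ℝ) ≤ i)]
      · exact hfac.1) y
  refine key.trans ?_
  have hρ2 : c0 * ®M ^ (g - (i + 1)) ≤ ρ := by
    rw [hρ, mul_rpow (by norm_num) hM0.le, hc0]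
    have : (1 / 8 : ℝ) ≤ 2 ^ (g - (i + 1)) := by
      calc (1 / 8 : ℝ) = 2 ^ (-3 : ℝ) := by rw [rpow_neg (by norm_num)]; norm_num
        _ ≤ _ := rpow_le_rpow_of_exponent_le (by norm_num) (by rcases hi with rfl | rfl <;> push_cast <;> linarith only [hg1, hg])
    calc |cf g (i + 1)| / 16 * ®M ^ (g - (i + 1)) = 1 * |cf g (i + 1)| / 2 * ((1 / 8) * ®M ^ (g - (i + 1))) := by ring
      _ ≤ _ := by gcongr
  have hκ2 : 2 * (1 / ®Y ^ i) / ρ ≤ 8 / c0 * ®M ^ (0.001 + 0.3454 * i : ℝ) := by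
    have h1 : 1 / ®Y ^ i ≤ 4 * ®M ^ (-((1 - 0.3454) * i) : ℝ) := by
      have : (®M ^ (1 - 0.3454 : ℝ) / 2) ^ i ≤ ®Y ^ i := pow_le_pow_left₀ ℙ hY i
      rw [div_pow, ← rpow_natCast, ← rpow_mul hM0.le] at this
      have h2 : (2 : ℝ) ^ i ≤ 4 := by rcases hi with rfl | rfl <;> norm_num
      rw [rpow_neg hM0.le, ← div_eq_mul_inv, div_le_div_iff₀ ℙ ℙ, one_mul]
      rw [div_le_iff₀ ℙ] at this
      exact this.trans ((mul_le_mul_of_nonneg_left h2 ℙ).trans_eq (mul_comm _ _))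
    calc 2 * (1 / ®Y ^ i) / ρ ≤ 2 * (4 * ®M ^ (-((1 - 0.3454) * i) : ℝ)) / (c0 * ®M ^ (g - (i + 1))) := by gcongr
      _ = 8 / c0 * (®M ^ (-((1 - 0.3454) * i) : ℝ) * ®M ^ (-(g - (i + 1)))) := by rw [rpow_neg hM0.le (g - (i + 1))]; field_simp; norm_num
      _ ≤ _ := by
        rw [← rpow_add hM0]; exact mul_le_mul_of_nonneg_left (rpow_le_rpow_of_exponent_le hM1 (by linarith only [hg])) ℙ
  have hf : ∀ E : ℝ, v + E ≤ 0.78 → ®M ^ v * ®M ^ E ≤ ®M ^ (0.78 : ℝ) := fun E hE => by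
    rw [← rpow_add hM0]; exact rpow_le_rpow_of_exponent_le hM1 hE
  have f1 := hf (0.001 + 0.3454 * i) (by rcases hi with rfl | rfl <;> rw [hv] <;> norm_num)
  have f2 := hf 0.22 (by rcases hi with rfl | rfl <;> rw [hv] <;> norm_num)
  calc (2 * (C1 * ®M ^ v) + 3) * (2 * (1 / ®Y ^ i) / ρ + (2 * r.den : ℕ))
      ≤ (5 * (C1 * ®M ^ v)) * (8 / c0 * ®M ^ (0.001 + 0.3454 * i : ℝ) + 2 * ®M ^ (0.22 : ℝ)) := by
        push_cast
        gcongr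
        linarith only [hMv, hC10, one_le_mul_of_one_le_of_one_le hC10 hMv]
    _ = 5 * C1 * (8 / c0 * (®M ^ v * ®M ^ (0.001 + 0.3454 * i : ℝ)) + 2 * (®M ^ v * ®M ^ (0.22 : ℝ))) := by ring
    _ ≤ 5 * C1 * (8 / c0 * ®M ^ (0.78 : ℝ) + 2 * ®M ^ (0.78 : ℝ)) := by gcongr
    _ = _ := by ring


/-- the target bound for the twisted sums -/
def B1 (d : ℕ) (c : ℝ) : Prop := ∃ C > 0, ∀ M : ℕ, 1 ≤ M → ∀ α : ℝ, ∀ h : ℤ, h ≠ 0 → |(h : ℝ)| ≤ ®M ^ (1 - 1 / c) →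
      ‖SS d (1 / c) α h M‖ ≤ C * ®M ^ (θdc d c / c)

set_option maxHeartbeats 1000000 in
lemma B1hi {d : ℕ} (hd : 4 ≤ d) {c : ℝ} (hc1 : 1 < c) (hc2 : c < 1 + c2ps d) : B1 d c := by
  have hg0 : 0 < 1 / c := by positivity
  have hg1 : 1 / c < 1 := by rw [div_lt_one 𝕃]; exact hc1
  have hcg : c * (1 / c) = 1 := by field_simp
  obtain ⟨H, hH0, hH, hθ, hcH⟩ := hi_H hd hc2
  obtain ⟨e, rfl⟩ : ∃ e, d = e + 2 := ⟨d - 2, by omega⟩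
  have he : 2 ≤ e := by omega
  have heR : (2 : ℝ) ≤ e := by exact_mod_cast he
  set D : ℝ := ((e + 2 : ℕ) : ℝ) with hD
  have hDe : D = e + 2 := by rw [hD]; push_cast; ring
  have hD4 : 20 ≤ D * (D + 1) := by rw [hDe]; nlinarith
  have hH1 : H ≤ 0.011 := by nlinarith
  set g := 1 / c with hgdef
  have h1g : 1 - g ≤ c - 1 := by nlinarith
  set p : ℝ := 1 / (D * (D + 1)) with hp
  have hp0 : 0 < p := by positivity
  have hpD : p * (D * (D + 1)) = 1 := one_div_mul_cancel (ne_of_gt 𝕃)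
  have hp20 : p ≤ 1 / 20 := by rw [hp]; exact one_div_le_one_div_of_le (by norm_num) hD4
  have hHp : H ≤ 0.2022 * p := by
    calc H = p * (H * (D * (D + 1))) := by rw [mul_left_comm, hpD, mul_one]
      _ ≤ p * 0.2022 := by gcongr
      _ = _ := mul_comm _ _
  have hθg : 1 - 0.21 * p ≤ θdc (e + 2) c / c := by
    have : θdc (e + 2) c / c = (1 + g) / 2 * (1 - H) := by rw [hθ, hgdef]; field_simp; ring
    rw [this]; linarith only [hc1, hg1, hcH, hH0, h1g, hHp, mul_nonneg (sub_nonneg.2 hg1.le) hH0.le]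
  obtain ⟨C, hC, hVB⟩ := VB (e + 2) 𝕆 (show 0 < 0.01 * p by positivity)
  obtain ⟨A1, hA1, hc1'⟩ := cnt_i (i := 1) (Or.inl rfl) he hg0 hg1 (by linarith only [hp20, hc1, hcH, h1g, hHp])
  obtain ⟨A2, hA2, hc2'⟩ := cnt_i (i := 2) (Or.inr rfl) he hg0 hg1 (by linarith only [hp20, hc1, hcH, h1g, hHp])
  set A := A1 + A2 + 2 with hA
  set a : ℝ := 1.036 / (e + 1) with ha
  have ha0 : 0 < a := by positivity
  have hae : a * (e + 1) = 1.036 := by rw [ha]; field_simp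
  have ha1 : a ≤ 0.3454 := by rw [ha, div_le_iff₀ ℙ]; linarith only [hp20, hc1, hcH, heR, hHp]
  set U : ℝ := |cf g (e + 1)| with hU
  refine ⟨2 ^ (e + 4) + (2 + 7 * U + C * A ^ p), by positivity, fun M hM α h hh hhM => ?_⟩
  have hM1 : (1 : ℝ) ≤ M := by exact_mod_cast hM
  have hM0 : (0 : ℝ) < M := by linarith only [hp20, hc1, hcH, hM1, hHp]
  have hup : ∀ E : ℝ, E ≤ 1 - 0.21 * p → ®M ^ E ≤ ®M ^ (θdc (e + 2) c / c) := fun E hE =>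
    rpow_le_rpow_of_exponent_le hM1 (hE.trans hθg)
  set Z := ®M ^ (θdc (e + 2) c / c) with hZ
  have hZ0 : 0 < Z := by positivity
  have hX1 : 1 ≤ ®M ^ (1 - a) := one_le_rpow hM1 (by linarith only [hp20, hc1, hcH, ha1, hHp])
  set Y := ⌊®M ^ (1 - a)⌋₊ with hY
  have hYle : (Y : ℝ) ≤ ®M ^ (1 - a) := floor_le ℙ
  have hY1 : 1 ≤ Y := le_floor (by simpa using hX1)
  have hY1' : (1 : ℝ) ≤ Y := by exact_mod_cast hY1
  have hYge : ®M ^ (1 - a) / 2 ≤ Y := by have := lt_floor_add_one (®M ^ (1 - a)); rw [← hY] at this; linarith only [this, hY1']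
  set κ : ℝ := 1 / ®Y ^ (e + 1) with hκ
  have hκ0 : 0 < κ := by positivity
  have hpow : (®M ^ (1 - a)) ^ (e + 1) = ®M ^ ((e : ℝ) + 1 - 1.036) := by
    rw [← rpow_natCast, ← rpow_mul hM0.le]; congr 1; push_cast; linarith only [hae, show (1 - a) * (e + 1) = e + 1 - a * (e + 1) by ring]
  have hκ2 : κ ≤ 2 ^ (e + 1) * ®M ^ (-((e : ℝ) + 1 - 1.036)) := by
    rw [hκ, rpow_neg hM0.le, ← hpow, ← div_eq_mul_inv, div_le_div_iff₀ ℙ ℙ, one_mul, ← mul_pow]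
    exact pow_le_pow_left₀ ℙ (by linarith only [hYge]) _
  by_cases hsm : 8 * M * κ < 1
  swap
  · refine (SS_triv _ _ _ _ _).trans ?_
    rw [add_mul]
    refine le_trans ?_ (le_add_of_nonneg_right ℙ)
    calc (M : ℝ) ≤ M * (8 * M * κ) := le_mul_of_one_le_right hM0.le (by linarith only [hsm])
      _ ≤ M * (8 * M * (2 ^ (e + 1) * ®M ^ (-((e : ℝ) + 1 - 1.036)))) := by gcongr
      _ = 2 ^ (e + 4) * (®M ^ (2 : ℝ) * ®M ^ (-((e : ℝ) + 1 - 1.036))) := by rw [rpow_two]; ring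
      _ ≤ _ := by
        rw [← rpow_add hM0]; gcongr; exact hup _ (by linarith only [hp20, hc1, hcH, heR, hHp])
  set γ : ℕ → Fin (e + 2) → ℝ := fun m j => α * ((e + 2).choose (j.val + 1) * ®m ^ (e + 1 - j.val)) +
    if j.val < e then h * (rp g (j.val + 1) m / (j.val + 1).factorial) else 0 with hγ
  have hE : ∀ m ∈ Ico M (2 * M), ∀ t : ℕ, 1 ≤ t → t ≤ Y →
      |(α * ((m + t : ℕ) : ℝ) ^ (e + 2) + h * ((m + t : ℕ) : ℝ) ^ g) - (α * ®m ^ (e + 2) + h * ®m ^ g) - ∑ j, γ m j * ®t ^ (j.val + 1)| ≤ U * ®M ^ (-0.036 : ℝ) := by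
    intro m hm t ht htY
    rw [mem_Ico] at hm
    have m1 : (M : ℝ) ≤ m := by exact_mod_cast hm.1
    have hT := taylor (e + 1) (rp g) m (U * ®M ^ (g - (e + 1))) (fun i _ u hu => rp_deriv g i (by linarith only [hp20, hc1, m1, hcH, hu, hM1, hHp])) (fun u hu => by
      rw [rp, abs_mul, abs_of_pos (show 0 < u ^ (g - ((e + 1 : ℕ) : ℝ)) from rpow_pos_of_pos (by linarith only [hp20, hc1, m1, hcH, hM1, hu, hHp]) _)]
      push_cast
      exact mul_le_mul_of_nonneg_left (rpow_le_rpow_of_nonpos hM0 (by linarith only [m1, hu]) (by linarith only [hp20, hc1, hg1, hcH, heR, hHp])) (abs_nonneg _)) t (cast_nonneg t)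
    have e1 : ∑ j, γ m j * ®t ^ (j.val + 1) = (α * ((m + t : ℕ) : ℝ) ^ (e + 2) - α * ®m ^ (e + 2)) +
        h * (∑ j ∈ range (e + 1), rp g j m * ®t ^ j / j.factorial - rp g 0 m) := by
      rw [binom_fin, sum_range_succ']
      simp only [pow_zero, Nat.factorial_zero, cast_one, div_one, mul_one, add_sub_cancel_right]
      simp only [hγ, add_mul, sum_add_distrib]
      congr 1
      rw [Fin.sum_univ_eq_sum_range (fun j => (if j < e then h * (rp g (j + 1) m / (j + 1).factorial) else 0) * ®t ^ (j + 1)) (e + 2),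
        sum_range_succ, sum_range_succ, if_neg 𝕆, if_neg 𝕆, zero_mul, zero_mul, add_zero, add_zero, mul_sum]
      refine sum_congr rfl fun j hj => ?_
      rw [if_pos (mem_range.1 hj)]; ring
    have e0 : ∀ u : ℝ, rp g 0 u = u ^ g := fun u => by simp [rp, cf]
    rw [e1, e0]
    rw [e0] at hT
    have : ∀ S : ℝ, (α * ((m + t : ℕ) : ℝ) ^ (e + 2) + h * ((m + t : ℕ) : ℝ) ^ g) - (α * ®m ^ (e + 2) + h * ®m ^ g) -
      ((α * ((m + t : ℕ) : ℝ) ^ (e + 2) - α * ®m ^ (e + 2)) + h * (S - ®m ^ g)) = h * ((m + t : ℝ) ^ g - S) := fun S => by push_cast; ring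
    rw [this, abs_mul]
    have htY' : (t : ℝ) ≤ ®M ^ (1 - a) := (cast_le.2 htY).trans hYle
    calc _ ≤ ®M ^ (1 - g) * (U * ®M ^ (g - (e + 1)) * (®M ^ (1 - a)) ^ (e + 1)) :=
          mul_le_mul hhM (hT.trans (by gcongr)) (abs_nonneg _) ℙ
      _ = U * (®M ^ (1 - g) * ®M ^ (g - (e + 1)) * ®M ^ ((e : ℝ) + 1 - 1.036)) := by rw [hpow]; ring
      _ = _ := by rw [← rpow_add hM0, ← rpow_add hM0]; congr 2; ring_nf
  have hcount : ∃ j0 : Fin (e + 2), ∀ y : ℝ, (((Ico M (2 * M)).filter fun i => nn (γ i j0 - y) ≤ 1 / ®Y ^ (j0.val + 1)).card : ℝ) ≤ A * ®M ^ (0.78 : ℝ) := by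
    have hM78 : 1 ≤ ®M ^ (0.78 : ℝ) := one_le_rpow hM1 (by norm_num)
    by_cases hcase : ∀ y : ℝ, (((Ico M (2 * M)).filter fun i : ℕ => nn (((e : ℝ) + 2) * α * i - y) ≤ κ).card : ℝ) ≤ 2 * ®M ^ (0.78 : ℝ)
    · refine ⟨⟨e, by omega⟩, fun y => le_trans (le_of_eq ?_) ((hcase y).trans (by gcongr; linarith only [hA1, hA2]))⟩
      congr 2
      refine Finset.filter_congr fun i _ => ?_
      simp only [hγ]
      rw [if_neg 𝕆, add_zero, show e + 1 - e = 1 by omega, pow_one, show (e + 2).choose (e + 1) = e + 2 from Nat.choose_succ_self_right (e + 1)]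
      push_cast
      rw [show α * ((e + 2) * (i : ℝ)) = (e + 2) * α * i by ring]
    push Not at hcase
    obtain ⟨y0, hy0⟩ := hcase
    obtain ⟨r, r1, r2⟩ := dich ((e + 2) * α) M hM hsm (by linarith only [hp20, hc1, hcH, hM78, hHp]) hy0
    have hT : ®M ^ (0.78 : ℝ) ≤ 2 * ®M ^ (0.78 : ℝ) - 1 := by linarith only [hM78]
    have r1' : (r.den : ℝ) ≤ ®M ^ (0.22 : ℝ) := by
      have : (r.den : ℝ) * ®M ^ (0.78 : ℝ) ≤ ®M ^ (0.22 : ℝ) * ®M ^ (0.78 : ℝ) := by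
        rw [← rpow_add hM0, show (0.22 + 0.78 : ℝ) = 1 by norm_num, rpow_one]
        exact (mul_le_mul_of_nonneg_left hT (cast_nonneg _)).trans r1
      exact le_of_mul_le_mul_right this ℙ
    have r2' : |(e + 2) * α - r| ≤ 2 ^ (e + 2) * ®M ^ (0.256 - (e + 1) : ℝ) := by
      have : |(e + 2) * α - r| * ®M ^ (0.78 : ℝ) ≤ 2 ^ (e + 2) * ®M ^ (0.256 - (e + 1) : ℝ) * ®M ^ (0.78 : ℝ) := by
        refine ((mul_le_mul_of_nonneg_left hT (abs_nonneg _)).trans r2).trans ?_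
        rw [mul_assoc, ← rpow_add hM0, pow_succ, mul_assoc, mul_comm ((2 : ℝ) ^ (e + 1)), mul_assoc, mul_comm _ ((2 : ℝ) ^ (e + 1))]
        refine mul_le_mul_of_nonneg_left (hκ2.trans_eq ?_) (by norm_num)
        congr 2; ring_nf
      exact le_of_mul_le_mul_right this ℙ
    have hYg : ®M ^ (1 - 0.3454 : ℝ) / 2 ≤ Y := le_trans (by gcongr) hYge
    have s2 : cf g 2 < 0 := by simp only [cf, prod_range_succ, Finset.prod_range_zero]; push_cast; linarith only [hg1, hg0, mul_pos hg0 (sub_pos.2 hg1)]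
    have s3 : 0 < cf g 3 := by
      rw [cf, prod_range_succ]; exact mul_pos_of_neg_of_neg s2 (by push_cast; linarith only [hp20, hc1, hg1, hcH, hHp])
    rcases le_total (((e + 2) * α - r) * h) 0 with hs | hs
    · refine ⟨⟨0, by omega⟩, fun y => le_trans (le_of_eq ?_) ((hc1' M Y α h r hM hh hhM r1' r2' (by rw [← mul_assoc]; exact mul_nonneg_of_nonpos_of_nonpos hs s2.le) hY1 hYg y).trans
        (by gcongr; linarith only [hp20, hc1, hcH, hA2, hHp]))⟩
      simp only [hγ, if_pos (show 0 < e by omega)]; rfl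
    · refine ⟨⟨1, by omega⟩, fun y => le_trans (le_of_eq ?_) ((hc2' M Y α h r hM hh hhM r1' r2' (by rw [← mul_assoc]; exact mul_nonneg hs s3.le) hY1 hYg y).trans
        (by gcongr; linarith only [hp20, hc1, hcH, hA1, hHp]))⟩
      simp only [hγ, if_pos (show 1 < e by omega)]; rfl
  obtain ⟨j0, hj0⟩ := hcount
  have key := hVB M Y hY1 hM (fun m => α * ®m ^ (e + 2) + h * ®m ^ g) (fun m => α * ®m ^ (e + 2) + h * ®m ^ g) γ _ _ ℙ hE j0 hj0
  refine key.trans ?_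
  rw [← hD, ← hp]
  have k1 : (Y : ℝ) ≤ Z := hYle.trans (hup _ (by
    have h1 := le_mul_of_one_le_right (by linarith only [hp20, hc1, hDe, hcH, heR, hHp] : 0 ≤ D) (by linarith only [hp20, hc1, hDe, hcH, heR, hHp] : 1 ≤ D + 1)
    have h2 := mul_le_mul_of_nonneg_left (show (e : ℝ) + 1 ≤ D * (D + 1) by linarith only [hp20, hc1, hDe, hcH, h1, hHp]) hp0.le
    have : 0.21 * p ≤ a := by rw [ha, le_div_iff₀ ℙ]; linarith only [hp20, hc1, hcH, hpD, hHp, h2]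
    linarith only [this]))
  have k2 : (M : ℝ) * (U * ®M ^ (-0.036 : ℝ)) ≤ U * Z := by
    calc _ = U * (®M ^ (1 : ℝ) * ®M ^ (-0.036 : ℝ)) := by rw [rpow_one]; ring
      _ ≤ _ := by rw [← rpow_add hM0]; gcongr; exact hup _ (by linarith only [hp20, hc1, hcH, hHp])
  have k3 : C * M * (A * ®M ^ (0.78 : ℝ) / M) ^ p * ®Y ^ (0.01 * p) ≤ C * A ^ p * Z := by
    have hYM : (Y : ℝ) ≤ M := hYle.trans (by simpa using rpow_le_rpow_of_exponent_le hM1 (show 1 - a ≤ 1 by linarith only [ha0]))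
    have : (A * ®M ^ (0.78 : ℝ) / M) ^ p = A ^ p * ®M ^ (-0.22 * p) := by
      rw [mul_div_assoc, show ®M ^ (0.78 : ℝ) / M = ®M ^ (-0.22 : ℝ) by
        nth_rw 2 [← rpow_one (M : ℝ)]; rw [← rpow_sub hM0]; norm_num, mul_rpow ℙ ℙ, ← rpow_mul hM0.le]
    rw [this]
    calc C * M * (A ^ p * ®M ^ (-0.22 * p)) * ®Y ^ (0.01 * p) ≤ C * M * (A ^ p * ®M ^ (-0.22 * p)) * ®M ^ (0.01 * p) := by gcongr
      _ = C * A ^ p * (®M ^ (1 : ℝ) * ®M ^ (-0.22 * p) * ®M ^ (0.01 * p)) := by rw [rpow_one]; ring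
      _ ≤ _ := by rw [← rpow_add hM0, ← rpow_add hM0]; gcongr; exact hup _ (by linarith only [])
  have k4 : 0 ≤ (2 : ℝ) ^ (e + 4) * Z := by positivity
  linarith only [k1, k2, k4, k3]


lemma submul_bound (f : ℕ → ℝ) (hf0 : ∀ n, 0 ≤ f n) (f1 : f 1 ≤ 1) (hmul : ∀ m n : ℕ, m.Coprime n → f (m * n) ≤ f m * f n) {B : ℝ} (hB : 1 ≤ B)
    (hpp : ∀ p k : ℕ, p.Prime → 0 < k → f (p ^ k) ≤ B * (k + 1)) {ε : ℝ} (hε : 0 < ε) : ∃ C > 0, ∀ n : ℕ, n ≠ 0 → f n ≤ C * ®n ^ ε := by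
  have hl : 0 < Real.log 2 := Real.log_pos (by norm_num)
  set P := ⌈(2 * B) ^ (1 / ε)⌉₊ with hP
  set A := B * (1 + 1 / (ε * Real.log 2)) with hA
  have hA1 : 1 ≤ A := one_le_mul_of_one_le_of_one_le hB (by linarith [show 0 < 1 / (ε * Real.log 2) by positivity])
  have main : ∀ n : ℕ, n ≠ 0 → f n ≤ A ^ (n.primeFactors.filter (· < P)).card * ®n ^ ε := by
    refine Nat.recOnPosPrimePosCoprime (fun p k hp hk _ => ?_) (fun h => absurd rfl h) (fun _ => by simpa using f1) (fun a b ha hb hab iha ihb _ => ?_)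
    · rw [Nat.primeFactors_prime_pow hk.ne' hp, Finset.filter_singleton]
      have hp0 : (0 : ℝ) < p := by exact_mod_cast hp.pos
      refine (hpp p k hp hk).trans ?_
      rw [Nat.cast_pow, ← rpow_natCast (p : ℝ) k, ← rpow_mul hp0.le, mul_comm (k : ℝ) ε]
      split_ifs with hpP
      · rw [Finset.card_singleton, pow_one]
        have h1 : 1 + k * (ε * Real.log 2) ≤ ®p ^ (ε * k) := by
          calc 1 + k * (ε * Real.log 2) ≤ Real.exp (k * (ε * Real.log 2)) := by linarith [Real.add_one_le_exp (k * (ε * Real.log 2))]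
            _ = (2 : ℝ) ^ (ε * k) := by rw [rpow_def_of_pos (by norm_num)]; congr 1; ring
            _ ≤ _ := rpow_le_rpow (by norm_num) (by exact_mod_cast hp.two_le) ℙ
        refine le_trans ?_ (mul_le_mul_of_nonneg_left h1 𝕃)
        rw [hA, mul_assoc]
        refine mul_le_mul_of_nonneg_left ?_ 𝕃
        have : (1 + 1 / (ε * Real.log 2)) * (1 + k * (ε * Real.log 2)) = k + 1 + (k * (ε * Real.log 2) + 1 / (ε * Real.log 2)) := by field_simp; ring
        rw [this]; linarith [show 0 ≤ k * (ε * Real.log 2) + 1 / (ε * Real.log 2) by positivity]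
      · rw [Finset.card_empty, pow_zero, one_mul, rpow_mul hp0.le, rpow_natCast]
        have h1 : 2 * B ≤ ®p ^ ε := by
          have : (2 * B) ^ (1 / ε) ≤ p := (Nat.le_ceil _).trans (by exact_mod_cast not_lt.1 hpP)
          calc 2 * B = ((2 * B) ^ (1 / ε)) ^ ε := by rw [← rpow_mul 𝕃, one_div_mul_cancel hε.ne', rpow_one]
            _ ≤ _ := rpow_le_rpow ℙ this hε.le
        refine le_trans ?_ (pow_le_pow_left₀ 𝕃 h1 k)
        rw [mul_pow, mul_comm]
        have h2 : (k : ℝ) + 1 ≤ 2 ^ k := by exact_mod_cast Nat.lt_two_pow_self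
        exact mul_le_mul h2 (le_self_pow₀ hB hk.ne') 𝕃 ℙ
    · refine (hmul a b hab).trans ((mul_le_mul (iha 𝕆) (ihb 𝕆) (hf0 _) ℙ).trans_eq ?_)
      rw [hab.primeFactors_mul, Finset.filter_union, Finset.card_union_of_disjoint (Finset.disjoint_filter_filter hab.disjoint_primeFactors), pow_add, Nat.cast_mul,
        mul_rpow ℙ ℙ]
      ring
  refine ⟨A ^ P, by positivity, fun n hn => (main n hn).trans (mul_le_mul_of_nonneg_right (pow_le_pow_right₀ hA1 ?_) ℙ)⟩
  conv_rhs => rw [← card_range P]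
  exact card_le_card fun p hp => mem_range.2 (mem_filter.1 hp).2

lemma tau_bound {ε : ℝ} (hε : 0 < ε) : ∃ C > 0, ∀ n : ℕ, n ≠ 0 → (n.divisors.card : ℝ) ≤ C * ®n ^ ε :=
  submul_bound (fun n => (n.divisors.card : ℝ)) (fun _ => cast_nonneg _) (by simp) (fun m n h => by rw [h.card_divisors_mul]; push_cast; rfl) le_rfl
    (fun p k hp hk => by rw [Nat.divisors_prime_pow hp]; simp) hε

/-- roots of unity modulo `n` -/
def Ku (d n : ℕ) : ℕ := Nat.card {u : (ZMod n)ˣ // u ^ d = 1}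

lemma cyc_index {G : Type} [CommGroup G] [Finite G] (H : Subgroup G) [IsCyclic H] {d : ℕ} (hd : 0 < d) : Nat.card {u : G // u ^ d = 1} ≤ d * H.index := by
  haveI := Fintype.ofFinite G
  rw [card_eq_fintype_card, Fintype.card_subtype]
  refine (Finset.card_le_mul_card_image (f := fun u : G => (u : G ⧸ H)) _ d fun a ha => ?_).trans (Nat.mul_le_mul_left _ ?_)
  · obtain ⟨x, hx, rfl⟩ := mem_image.1 ha
    refine le_trans ?_ (IsCyclic.card_pow_eq_one_le (α := H) hd)
    refine card_le_card_of_injOn (fun u => if h : x⁻¹ * u ∈ H then ⟨x⁻¹ * u, h⟩ else 1) (fun u hu => ?_) (fun u hu v hv huv => ?_)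
    · simp only [coe_filter, mem_filter, mem_univ, true_and, Set.mem_setOf_eq] at hu hx ⊢
      rw [dif_pos (QuotientGroup.eq.1 hu.2.symm)]
      ext; simp [mul_pow, hu.1, hx]
    · simp only [coe_filter, mem_filter, mem_univ, true_and, Set.mem_setOf_eq] at hu hv
      simp only [dif_pos (QuotientGroup.eq.1 hu.2.symm), dif_pos (QuotientGroup.eq.1 hv.2.symm), Subtype.mk.injEq, mul_right_inj] at huv
      exact huv
  · rw [Subgroup.index, card_eq_fintype_card]; exact Finset.card_le_univ _

lemma Ku_pp {d : ℕ} (hd : 0 < d) (p k : ℕ) (hp : p.Prime) : Ku d (p ^ k) ≤ d * 2 := by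
  haveI : NeZero (p ^ k) := ⟨pow_ne_zero _ hp.ne_zero⟩
  have cyc : IsCyclic (ZMod (p ^ k))ˣ → Ku d (p ^ k) ≤ d * 2 := fun h =>
    (cyc_index ⊤ hd).trans (Nat.mul_le_mul_left _ (by simp))
  by_cases h2 : p = 2
  · subst h2
    rcases le_or_gt k 2 with h | h
    · exact cyc ((ZMod.isCyclic_units_two_pow_iff k).2 h)
    obtain ⟨n, rfl⟩ := Nat.exists_eq_add_of_le' h.le
    have h5 : IsUnit (5 : ZMod (2 ^ (n + 2))) := by
      have := (ZMod.isUnit_iff_coprime 5 (2 ^ (n + 2))).2 (Coprime.pow_right _ (by norm_num)); exact_mod_cast this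
    obtain ⟨g, hg⟩ := h5
    refine (cyc_index (Subgroup.zpowers g) hd).trans (Nat.mul_le_mul_left _ (le_of_eq ?_))
    have h1 := (Subgroup.zpowers g).card_mul_index
    rw [Nat.card_zpowers, ← orderOf_units, hg, ZMod.orderOf_five, card_eq_fintype_card, ZMod.card_units_eq_totient, Nat.totient_prime_pow hp 𝕆] at h1
    exact eq_of_mul_eq_mul_left (pow_pos two_pos n) (h1.trans (by simp [pow_succ]))
  · exact cyc (ZMod.isCyclic_units_of_prime_pow p hp h2 k)

lemma Ku_bound {d : ℕ} (hd : 0 < d) {ε : ℝ} (hε : 0 < ε) : ∃ C > 0, ∀ n : ℕ, n ≠ 0 → (Ku d n : ℝ) ≤ C * ®n ^ ε := by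
  have hd' : (1 : ℝ) ≤ d := by exact_mod_cast hd
  refine submul_bound (fun n => (Ku d n : ℝ)) (fun _ => cast_nonneg _) ?_ (fun m n h => ?_) (B := d * 2) 𝕃 (fun p k hp hk => ?_) hε
  · have : Ku d 1 ≤ 1 := Finite.card_le_one_iff_subsingleton.2 (inferInstanceAs (Subsingleton {u : (ZMod 1)ˣ // u ^ d = 1}))
    exact_mod_cast this
  · have e : (ZMod (m * n))ˣ ≃* (ZMod m)ˣ × (ZMod n)ˣ := (Units.mapEquiv (ZMod.chineseRemainder h).toMulEquiv).trans .prodUnits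
    have : Ku d (m * n) = Ku d m * Ku d n := by
      rw [Ku, Ku, Ku, ← Nat.card_prod]
      refine Nat.card_congr ((e.toEquiv.subtypeEquiv (q := fun z => z.1 ^ d = 1 ∧ z.2 ^ d = 1) fun u => ?_).trans (Equiv.subtypeProdEquivProd (p := fun u : (ZMod m)ˣ => u ^ d = 1) (q := fun u : (ZMod n)ˣ => u ^ d = 1)))
      rw [← e.map_eq_one_iff, map_pow, Prod.ext_iff]; rfl
    rw [this]; push_cast; rfl
  · have : (Ku d (p ^ k) : ℝ) ≤ d * 2 := by exact_mod_cast Ku_pp hd p k hp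
    exact this.trans (le_mul_of_one_le_right ℙ (by linarith [show (0 : ℝ) ≤ k by positivity]))


/-- sums over units -/
def UZ (d n : ℕ) [NeZero n] (b : ZMod n) : ℂ := ∑ u : (ZMod n)ˣ, ZMod.stdAddChar (b * (u : ZMod n) ^ d)

lemma UZ_sq (d n : ℕ) [NeZero n] (b : ZMod n) :
    ‖UZ d n b‖ ^ 2 ≤ (univ.filter fun t : (ZMod n)ˣ => b * (t : ZMod n) ^ d = b).card * (n * Ku d n) := by
  set F := (univ.filter fun t : (ZMod n)ˣ => b * (t : ZMod n) ^ d = b).card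
  have hK : ∀ v : (ZMod n)ˣ, (univ.filter fun u : (ZMod n)ˣ => u ^ d = v ^ d).card = Ku d n := fun v => by
    rw [Ku, card_eq_fintype_card, Fintype.card_subtype]
    refine Finset.card_nbij' (· * v⁻¹) (· * v) ?_ ?_ ?_ ?_ <;> intro u hu <;> simp_all [mul_pow]
  have h1 : ∑ b' : ZMod n, ‖UZ d n b'‖ ^ 2 = n * (Fintype.card (ZMod n)ˣ * Ku d n) := by
    have : ((∑ b' : ZMod n, ‖UZ d n b'‖ ^ 2 : ℝ) : ℂ) = ((n * (Fintype.card (ZMod n)ˣ * Ku d n) : ℝ) : ℂ) := by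
      push_cast
      have h : ∀ b' : ZMod n, (‖UZ d n b'‖ : ℂ) ^ 2 = ∑ v : (ZMod n)ˣ, ∑ u : (ZMod n)ˣ, (ZMod.stdAddChar (b' * ((u : ZMod n) ^ d - (v : ZMod n) ^ d)) : ℂ) := fun b' => by
        rw [← mul_conj', UZ, map_sum, mul_sum]
        refine sum_congr rfl fun v _ => ?_
        rw [sum_mul]
        refine sum_congr rfl fun u _ => ?_
        rw [← AddChar.map_neg_eq_conj, ← AddChar.map_add_eq_mul]; congr 1; ring
      rw [sum_congr rfl fun b' _ => h b', sum_comm]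
      have h2 : ∀ v : (ZMod n)ˣ, (∑ b' : ZMod n, ∑ u : (ZMod n)ˣ, (ZMod.stdAddChar (b' * ((u : ZMod n) ^ d - (v : ZMod n) ^ d)) : ℂ)) = n * Ku d n := fun v => by
        rw [sum_comm, ← hK v, Finset.card_filter, Nat.cast_sum, mul_sum]
        refine sum_congr rfl fun u _ => ?_
        rw [AddChar.sum_mulShift _ (ZMod.isPrimitive_stdAddChar n), ZMod.card]
        have : (u : ZMod n) ^ d = (v : ZMod n) ^ d ↔ u ^ d = v ^ d := by rw [Units.ext_iff]; simp
        simp only [sub_eq_zero, this]; split_ifs <;> simp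
      rw [sum_congr rfl fun v _ => h2 v, sum_const, nsmul_eq_mul, card_univ]; ring
    exact_mod_cast this
  set O := univ.image fun v : (ZMod n)ˣ => b * (v : ZMod n) ^ d with hO
  have h2 : Fintype.card (ZMod n)ˣ ≤ F * O.card := by
    refine Finset.card_le_mul_card_image _ F fun a ha => ?_
    obtain ⟨v, _, rfl⟩ := mem_image.1 ha
    refine card_le_card_of_injOn (· * v⁻¹) (fun u hu => ?_) (fun _ _ _ _ h => mul_right_cancel h)
    simp only [coe_filter, mem_univ, true_and, Set.mem_setOf_eq] at hu ⊢
    rw [Units.val_mul, mul_pow, ← mul_assoc, hu, mul_assoc, ← mul_pow, Units.mul_inv, one_pow, mul_one]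
  have h3 : O.card * ‖UZ d n b‖ ^ 2 ≤ ∑ b' : ZMod n, ‖UZ d n b'‖ ^ 2 := by
    rw [← nsmul_eq_mul, ← sum_const]
    refine le_trans (le_of_eq (sum_congr rfl fun b' hb' => ?_)) (sum_le_sum_of_subset_of_nonneg (Finset.subset_univ O) fun _ _ _ => by positivity)
    obtain ⟨v, _, rfl⟩ := mem_image.1 hb'
    congr 2; unfold UZ
    refine Fintype.sum_equiv (Equiv.mulLeft v⁻¹) _ _ fun u => ?_
    simp only [Equiv.coe_mulLeft, Units.val_mul, mul_pow]
    rw [mul_assoc, ← mul_assoc (_ ^ d), ← mul_pow, Units.mul_inv, one_pow, one_mul]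
  have h4 : (0 : ℝ) < Fintype.card (ZMod n)ˣ := by exact_mod_cast Fintype.card_pos
  refine le_of_mul_le_mul_left ?_ h4
  calc (Fintype.card (ZMod n)ˣ : ℝ) * ‖UZ d n b‖ ^ 2 ≤ (F * O.card) * ‖UZ d n b‖ ^ 2 := mul_le_mul_of_nonneg_right (by exact_mod_cast h2) ℙ
    _ = F * (O.card * ‖UZ d n b‖ ^ 2) := by ring
    _ ≤ F * (n * (Fintype.card (ZMod n)ˣ * Ku d n)) := mul_le_mul_of_nonneg_left (h1 ▸ h3) ℙ
    _ = _ := by ring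

lemma FF_le (d n : ℕ) [NeZero n] (B : ℤ) : ∃ n'' : ℕ, n'' ≠ 0 ∧ n'' ≤ n ∧
    (univ.filter fun t : (ZMod n)ˣ => (B : ZMod n) * (t : ZMod n) ^ d = B).card ≤ Int.gcd B n * Ku d n'' := by
  have hn := NeZero.ne n
  have hh : 0 < Int.gcd B n := Int.gcd_pos_iff.2 (Or.inr (by exact_mod_cast hn))
  obtain ⟨n'', e⟩ : Int.gcd B n ∣ n := by exact_mod_cast Int.gcd_dvd_right B (n : ℤ)
  set h := Int.gcd B n
  have hn'' : n'' ≠ 0 := fun h0 => hn (by rw [e, h0, mul_zero])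
  haveI : NeZero n'' := ⟨hn''⟩
  have hdv : n'' ∣ n := ⟨h, by rw [mul_comm]; exact e⟩
  refine ⟨n'', hn'', le_of_dvd (Nat.pos_of_ne_zero hn) hdv, ?_⟩
  have hval : ∀ t : (ZMod n)ˣ, ((ZMod.unitsMap hdv t : (ZMod n'')ˣ) : ZMod n'') = (((t : ZMod n).val : ℕ) : ZMod n'') := fun t => by
    rw [ZMod.unitsMap_val, ZMod.natCast_val]
  rw [Ku, card_eq_fintype_card, Fintype.card_subtype]
  refine Finset.card_le_mul_card_image_of_maps_to (f := ZMod.unitsMap hdv) (fun t ht => ?_) h fun a _ => ?_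
  · rw [mem_filter] at ht ⊢
    refine ⟨mem_univ _, Units.ext ?_⟩
    obtain ⟨B', hB'⟩ : (h : ℤ) ∣ B := Int.gcd_dvd_left B (n : ℤ)
    have h1 : ((B * (((t : ZMod n).val : ℤ) ^ d - 1) : ℤ) : ZMod n) = 0 := by
      push_cast; rw [ZMod.natCast_zmod_val, mul_sub, ht.2, mul_one, sub_self]
    rw [ZMod.intCast_zmod_eq_zero_iff_dvd] at h1
    have h2 : (n'' : ℤ) ∣ B' * (((t : ZMod n).val : ℤ) ^ d - 1) := by
      refine Int.dvd_of_mul_dvd_mul_left (a := (h : ℤ)) (by exact_mod_cast hh.ne') ?_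
      rw [← mul_assoc, ← hB', ← Nat.cast_mul, ← e]; exact h1
    have hco : IsCoprime (n'' : ℤ) B' := by
      rw [Int.isCoprime_iff_gcd_eq_one, Int.gcd_comm]
      have h3 : Int.gcd (h * B') (h * n'') = h := by rw [← hB', ← Nat.cast_mul, ← e]
      rw [Int.gcd_mul_left, Int.natAbs_natCast] at h3
      exact eq_of_mul_eq_mul_left hh (h3.trans (mul_one h).symm)
    have h4 := (ZMod.intCast_zmod_eq_zero_iff_dvd _ n'').2 (hco.dvd_of_dvd_mul_left h2)
    push_cast at h4
    rw [Units.val_pow_eq_pow_val, hval, Units.val_one]; exact sub_eq_zero.1 h4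
  · rw [filter_filter]
    conv_rhs => rw [← card_range h]
    refine card_le_card_of_injOn (fun t => (t : ZMod n).val / n'') (fun t _ => ?_) (fun t ht s hs hts => ?_)
    · exact mem_coe.2 (mem_range.2 ((Nat.div_lt_iff_lt_mul (Nat.pos_of_ne_zero hn'')).2 ((ZMod.val_lt _).trans_eq e)))
    · have h1 : (((t : ZMod n).val : ℕ) : ZMod n'') = (((s : ZMod n).val : ℕ) : ZMod n'') := by
        rw [← hval, ← hval, (mem_filter.1 ht).2.2, (mem_filter.1 hs).2.2]
      rw [ZMod.natCast_eq_natCast_iff'] at h1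
      refine Units.ext (ZMod.val_injective n ?_)
      rw [← div_add_mod (t : ZMod n).val n'', ← div_add_mod (s : ZMod n).val n'', h1]; simp only at hts; rw [hts]

lemma complete {d : ℕ} (hd : 2 ≤ d) {ε : ℝ} (hε : 0 < ε) : ∃ C > 0, ∀ r : ℚ, ‖∑ x ∈ range r.den, eC (r * ®x ^ d)‖ ≤ C * (r.den : ℝ) ^ (1 - 1 / d + ε) := by
  obtain ⟨A, hA, hτ⟩ := tau_bound (show 0 < ε / 2 by linarith)
  obtain ⟨B, hB, hK⟩ := Ku_bound (show 0 < d by omega) (show 0 < ε / 2 by linarith)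
  refine ⟨A * B, by positivity, fun r => ?_⟩
  set q := r.den with hq
  have hq0 : q ≠ 0 := r.den_nz
  have hqr : (0 : ℝ) < q := by exact_mod_cast r.den_pos
  rw [← sum_fiberwise_of_maps_to (t := q.divisors) (g := fun x => Nat.gcd q x) fun x _ => Nat.mem_divisors.2 ⟨Nat.gcd_dvd_left _ _, hq0⟩]
  have main : ∀ g ∈ q.divisors, ‖∑ x ∈ (range q).filter (fun x => Nat.gcd q x = g), eC (r * ®x ^ d)‖ ≤ B * ®q ^ (ε / 2) * ®q ^ (1 - 1 / (d : ℝ)) := by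
    intro g hg
    obtain ⟨n, e⟩ := Nat.dvd_of_mem_divisors hg
    have hg0 : 0 < g := Nat.pos_of_mem_divisors hg
    have hn0 : n ≠ 0 := fun h => hq0 (by rw [e, h, mul_zero])
    haveI : NeZero n := ⟨hn0⟩
    have hnq : n ≤ q := by rw [e]; exact le_mul_of_pos_left n hg0
    set b : ℤ := r.num * g ^ (d - 1) with hb
    have h1 : ∑ x ∈ (range q).filter (fun x => Nat.gcd q x = g), eC (r * ®x ^ d) = UZ d n (b : ZMod n) := by
      symm
      refine Finset.sum_nbij (fun u => g * (u : ZMod n).val) (fun u _ => ?_) (fun u _ v _ h => ?_) (fun x hx => ?_) (fun u _ => ?_)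
      · rw [mem_filter, mem_range, e]
        refine ⟨Nat.mul_lt_mul_of_pos_left (ZMod.val_lt _) hg0, ?_⟩
        rw [Nat.gcd_mul_left, Nat.gcd_comm, (ZMod.val_coe_unit_coprime u : Nat.gcd _ n = 1), mul_one]
      · exact Units.ext (ZMod.val_injective n (eq_of_mul_eq_mul_left hg0 h))
      · rw [mem_coe, mem_filter, mem_range] at hx
        obtain ⟨y, rfl⟩ : g ∣ x := hx.2 ▸ Nat.gcd_dvd_right q x
        have hy : y < n := lt_of_mul_lt_mul_left (e ▸ hx.1) (Nat.zero_le g)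
        have hc : Coprime y n := by
          have := hx.2; rw [e, Nat.gcd_mul_left, Nat.gcd_comm] at this
          exact eq_of_mul_eq_mul_left hg0 (this.trans (mul_one g).symm)
        exact ⟨ZMod.unitOfCoprime y hc, by simp, by simp [ZMod.val_cast_of_lt hy]⟩
      · have h2 : (b : ZMod n) * (u : ZMod n) ^ d = ((b * ((u : ZMod n).val : ℤ) ^ d : ℤ) : ZMod n) := by push_cast; rw [ZMod.natCast_zmod_val]
        rw [h2, ZMod.stdAddChar_coe, eC]
        congr 1
        have hr : (r : ℝ) = r.num / (g * n) := by rw [← Nat.cast_mul, ← e, hq]; exact_mod_cast (Rat.num_div_den r).symm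
        have hgc : (g : ℂ) ≠ 0 := by exact_mod_cast hg0.ne'
        have hnc : (n : ℂ) ≠ 0 := by exact_mod_cast hn0
        rw [hr, hb]; push_cast
        rw [mul_pow, ← mul_pow_sub_one (show d ≠ 0 by omega) (g : ℂ)]; field_simp
    rw [h1]
    obtain ⟨m, hm0, hmn, hF⟩ := FF_le d n b
    have h3 : Int.gcd b n ≤ n := le_of_dvd (Nat.pos_of_ne_zero hn0) (by exact_mod_cast Int.gcd_dvd_right b (n : ℤ))
    have h4 : Int.gcd b n ≤ g ^ (d - 1) := by
      have hc : Coprime (Int.gcd b n) r.num.natAbs :=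
        Coprime.coprime_dvd_left ((by exact_mod_cast Int.gcd_dvd_right b (n : ℤ) : Int.gcd b n ∣ n).trans ⟨g, by rw [mul_comm]; exact e⟩ : _ ∣ r.den) r.reduced.symm
      refine le_of_dvd (pow_pos hg0 _) (hc.dvd_of_dvd_mul_left ?_)
      have := Int.natAbs_dvd_natAbs.2 (Int.gcd_dvd_left b (n : ℤ))
      rw [hb, Int.natAbs_mul, Int.natAbs_pow] at this; simpa using this
    set h := Int.gcd b n
    have h5 : ((h * n : ℕ) : ℝ) ≤ (®q ^ (1 - 1 / (d : ℝ))) ^ 2 := by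
      have h6 : (h * n) ^ d ≤ q ^ (2 * (d - 1)) := by
        obtain ⟨k, rfl⟩ := Nat.exists_eq_add_of_le' hd
        calc (h * n) ^ (k + 2) = h ^ 2 * (h ^ k * n ^ (k + 2)) := by ring
          _ ≤ (g ^ (k + 2 - 1)) ^ 2 * (n ^ k * n ^ (k + 2)) := Nat.mul_le_mul (Nat.pow_le_pow_left h4 2) (Nat.mul_le_mul_right _ (Nat.pow_le_pow_left h3 k))
          _ = _ := by rw [e, Nat.add_sub_assoc (by norm_num), mul_pow]; ring
      have hd0 : (d : ℝ) ≠ 0 := by positivity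
      refine le_of_pow_le_pow_left₀ (show d ≠ 0 by omega) ℙ ?_
      rw [← pow_mul, ← rpow_natCast _ (2 * d), ← rpow_mul hqr.le]
      refine (by exact_mod_cast h6 : ((h * n : ℕ) : ℝ) ^ d ≤ ®q ^ (2 * (d - 1))).trans_eq ?_
      rw [← rpow_natCast]; congr 1; push_cast [cast_sub (show 1 ≤ d by omega)]; field_simp
    have hKq : ∀ k : ℕ, k ≠ 0 → k ≤ n → (Ku d k : ℝ) ≤ B * ®q ^ (ε / 2) := fun k hk hkn =>
      (hK k hk).trans (mul_le_mul_of_nonneg_left (rpow_le_rpow ℙ (by exact_mod_cast hkn.trans hnq) 𝕃) hB.le)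
    refine le_of_sq_le_sq ?_ ℙ
    calc ‖UZ d n b‖ ^ 2 ≤ _ := UZ_sq d n b
      _ ≤ (h * Ku d m : ℕ) * (n * Ku d n) := mul_le_mul_of_nonneg_right (by exact_mod_cast hF) ℙ
      _ = (h * n : ℕ) * (Ku d m * Ku d n) := by push_cast; ring
      _ ≤ (®q ^ (1 - 1 / (d : ℝ))) ^ 2 * ((B * ®q ^ (ε / 2)) * (B * ®q ^ (ε / 2))) :=
        mul_le_mul h5 (mul_le_mul (hKq m hm0 hmn) (hKq n hn0 le_rfl) ℙ ℙ) ℙ ℙ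
      _ = _ := by ring
  refine (norm_sum_le _ _).trans ((sum_le_sum main).trans ?_)
  rw [sum_const, nsmul_eq_mul]
  refine (mul_le_mul_of_nonneg_right (hτ q hq0) ℙ).trans_eq ?_
  rw [show 1 - 1 / (d : ℝ) + ε = ε / 2 + ε / 2 + (1 - 1 / d) by ring, rpow_add hqr, rpow_add hqr]; ring


lemma pow_diff_le (d : ℕ) {a u b : ℝ} (ha : 0 ≤ a) (hu : 0 ≤ u) (hb : a + u ≤ b) : |(a + u) ^ d - a ^ d| ≤ u * d * b ^ (d - 1) := by
  refine (abs_pow_sub_pow_le (a := a + u) (b := a) (n := d)).trans ?_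
  rw [add_sub_cancel_left, abs_of_nonneg hu, abs_of_nonneg ha, abs_of_nonneg 𝕃, max_eq_left 𝕃]
  gcongr

lemma TT_bound {d : ℕ} (hd : 2 ≤ d) {M q J : ℕ} (hM : 1 ≤ M) (hq : 1 ≤ q) (hJ : q * J ≤ M) {β : ℝ} (hβ : |β| * q * (d * 2 ^ (d - 1) + 1) * ®M ^ (d - 1) ≤ 1) :
    ‖∑ j ∈ range J, eC (β * ((M : ℝ) + j * q) ^ d)‖ * (|β| * q * ®M ^ (d - 1)) ≤ 1 := by
  wlog h0 : 0 < β generalizing β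
  · rcases eq_or_lt_of_le (not_lt.1 h0) with h | h
    · rw [h]; simp
    · have := this (β := -β) (by rwa [abs_neg]) 𝕃
      simp only [neg_mul, eC_neg] at this
      rwa [abs_neg, ← map_sum, RCLike.norm_conj] at this
  rw [abs_of_pos h0] at hβ ⊢
  have hM0 : (0 : ℝ) < M := by exact_mod_cast hM
  have hq0 : (0 : ℝ) < q := by exact_mod_cast hq
  have hμ : 0 < β * q * ®M ^ (d - 1) := by positivity
  have hf := KL (fun j => β * ((M : ℝ) + j * q) ^ d) 0 0 J hμ (fun n hn => ?_) (fun n _ _ => ?_)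
  · rw [← Finset.range_eq_Ico, le_div_iff₀ hμ] at hf; exact hf
  · have hn' : (q : ℝ) * (n + 1) ≤ M := by
      have : q * (n + 1) ≤ M := (Nat.mul_le_mul_left _ (mem_Ico.1 hn).2).trans hJ
      exact_mod_cast this
    set a : ℝ := M + n * q with ha
    have e : (M : ℝ) + (n + 1 : ℕ) * q = a + q := by push_cast; ring
    have haM : (M : ℝ) ≤ a := by rw [ha]; linarith [show 0 ≤ (n : ℝ) * q by positivity]
    simp only [e, Int.cast_zero, zero_add]
    rw [← mul_sub]
    have h1 := (abs_le.1 (pow_diff_le d 𝕃 hq0.le (show a + q ≤ 2 * M by rw [ha]; linarith))).2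
    have h2 : q * ®M ^ (d - 1) ≤ (a + q) ^ d - a ^ d := by
      have h3 : a ^ (d - 1) ≤ (a + q) ^ (d - 1) := pow_le_pow_left₀ 𝕃 𝕃 _
      have h4 : ®M ^ (d - 1) ≤ (a + q) ^ (d - 1) := pow_le_pow_left₀ 𝕃 𝕃 _
      rw [← mul_pow_sub_one (show d ≠ 0 by omega) (a + q), ← mul_pow_sub_one (show d ≠ 0 by omega) a]
      linarith [mul_le_mul_of_nonneg_left h3 (show 0 ≤ a by linarith), mul_le_mul_of_nonneg_left h4 hq0.le]
    refine ⟨by rw [mul_assoc]; exact mul_le_mul_of_nonneg_left h2 h0.le, (mul_le_mul_of_nonneg_left h1 h0.le).trans ?_⟩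
    rw [mul_pow]; linarith only [hβ]
  · have h := (convexOn_pow (𝕜 := ℝ) d).2 (show (M : ℝ) + n * q ∈ Set.Ici 0 from (by positivity : (0 : ℝ) ≤ M + n * q)) (show (M : ℝ) + (n + 2) * q ∈ Set.Ici 0 from (by positivity : (0 : ℝ) ≤ M + (n + 2) * q))
      (show (0 : ℝ) ≤ 1 / 2 by norm_num) (show (0 : ℝ) ≤ 1 / 2 by norm_num) (by norm_num)
    simp only [smul_eq_mul] at h
    rw [show 1 / 2 * ((M : ℝ) + n * q) + 1 / 2 * (M + (n + 2) * q) = M + (n + 1) * q by ring] at h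
    push_cast
    linarith [mul_le_mul_of_nonneg_left h h0.le]

lemma major {d : ℕ} (hd : 2 ≤ d) {s ε : ℝ} (hε : 0 < ε) : ∃ C > 0, ∀ x M : ℕ, 1 ≤ M → M ≤ x → ∀ (α : ℝ) (r : ℚ), (r.den : ℝ) ≤ ®x ^ (1 - s) →
    |α - r| * r.den ≤ ®x ^ (-((d : ℝ) - 1 + s)) →
    ‖SS d 1 α 0 M‖ ≤ C * (x * ((r.den : ℝ) * (1 + ®x ^ d * |α - r|)) ^ (-(1 / (d : ℝ))) * (r.den : ℝ) ^ ε + ®x ^ (1 - s)) := by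
  obtain ⟨A, hA, hc⟩ := complete hd hε
  set D : ℝ := d * 2 ^ (d - 1) + 1 with hD
  have hD1 : 1 ≤ D := by rw [hD]; linarith [show (0 : ℝ) ≤ d * 2 ^ (d - 1) by positivity]
  refine ⟨2 * A + 8 * D, by positivity, fun x M hM hMx α r hq hβ => ?_⟩
  have hx0 : (0 : ℝ) < x := by exact_mod_cast hM.trans hMx
  have hMx' : (M : ℝ) ≤ x := by exact_mod_cast hMx
  have hM0 : (0 : ℝ) < M := by exact_mod_cast hM
  set q := r.den with hqd
  have hq1 : 1 ≤ q := r.den_pos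
  have hq0 : (0 : ℝ) < q := by exact_mod_cast hq1
  set β := α - r with hβd
  set X := ®x ^ (1 - s) with hX
  have hX0 : 0 < X := by positivity
  set Y := x * ((q : ℝ) * (1 + ®x ^ d * |β|)) ^ (-(1 / (d : ℝ))) * ®q ^ ε with hY
  have hY0 : 0 ≤ Y := by positivity
  have hβ' : |β| * q * ®x ^ (d - 1) * x ≤ X := by
    have : X = ®x ^ (-((d : ℝ) - 1 + s)) * (®x ^ (d - 1) * x) := by
      rw [← pow_succ, Nat.sub_add_cancel 𝕆, ← rpow_natCast, ← rpow_add hx0, hX]; congr 1; ring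
    rw [this, mul_assoc]; exact mul_le_mul_of_nonneg_right hβ ℙ
  by_cases hbig : (x : ℝ) ≤ D * X
  · refine (SS_triv _ _ _ _ _).trans ?_
    have h1 : 0 ≤ A * Y := by positivity
    have h2 : 0 ≤ A * X := by positivity
    have h3 : 0 ≤ D * Y := by positivity
    have h4 : 0 ≤ D * X := by positivity
    linarith
  push Not at hbig
  have hsm : |β| * q * D * ®M ^ (d - 1) ≤ 1 := by
    have h1 : ®M ^ (d - 1) ≤ ®x ^ (d - 1) := pow_le_pow_left₀ hM0.le hMx' _
    have h2 : |β| * q * D * ®M ^ (d - 1) ≤ |β| * q * D * ®x ^ (d - 1) := mul_le_mul_of_nonneg_left h1 ℙ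
    refine h2.trans (le_of_mul_le_mul_right ?_ hx0)
    linarith [mul_le_mul_of_nonneg_left hβ' (show 0 ≤ D by linarith)]
  set G := ∑ u ∈ range q, eC (r * ®u ^ d) with hG
  have per : ∀ a : ℕ, ∑ u ∈ range q, eC (r * ((a : ℝ) + u) ^ d) = G := by
    intro a
    induction a with
    | zero => simp [hG]
    | succ a ih =>
      rw [← ih]
      have h1 := sum_range_succ (fun u : ℕ => eC (r * ((a : ℝ) + u) ^ d)) q
      rw [sum_range_succ'] at h1
      have h2 : eC (r * ((a : ℝ) + (q : ℕ)) ^ d) = eC (r * ((a : ℝ) + (0 : ℕ)) ^ d) := by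
        obtain ⟨z, hz⟩ : (q : ℤ) ∣ ((a : ℤ) + q) ^ d - (a : ℤ) ^ d := by
          have := sub_dvd_pow_sub_pow ((a : ℤ) + q) a d; rwa [add_sub_cancel_left] at this
        have hz' : ((a : ℝ) + q) ^ d = ®a ^ d + q * z := by exact_mod_cast sub_eq_iff_eq_add'.1 hz
        have hr : (r : ℝ) * q = r.num := by exact_mod_cast Rat.mul_den_eq_num r
        rw [hz', mul_add, ← mul_assoc, hr, cast_zero, add_zero, ← Int.cast_mul, eC_add_int]
      rw [h2] at h1
      rw [← add_right_cancel h1]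
      refine sum_congr rfl fun u _ => ?_
      push_cast; ring_nf
  set E : ℝ := 7 * (|β| * (q * d * (2 * M) ^ (d - 1))) with hE
  have blk : ∀ a : ℕ, M ≤ a → a + q ≤ 2 * M → ‖∑ u ∈ range q, eC (α * ((a : ℝ) + u) ^ d) - G * eC (β * ®a ^ d)‖ ≤ q * E := by
    intro a _ ha
    rw [← per a, sum_mul, ← sum_sub_distrib]
    refine (norm_sum_le_of_le _ (f := fun u : ℕ => eC (α * ((a : ℝ) + u) ^ d) - eC (r * ((a : ℝ) + u) ^ d) * eC (β * ®a ^ d)) (fun u hu => ?_)).trans_eq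
      (show ∑ _u ∈ range q, E = q * E by rw [sum_const, card_range, nsmul_eq_mul])
    have hu' : (u : ℝ) ≤ q := by exact_mod_cast (mem_range.1 hu).le
    have ha' : (a : ℝ) + q ≤ 2 * M := by exact_mod_cast ha
    rw [show α * ((a : ℝ) + u) ^ d = r * ((a : ℝ) + u) ^ d + β * ((a : ℝ) + u) ^ d by rw [hβd]; ring, eC_add, ← mul_sub, norm_mul, norm_eC, one_mul]
    refine (eC_lip _ _).trans ?_
    rw [← mul_sub, abs_mul, hE]
    have h1 := pow_diff_le d (cast_nonneg a) (cast_nonneg u) (show (a : ℝ) + u ≤ 2 * M by linarith)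
    have h2 : (u : ℝ) * d * (2 * M) ^ (d - 1) ≤ q * d * (2 * M) ^ (d - 1) := by gcongr
    exact mul_le_mul_of_nonneg_left (mul_le_mul_of_nonneg_left (h1.trans h2) (abs_nonneg _)) (by norm_num)
  have blks : ∀ J : ℕ, q * J ≤ M → ‖∑ i ∈ range (q * J), eC (α * ((M : ℝ) + i) ^ d) - G * ∑ j ∈ range J, eC (β * ((M : ℝ) + j * q) ^ d)‖ ≤ J * (q * E) := by
    intro J
    induction J with
    | zero => simp
    | succ J ih =>
      intro hJ
      rw [mul_add, mul_one] at hJ ⊢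
      rw [Finset.sum_range_add, sum_range_succ, mul_add, add_sub_add_comm]
      have h1 := blk (M + q * J) 𝕆 𝕆
      push_cast at h1 ⊢
      rw [add_one_mul]
      refine (norm_add_le _ _).trans (add_le_add (ih 𝕆) ?_)
      rw [mul_comm (J : ℝ)]; simpa only [add_assoc] using h1
  set J := M / q with hJ
  have hqJ : q * J ≤ M := mul_div_le M q
  have hqJr : (q : ℝ) * J ≤ M := by exact_mod_cast hqJ
  set T := ‖∑ j ∈ range J, eC (β * ((M : ℝ) + j * q) ^ d)‖ with hT
  have hS : SS d 1 α 0 M = ∑ i ∈ range (q * J), eC (α * ((M : ℝ) + i) ^ d) + ∑ i ∈ range (M % q), eC (α * ((M : ℝ) + (q * J + i : ℕ)) ^ d) := by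
    rw [← Finset.sum_range_add, hJ, div_add_mod, SS, sum_Ico_eq_sum_range, show 2 * M - M = M by omega]
    simp
  have hy : (q * T) * (1 + ®x ^ d * |β|) ^ (1 / (d : ℝ)) ≤ 2 * x := by
    have hd0 : d ≠ 0 := by omega
    have h1 : q * T ≤ M := (mul_le_mul_of_nonneg_left ((norm_sum_eC_le _ _).trans_eq (by simp)) hq0.le).trans hqJr
    have h2 := TT_bound hd hM hq1 hqJ hsm
    rw [← hT] at h2
    have hy0 : 0 ≤ q * T := by positivity
    have h3 : (q * T) ^ d * |β| ≤ 1 := by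
      rw [← mul_pow_sub_one hd0]
      have := mul_le_mul_of_nonneg_left (pow_le_pow_left₀ hy0 h1 (d - 1)) (show 0 ≤ q * T * |β| by positivity)
      linarith
    refine le_of_pow_le_pow_left₀ hd0 ℙ ?_
    rw [mul_pow, ← rpow_natCast (_ ^ (1 / (d : ℝ))), ← rpow_mul ℙ, one_div_mul_cancel ℙ, rpow_one, mul_pow (2 : ℝ)]
    have h4 : (q * T) ^ d ≤ ®x ^ d := pow_le_pow_left₀ hy0 (h1.trans hMx') _
    have h5 := mul_le_mul_of_nonneg_left h3 (show 0 ≤ ®x ^ d by positivity)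
    have h6 : (2 : ℝ) * x ^ d ≤ 2 ^ d * x ^ d := mul_le_mul_of_nonneg_right (le_self_pow₀ (by norm_num) hd0) ℙ
    linarith
  have hGT : ‖G‖ * T ≤ 2 * A * Y := by
    have h1 := mul_le_mul_of_nonneg_right (hc r) (show 0 ≤ T by positivity)
    refine h1.trans ?_
    have hv : 0 < (1 + ®x ^ d * |β|) := by positivity
    have hvp := rpow_pos_of_pos hv (1 / (d : ℝ))
    have e1 : A * ®q ^ (1 - 1 / (d : ℝ) + ε) * T = A * (®q ^ (-(1 / (d : ℝ))) * ®q ^ ε) * (q * T) := by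
      rw [show 1 - 1 / (d : ℝ) + ε = 1 + (-(1 / d) + ε) by ring, rpow_add hq0, rpow_add hq0, rpow_one]; ring
    have e2 : q * T ≤ 2 * x * (1 + ®x ^ d * |β|) ^ (-(1 / (d : ℝ))) := by
      rw [rpow_neg hv.le, ← div_eq_mul_inv, le_div_iff₀ hvp]; exact hy
    rw [← hqd, e1]
    refine (mul_le_mul_of_nonneg_left e2 ℙ).trans_eq ?_
    rw [hY, mul_rpow hq0.le hv.le]; ring
  have hEX : J * (q * E) ≤ 7 * D * X := by
    have h1 : ®M ^ (d - 1) * M ≤ ®x ^ (d - 1) * x := by gcongr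
    have h2 : J * (q * E) ≤ M * E := by rw [← mul_assoc, mul_comm (J : ℝ)]; exact mul_le_mul_of_nonneg_right hqJr ℙ
    have h3 : M * E = 7 * (d * 2 ^ (d - 1)) * (|β| * q * (®M ^ (d - 1) * M)) := by rw [hE, mul_pow]; ring
    have h4 : |β| * q * (®M ^ (d - 1) * M) ≤ X := (mul_le_mul_of_nonneg_left h1 ℙ).trans (by rw [← mul_assoc]; exact hβ')
    rw [h3] at h2
    refine h2.trans ((mul_le_mul_of_nonneg_left h4 ℙ).trans (mul_le_mul_of_nonneg_right ?_ hX0.le))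
    rw [hD]; linarith
  have hleft : ‖∑ i ∈ range (M % q), eC (α * ((M : ℝ) + (q * J + i : ℕ)) ^ d)‖ ≤ X := by
    refine (norm_sum_eC_le _ _).trans (le_trans ?_ hq)
    rw [card_range]; exact_mod_cast (mod_lt _ hq1).le
  have hfin : ‖SS d 1 α 0 M‖ ≤ J * (q * E) + ‖G‖ * T + X := by
    rw [hS, ← norm_mul]
    refine (norm_add_le _ _).trans (add_le_add ?_ hleft)
    have := norm_add_le_of_le (blks J hqJ) le_rfl (a₂ := G * ∑ j ∈ range J, eC (β * ((M : ℝ) + j * q) ^ d))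
    rwa [sub_add_cancel] at this
  have h1 : 0 ≤ A * X := by positivity
  have h2 : 0 ≤ D * Y := by positivity
  have h3 : X ≤ D * X := le_mul_of_one_le_left hX0.le hD1
  linarith


/-- number of divisors up to `K` -/
def dK (K n : ℕ) : ℕ := ((Icc 1 K).filter (· ∣ n)).card

lemma one_add_log_le {ε : ℝ} (hε : 0 < ε) {y : ℝ} (hy : 1 ≤ y) : 1 + Real.log y ≤ (1 + 1 / ε) * y ^ ε := by
  have h1 := Real.log_le_rpow_div (show 0 ≤ y by linarith) hε
  have h2 := one_le_rpow hy hε.le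
  rw [one_add_mul, one_div_mul_eq_div]; linarith

lemma gcd_sum (K D : ℕ) (hD : D ≠ 0) : ∑ q ∈ Icc 1 K, (Nat.gcd D q : ℝ) / q ≤ D.divisors.card * (1 + Real.log K) := by
  rw [← sum_fiberwise_of_maps_to (t := D.divisors) (g := fun q => Nat.gcd D q) fun q _ => Nat.mem_divisors.2 ⟨Nat.gcd_dvd_left _ _, hD⟩, ← nsmul_eq_mul]
  refine sum_le_card_nsmul _ _ _ fun g hg => ?_
  have hg0 := Nat.pos_of_mem_divisors hg
  have hH : ∑ i ∈ Icc 1 K, ((i : ℝ))⁻¹ ≤ 1 + Real.log K := by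
    have := harmonic_le_one_add_log K; rw [harmonic_eq_sum_Icc] at this; push_cast at this; exact this
  refine le_trans ?_ hH
  have hdv : ∀ q ∈ (Icc 1 K).filter (fun q => Nat.gcd D q = g), g * (q / g) = q := fun q hq => Nat.mul_div_cancel' ((mem_filter.1 hq).2 ▸ Nat.gcd_dvd_right D q)
  have e : ∑ q ∈ (Icc 1 K).filter (fun q => Nat.gcd D q = g), (Nat.gcd D q : ℝ) / q = ∑ i ∈ ((Icc 1 K).filter (fun q => Nat.gcd D q = g)).image (· / g), ((i : ℝ))⁻¹ := by
    rw [sum_image fun a ha b hb h => by rw [← hdv a ha, ← hdv b hb]; exact congrArg (g * ·) h]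
    refine sum_congr rfl fun q hq => ?_
    rw [(mem_filter.1 hq).2]
    conv_lhs => rw [← hdv q hq, Nat.cast_mul]
    rw [← div_div, div_self ℙ, one_div]
  rw [e]
  refine sum_le_sum_of_subset_of_nonneg (fun i hi => ?_) fun _ _ _ => by positivity
  obtain ⟨q, hq, rfl⟩ := mem_image.1 hi
  have h1 := hdv q hq
  have h2 := mem_Icc.1 (mem_filter.1 hq).1
  refine mem_Icc.2 ⟨Nat.pos_of_ne_zero fun h => ?_, (Nat.div_le_self _ _).trans h2.2⟩
  rw [h] at h1; omega

lemma moment (k : ℕ) : ∀ (ε : ℝ) (j : ℕ), 0 < ε → ∃ C > 0, ∀ K D Z : ℕ, 1 ≤ K → 1 ≤ D → D ≤ K ^ j →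
    ∑ n ∈ (Ioc 0 Z).filter (D ∣ ·), (dK K n : ℝ) ^ k ≤ C * ®K ^ ε * (Z / D) := by
  induction k with
  | zero =>
    intro ε j hε
    refine ⟨1, one_pos, fun K D Z hK hD _ => ?_⟩
    simp only [pow_zero, sum_const, nsmul_eq_mul, mul_one, one_mul]
    rw [Nat.Ioc_filter_dvd_card_eq_div]
    exact Nat.cast_div_le.trans (le_mul_of_one_le_left ℙ (one_le_rpow (by exact_mod_cast hK) hε.le))
  | succ k ih =>
    intro ε j hε
    obtain ⟨C, hC, h⟩ := ih (ε / 2) (j + 1) 𝕃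
    have hε' : 0 < ε / (4 * (j + 1)) := by positivity
    obtain ⟨A, hA, hτ⟩ := tau_bound hε'
    refine ⟨C * (A * (1 + 1 / (ε / 4))), by positivity, fun K D Z hK hD hDK => ?_⟩
    have hK1 : (1 : ℝ) ≤ K := by exact_mod_cast hK
    have hD0 : (0 : ℝ) < D := by exact_mod_cast hD
    have e : ∑ n ∈ (Ioc 0 Z).filter (D ∣ ·), (dK K n : ℝ) ^ (k + 1) = ∑ q ∈ Icc 1 K, ∑ n ∈ (Ioc 0 Z).filter (Nat.lcm D q ∣ ·), (dK K n : ℝ) ^ k := by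
      have : ∀ n, (dK K n : ℝ) ^ (k + 1) = ∑ q ∈ Icc 1 K, if q ∣ n then (dK K n : ℝ) ^ k else 0 := fun n => by
        rw [← sum_filter, sum_const, nsmul_eq_mul, pow_succ']; rfl
      rw [sum_congr rfl fun n _ => this n, sum_comm]
      refine sum_congr rfl fun q _ => ?_
      rw [← sum_filter, filter_filter]
      simp only [Nat.lcm_dvd_iff]
    rw [e]
    have hq : ∀ q ∈ Icc 1 K, ∑ n ∈ (Ioc 0 Z).filter (Nat.lcm D q ∣ ·), (dK K n : ℝ) ^ k ≤ C * ®K ^ (ε / 2) * (Z / D) * ((Nat.gcd D q : ℝ) / q) := fun q hq => by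
      have hq' := mem_Icc.1 hq
      have hq0 : (0 : ℝ) < q := by exact_mod_cast hq'.1
      have hl : 0 < Nat.lcm D q := Nat.lcm_pos hD hq'.1
      refine (h K (Nat.lcm D q) Z hK hl ((le_of_dvd (Nat.mul_pos hD hq'.1) (Nat.lcm_dvd_mul D q)).trans (by rw [pow_succ]; exact Nat.mul_le_mul hDK hq'.2))).trans_eq ?_
      have h1 : (Nat.gcd D q : ℝ) * Nat.lcm D q = D * q := by exact_mod_cast Nat.gcd_mul_lcm D q
      have hl0 : (0 : ℝ) < Nat.lcm D q := by exact_mod_cast hl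
      rw [mul_assoc (C * ®K ^ (ε / 2))]; congr 1
      rw [div_mul_div_comm, ← h1]
      have hg0 : (0 : ℝ) < Nat.gcd D q := by exact_mod_cast Nat.gcd_pos_of_pos_left q hD
      rw [mul_comm (Z : ℝ), mul_div_mul_left _ _ hg0.ne']
    refine (sum_le_sum hq).trans ?_
    rw [← mul_sum]
    have h1 := gcd_sum K D 𝕆
    have h2 : (D.divisors.card : ℝ) ≤ A * ®K ^ (ε / 4) := by
      refine (hτ D 𝕆).trans (mul_le_mul_of_nonneg_left ?_ hA.le)
      refine (rpow_le_rpow hD0.le (by exact_mod_cast hDK : (D : ℝ) ≤ ®K ^ j) hε'.le).trans ?_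
      rw [← rpow_natCast, ← rpow_mul 𝕃]
      refine rpow_le_rpow_of_exponent_le hK1 ?_
      rw [mul_div_assoc', div_le_div_iff₀ ℙ (by norm_num)]; linarith
    have h3 := one_add_log_le (show 0 < ε / 4 by linarith) hK1
    have h4 : 0 ≤ 1 + Real.log K := by linarith [Real.log_nonneg hK1]
    calc C * ®K ^ (ε / 2) * (Z / D) * ∑ q ∈ Icc 1 K, (Nat.gcd D q : ℝ) / q
        ≤ C * ®K ^ (ε / 2) * (Z / D) * ((A * ®K ^ (ε / 4)) * ((1 + 1 / (ε / 4)) * ®K ^ (ε / 4))) :=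
          mul_le_mul_of_nonneg_left (h1.trans (mul_le_mul h2 h3 h4 ℙ)) ℙ
      _ = _ := by
        rw [show ®K ^ ε = ®K ^ (ε / 2) * (®K ^ (ε / 4) * ®K ^ (ε / 4)) by rw [← rpow_add 𝕃, ← rpow_add 𝕃]; congr 1; ring]
        ring


lemma fejer_low {t : ℝ} {N : ℕ} (h : nn t * (14 * N) ≤ 1) : ®N ^ 2 / 4 ≤ ‖∑ n ∈ range N, eC (n * t)‖ ^ 2 := by
  have h1 : ‖∑ n ∈ range N, (eC (n * t) - 1)‖ ≤ N * (1 / 2) := by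
    refine (norm_sum_le_of_le (range N) (f := fun n : ℕ => eC (n * t) - 1) (n := fun _ => 1 / 2) fun n hn => ?_).trans_eq (by rw [sum_const, card_range, nsmul_eq_mul])
    have hn' : (n : ℝ) ≤ N := by exact_mod_cast (mem_range.1 hn).le
    have e : eC (n * t) = eC (n * (t - round t)) := by
      rw [← eC_add_int (n * (t - round t)) (n * round t)]; congr 1; push_cast; ring
    rw [e]
    refine (eC_sub_one_le _).trans ?_
    rw [abs_mul, abs_of_nonneg (cast_nonneg n), ← nn]
    linarith [mul_le_mul_of_nonneg_right hn' (nn_nonneg t)]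
  rw [sum_sub_distrib, sum_const, card_range, nsmul_eq_mul, mul_one, norm_sub_rev] at h1
  have h2 := norm_sub_norm_le (N : ℂ) (∑ n ∈ range N, eC (n * t))
  rw [Complex.norm_natCast] at h2
  have h3 : (N : ℝ) / 2 ≤ ‖∑ n ∈ range N, eC (n * t)‖ := by linarith
  have := pow_le_pow_left₀ ℙ h3 2
  linarith [show ((N : ℝ) / 2) ^ 2 = N ^ 2 / 4 by ring]

/-- exponential sums over the points -/
def AP {R : ℕ} (Θ : Fin R → ℝ) (n : ℕ) : ℂ := ∑ r, eC (n * Θ r)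

lemma AP_le {R : ℕ} (Θ : Fin R → ℝ) (n : ℕ) : ‖AP Θ n‖ ≤ R := (norm_sum_eC_le _ _).trans_eq (by simp)

lemma pair_sum {R : ℕ} (Θ : Fin R → ℝ) (N q : ℕ) :
    ∑ r, ∑ r', ‖∑ n ∈ range N, eC (n * (q * (Θ r - Θ r')))‖ ^ 2 ≤ N * (2 * ∑ k ∈ range N, ‖AP Θ (q * k)‖ ^ 2) := by
  have hs : ∀ n m : ℕ, ‖∑ r, eC (((n : ℝ) - m) * q * Θ r)‖ = ‖AP Θ (q * ((n : ℤ) - m).natAbs)‖ := fun n m => by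
    unfold AP
    have h0 : (((n : ℤ) - m).natAbs : ℝ) = |(n : ℝ) - m| := by rw [Nat.cast_natAbs]; push_cast; rfl
    push_cast; rw [h0]
    rcases abs_choice ((n : ℝ) - m) with h | h
    · rw [h]; congr 1; refine sum_congr rfl fun r _ => ?_; congr 1; ring
    · rw [h, ← RCLike.norm_conj, map_sum]; congr 1; refine sum_congr rfl fun r _ => ?_
      rw [← eC_neg]; congr 1; ring
  have e : ∑ r, ∑ r', ‖∑ n ∈ range N, eC (n * (q * (Θ r - Θ r')))‖ ^ 2 = ∑ n ∈ range N, ∑ m ∈ range N, ‖AP Θ (q * ((n : ℤ) - m).natAbs)‖ ^ 2 := by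
    simp only [← hs]
    have h : ((∑ r, ∑ r', ‖∑ n ∈ range N, eC (n * (q * (Θ r - Θ r')))‖ ^ 2 : ℝ) : ℂ) = ((∑ n ∈ range N, ∑ m ∈ range N, ‖∑ r, eC (((n : ℝ) - m) * q * Θ r)‖ ^ 2 : ℝ) : ℂ) := by
      push_cast
      simp only [← mul_conj', map_sum, sum_mul_sum, ← eC_sub]
      have key : ∀ F : Fin R → Fin R → ℕ → ℕ → ℂ, ∑ r, ∑ r', ∑ n ∈ range N, ∑ m ∈ range N, F r r' n m = ∑ n ∈ range N, ∑ m ∈ range N, ∑ r, ∑ r', F r r' n m := fun F => by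
        rw [sum_congr rfl fun r _ => sum_comm, sum_comm]
        refine sum_congr rfl fun n _ => ?_
        rw [sum_congr rfl fun r _ => sum_comm, sum_comm]
      rw [key]
      refine sum_congr rfl fun n _ => sum_congr rfl fun m _ => sum_congr rfl fun r _ => sum_congr rfl fun r' _ => ?_
      congr 1; ring
    exact_mod_cast h
  rw [e]
  refine (sum_le_card_nsmul _ _ (2 * ∑ k ∈ range N, ‖AP Θ (q * k)‖ ^ 2) fun n hn => ?_).trans_eq (by rw [card_range, nsmul_eq_mul])
  have hn' := mem_range.1 hn
  rw [← sum_fiberwise_of_maps_to (t := range N) (g := fun m : ℕ => ((n : ℤ) - m).natAbs) fun m hm => by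
    have := mem_range.1 hm; rw [mem_range]; omega]
  rw [mul_sum]
  refine sum_le_sum fun k _ => ?_
  rw [sum_congr rfl fun m hm => by rw [(mem_filter.1 hm).2], sum_const, nsmul_eq_mul]
  refine mul_le_mul_of_nonneg_right ?_ ℙ
  have : ((range N).filter fun m : ℕ => ((n : ℤ) - m).natAbs = k).card ≤ ({n - k, n + k} : Finset ℕ).card :=
    card_le_card fun m hm => by
      have := (mem_filter.1 hm).2; rw [Finset.mem_insert, Finset.mem_singleton]; omega
  exact_mod_cast this.trans Finset.card_le_two

/-- pairs whose difference is close to a rational with small denominator -/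
def GK {R : ℕ} (Θ : Fin R → ℝ) (K X : ℕ) : Finset (Fin R × Fin R) :=
  univ.filter fun p => ∃ q ∈ Icc 1 K, nn (q * (Θ p.1 - Θ p.2)) ≤ (K : ℝ) / X

lemma GK_le {R : ℕ} (Θ : Fin R → ℝ) {K X : ℕ} (hK : 1 ≤ K) (hX : 14 * K ≤ X) :
    ((GK Θ K X).card : ℝ) ≤ 224 * K / X * (K * ®R ^ 2 + ∑ n ∈ Ioc 0 X, dK K n * ‖AP Θ n‖ ^ 2) := by
  set N := X / (14 * K) with hN
  have hN1 : 1 ≤ N := (Nat.one_le_div_iff 𝕆).2 hX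
  have hNX : 14 * K * N ≤ X := mul_div_le _ _
  have hX2 : X < 14 * K * (N + 1) := lt_mul_div_succ X 𝕆
  have hN0 : (0 : ℝ) < N := by exact_mod_cast hN1
  have hX0 : (0 : ℝ) < X := by exact_mod_cast (by omega : 0 < X)
  have hNXr : (14 : ℝ) * K * N ≤ X := by exact_mod_cast hNX
  have h28 : (X : ℝ) ≤ 28 * K * N := by
    have : X ≤ 28 * K * N := by nlinarith
    exact_mod_cast this
  have h1 : (GK Θ K X).card * (®N ^ 2 / 4) ≤ ∑ q ∈ Icc 1 K, ∑ r, ∑ r', ‖∑ n ∈ range N, eC (n * (q * (Θ r - Θ r')))‖ ^ 2 := by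
    simp only [← Fintype.sum_prod_type']
    rw [sum_comm, ← nsmul_eq_mul]
    refine (Finset.card_nsmul_le_sum (GK Θ K X) _ _ fun p hp => ?_).trans (sum_le_sum_of_subset_of_nonneg (Finset.subset_univ _) fun _ _ _ => sum_nonneg fun _ _ => by positivity)
    obtain ⟨-, q, hq, h⟩ := by simpa only [GK, mem_filter] using hp
    refine le_trans (fejer_low ?_) (single_le_sum (f := fun q : ℕ => ‖∑ n ∈ range N, eC (n * (q * (Θ p.1 - Θ p.2)))‖ ^ 2) (fun _ _ => by positivity) hq)
    refine (mul_le_mul_of_nonneg_right h ℙ).trans ?_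
    rw [div_mul_eq_mul_div, div_le_one hX0]; linarith
  have h2 : ∀ q ∈ Icc 1 K, ∑ r, ∑ r', ‖∑ n ∈ range N, eC (n * (q * (Θ r - Θ r')))‖ ^ 2 ≤
      N * (2 * (®R ^ 2 + ∑ n ∈ (Ioc 0 X).filter (q ∣ ·), ‖AP Θ n‖ ^ 2)) := fun q hq => by
    have hq' := mem_Icc.1 hq
    refine (pair_sum Θ N q).trans (mul_le_mul_of_nonneg_left (mul_le_mul_of_nonneg_left ?_ (by norm_num)) hN0.le)
    rw [Finset.range_eq_Ico, Finset.sum_eq_sum_Ico_succ_bot hN1]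
    refine add_le_add (pow_le_pow_left₀ (norm_nonneg _) (AP_le _ _) 2) ?_
    rw [← sum_image (f := fun n => ‖AP Θ n‖ ^ 2) (g := fun k => q * k) fun a _ b _ h => eq_of_mul_eq_mul_left hq'.1 h]
    refine sum_le_sum_of_subset_of_nonneg (fun n hn => ?_) fun _ _ _ => by positivity
    obtain ⟨k, hk, rfl⟩ := mem_image.1 hn
    have hk' := mem_Ico.1 hk
    refine mem_filter.2 ⟨Finset.mem_Ioc.2 ⟨Nat.mul_pos hq'.1 𝕆, ?_⟩, dvd_mul_right _ _⟩
    have := Nat.mul_le_mul hq'.2 hk'.2.le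
    exact this.trans ((Nat.mul_le_mul_right N 𝕆).trans hNX)
  have h3 : ∑ q ∈ Icc 1 K, ∑ n ∈ (Ioc 0 X).filter (q ∣ ·), ‖AP Θ n‖ ^ 2 = ∑ n ∈ Ioc 0 X, dK K n * ‖AP Θ n‖ ^ 2 := by
    simp only [sum_filter]
    rw [sum_comm]
    refine sum_congr rfl fun n _ => ?_
    rw [← sum_filter, sum_const, nsmul_eq_mul]; rfl
  have h4 := h1.trans (sum_le_sum h2)
  rw [← mul_sum, ← mul_sum, sum_add_distrib, h3, sum_const, Nat.card_Icc, nsmul_eq_mul, Nat.add_sub_cancel] at h4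
  set Q := K * ®R ^ 2 + ∑ n ∈ Ioc 0 X, dK K n * ‖AP Θ n‖ ^ 2
  have hQ : 0 ≤ Q := add_nonneg ℙ (sum_nonneg fun n _ => by positivity)
  have h5 : (GK Θ K X).card * N ≤ 8 * Q := le_of_mul_le_mul_right 𝕃 hN0
  rw [div_mul_eq_mul_div, le_div_iff₀ hX0]
  have h6 := mul_le_mul_of_nonneg_left h28 (cast_nonneg (α := ℝ) (GK Θ K X).card)
  have h7 := mul_le_mul_of_nonneg_left h5 (cast_nonneg (α := ℝ) K)
  linarith

lemma AP_LS {R : ℕ} (Θ : Fin R → ℝ) {X : ℕ} (hX : 1 ≤ X) (hsp : ∀ r r', r ≠ r' → 1 / (2 * X : ℝ) ≤ nn (Θ r - Θ r')) :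
    ∑ n ∈ Ioc 0 X, ‖AP Θ n‖ ^ 2 ≤ 160 * X * R := by
  have hX0 : (1 : ℝ) ≤ X := by exact_mod_cast hX
  have h := LS univ Θ (fun _ => 1) (X + 1) 𝕆 (𝓜 := 5) fun y => by
    refine (spaced_nn _ Θ (κ := 1 / (X + 1 : ℕ)) (ρ := 1 / (2 * X)) (y := y) ℙ (fun i hi => (mem_filter.1 hi).2) (fun i _ j _ => hsp i j) ℙ).trans ?_
    push_cast
    rw [div_div_eq_mul_div, div_one, mul_assoc, div_mul_eq_mul_div, one_mul, mul_div_assoc', ← le_sub_iff_add_le, div_le_iff₀ ℙ]; linarith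
  simp only [one_mul, norm_one, one_pow, sum_const, card_univ, Fintype.card_fin, nsmul_eq_mul, mul_one] at h
  have h2 : ∑ n ∈ Ioc 0 X, ‖AP Θ n‖ ^ 2 ≤ ∑ n ∈ range (X + 1), ‖AP Θ n‖ ^ 2 :=
    sum_le_sum_of_subset_of_nonneg (fun n hn => by have := Finset.mem_Ioc.1 hn; rw [mem_range]; omega) fun _ _ _ => by positivity
  refine (h2.trans h).trans (mul_le_mul_of_nonneg_right ?_ (cast_nonneg R))
  push_cast; linarith

lemma GK_bound {ε : ℝ} (hε : 0 < ε) (B : ℝ) : ∃ C > 0, ∀ (R : ℕ) (Θ : Fin R → ℝ) (K X : ℕ) (P : ℝ), 1 ≤ K → K ≤ P → 14 * K ≤ X →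
    (∀ r r', r ≠ r' → 1 / (2 * X : ℝ) ≤ nn (Θ r - Θ r')) →
    ((GK Θ K X).card : ℝ) ≤ C * (K * P ^ ε * R + ®R ^ 2 * (P ^ 2 / X + P ^ (-B))) := by
  obtain ⟨l, hl⟩ := exists_nat_ge ((B + 2) / ε)
  rw [div_le_iff₀ hε] at hl
  obtain ⟨C, hC, hm⟩ := moment (l + 1) 1 0 one_pos
  refine ⟨224 * (1 + 160 + C), by positivity, fun R Θ K X P hK hKP hX hsp => ?_⟩
  have hK1 : (1 : ℝ) ≤ K := by exact_mod_cast hK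
  have hP : 0 < P := by linarith
  have hX0 : (0 : ℝ) < X := by exact_mod_cast (by omega : 0 < X)
  have hV : 0 < P ^ ε := rpow_pos_of_pos hP _
  have hm' := hm K 1 X hK le_rfl (by simp)
  simp only [isUnit_one, IsUnit.dvd, Finset.filter_true, cast_one, div_one, rpow_one] at hm'
  refine (GK_le Θ hK hX).trans ?_
  have h1 : ∀ n, dK K n * ‖AP Θ n‖ ^ 2 ≤ P ^ ε * ‖AP Θ n‖ ^ 2 + ®R ^ 2 / (P ^ ε) ^ l * (dK K n : ℝ) ^ (l + 1) := fun n => by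
    rcases le_or_gt (dK K n : ℝ) (P ^ ε) with h | h
    · exact le_add_of_le_of_nonneg (mul_le_mul_of_nonneg_right h ℙ) ℙ
    · refine le_add_of_nonneg_of_le ℙ ?_
      rw [pow_succ (dK K n : ℝ) l, ← mul_assoc, mul_comm (dK K n : ℝ)]
      refine mul_le_mul_of_nonneg_right ((pow_le_pow_left₀ (norm_nonneg _) (AP_le _ _) 2).trans ?_) ℙ
      rw [div_mul_eq_mul_div, le_div_iff₀ ℙ]
      exact mul_le_mul_of_nonneg_left (pow_le_pow_left₀ hV.le h.le l) ℙ
  have h2 := sum_le_sum fun n (_ : n ∈ Ioc 0 X) => h1 n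
  rw [sum_add_distrib, ← mul_sum, ← mul_sum] at h2
  have h3 := mul_le_mul_of_nonneg_left (AP_LS Θ 𝕆 hsp) hV.le
  have h4 := mul_le_mul_of_nonneg_left hm' (show 0 ≤ ®R ^ 2 / (P ^ ε) ^ l by positivity)
  have h5 : ®K ^ 2 / (P ^ ε) ^ l ≤ P ^ (-B) := by
    rw [div_le_iff₀ ℙ, ← rpow_natCast (P ^ ε), ← rpow_mul hP.le, ← rpow_add hP]
    refine (pow_le_pow_left₀ 𝕃 hKP 2).trans ?_
    rw [← rpow_natCast]
    exact rpow_le_rpow_of_exponent_le 𝕃 (by push_cast; linarith)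
  have h6 : ®K ^ 2 / X ≤ P ^ 2 / X := div_le_div_of_nonneg_right (pow_le_pow_left₀ 𝕃 hKP 2) hX0.le
  have h7 : 224 * K / X * (K * ®R ^ 2 + ∑ n ∈ Ioc 0 X, dK K n * ‖AP Θ n‖ ^ 2) ≤
      224 * K / X * (K * ®R ^ 2 + (P ^ ε * (160 * X * R) + ®R ^ 2 / (P ^ ε) ^ l * (C * K * X))) :=
    mul_le_mul_of_nonneg_left 𝕃 ℙ
  refine h7.trans ?_
  have e : 224 * K / X * (K * ®R ^ 2 + (P ^ ε * (160 * X * R) + ®R ^ 2 / (P ^ ε) ^ l * (C * K * X))) =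
      224 * (®R ^ 2 * (®K ^ 2 / X) + 160 * (K * P ^ ε * R) + C * (®R ^ 2 * (®K ^ 2 / (P ^ ε) ^ l))) := by field_simp; ring
  rw [e]
  have h8 := mul_le_mul_of_nonneg_left h5 (show 0 ≤ ®R ^ 2 by positivity)
  have h9 := mul_le_mul_of_nonneg_left h6 (show 0 ≤ ®R ^ 2 by positivity)
  have h10 := mul_le_mul_of_nonneg_left h8 hC.le
  have a1 : 0 ≤ (1 + C) * (K * P ^ ε * R) := by positivity
  have a2 : 0 ≤ (160 + C) * (®R ^ 2 * (P ^ 2 / X)) := by positivity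
  have a3 : 0 ≤ 161 * (®R ^ 2 * P ^ (-B)) := by positivity
  linarith only [a1, h10, h9, a3, a2]


lemma conclude {e ε C₀ : ℝ} (he : 0 < e) (he2 : e ≤ 1 / 2) (hε : 0 < ε) : ∃ C > 0, ∃ C₁ > 0, ∀ (R : ℕ) (Θ : Fin R → ℝ) (X : ℕ) (δ : ℝ) (κ : Fin R → Fin R → ℝ),
    0 < δ → δ < 1 → C₁ * δ ^ (-(4 / e + 4)) ≤ X → (∀ r r', r ≠ r' → 1 / (2 * X : ℝ) ≤ nn (Θ r - Θ r')) →
    (∀ r r', 1 ≤ κ r r' ∧ ∃ q : ℕ, 1 ≤ q ∧ q ≤ κ r r' ∧ nn (q * (Θ r - Θ r')) ≤ κ r r' / X) →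
    ®R ^ 2 * δ ^ 2 ≤ C₀ * ∑ r, ∑ r', κ r r' ^ (-e) → (R : ℝ) ≤ C * δ ^ (-(2 / e + ε)) := by
  set η := min e (e * ε / 4) with hη
  have hη0 : 0 < η := lt_min he ℙ
  have hηe : η ≤ e := min_le_left _ _
  have hηε : 4 * η ≤ e * ε := by have := min_le_right e (e * ε / 4); rw [← hη] at this; linarith
  obtain ⟨G, hG, hGK⟩ := GK_bound hη0 2
  set D := 2 * (1 + 1 / η) * (G + 1) with hD
  have hD2 : 2 ≤ D := by
    rw [hD]; have h1 : 0 < 1 / η := by positivity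
    have := mul_pos h1 hG; linarith
  set C' := max C₀ (2 * D) with hC'
  have hC'0 : 2 * D ≤ C' := le_max_right _ _
  have hCp : 0 < 2 * C' := by linarith
  refine ⟨16 * C' * D * (2 * C') ^ ((1 - e + 2 * η) / e), by positivity, 16 * D * (2 * C') ^ ((2 + 2 * e) / e), by positivity, ?_⟩
  intro R Θ X δ κ hδ hδ1 hX hsp hκ hmain
  set P := (2 * C' / δ ^ 2) ^ (1 / e) with hP
  have hb1 : 2 * C' ≤ 2 * C' / δ ^ 2 := le_div_self hCp.le ℙ (pow_le_one₀ hδ.le hδ1.le)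
  have hb0 : 1 ≤ 2 * C' / δ ^ 2 := by linarith
  have hPpow : ∀ u : ℝ, P ^ u = (2 * C') ^ (u / e) * δ ^ (-(2 * u / e)) := fun u => by
    rw [hP, ← rpow_mul ℙ, div_rpow hCp.le ℙ, ← rpow_natCast, ← rpow_mul hδ.le, rpow_neg hδ.le, div_eq_mul_inv]
    congr 2 <;> push_cast <;> ring_nf
  have hPe : P ^ e = 2 * C' / δ ^ 2 := by rw [hP, ← rpow_mul ℙ, one_div_mul_cancel he.ne', rpow_one]
  have hPb : 2 * C' ≤ P := hb1.trans ((rpow_one _).symm.le.trans (rpow_le_rpow_of_exponent_le hb0 (by rw [le_div_iff₀ he]; linarith)))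
  have hP1 : 1 ≤ P := by linarith
  have hP0 : 0 < P := by linarith
  have hXP : 16 * D * P ^ (2 + 2 * e) ≤ X := by
    refine le_of_eq_of_le ?_ hX
    rw [hPpow, ← mul_assoc]; congr 2; field_simp; ring
  have hX28 : 28 * P ≤ X := by
    have : P ^ (1 : ℝ) ≤ P ^ (2 + 2 * e) := rpow_le_rpow_of_exponent_le hP1 𝕃
    rw [rpow_one] at this
    have := mul_le_mul hD2 this hP0.le 𝕃
    linarith
  have hX0 : (0 : ℝ) < X := by linarith
  set J := Nat.log 2 ⌊P⌋₊ + 1 with hJ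
  have hfl : ∀ y : ℝ, 1 ≤ y → (2 : ℝ) ^ Nat.log 2 ⌊y⌋₊ ≤ y ∧ y < 2 ^ (Nat.log 2 ⌊y⌋₊ + 1) := fun y hy => by
    have h1 : ⌊y⌋₊ ≠ 0 := (floor_pos.2 hy).ne'
    refine ⟨le_trans ?_ (floor_le 𝕃), ?_⟩
    · exact_mod_cast pow_log_le_self 2 h1
    · exact_mod_cast (Nat.floor_lt 𝕃).1 (Nat.lt_pow_succ_log_self one_lt_two ⌊y⌋₊)
  have hJD : J * (G + 1) ≤ D * P ^ η := by
    have h1 : (J : ℝ) ≤ 2 * (1 + Real.log P) := by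
      have h2 := Real.log_le_log ℙ (hfl P hP1).1
      rw [Real.log_pow] at h2
      have h3 := Real.log_two_gt_d9
      have h4 : (0 : ℝ) ≤ Nat.log 2 ⌊P⌋₊ := cast_nonneg _
      rw [hJ]; push_cast
      linarith [mul_le_mul_of_nonneg_left h3.le h4]
    have h2 := one_add_log_le hη0 hP1
    rw [hD, mul_right_comm]
    exact mul_le_mul_of_nonneg_right 𝕃 𝕃
  have hgk : ∀ j ∈ range J, ((2 : ℝ) ^ j) ^ (-e) * (GK Θ (2 ^ (j + 1)) X).card ≤ (G + 1) * (4 * P ^ (1 - e + η) * R + ®R ^ 2 * (4 * P ^ 2 / X + P ^ (-2 : ℝ))) := by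
    intro j hj
    have hj2 : (2 : ℝ) ^ j ≤ P := (pow_le_pow_right₀ (by norm_num) (by have := mem_range.1 hj; omega)).trans (hfl P hP1).1
    have h1 : (((2 : ℕ) ^ (j + 1) : ℕ) : ℝ) ≤ 2 * P := by push_cast; rw [pow_succ]; linarith
    have hK14 : 14 * 2 ^ (j + 1) ≤ X := by
      have : ((14 * 2 ^ (j + 1) : ℕ) : ℝ) ≤ X := by push_cast at h1 ⊢; linarith
      exact_mod_cast this
    have h2 := hGK R Θ (2 ^ (j + 1)) X (2 * P) Nat.one_le_two_pow h1 hK14 hsp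
    have hw0 : (0 : ℝ) < (2 : ℝ) ^ j := by positivity
    have hw1 : ((2 : ℝ) ^ j) ^ (-e) ≤ 1 := rpow_le_one_of_one_le_of_nonpos (one_le_pow₀ (by norm_num)) 𝕃
    have h3 : ((2 : ℝ) ^ j) ^ (-e) * (((2 : ℕ) ^ (j + 1) : ℕ) * (2 * P) ^ η * R) ≤ 4 * P ^ (1 - e + η) * R := by
      have h4 : ((2 : ℝ) ^ j) ^ (-e) * (2 : ℝ) ^ j ≤ P ^ (1 - e) := by
        rw [← rpow_add_one hw0.ne', show -e + 1 = 1 - e by ring]; exact rpow_le_rpow hw0.le hj2 𝕃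
      have h5 : (2 * P) ^ η ≤ 2 * P ^ η := by
        rw [mul_rpow (by norm_num) hP0.le]
        refine mul_le_mul_of_nonneg_right ?_ ℙ
        exact (rpow_le_rpow_of_exponent_le one_le_two (show η ≤ 1 by linarith)).trans_eq (rpow_one _)
      have h6 := mul_le_mul h4 h5 ℙ ℙ
      rw [rpow_add hP0]; push_cast; rw [pow_succ]
      linarith [mul_le_mul_of_nonneg_right h6 (cast_nonneg (α := ℝ) R)]
    have h7 : (2 * P) ^ (-2 : ℝ) ≤ P ^ (-2 : ℝ) := rpow_le_rpow_of_nonpos hP0 𝕃 (by norm_num)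
    set Z := ®R ^ 2 * (4 * P ^ 2 / X + P ^ (-2 : ℝ)) with hZ
    have hZ0 : 0 ≤ Z := by positivity
    have h8 : ®R ^ 2 * ((2 * P) ^ 2 / X + (2 * P) ^ (-2 : ℝ)) ≤ Z := by
      rw [hZ, show (2 * P) ^ 2 = 4 * P ^ 2 by ring]; exact mul_le_mul_of_nonneg_left (by linarith only [h7]) ℙ
    have h9 := mul_le_mul_of_nonneg_left h2 (show 0 ≤ ((2 : ℝ) ^ j) ^ (-e) by positivity)
    have h10 : ((2 : ℝ) ^ j) ^ (-e) * (®R ^ 2 * ((2 * P) ^ 2 / X + (2 * P) ^ (-2 : ℝ))) ≤ Z := (mul_le_of_le_one_left ℙ hw1).trans h8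
    have h11 := mul_le_mul_of_nonneg_left (add_le_add h3 h10) hG.le
    have h12 : 0 ≤ 4 * P ^ (1 - e + η) * R + Z := by positivity
    linarith only [h12, h11, h9]
  have hsum : ∑ r, ∑ r', κ r r' ^ (-e) ≤ ®R ^ 2 * (δ ^ 2 / (2 * C')) + ∑ j ∈ range J, ((2 : ℝ) ^ j) ^ (-e) * (GK Θ (2 ^ (j + 1)) X).card := by
    have h1 : ∀ p : Fin R × Fin R, κ p.1 p.2 ^ (-e) ≤ δ ^ 2 / (2 * C') + ∑ j ∈ range J, if p ∈ GK Θ (2 ^ (j + 1)) X then ((2 : ℝ) ^ j) ^ (-e) else 0 := fun p => by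
      obtain ⟨hk1, q, hq1, hqk, hnn⟩ := hκ p.1 p.2
      rcases le_or_gt P (κ p.1 p.2) with h | h
      · refine le_add_of_le_of_nonneg ?_ (sum_nonneg fun j _ => by split_ifs <;> positivity)
        refine (rpow_le_rpow_of_nonpos hP0 h 𝕃).trans_eq ?_
        rw [rpow_neg hP0.le, hPe, inv_div]
      · refine le_add_of_nonneg_of_le ℙ ?_
        obtain ⟨ha, hb⟩ := hfl _ hk1
        set j := Nat.log 2 ⌊κ p.1 p.2⌋₊
        have hj : j ∈ range J := mem_range.2 (lt_succ_of_le (Nat.log_mono_right (Nat.floor_le_floor h.le)))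
        refine le_trans ?_ (single_le_sum (f := fun j => if p ∈ GK Θ (2 ^ (j + 1)) X then ((2 : ℝ) ^ j) ^ (-e) else 0) (fun j _ => by split_ifs <;> positivity) hj)
        have hmem : p ∈ GK Θ (2 ^ (j + 1)) X := by
          simp only [GK, mem_filter]
          refine ⟨mem_univ _, q, mem_Icc.2 ⟨hq1, ?_⟩, hnn.trans ?_⟩
          · exact_mod_cast hqk.trans hb.le
          · push_cast; exact div_le_div_of_nonneg_right hb.le hX0.le
        rw [if_pos hmem]
        exact rpow_le_rpow_of_nonpos ℙ ha 𝕃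
    rw [← Fintype.sum_prod_type']
    refine (sum_le_sum fun p _ => h1 p).trans_eq ?_
    rw [sum_add_distrib, sum_const, sum_comm, card_univ, Fintype.card_prod, Fintype.card_fin, nsmul_eq_mul]
    congr 1
    · push_cast; ring
    · refine sum_congr rfl fun j _ => ?_
      rw [← sum_filter, sum_const, nsmul_eq_mul, mul_comm, Finset.filter_mem_eq_inter, Finset.univ_inter]
  have hS0 : 0 ≤ ∑ r, ∑ r', κ r r' ^ (-e) := sum_nonneg fun r _ => sum_nonneg fun r' _ => rpow_nonneg (by linarith [(hκ r r').1]) _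
  have hgs := sum_le_card_nsmul _ _ _ hgk
  rw [card_range, nsmul_eq_mul, ← mul_assoc] at hgs
  set Y := 4 * P ^ (1 - e + η) * R + ®R ^ 2 * (4 * P ^ 2 / X + P ^ (-2 : ℝ)) with hY
  have hY0 : 0 ≤ Y := by positivity
  have hgs2 := hgs.trans (mul_le_mul_of_nonneg_right hJD hY0)
  have hmain2 : ®R ^ 2 * δ ^ 2 ≤ ®R ^ 2 * δ ^ 2 / 2 + C' * (D * P ^ η * Y) := by
    refine hmain.trans ((mul_le_mul_of_nonneg_right (le_max_left C₀ (2 * D)) hS0).trans ?_)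
    rw [← hC']
    refine (mul_le_mul_of_nonneg_left (hsum.trans (add_le_add le_rfl hgs2)) 𝕃).trans_eq ?_
    rw [mul_add]; congr 1; have := hCp.ne'; field_simp; exact mul_div_cancel_left₀ _ 𝕃
  have hsmall : D * P ^ η * (4 * P ^ 2 / X + P ^ (-2 : ℝ)) ≤ P ^ (-e) / 2 := by
    have hPη : P ^ η ≤ P ^ e := rpow_le_rpow_of_exponent_le hP1 hηe
    have h1 : D * P ^ η * (4 * P ^ 2 / X) ≤ P ^ (-e) / 4 := by
      rw [mul_div_assoc', div_le_iff₀ hX0]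
      have h2 := mul_le_mul_of_nonneg_left hXP (show 0 ≤ P ^ (-e) / 4 by positivity)
      refine le_trans ?_ h2
      have h3 : P ^ (-e) / 4 * (16 * D * P ^ (2 + 2 * e)) = D * P ^ e * (4 * P ^ 2) := by
        have : P ^ (-e) * P ^ (2 + 2 * e) = P ^ e * P ^ 2 := by rw [← rpow_natCast P 2, ← rpow_add hP0, ← rpow_add hP0]; congr 1; push_cast; ring
        linear_combination 4 * D * this
      rw [h3]; gcongr
    have h2 : D * P ^ η * P ^ (-2 : ℝ) ≤ P ^ (-e) / 4 := by
      have h3 : 4 * D ≤ P := by linarith only [hPb, hC'0]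
      have h4 : P ^ η * P ^ (-2 : ℝ) * P ≤ P ^ (-e) := by
        rw [← rpow_add hP0, ← rpow_add_one hP0.ne']; exact rpow_le_rpow_of_exponent_le hP1 (by linarith only [hηe, he2])
      have h5 := mul_le_mul_of_nonneg_right h3 (show 0 ≤ P ^ η * P ^ (-2 : ℝ) by positivity)
      linarith only [h4, h5]
    rw [mul_add]; linarith only [h1, h2]
  have hPme : P ^ (-e) * (2 * C') = δ ^ 2 := by rw [rpow_neg hP0.le, hPe, inv_div, div_mul_cancel₀ _ hCp.ne']
  have h1 : ®R ^ 2 * δ ^ 2 / 4 ≤ C' * (D * P ^ η * (4 * P ^ (1 - e + η) * R)) := by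
    have h2 := mul_le_mul_of_nonneg_left hsmall (show 0 ≤ C' * ®R ^ 2 by positivity)
    have h3 : C' * ®R ^ 2 * (P ^ (-e) / 2) = ®R ^ 2 * δ ^ 2 / 4 := by rw [← hPme]; ring
    rw [h3] at h2
    have h4 : C' * (D * P ^ η * Y) = C' * (D * P ^ η * (4 * P ^ (1 - e + η) * R)) + C' * ®R ^ 2 * (D * P ^ η * (4 * P ^ 2 / X + P ^ (-2 : ℝ))) := by rw [hY]; ring
    linarith only [h2, hmain2]
  rcases Nat.eq_zero_or_pos R with hR | hR
  · rw [hR, cast_zero]; positivity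
  have hR0 : (0 : ℝ) < R := by exact_mod_cast hR
  have h2 : R * δ ^ 2 ≤ 16 * C' * D * P ^ (1 - e + 2 * η) := by
    refine le_of_mul_le_mul_right ?_ hR0
    have : P ^ η * P ^ (1 - e + η) = P ^ (1 - e + 2 * η) := by rw [← rpow_add hP0]; congr 1; ring
    rw [← this]; linarith only [h1]
  rw [← le_div_iff₀ ℙ] at h2
  refine h2.trans ?_
  rw [hPpow, ← mul_assoc, mul_div_assoc]
  refine mul_le_mul_of_nonneg_left ?_ ℙ
  rw [← rpow_natCast, ← rpow_sub hδ]
  refine rpow_le_rpow_of_exponent_ge hδ hδ1.le ?_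
  push_cast
  have : 2 * (1 - e + 2 * η) / e = 2 / e - 2 + 4 * η / e := by field_simp; ring
  rw [this]
  have : 4 * η / e ≤ ε := by rw [div_le_iff₀ he]; linarith only [hηε]
  linarith only [this]


lemma pars {d : ℕ} (hd : 2 ≤ d) {c : ℝ} (hc1 : 1 < c) (hc2 : c < 1 + c2ps d) :
    B1 d c ∧ 0 < 1 - θdc d c ∧ 1 - θdc d c ≤ 1 / 6 ∧ B0 d ((1 - θdc d c) / c) := by
  have key : 0 < 1 - θdc d c → (1 - θdc d c) / c ≤ 1 - θdc d c := fun h => div_le_self h.le hc1.le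
  rcases (by omega : d = 2 ∨ d = 3 ∨ 4 ≤ d) with rfl | rfl | h
  · have e : θdc 2 c = (4 * c + 7) / 13 := by simp [θdc]
    have hc : c < 1 + 1 / 54 := by simpa [c2ps] using hc2
    have h0 : 0 < 1 - θdc 2 c := by rw [e]; linarith
    have h1 : 1 - θdc 2 c ≤ 1 / 6 := by rw [e]; linarith
    exact ⟨B1low (.inl rfl) hc1 hc2, h0, h1, B0two ℙ ((key h0).trans h1)⟩
  · have e : θdc 3 c = (15 * c + 14) / 30 := by simp [θdc]
    have hc : c < 1 + 1 / 495 := by simpa [c2ps] using hc2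
    have h0 : 0 < 1 - θdc 3 c := by rw [e]; linarith
    have h1 : 1 - θdc 3 c ≤ 1 / 30 := by rw [e]; linarith
    refine ⟨B1low (.inr rfl) hc1 hc2, h0, by linarith, B0hi le_rfl ℙ ?_⟩
    have := key h0; push_cast; linarith
  · obtain ⟨H, hH, hH2, hθ, hcH⟩ := hi_H h hc2
    have hd4 : (4 : ℝ) ≤ d := by exact_mod_cast h
    have h20 : (20 : ℝ) ≤ d * (d + 1) := by nlinarith
    have hH1 : H ≤ 1 / 6 := by linarith [mul_le_mul_of_nonneg_left h20 hH.le]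
    have h0 : 0 < 1 - θdc d c := by rw [hθ]; nlinarith
    have h1 : 1 - θdc d c ≤ H := by rw [hθ]; nlinarith
    refine ⟨B1hi h hc1 hc2, h0, by linarith, B0hi 𝕆 ℙ ?_⟩
    have h2 := mul_le_mul_of_nonneg_right ((key h0).trans h1) (show (0 : ℝ) ≤ d * (d + 2) by positivity)
    nlinarith

lemma arc {d : ℕ} (hd : 2 ≤ d) {t e : ℝ} (ht : 0 ≤ t) (hB : B0 d t) (he : e < 1 / d) : ∃ C > 0, ∀ x : ℕ, 1 ≤ x → ∀ α : ℝ, ∃ κ : ℝ,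
    (1 ≤ κ ∧ ∃ q : ℕ, 1 ≤ q ∧ q ≤ κ ∧ nn (q * α) ≤ κ / ((x ^ d : ℕ) : ℝ)) ∧
    ∀ M : ℕ, 1 ≤ M → M ≤ x → ‖SS d 1 α 0 M‖ ≤ x * (C * (κ ^ (-e) + ®x ^ (-t))) := by
  obtain ⟨C, hC, h0⟩ := hB
  obtain ⟨D, hD, h1⟩ := major hd (s := t) (sub_pos.2 he)
  refine ⟨C + D, by positivity, fun x hx α => ?_⟩
  have hx1 : (1 : ℝ) ≤ x := by exact_mod_cast hx
  have hx0 : (0 : ℝ) < x := by linarith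
  have hd2 : (2 : ℝ) ≤ d := by exact_mod_cast hd
  have hX : (1 : ℝ) ≤ ®x ^ d := one_le_pow₀ hx1
  have ex : ®x ^ (1 - t) = x * ®x ^ (-t) := by rw [sub_eq_add_neg, rpow_add hx0, rpow_one]
  set n := ⌊®x ^ ((d : ℝ) - 1 + t)⌋₊ with hn
  have hn1 : 1 ≤ n := floor_pos.2 (one_le_rpow hx1 𝕃)
  obtain ⟨r, hr, hrn⟩ := Real.exists_rat_abs_sub_le_and_den_le α hn1
  have hq1 : (1 : ℝ) ≤ r.den := by exact_mod_cast r.pos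
  have hrn' : (r.den : ℝ) ≤ n := by exact_mod_cast hrn
  have hβ := abs_nonneg (α - r)
  rcases le_total ((r.den : ℝ)) (®x ^ (1 - t)) with h | h
  · have h2 : |α - r| * r.den ≤ ®x ^ (-((d : ℝ) - 1 + t)) := by
      rw [le_div_iff₀ ℙ] at hr
      rw [rpow_neg hx0.le, ← one_div, le_div_iff₀ ℙ]
      refine (mul_le_mul_of_nonneg_left (lt_floor_add_one _).le ℙ).trans ?_
      rw [← hn]; linarith
    set κ := (r.den : ℝ) * (1 + ®x ^ d * |α - r|) with hκ
    have hqκ : (r.den : ℝ) ≤ κ := le_mul_of_one_le_right 𝕃 (le_add_of_nonneg_right ℙ)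
    have hκ0 : 0 < κ := by linarith
    refine ⟨κ, ⟨by linarith, r.den, r.pos, hqκ, ?_⟩, fun M hM hMx => ?_⟩
    · refine (nn_le _ r.num).trans ?_
      have : (r.den : ℝ) * α - r.num = r.den * (α - r) := by
        have h3 : (r.num : ℝ) = r * r.den := by exact_mod_cast (Rat.mul_den_eq_num r).symm
        rw [h3]; ring
      rw [this, abs_mul, abs_of_pos 𝕃, le_div_iff₀ (by push_cast; positivity), hκ]
      push_cast; linarith
    · refine (h1 x M hM hMx α r h h2).trans ?_
      rw [← hκ, ex]
      have h3 : κ ^ (-(1 / (d : ℝ))) * (r.den : ℝ) ^ (1 / (d : ℝ) - e) ≤ κ ^ (-e) := by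
        refine (mul_le_mul_of_nonneg_left (rpow_le_rpow 𝕃 hqκ 𝕃) ℙ).trans_eq ?_
        rw [← rpow_add hκ0]; congr 1; ring
      have h4 := mul_le_mul_of_nonneg_left h3 (show 0 ≤ D * x by positivity)
      have h5 : 0 ≤ C * x * (κ ^ (-e) + ®x ^ (-t)) := by positivity
      linarith
  · refine ⟨®x ^ d, ⟨hX, 1, le_rfl, by simpa using hX, ?_⟩, fun M hM hMx => ?_⟩
    · push_cast; rw [div_self ℙ]; linarith [nn_le_half (1 * α)]
    · refine (h0 x M hM hMx α r (hr.trans ?_) h (hrn'.trans (floor_le ℙ))).trans ?_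
      · rw [pow_two]; gcongr; linarith
      · rw [ex]
        have h4 : 0 ≤ (C + D) * x * (®x ^ d) ^ (-e) := by positivity
        have h5 : 0 ≤ D * x * ®x ^ (-t) := by positivity
        linarith

lemma Wlog (d : ℕ) : ∃ x₀ : ℕ, ∀ x : ℕ, x₀ ≤ x → (Wps d x : ℝ) ≤ Real.log x := by
  have hl : Real.log 2 < 1 := by linarith [Real.log_two_lt_d9]
  have h1 := ((tendsto_rpow_atTop (sub_pos.2 hl)).comp (Real.tendsto_log_atTop.comp tendsto_natCast_atTop_atTop)).eventually_ge_atTop (4 * ®d ^ 3)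
  have h2 := (Real.tendsto_log_atTop.comp tendsto_natCast_atTop_atTop).eventually_ge_atTop 1
  obtain ⟨x₀, h⟩ := Filter.eventually_atTop.1 (h1.and h2)
  refine ⟨x₀, fun x hx => ?_⟩
  obtain ⟨h3, h4⟩ := h x hx
  simp only [Function.comp] at h3 h4
  set y := Real.log x with hy
  have hy0 : 0 < y := by linarith
  have hw : 0 ≤ wps x := by rw [wps, ← hy]; linarith [Real.log_nonneg h4]
  have e1 : ∏ p ∈ Finset.filter Nat.Prime (Finset.Iic ⌊wps x⌋₊), p = primorial ⌊wps x⌋₊ := by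
    unfold primorial; refine Finset.prod_congr (Finset.ext fun p => ?_) fun _ _ => rfl
    simp [lt_succ_iff]
  have h5 : (primorial ⌊wps x⌋₊ : ℝ) ≤ y ^ Real.log 2 := by
    have h6 : (primorial ⌊wps x⌋₊ : ℝ) ≤ 4 ^ ⌊wps x⌋₊ := by exact_mod_cast primorial_le_four_pow _
    refine h6.trans ?_
    rw [← rpow_natCast]
    refine (rpow_le_rpow_of_exponent_le (by norm_num) (floor_le hw)).trans_eq ?_
    rw [rpow_def_of_pos (by norm_num), rpow_def_of_pos hy0, wps, ← hy, show (4 : ℝ) = 2 ^ 2 by norm_num, Real.log_pow]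
    congr 1; push_cast; ring
  rw [Wps, e1]; push_cast
  refine (mul_le_mul h3 h5 ℙ ℙ).trans_eq ?_
  rw [← rpow_add hy0, sub_add_cancel, rpow_one]


lemma ps_nn {c : ℝ} (hc1 : 1 < c) {m : ℕ} (hm : m ∈ PS c) (hm1 : 1 ≤ m) : nn (®m ^ (1 / c)) ≤ ®m ^ (1 / c - 1) := by
  obtain ⟨n, hn, he⟩ := hm
  have hm0 : (0 : ℝ) < m := by exact_mod_cast hm1
  have hg : 1 / c ≤ 1 := by rw [div_le_one 𝕃]; exact hc1.le
  have hg0 : 0 ≤ 1 / c := by positivity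
  have hn0 : (0 : ℝ) ≤ ®n ^ c := by positivity
  have e : (®n ^ c) ^ (1 / c) = n := by rw [← rpow_mul (cast_nonneg _), mul_one_div_cancel 𝕃, rpow_one]
  have h1 : ®m ^ (1 / c) ≤ n := by
    rw [← e]; refine rpow_le_rpow hm0.le ?_ ℙ; rw [he]; exact floor_le hn0
  have h2 : (n : ℝ) ≤ ®m ^ (1 / c) + ®m ^ (1 / c - 1) := by
    have h3 : (n : ℝ) ≤ ((m : ℝ) * (1 + 1 / m)) ^ (1 / c) := by
      rw [← e, mul_add, mul_one, mul_one_div_cancel hm0.ne']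
      refine rpow_le_rpow hn0 ?_ ℙ; rw [he]; exact (lt_floor_add_one _).le
    refine h3.trans ?_
    rw [mul_rpow hm0.le ℙ, rpow_sub_one hm0.ne']
    have h4 : (0 : ℝ) < 1 / m := by positivity
    have h5 := mul_le_mul_of_nonneg_left ((rpow_one_add_le_one_add_mul_self 𝕃 hg0 hg).trans (add_le_add le_rfl (mul_le_of_le_one_left h4.le hg))) (show 0 ≤ ®m ^ (1 / c) by positivity)
    rwa [mul_add, mul_one, mul_one_div] at h5
  have := nn_le (®m ^ (1 / c)) n
  rw [Int.cast_natCast, abs_sub_comm, abs_of_nonneg 𝕃] at this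
  linarith

lemma expand {ι : Type*} (S : Finset ι) (T : Finset ℕ) (z : ι → ℂ) (hz : ∀ i, ‖z i‖ ≤ 1) (φ : ι → ℕ → ℝ) :
    ∑ m ∈ T, ‖∑ i ∈ S, z i * eC (φ i m)‖ ^ 2 ≤ ∑ i ∈ S, ∑ j ∈ S, ‖∑ m ∈ T, eC (φ i m - φ j m)‖ := by
  have h : ((∑ m ∈ T, ‖∑ i ∈ S, z i * eC (φ i m)‖ ^ 2 : ℝ) : ℂ) = ∑ i ∈ S, ∑ j ∈ S, z i * (starRingEnd ℂ) (z j) * ∑ m ∈ T, eC (φ i m - φ j m) := by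
    push_cast
    simp_rw [← mul_conj', map_sum, sum_mul_sum, mul_sum]
    rw [sum_comm]; refine sum_congr rfl fun i _ => ?_
    rw [sum_comm]; refine sum_congr rfl fun j _ => sum_congr rfl fun m _ => ?_
    rw [eC_sub, map_mul]; ring
  have h2 : 0 ≤ ∑ m ∈ T, ‖∑ i ∈ S, z i * eC (φ i m)‖ ^ 2 := sum_nonneg fun _ _ => by positivity
  rw [← abs_of_nonneg h2, ← norm_eq_abs, ← norm_real, h]
  refine (norm_sum_le _ _).trans (sum_le_sum fun i _ => (norm_sum_le _ _).trans (sum_le_sum fun j _ => ?_))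
  rw [norm_mul, norm_mul, norm_conj]
  exact mul_le_of_le_one_left (norm_nonneg _) (mul_le_one₀ (hz i) (norm_nonneg _) (hz j))

lemma psum {d : ℕ} (hd : 2 ≤ d) {c : ℝ} (hc1 : 1 < c) (hB : B1 d c) (hs0 : 0 < 1 - θdc d c) (hs1 : 1 - θdc d c ≤ 1 / 6) :
    ∃ C > 0, ∀ (x R : ℕ) (Θ : Fin R → ℝ) (ξ : Fin R → ℂ) (Y : Fin R → Fin R → ℝ), 1 ≤ x → (∀ r, ‖ξ r‖ ≤ 1) →
      (∀ r r' M, 1 ≤ M → M ≤ x → ‖SS d 1 (Θ r - Θ r') 0 M‖ ≤ x * Y r r') →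
      ∑ m ∈ (Icc 1 x).filter (· ∈ PS c), ®m ^ ((d : ℝ) - 1 / c) * ‖∑ r, ξ r * eC (Θ r * ®m ^ d)‖ ^ 2 ≤
        C * ®x ^ d * ∑ r, ∑ r', (Y r r' + ®x ^ (-((1 - θdc d c) / c))) := by
  obtain ⟨B, hB0, hB⟩ := hB
  have hd2 : (2 : ℝ) ≤ d := by exact_mod_cast hd
  have hg0 : 0 < 1 / c := by positivity
  have hg1 : 1 / c ≤ 1 := by rw [div_le_one 𝕃]; exact hc1.le
  set t := (1 - θdc d c) / c with ht
  have ht1 : t ≤ 1 := (div_le_self hs0.le hc1.le).trans 𝕃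
  refine ⟨2 * (2 ^ d * 4 * (28 + B)), by positivity, fun x R Θ ξ Y hx hξ hY => ?_⟩
  have hx0 : (0 : ℝ) < x := by exact_mod_cast hx
  have hY0 : ∀ r r', 0 ≤ Y r r' := fun r r' => by
    have := (norm_nonneg _).trans (hY r r' 1 le_rfl hx)
    exact nonneg_of_mul_nonneg_right this hx0
  set Z := ∑ r, ∑ r', (Y r r' + ®x ^ (-t)) with hZ
  set f : ℕ → ℝ := fun m => ®m ^ ((d : ℝ) - 1 / c) * ‖∑ r, ξ r * eC (Θ r * ®m ^ d)‖ ^ 2 with hf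
  have hf0 : ∀ m, 0 ≤ f m := fun m => by positivity
  have dy : ∀ M : ℕ, 1 ≤ M → M ≤ x → ∑ m ∈ (Ico M (2 * M)).filter (· ∈ PS c), f m ≤ 2 ^ d * 4 * (28 + B) * M * ®x ^ ((d : ℝ) - 1) * Z := by
    intro M hM hMx
    have hM0 : (0 : ℝ) < M := by exact_mod_cast hM
    have hM1 : (1 : ℝ) ≤ M := by exact_mod_cast hM
    have hMx' : (M : ℝ) ≤ x := by exact_mod_cast hMx
    set V := ®M ^ (1 - 1 / c) with hV
    have hV0 : 0 < V := by positivity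
    set H := max 1 ⌊V / 14⌋₊ with hH
    have hH1 : 1 ≤ H := le_max_left _ _
    have hH0 : (0 : ℝ) < H := by exact_mod_cast hH1
    have hfl : (⌊V / 14⌋₊ : ℝ) ≤ V / 14 := floor_le ℙ
    have hVH : V ≤ 28 * H := by
      have h1 := lt_floor_add_one (V / 14)
      have h2 : (⌊V / 14⌋₊ : ℝ) ≤ H := by exact_mod_cast le_max_right _ _
      have h3 : (1 : ℝ) ≤ H := by exact_mod_cast hH1
      linarith only [h3, h1, h2]
    set F : ℕ → ℂ := fun m => ∑ h ∈ range H, eC (h * ®m ^ (1 / c)) with hF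
    have hFl : ∀ m ∈ (Ico M (2 * M)).filter (· ∈ PS c), ®H ^ 2 / 4 ≤ ‖F m‖ ^ 2 := fun m hm => by
      simp only [mem_filter, mem_Ico] at hm
      rcases Nat.eq_zero_or_pos ⌊V / 14⌋₊ with h | h
      · have : H = 1 := by rw [hH, h]; rfl
        norm_num [hF, this, eC_zero]
      · refine fejer_low ?_
        have e : H = ⌊V / 14⌋₊ := max_eq_right h
        have h1 : 14 * (H : ℝ) ≤ V := by rw [e]; linarith only [hfl]
        have hmM : (M : ℝ) ≤ m := by exact_mod_cast hm.1.1
        refine (mul_le_mul ((ps_nn hc1 hm.2 (hM.trans hm.1.1)).trans (rpow_le_rpow_of_nonpos hM0 hmM (by linarith only [hg1]))) h1 ℙ ℙ).trans_eq ?_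
        rw [hV, ← rpow_add hM0]; simp
    have hP : ∑ m ∈ Ico M (2 * M), ‖F m‖ ^ 2 * ‖∑ r, ξ r * eC (Θ r * ®m ^ d)‖ ^ 2 ≤ ∑ r, ∑ r', (H * (x * Y r r') + ®H ^ 2 * (B * ®M ^ (θdc d c / c))) := by
      have h1 := expand (univ ×ˢ range H : Finset (Fin R × ℕ)) (Ico M (2 * M)) (fun i => ξ i.1) (fun i => hξ i.1) (fun i m => Θ i.1 * ®m ^ d + i.2 * ®m ^ (1 / c))
      refine le_trans (le_of_eq (sum_congr rfl fun m _ => ?_)) (h1.trans ?_)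
      · rw [← mul_pow, ← norm_mul, mul_comm, hF, sum_mul_sum, sum_product]
        congr 2; refine sum_congr rfl fun r _ => sum_congr rfl fun h _ => ?_
        rw [eC_add]; ring
      · rw [sum_product]
        refine sum_le_sum fun r _ => ?_
        simp_rw [sum_product]
        rw [sum_comm]
        refine sum_le_sum fun r' _ => ?_
        have h2 : ∀ h ∈ range H, ∀ h' ∈ range H, ‖∑ m ∈ Ico M (2 * M), eC (Θ r * ®m ^ d + h * ®m ^ (1 / c) - (Θ r' * ®m ^ d + h' * ®m ^ (1 / c)))‖ ≤
            (if h = h' then x * Y r r' else 0) + B * ®M ^ (θdc d c / c) := fun h hh h' hh' => by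
          rw [mem_range] at hh hh'
          split_ifs with heq
          · refine le_add_of_le_of_nonneg (le_of_eq_of_le ?_ (hY r r' M hM hMx)) ℙ
            rw [SS, heq]; congr 2; ext m; congr 1; push_cast; ring
          · rw [zero_add]
            refine le_of_eq_of_le ?_ (hB M hM (Θ r - Θ r') (h - h') 𝕆 ?_)
            · rw [SS]; congr 2; ext m; congr 1; push_cast; ring
            · have h3 : |(h : ℤ) - h'| ≤ (⌊V / 14⌋₊ : ℤ) := by rw [abs_le]; omega
              have h4 : ((|(h : ℤ) - h'| : ℤ) : ℝ) ≤ (⌊V / 14⌋₊ : ℝ) := by exact_mod_cast h3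
              rw [Int.cast_abs] at h4; linarith only [hfl, h4, hV0]
        refine (sum_le_sum fun h hh => sum_le_sum fun h' hh' => h2 h hh h' hh').trans_eq ?_
        simp only [sum_add_distrib, Finset.sum_ite_eq, sum_const, card_range, nsmul_eq_mul]
        rw [Finset.sum_ite_of_true (fun _ h => h)]
        simp only [sum_const, card_range, nsmul_eq_mul]; ring
    have hK : ∀ m ∈ (Ico M (2 * M)).filter (· ∈ PS c), f m ≤ 2 ^ d * 4 * ®M ^ ((d : ℝ) - 1 / c) / H ^ 2 * (‖F m‖ ^ 2 * ‖∑ r, ξ r * eC (Θ r * ®m ^ d)‖ ^ 2) := fun m hm => by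
      have h1 := hFl m hm
      simp only [mem_filter, mem_Ico] at hm
      have h2 : ®m ^ ((d : ℝ) - 1 / c) ≤ 2 ^ d * ®M ^ ((d : ℝ) - 1 / c) := by
        have h3 : (m : ℝ) ≤ 2 * M := by exact_mod_cast hm.1.2.le
        refine (rpow_le_rpow ℙ h3 𝕃).trans ?_
        rw [mul_rpow (by norm_num) hM0.le, ← rpow_natCast 2 d]
        refine mul_le_mul_of_nonneg_right (rpow_le_rpow_of_exponent_le (by norm_num) 𝕃) ℙ
      rw [hf, ← mul_assoc]
      refine mul_le_mul_of_nonneg_right (h2.trans ?_) ℙ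
      rw [div_mul_eq_mul_div, le_div_iff₀ ℙ]
      have := mul_le_mul_of_nonneg_left h1 (show 0 ≤ 2 ^ d * 4 * ®M ^ ((d : ℝ) - 1 / c) by positivity)
      linarith
    refine (sum_le_sum hK).trans ?_
    rw [← mul_sum]
    refine (mul_le_mul_of_nonneg_left ((sum_le_sum_of_subset_of_nonneg (filter_subset _ _) fun _ _ _ => by positivity).trans hP) ℙ).trans ?_
    rw [hZ, mul_sum, mul_sum]
    refine sum_le_sum fun r _ => ?_
    rw [mul_sum, mul_sum]
    refine sum_le_sum fun r' _ => ?_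
    have k1 : ®M ^ ((d : ℝ) - 1 / c) * x ≤ 28 * H * (M * ®x ^ ((d : ℝ) - 1)) := by
      have e1 : ®M ^ ((d : ℝ) - 1 / c) = V * (M * ®M ^ ((d : ℝ) - 2)) := by
        nth_rw 2 [← rpow_one (M : ℝ)]; rw [hV, ← rpow_add hM0, ← rpow_add hM0]; congr 1; ring
      have e2 : ®x ^ ((d : ℝ) - 1) = ®x ^ ((d : ℝ) - 2) * x := by
        rw [← rpow_add_one hx0.ne']; congr 1; ring
      have h1 : ®M ^ ((d : ℝ) - 2) ≤ ®x ^ ((d : ℝ) - 2) := rpow_le_rpow hM0.le hMx' 𝕃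
      rw [e1, e2, mul_assoc, mul_assoc (M : ℝ), ← mul_assoc (M : ℝ)]
      refine mul_le_mul hVH ?_ ℙ ℙ
      rw [← mul_assoc]; gcongr
    have k2 : ®M ^ ((d : ℝ) - 1 / c) * ®M ^ (θdc d c / c) ≤ M * ®x ^ ((d : ℝ) - 1) * ®x ^ (-t) := by
      have e1 : ®M ^ ((d : ℝ) - 1 / c) * ®M ^ (θdc d c / c) = M * ®M ^ ((d : ℝ) - 1 + -t) := by
        nth_rw 3 [← rpow_one (M : ℝ)]; rw [← rpow_add hM0, ← rpow_add hM0]; congr 1; rw [ht]; ring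
      rw [e1, mul_assoc, ← rpow_add hx0]
      exact mul_le_mul_of_nonneg_left (rpow_le_rpow hM0.le hMx' (by linarith only [hd2, ht1])) hM0.le
    have e3 : 2 ^ d * 4 * ®M ^ ((d : ℝ) - 1 / c) / H ^ 2 * (H * (x * Y r r') + ®H ^ 2 * (B * ®M ^ (θdc d c / c))) =
        2 ^ d * 4 * (®M ^ ((d : ℝ) - 1 / c) * x / H * Y r r' + B * (®M ^ ((d : ℝ) - 1 / c) * ®M ^ (θdc d c / c))) := by
      field_simp
    rw [e3, mul_assoc (2 ^ d * 4 * (28 + B)), mul_assoc (2 ^ d * 4), mul_assoc (2 ^ d * 4)]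
    refine mul_le_mul_of_nonneg_left ?_ ℙ
    have k3 : ®M ^ ((d : ℝ) - 1 / c) * x / H ≤ 28 * (M * ®x ^ ((d : ℝ) - 1)) := by rw [div_le_iff₀ hH0]; linarith only [k1]
    have k4 := mul_le_mul_of_nonneg_right k3 (hY0 r r')
    have k5 := mul_le_mul_of_nonneg_left k2 hB0.le
    have k6 : 0 ≤ B * (M * ®x ^ ((d : ℝ) - 1)) * Y r r' := mul_nonneg ℙ (hY0 r r')
    have k7 : 0 ≤ 28 * (M * ®x ^ ((d : ℝ) - 1)) * ®x ^ (-t) := by positivity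
    linarith only [k6, k4, k7, k5]
  have hmap : ∀ m ∈ (Icc 1 x).filter (· ∈ PS c), Nat.log 2 m ∈ range (Nat.log 2 x + 1) := fun m hm => by
    simp only [mem_filter, mem_Icc] at hm
    exact mem_range.2 (lt_succ_of_le (Nat.log_mono_right hm.1.2))
  rw [← sum_fiberwise_of_maps_to hmap]
  have hl : ∀ i ∈ range (Nat.log 2 x + 1), 2 ^ i ≤ x := fun i hi =>
    (Nat.pow_le_pow_right two_pos (lt_succ_iff.1 (mem_range.1 hi))).trans (pow_log_le_self 2 𝕆)
  have hZ0 : 0 ≤ Z := sum_nonneg fun r _ => sum_nonneg fun r' _ => add_nonneg (hY0 r r') ℙ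
  refine (sum_le_sum fun i hi => (sum_le_sum_of_subset_of_nonneg (?_ : _ ⊆ (Ico (2 ^ i) (2 * 2 ^ i)).filter (· ∈ PS c)) fun m _ _ => hf0 m).trans (dy (2 ^ i) Nat.one_le_two_pow (hl i hi))).trans ?_
  · intro m hm
    simp only [mem_filter, mem_Icc, mem_Ico] at hm ⊢
    obtain ⟨⟨⟨h1, h2⟩, h3⟩, rfl⟩ := hm
    refine ⟨⟨pow_log_le_self 2 𝕆, ?_⟩, h3⟩
    rw [mul_comm, ← pow_succ]; exact Nat.lt_pow_succ_log_self one_lt_two m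
  · simp_rw [← sum_mul, ← mul_sum]
    have h1 : ∑ i ∈ range (Nat.log 2 x + 1), (((2 : ℕ) ^ i : ℕ) : ℝ) ≤ 2 * x := by
      have h2 := hl _ (Finset.self_mem_range_succ _)
      have h3 : (2 : ℝ) ^ Nat.log 2 x ≤ x := by exact_mod_cast h2
      push_cast; rw [geom_sum_eq (by norm_num), pow_succ]; linarith
    have e : ®x ^ d = x * ®x ^ ((d : ℝ) - 1) := by
      rw [← rpow_natCast, ← rpow_one_add' hx0.le 𝕃]; congr 1; ring
    rw [e]
    refine mul_le_mul_of_nonneg_right ?_ hZ0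
    have := mul_le_mul_of_nonneg_left h1 (show 0 ≤ 2 ^ d * 4 * (28 + B) * ®x ^ ((d : ℝ) - 1) by positivity)
    linarith


lemma dual {S : Finset ℕ} {R d : ℕ} {F : Fin R → ℂ} {g : ℕ → ℂ} {wt : ℕ → ℝ} {Θ : Fin R → ℝ} {b : ℝ} (hw : ∀ m, 0 ≤ wt m) (hg : ∀ m ∈ S, ‖g m‖ ≤ wt m)
    (hF : ∀ r, F r = ∑ m ∈ S, g m * eC (Θ r * (®m ^ d + b))) :
    ∃ ξ : Fin R → ℂ, (∀ r, ‖ξ r‖ ≤ 1) ∧ (∑ r, ‖F r‖) ^ 2 ≤ (∑ m ∈ S, wt m) * ∑ m ∈ S, wt m * ‖∑ r, ξ r * eC (Θ r * ®m ^ d)‖ ^ 2 := by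
  set z : Fin R → ℂ := fun r => (starRingEnd ℂ) (F r) / ‖F r‖ with hz
  have hz1 : ∀ r, ‖z r‖ ≤ 1 := fun r => by rw [hz, norm_div, norm_conj, norm_real, norm_norm]; exact div_self_le_one _
  have hzF : ∀ r, (‖F r‖ : ℂ) = z r * F r := fun r => by
    rw [hz, div_mul_eq_mul_div, Complex.conj_mul', pow_two, mul_self_div_self]
  refine ⟨fun r => z r * eC (Θ r * b), fun r => by rw [norm_mul, norm_eC, mul_one]; exact hz1 r, ?_⟩
  set A : ℕ → ℂ := fun m => ∑ r, z r * eC (Θ r * b) * eC (Θ r * ®m ^ d) with hA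
  have h1 : ((∑ r, ‖F r‖ : ℝ) : ℂ) = ∑ m ∈ S, g m * A m := by
    push_cast; simp_rw [hzF, hF, hA, mul_sum]
    rw [sum_comm]
    refine sum_congr rfl fun m _ => sum_congr rfl fun r _ => ?_
    rw [mul_add, eC_add]; ring
  have h0 : 0 ≤ ∑ r, ‖F r‖ := sum_nonneg fun _ _ => norm_nonneg _
  have h2 : ∑ r, ‖F r‖ ≤ ∑ m ∈ S, wt m * ‖A m‖ := by
    rw [← abs_of_nonneg h0, ← norm_eq_abs, ← norm_real, h1]
    refine norm_sum_le_of_le _ fun m hm => ?_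
    rw [norm_mul]; exact mul_le_mul_of_nonneg_right (hg m hm) (norm_nonneg _)
  exact (pow_le_pow_left₀ h0 h2 2).trans (Finset.sum_sq_le_sum_mul_sum_of_sq_eq_mul S (fun m _ => hw m) (fun m _ => mul_nonneg (hw m) ℙ) fun m _ => by ring)

lemma FTb {d x b : ℕ} (hd : 2 ≤ d) {c : ℝ} (hc1 : 1 < c) (hW : 0 < Wps d x) {τ : ℤ → ℝ} (hτ : tauSpec d x c b τ) {ψ : ℤ → ℂ} (hψ : ∀ n, ‖ψ n‖ ≤ τ n) :
    ∃ g : ℕ → ℂ, (∀ m ∈ (Icc 1 x).filter (· ∈ PS c), ‖g m‖ ≤ c * ®m ^ ((d : ℝ) - 1 / c)) ∧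
      ∀ θ : ℝ, FT ψ θ = ∑ m ∈ (Icc 1 x).filter (· ∈ PS c), g m * eC (θ / Wps d x * (®m ^ d + b)) := by
  set W := Wps d x with hWd
  have hW' : (W : ℤ) ≠ 0 := by exact_mod_cast hW.ne'
  set v : ℕ → ℤ := fun m => ((m : ℤ) ^ d + b) / W with hv
  refine ⟨fun m => if (W : ℤ) ∣ (m : ℤ) ^ d + b then ψ (v m) else 0, fun m hm => ?_, fun θ => ?_⟩
  · simp only [mem_filter, mem_Icc] at hm
    have h0 : 0 ≤ c * ®m ^ ((d : ℝ) - 1 / c) := by positivity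
    dsimp only
    split_ifs with h
    · refine (hψ _).trans ?_
      rw [hτ.1 (v m) m hm.2 hm.1.2 (by rw [← hWd, hv, mul_ediv_cancel' h]; ring)]
      refine mul_le_mul_of_nonneg_right ?_ ℙ
      rcases Nat.eq_zero_or_pos (sigmaPS d (Wps d x) b) with h | h
      · rw [h]; simp; linarith
      · exact div_le_self 𝕃 (by exact_mod_cast h)
    · simpa using h0
  · set T := ((Icc 1 x).filter (· ∈ PS c)).filter fun m : ℕ => (W : ℤ) ∣ (m : ℤ) ^ d + b with hT
    have hinj : Set.InjOn v T := fun m hm m' hm' he => by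
      simp only [hT, coe_filter, Set.mem_setOf_eq] at hm hm'
      have h1 : (m : ℤ) ^ d = (m' : ℤ) ^ d := by
        have := congrArg ((W : ℤ) * ·) he
        simp only [hv, mul_ediv_cancel' hm.2, mul_ediv_cancel' hm'.2] at this
        linarith
      exact Nat.pow_left_injective (by omega : d ≠ 0) (by exact_mod_cast h1)
    have hsup : (Function.support fun n : ℤ => ψ n * eC (θ * n)) ⊆ (T.image v : Finset ℤ) := fun n hn => by
      by_contra hc
      refine hn ?_
      have : ψ n = 0 := by
        rw [← norm_le_zero_iff, ← hτ.2 n ?_]; · exact hψ n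
        rintro ⟨m, hm, hmx, he⟩
        have e : (m : ℤ) ^ d + b = W * n := by linarith
        refine hc (mem_coe.2 (mem_image.2 ⟨m, ?_, ?_⟩))
        · simp only [hT, mem_filter, mem_Icc]
          refine ⟨⟨⟨?_, hmx⟩, hm⟩, e ▸ dvd_mul_right _ _⟩
          obtain ⟨k, hk, rfl⟩ := hm
          exact floor_pos.2 (one_le_rpow (by exact_mod_cast hk) 𝕃)
        · rw [hv]; dsimp only; rw [e, mul_ediv_cancel_left _ hW']
      simp [this]
    rw [FT, finsum_eq_sum_of_support_subset _ hsup, sum_image hinj, hT, sum_filter]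
    refine sum_congr rfl fun m _ => ?_
    dsimp only
    split_ifs with h
    · congr 2
      have h1 : ((W * v m : ℤ) : ℝ) = ®m ^ d + b := by rw [hv]; dsimp only; rw [mul_ediv_cancel' h]; push_cast; ring
      have h2 : (W : ℝ) ≠ 0 := by exact_mod_cast hW.ne'
      rw [← h1]; push_cast; field_simp
    · rw [zero_mul]

lemma eps {d : ℕ} (hd : 2 ≤ d) {c ε : ℝ} (hc1 : 1 < c) (hε : 0 < ε) (hs : 0 < 1 - θdc d c) :
    0 < ε3ps d c ε ∧ (θdc d c - 1) / (2 * (d : ℝ) * c) + ε3ps d c ε ≤ 0 := by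
  have hS : (0 : ℝ) < Sd d := by
    have : 2 ≤ d ^ 2 / 2 := by rw [Nat.le_div_iff_mul_le (by norm_num)]; nlinarith
    have : 0 < Sd d := by unfold Sd; omega
    exact_mod_cast this
  have hd0 : (0 : ℝ) < d := by exact_mod_cast (by omega : 0 < d)
  have hc : 0 < c - 1 := by linarith
  have hu : 0 < u1ps d c := by unfold u1ps; positivity
  have e : (Sd d : ℝ) * (c - 1) = u1ps d c * (1 - θdc d c) / 2 := by unfold u1ps; field_simp
  have hc0 : 0 < c := by linarith
  refine ⟨by unfold ε3ps; positivity, ?_⟩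
  have h1 : ε3ps d c ε ≤ (1 - θdc d c) / (2 * (d : ℝ) * c) := by
    rw [ε3ps, e, div_le_div_iff₀ ℙ ℙ]
    have : 0 ≤ (1 - θdc d c) * (2 * d * c * u1ps d c) * (u1ps d c + ε / 2) := by positivity
    linarith
  have h2 : (θdc d c - 1) / (2 * (d : ℝ) * c) = -((1 - θdc d c) / (2 * (d : ℝ) * c)) := by ring
  linarith

end VM

open VM
set_option maxHeartbeats 1000000
theorem stmt19 (d : ℕ) (hd : 2 ≤ d) (c : ℝ) (hc1 : 1 < c) (hc2 : c < 1 + c2ps d)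
    (ε₁ : ℝ) (hε₁ : 0 < ε₁) :
    ∃ C : ℝ, 0 < C ∧ ∃ x₀ : ℕ, ∀ x : ℕ, x₀ ≤ x →
      ∀ b : ℕ, bSpec d x b →
        ∀ τ : ℤ → ℝ, tauSpec d x c b τ →
          ∀ ψ : ℤ → ℂ, (∀ n, ‖ψ n‖ ≤ τ n) →
            ∀ δ : ℝ,
              (Nps d x : ℝ) ^ ((θdc d c - 1) / (2 * (d : ℝ) * c) + ε3ps d c ε₁) < δ →
              δ < 1 →
              ∀ (R : ℕ) (θp : Fin R → ℝ),
                (∀ r, θp r ∈ Set.Ico (0 : ℝ) 1 ∧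
                  δ * (Nps d x : ℝ) * Real.log x < ‖FT ψ (θp r)‖) →
                (∀ r r' : Fin R, r ≠ r' →
                  ∀ m : ℤ, (1 : ℝ) / (Nps d x : ℝ) ≤ |θp r - θp r' - (m : ℝ)|) →
                (R : ℝ) ≤ C * δ ^ (-(2 * (d : ℝ) + ε₁)) := by
  obtain ⟨hB1, hs0, hs1, hB0⟩ := pars hd hc1 hc2
  obtain ⟨hε3, hE⟩ := eps hd hc1 hε₁ hs0
  set E := (θdc d c - 1) / (2 * (d : ℝ) * c) + ε3ps d c ε₁ with hEd
  set t := (1 - θdc d c) / c with ht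
  have hc0 : 0 < c := by linarith
  have hd2 : (2 : ℝ) ≤ d := by exact_mod_cast hd
  have ht0 : 0 < t := by positivity
  have ht1 : t ≤ 1 / 6 := (div_le_self hs0.le hc1.le).trans hs1
  have hEt : 2 * (d * E) = -t + 2 * d * ε3ps d c ε₁ := by rw [hEd, ht]; field_simp; ring
  have hdε : 0 < 2 * d * ε3ps d c ε₁ := by positivity
  set ε := min ε₁ 1 with hε
  have hε0 : 0 < ε := lt_min hε₁ one_pos
  have hε1 : ε ≤ 1 := min_le_right _ _
  set e := 2 / (2 * d + ε / 2) with he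
  have he0 : 0 < e := by positivity
  have hed : e < 1 / d := by rw [he, div_lt_div_iff₀ (by positivity) (by positivity)]; linarith
  have he2 : e ≤ 1 / 2 := by rw [he, div_le_div_iff₀ (by positivity) (by positivity)]; linarith
  have h2e : 2 / e = 2 * d + ε / 2 := by rw [he]; field_simp
  obtain ⟨C2, hC2, harc⟩ := arc hd ht0.le hB0 hed
  obtain ⟨C3, hC3, hps⟩ := psum hd hc1 hB1 hs0 hs1
  set K := 2 * c ^ 2 * C3 ^ 2 * (C2 + 1) with hK
  have hK0 : 0 < K := by positivity
  obtain ⟨C, hC, C₁, hC₁, hcon⟩ := conclude (C₀ := 2 * K) he0 he2 (half_pos hε0)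
  obtain ⟨x₁, hx₁⟩ := Wlog d
  have hev : ∀ᶠ x : ℕ in Filter.atTop, 2 * K ≤ (x : ℝ) ^ (2 * d * ε3ps d c ε₁) ∧ C₁ ≤ (x : ℝ) ^ (1 / 2 : ℝ) :=
    (((tendsto_rpow_atTop hdε).comp tendsto_natCast_atTop_atTop).eventually_ge_atTop _).and
      (((tendsto_rpow_atTop (by norm_num)).comp tendsto_natCast_atTop_atTop).eventually_ge_atTop _)
  obtain ⟨x₂, hx₂⟩ := Filter.eventually_atTop.1 hev
  refine ⟨C, hC, max 2 (max x₁ x₂), fun x hx b _ τ hτ ψ hψ δ hNδ hδ1 R θp hθ hsp => ?_⟩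
  simp only [max_le_iff] at hx
  obtain ⟨hxK, hxC⟩ := hx₂ x hx.2.2
  have hWl := hx₁ x hx.2.1
  have hx2 : (2 : ℝ) ≤ x := by exact_mod_cast hx.1
  have hx1 : (1 : ℝ) ≤ x := by linarith
  have hx0 : (0 : ℝ) < x := by linarith
  have hW2 : 2 ≤ Wps d x := by
    have h1 : 0 < ∏ p ∈ Finset.filter Nat.Prime (Finset.Iic ⌊wps x⌋₊), p := Finset.prod_pos fun p hp => (Finset.mem_filter.1 hp).2.pos
    have h2 : 0 < d ^ 3 := by positivity
    have h3 := Nat.mul_pos h2 h1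
    unfold Wps; rw [mul_assoc]; omega
  have hW2' : (2 : ℝ) ≤ Wps d x := by exact_mod_cast hW2
  have hW0 : (0 : ℝ) < Wps d x := by linarith
  have hxd : (x : ℝ) ≤ (x : ℝ) ^ d := le_self_pow₀ hx1 (by omega)
  have hlx : Real.log x ≤ x := Real.log_le_self hx0.le
  have hX0 : (0 : ℝ) < (x : ℝ) ^ d := by positivity
  have hN1 : (x : ℝ) ^ d ≤ Nps d x * Wps d x := by
    rw [← div_le_iff₀ hW0, Nps]; push_cast; exact (Nat.lt_floor_add_one _).le
  have hfl : (⌊(x : ℝ) ^ d / Wps d x⌋₊ : ℝ) ≤ (x : ℝ) ^ d / Wps d x := Nat.floor_le (by positivity)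
  have hN2 : (Nps d x : ℝ) * Wps d x ≤ 2 * (x : ℝ) ^ d := by
    rw [le_div_iff₀ hW0] at hfl
    rw [Nps]; push_cast; linarith only [hWl, hlx, hxd, hfl]
  have hN0 : (0 : ℝ) < Nps d x := by unfold Nps; positivity
  have hNx : (Nps d x : ℝ) ≤ (x : ℝ) ^ d := by
    have := mul_le_mul_of_nonneg_left hW2' hN0.le
    linarith only [this, hN2]
  have hδ0 : 0 < δ := lt_of_le_of_lt (by positivity) hNδ
  have hδx : (x : ℝ) ^ (d * E) ≤ δ := by
    rw [rpow_mul hx0.le, rpow_natCast]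
    exact (rpow_le_rpow_of_nonpos hN0 hNx hE).trans hNδ.le
  have hδ2 : 2 * K * (x : ℝ) ^ (-t) ≤ δ ^ 2 := by
    refine le_trans ?_ (pow_le_pow_left₀ (by positivity) hδx 2)
    rw [← rpow_natCast, ← rpow_mul hx0.le, show d * E * ((2 : ℕ) : ℝ) = 2 * d * ε3ps d c ε₁ + -t by push_cast; linarith only [hEt], rpow_add hx0]
    gcongr
  set Θ : Fin R → ℝ := fun r => θp r / Wps d x with hΘ
  choose κ hκ1 hκ2 using fun r r' => harc x (by omega) (Θ r - Θ r')
  obtain ⟨g, hg1, hg2⟩ := FTb (b := b) hd hc1 (by omega) hτ hψ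
  obtain ⟨ξ, hξ, hdual⟩ := dual (F := fun r => FT ψ (θp r)) (Θ := Θ) (wt := fun m => c * (m : ℝ) ^ ((d : ℝ) - 1 / c)) (fun m => by positivity) hg1 (fun r => hg2 (θp r))
  have hs2 := hps x R Θ ξ _ (by omega) hξ hκ2
  have hs3 := hps x 1 0 1 1 (by omega) (by simp) (fun _ _ M _ hM => (SS_triv _ _ _ _ _).trans (by simpa using hM))
  simp only [Pi.one_apply, Pi.zero_apply, zero_mul, eC_zero, mul_one, Finset.sum_const, Finset.card_univ, Fintype.card_fin, one_smul, norm_one, one_pow] at hs3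
  have hxt : (x : ℝ) ^ (-t) ≤ 1 := rpow_le_one_of_one_le_of_nonpos hx1 (by linarith only [ht0])
  have hs4 := hs3.trans (mul_le_mul_of_nonneg_left (add_le_add le_rfl hxt) (by positivity))
  have hlow : R * (δ * (x : ℝ) ^ d) ≤ ∑ r, ‖FT ψ (θp r)‖ := by
    have h1 : ∀ r ∈ Finset.univ, δ * (x : ℝ) ^ d ≤ ‖FT ψ (θp r)‖ := fun r _ => by
      refine le_trans ?_ (hθ r).2.le
      rw [mul_assoc]; exact mul_le_mul_of_nonneg_left (hN1.trans (mul_le_mul_of_nonneg_left hWl hN0.le)) hδ0.le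
    simpa using Finset.card_nsmul_le_sum _ _ _ h1
  set Q := ∑ r, ∑ r', κ r r' ^ (-e) with hQ
  have hmain : (R : ℝ) ^ 2 * δ ^ 2 ≤ 2 * K * Q := by
    have h1 := (pow_le_pow_left₀ (by positivity) hlow 2).trans hdual
    simp only [mul_assoc c, ← Finset.mul_sum] at h1
    rw [← mul_assoc c] at h1
    have e1 : ∑ r, ∑ r', (C2 * (κ r r' ^ (-e) + (x : ℝ) ^ (-t)) + (x : ℝ) ^ (-t)) = C2 * Q + (C2 + 1) * (R : ℝ) ^ 2 * (x : ℝ) ^ (-t) := by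
      simp only [Finset.sum_add_distrib, ← Finset.mul_sum, Finset.sum_const, Finset.card_univ, Fintype.card_fin, nsmul_eq_mul, ← hQ]; ring
    have hQ0 : 0 ≤ Q := Finset.sum_nonneg fun r _ => Finset.sum_nonneg fun r' _ => rpow_nonneg (by linarith only [hs0, hκ1, hs1, (hκ1 r r').1]) _
    have e2 : ∑ r, ∑ r', (C2 * (κ r r' ^ (-e) + (x : ℝ) ^ (-t)) + (x : ℝ) ^ (-t)) ≤ (C2 + 1) * (Q + (R : ℝ) ^ 2 * (x : ℝ) ^ (-t)) := by
      rw [e1]; linarith only [hQ0]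
    have h2 := mul_le_mul (mul_le_mul_of_nonneg_left hs4 hc0.le) (mul_le_mul_of_nonneg_left (hs2.trans (mul_le_mul_of_nonneg_left e2 (by positivity))) hc0.le)
      (mul_nonneg hc0.le (Finset.sum_nonneg fun _ _ => by positivity)) (by positivity)
    have h3 : ((x : ℝ) ^ d) ^ 2 * ((R : ℝ) ^ 2 * δ ^ 2) ≤ ((x : ℝ) ^ d) ^ 2 * (K * (Q + (R : ℝ) ^ 2 * (x : ℝ) ^ (-t))) := by
      refine le_trans (le_of_eq ?_) ((h1.trans h2).trans_eq ?_)
      · ring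
      · rw [hK]; ring
    have h4 := le_of_mul_le_mul_left h3 (by positivity)
    have h5 := mul_le_mul_of_nonneg_left hδ2 (sq_nonneg (R : ℝ))
    linarith only [h4, h5]
  refine (hcon R Θ (x ^ d) δ κ hδ0 hδ1 ?_ (fun r r' hr => ?_) hκ1 hmain).trans ?_
  · have h1 : δ ^ (-(4 / e + 4)) ≤ (x : ℝ) ^ ((d : ℝ) - 1 / 2) := by
      have h0 : 0 < 4 / e := by positivity
      refine (rpow_le_rpow_of_nonpos (by positivity) hδx (by linarith only [h0, hs0, hs1])).trans ?_
      rw [← rpow_mul hx0.le]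
      refine rpow_le_rpow_of_exponent_le hx1 ?_
      have h2 : 4 / e = 4 * d + ε := by linear_combination 2 * h2e
      have h3 : -(d * E) ≤ 1 / 12 := by linarith only [hEt, hdε, ht1]
      rw [h2]
      have h4 := mul_le_mul_of_nonneg_right h3 (show 0 ≤ 4 * (d : ℝ) + ε + 4 by positivity)
      linarith only [hs0, h4, hε1, hs1, hd2]
    push_cast
    refine (mul_le_mul hxC h1 (by positivity) (by positivity)).trans_eq ?_
    rw [← rpow_add hx0, ← rpow_natCast]; congr 1; ring
  · have h1 := hsp r r' hr (round (Θ r - Θ r') * Wps d x)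
    have h2 : θp r - θp r' - ((round (Θ r - Θ r') * Wps d x : ℤ) : ℝ) = (Θ r - Θ r' - round (Θ r - Θ r')) * Wps d x := by
      push_cast; rw [sub_mul, hΘ, sub_mul]; field_simp
    rw [h2, abs_mul, abs_of_pos hW0, ← div_le_iff₀ hW0, div_div] at h1
    refine le_trans ?_ h1
    push_cast
    exact one_div_le_one_div_of_le (by positivity) hN2
  · refine mul_le_mul_of_nonneg_left (rpow_le_rpow_of_exponent_ge hδ0 hδ1.le ?_) hC.le
    rw [h2e]; linarith only [min_le_left ε₁ 1]
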